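/- Let L = PSL_n(q) be simple (i.e., (n,q) is not (2,2) or (2,3)), and suppose that either n ≠ 4, or q is prime, or q is even. Then L is recognizable by spectrum from its covers: for every finite group G admitting a surjective group homomorphism onto L, if the set of element orders of G equals the set of element orders of L, then G is isomorphic to L. -/

import Mathlib

/-- The spectrum of a group: the set of orders of its elements. -/
def groupSpectrum (G : Type*) [Group G] : Set ℕ := {k | ∃ g : G, orderOf g = k}

universe u

section

open Function

lemma exists_orderOf_eq_of_dvd {G : Type*} [Group G] [Finite G] (g : G) {k : ℕ}
    (h : k ∣ orderOf g) : ∃ g' : G, orderOf g' = k := by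
  obtain ⟨m, hm⟩ := h
  have hpos := orderOf_pos g
  refine ⟨g ^ m, ?_⟩
  have hm0 : m ≠ 0 := by rintro rfl; omega
  rw [orderOf_pow_of_dvd hm0 (hm ▸ dvd_mul_left _ _), hm, Nat.mul_div_cancel _ (by omega)]

lemma groupSpectrum_subset_of_surjective {G H : Type*} [Group G] [Group H] [Finite G]
    (f : G →* H) (hf : Surjective f) : groupSpectrum H ⊆ groupSpectrum G := by
  rintro k ⟨x, rfl⟩
  obtain ⟨g, rfl⟩ := hf x
  exact exists_orderOf_eq_of_dvd g (orderOf_map_dvd f g)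

lemma groupSpectrum_subset_of_injective {G H : Type*} [Group G] [Group H]
    (f : G →* H) (hf : Injective f) : groupSpectrum G ⊆ groupSpectrum H := by
  rintro k ⟨x, rfl⟩
  exact ⟨f x, orderOf_injective f hf x⟩

/-- If no cover of `L` with elementary abelian kernel has its spectrum inside that of `L`, then
every cover of `L` whose spectrum is contained in that of `L` is an isomorphism. -/
theorem ker_eq_bot_of_elementary_abelian {L : Type*} [Group L]
    (key : ∀ (r : ℕ) (G : Type u) [Group G] [Finite G] (f : G →* L), r.Prime → Surjective f →
      groupSpectrum G ⊆ groupSpectrum L → (∀ x ∈ f.ker, x ^ r = 1) →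
      (∀ x ∈ f.ker, ∀ y ∈ f.ker, x * y = y * x) → f.ker = ⊥)
    (G : Type u) [Group G] [Finite G] (f : G →* L) (hf : Surjective f)
    (hsp : groupSpectrum G ⊆ groupSpectrum L) : f.ker = ⊥ := by
  induction hc : Nat.card G using Nat.strong_induction_on generalizing G with
  | _ c ih =>
  subst hc
  by_contra hK
  -- quotients
  have hquot : ∀ M : Subgroup G, M.Normal → M ≤ f.ker → M ≠ ⊥ → f.ker ≤ M := by
    intro M hM hMK hM1
    have hker : ∀ x ∈ M, f x = 1 := fun x hx => hMK hx
    let f' : G ⧸ M →* L := QuotientGroup.lift M f hker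
    have hf' : Surjective f' := by
      intro y
      obtain ⟨g, rfl⟩ := hf y
      exact ⟨(g : G ⧸ M), rfl⟩
    have hlt : Nat.card (G ⧸ M) < Nat.card G := by
      rw [Subgroup.card_eq_card_quotient_mul_card_subgroup M]
      have h1 : 1 < Nat.card M := by
        rw [Subgroup.one_lt_card_iff_ne_bot]; exact hM1
      have h2 : 0 < Nat.card (G ⧸ M) := Nat.card_pos
      nlinarith
    have := ih _ hlt (G ⧸ M) f' hf' ((groupSpectrum_subset_of_surjective
      (QuotientGroup.mk' M) (QuotientGroup.mk'_surjective M)).trans hsp) rfl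
    intro x hx
    have hx' : (x : G ⧸ M) ∈ f'.ker := hx
    rw [this, Subgroup.mem_bot] at hx'
    exact (QuotientGroup.eq_one_iff x).1 hx'
  have hcard : Nat.card f.ker ≠ 1 := by
    rw [Ne, Subgroup.card_eq_one]; exact hK
  obtain ⟨r, hr, hrdvd⟩ := Nat.exists_prime_and_dvd hcard
  have : Fact r.Prime := ⟨hr⟩
  let P : Sylow r f.ker := default
  have hP1 : (P : Subgroup f.ker) ≠ ⊥ := by
    have := P.ne_bot_of_dvd_card hrdvd
    exact this
  let R : Subgroup G := (P : Subgroup f.ker).map f.ker.subtype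
  have hR1 : R ≠ ⊥ := by
    intro h
    rw [Subgroup.map_eq_bot_iff_of_injective _ (Subgroup.subtype_injective _)] at h
    exact hP1 h
  have hRK : R ≤ f.ker := Subgroup.map_subtype_le _
  have hfr : Subgroup.normalizer (R : Set G) ⊔ f.ker = ⊤ := Sylow.normalizer_sup_eq_top P
  have hRn : R.Normal := by
    rw [← Subgroup.normalizer_eq_top_iff]
    by_contra hne
    let H := Subgroup.normalizer (R : Set G)
    have hsurj : Surjective (f.comp H.subtype) := by
      intro y
      obtain ⟨g, rfl⟩ := hf y
      have : g ∈ H ⊔ f.ker := by rw [hfr]; trivial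
      obtain ⟨a, ha, b, hb, rfl⟩ := Subgroup.mem_sup_of_normal_right.1 this
      refine ⟨⟨a, ha⟩, ?_⟩
      have hb' : f b = 1 := hb
      simp [hb']
    have hlt : Nat.card H < Nat.card G := by
      refine lt_of_le_of_ne (Subgroup.card_le_card_group _) ?_
      intro h
      exact hne ((Subgroup.card_eq_iff_eq_top _).1 h)
    have h0 := ih _ hlt H (f.comp H.subtype) hsurj ((groupSpectrum_subset_of_injective
      H.subtype (Subgroup.subtype_injective _)).trans hsp) rfl
    apply hR1
    rw [eq_bot_iff]
    intro x hx
    have hxH : x ∈ H := Subgroup.le_normalizer hx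
    have : (⟨x, hxH⟩ : H) ∈ (f.comp H.subtype).ker := hRK hx
    rw [h0, Subgroup.mem_bot] at this
    exact Subgroup.mem_bot.2 (congrArg Subtype.val this)
  have hKR : f.ker = R := le_antisymm (hquot R hRn hRK hR1) hRK
  have hPtop : (P : Subgroup f.ker) = ⊤ := by
    rw [eq_top_iff]
    intro x _
    have hx : (x : G) ∈ R := hKR ▸ x.2
    obtain ⟨y, hy, hyx⟩ := hx
    have : y = x := Subtype.ext hyx
    exact this ▸ hy
  have hpg : IsPGroup r f.ker := by
    have := P.2
    intro x
    have hx : x ∈ (P : Subgroup f.ker) := hPtop ▸ Subgroup.mem_top x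
    obtain ⟨k, hk⟩ := this ⟨x, hx⟩
    exact ⟨k, by simpa using congrArg Subtype.val hk⟩
  -- commutativity
  have hcomm : ∀ x ∈ f.ker, ∀ y ∈ f.ker, x * y = y * x := by
    have : Group.IsNilpotent f.ker := hpg.isNilpotent
    have : Nontrivial f.ker := (Subgroup.nontrivial_iff_ne_bot _).2 hK
    have hlt : commutator f.ker < ⊤ := Group.IsSolvable.commutator_lt_top_of_nontrivial f.ker
    have hbot : ⁅f.ker, f.ker⁆ = ⊥ := by
      by_contra hne
      have hle := hquot ⁅f.ker, f.ker⁆ inferInstance (Subgroup.commutator_le_left _ _) hne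
      apply hlt.ne
      rw [eq_top_iff]
      intro x _
      have hx := hle x.2
      have hm : ⁅f.ker, f.ker⁆ = (commutator f.ker).map f.ker.subtype := by
        rw [commutator_def, Subgroup.map_commutator]
        simp [← MonoidHom.range_eq_map]
      rw [hm] at hx
      obtain ⟨y, hy, hyx⟩ := hx
      have : y = x := Subtype.ext hyx
      exact this ▸ hy
    intro x hx y hy
    have := Subgroup.commutator_mem_commutator hx hy
    rw [hbot, Subgroup.mem_bot, commutatorElement_eq_one_iff_mul_comm] at this
    exact this
  -- exponent
  have hexp : ∀ x ∈ f.ker, x ^ r = 1 := by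
    let M : Subgroup G :=
      { carrier := {y | ∃ x ∈ f.ker, x ^ r = y}
        one_mem' := ⟨1, f.ker.one_mem, one_pow r⟩
        mul_mem' := by
          rintro _ _ ⟨x, hx, rfl⟩ ⟨y, hy, rfl⟩
          exact ⟨x * y, f.ker.mul_mem hx hy, (show Commute x y from hcomm x hx y hy).mul_pow r⟩
        inv_mem' := by
          rintro _ ⟨x, hx, rfl⟩
          exact ⟨x⁻¹, f.ker.inv_mem hx, inv_pow x r⟩ }
    have hMn : M.Normal := by
      constructor
      rintro _ ⟨x, hx, rfl⟩ g
      exact ⟨g * x * g⁻¹, (MonoidHom.normal_ker f).conj_mem x hx g, conj_pow⟩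
    have hMK : M ≤ f.ker := by
      rintro _ ⟨x, hx, rfl⟩
      exact f.ker.pow_mem hx r
    have hM1 : M = ⊥ := by
      by_contra hne
      have hle := hquot M hMn hMK hne
      have hsur : Surjective (fun x : f.ker => x ^ r) := by
        intro y
        obtain ⟨x, hx, hxy⟩ := hle y.2
        exact ⟨⟨x, hx⟩, Subtype.ext hxy⟩
      have hinj := (Finite.injective_iff_surjective).2 hsur
      obtain ⟨z, hz⟩ := exists_prime_orderOf_dvd_card' r hrdvd
      have : z = 1 := hinj (by simp [← hz, pow_orderOf_eq_one])
      rw [this, orderOf_one] at hz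
      exact hr.one_lt.ne hz
    intro x hx
    have : x ^ r ∈ M := ⟨x, hx, rfl⟩
    rwa [hM1, Subgroup.mem_bot] at this
  exact hK (key r G f hr hf hsp hexp hcomm)

/-- A cover with abelian kernel of exponent `r` yields an action on the kernel, in which the norm
of `x` vanishes as soon as `r` times the order of `x` is not the order of an element. -/
theorem exists_action_of_cover {L S : Type*} [Group L] [Group S] (π : S →* L) (r : ℕ)
    {G : Type u} [Group G] [Finite G] (f : G →* L) (hr : r.Prime) (hf : Surjective f)
    (hsp : groupSpectrum G ⊆ groupSpectrum L) (hexp : ∀ x ∈ f.ker, x ^ r = 1)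
    (hcomm : ∀ x ∈ f.ker, ∀ y ∈ f.ker, x * y = y * x) (hne : f.ker ≠ ⊥) :
    ∃ (V : Type u) (_ : AddCommGroup V) (_ : Finite V) (_ : Nontrivial V)
      (ρ : S →* AddMonoid.End V), (∀ v : V, r • v = 0) ∧ (∀ z ∈ π.ker, ρ z = 1) ∧
      ∀ x : S, r * orderOf (π x) ∉ groupSpectrum L →
        ∀ v, ∑ j ∈ Finset.range (orderOf (π x)), ρ (x ^ j) v = 0 := by
  let instC : CommGroup f.ker := { (inferInstance : Group f.ker) with
    mul_comm := fun x y => Subtype.ext (hcomm x x.2 y y.2) }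
  let c : G →* MulAut f.ker := MulAut.conjNormal
  have hc : ∀ g v, ((c g v : f.ker) : G) = g * v * g⁻¹ := fun g v => MulAut.conjNormal_apply g v
  have hker : f.ker ≤ c.ker := by
    intro g hg
    rw [MonoidHom.mem_ker]
    ext v
    rw [hc, hcomm g hg v v.2]
    simp
  let c' : L →* MulAut f.ker :=
    f.liftOfRightInverse (surjInv hf) (rightInverse_surjInv hf) ⟨c, hker⟩
  have hc' : ∀ g, c' (f g) = c g := fun g =>
    MonoidHom.liftOfRightInverse_comp_apply f _ (rightInverse_surjInv hf) ⟨c, hker⟩ g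
  let e : MulAut f.ker →* AddMonoid.End (Additive f.ker) :=
    { toFun := fun a => MonoidHom.toAdditive a.toMonoidHom
      map_one' := rfl
      map_mul' := fun _ _ => rfl }
  have hnt : Nontrivial f.ker := (Subgroup.nontrivial_iff_ne_bot _).2 hne
  refine ⟨Additive f.ker, inferInstance, (inferInstance : Finite f.ker),
    (inferInstance : Nontrivial f.ker), e.comp (c'.comp π), ?_, ?_, ?_⟩
  · intro v
    have : (v.toMul : f.ker) ^ r = 1 := Subtype.ext (hexp _ v.toMul.2)
    exact congrArg Additive.ofMul this
  · intro z hz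
    have hz : π z = 1 := hz
    simp [hz]
  · intro x hx v
    obtain ⟨g, hg⟩ := hf (π x)
    have hprod : ∀ (k : ℕ) (w : f.ker), ((w : G) * g) ^ k =
        ((∏ j ∈ Finset.range k, c (g ^ j) w : f.ker) : G) * g ^ k := by
      intro k w
      induction k with
      | zero => simp
      | succ k ih =>
        rw [pow_succ, ih, Finset.prod_range_succ, Subgroup.coe_mul, hc, pow_succ]
        group
    have key : ∀ w : f.ker, ((w : G) * g) ^ orderOf (π x) = 1 := by
      intro w
      by_contra hw
      apply hx
      apply hsp
      have hfw : f ((w : G) * g) = π x := by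
        rw [map_mul, hg, show f w = 1 from w.2, one_mul]
      have hmem : ((w : G) * g) ^ orderOf (π x) ∈ f.ker := by
        rw [MonoidHom.mem_ker, map_pow, hfw, pow_orderOf_eq_one]
      have h1 : orderOf (((w : G) * g) ^ orderOf (π x)) = r :=
        orderOf_eq_prime_iff (hp := ⟨hr⟩) |>.2 ⟨hexp _ hmem, hw⟩
      have hd : orderOf (π x) ∣ orderOf ((w : G) * g) := hfw ▸ orderOf_map_dvd f _
      have hpos : orderOf (π x) ≠ 0 := by
        intro h0
        rw [h0, zero_dvd_iff] at hd
        exact (orderOf_pos ((w : G) * g)).ne' hd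
      refine ⟨(w : G) * g, ?_⟩
      rw [orderOf_pow_of_dvd hpos hd] at h1
      rw [← h1, Nat.div_mul_cancel hd]
    have h1 := key 1
    have h2 := key v.toMul
    rw [hprod] at h2
    have h1' : g ^ orderOf (π x) = 1 := by simpa using h1
    rw [h1', mul_one] at h2
    have h3 : (∏ j ∈ Finset.range (orderOf (π x)), c (g ^ j) v.toMul : f.ker) = 1 :=
      Subtype.ext h2
    have h4 := congrArg Additive.ofMul h3
    rw [ofMul_prod, ofMul_one] at h4
    rw [← h4]
    refine Finset.sum_congr rfl fun j _ => ?_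
    change e (c' (π (x ^ j))) v = _
    rw [map_pow π, ← hg, ← map_pow f, hc']
    rfl

end

section

open Polynomial

/-- A root of an irreducible polynomial over a finite field satisfies the Frobenius equation. -/
lemma adjoinRoot_root_pow_card {F : Type*} [Field F] [Fintype F] {f : F[X]} (hf : Irreducible f)
    (x : AdjoinRoot f) : x ^ Fintype.card F ^ f.natDegree = x := by
  have : Fact (Irreducible f) := ⟨hf⟩
  have : Module.Finite F (AdjoinRoot f) := (AdjoinRoot.powerBasis hf.ne_zero).finite
  have : Finite (AdjoinRoot f) := Module.finite_of_finite F
  have := Fintype.ofFinite (AdjoinRoot f)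
  have hc := Module.card_eq_pow_finrank (K := F) (V := AdjoinRoot f)
  have h2 := FiniteField.pow_card x
  rwa [← Nat.card_eq_fintype_card, Nat.card_eq_fintype_card, hc,
    (AdjoinRoot.powerBasis hf.ne_zero).finrank, AdjoinRoot.powerBasis_dim] at h2

lemma minpoly_dvd_X_pow_orderOf_sub_one {F ι : Type*} [Field F] [Fintype ι] [DecidableEq ι]
    (y : Matrix ι ι F) : minpoly F y ∣ X ^ orderOf y - 1 := by
  apply minpoly.dvd
  simp [pow_orderOf_eq_one]

lemma exists_irreducible_factor_of_dvd_orderOf {F ι : Type*} [Field F] [Fintype F] [Fintype ι]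
    [DecidableEq ι] [Nonempty ι] (p : ℕ) [Fact p.Prime] [CharP F p] {y : Matrix ι ι F}
    (h0 : 0 < orderOf y) {ℓ e : ℕ} (hℓ : ℓ.Prime) (hℓp : ℓ ≠ p) (he : 0 < e)
    (h : ℓ ^ e ∣ orderOf y) :
    ∃ f : F[X], Irreducible f ∧ f.Monic ∧ f ∣ y.charpoly ∧
      ℓ ^ e ∣ Fintype.card F ^ f.natDegree - 1 := by
  classical
  by_contra! hcon
  set M := orderOf y with hM
  have hℓM : ℓ ∣ M := (dvd_pow_self ℓ he.ne').trans h
  have hm0 : minpoly F y ≠ 0 := minpoly.ne_zero (Matrix.isIntegral y)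
  have hfac : ∀ f ∈ UniqueFactorizationMonoid.normalizedFactors (minpoly F y),
      f ∣ X ^ (M / ℓ) - 1 := by
    intro f hf
    have hirr := UniqueFactorizationMonoid.irreducible_of_normalized_factor f hf
    have hdvd := UniqueFactorizationMonoid.dvd_of_mem_normalizedFactors hf
    have hmon : f.Monic := by
      rw [← UniqueFactorizationMonoid.normalize_normalized_factor f hf]
      exact monic_normalize hirr.ne_zero
    have hnot := hcon f hirr hmon (hdvd.trans (Matrix.minpoly_dvd_charpoly y))
    have : Fact (Irreducible f) := ⟨hirr⟩
    have hroot : (AdjoinRoot.root f) ^ M = 1 := by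
      have := (AdjoinRoot.mk_eq_zero (f := f)).2 (hdvd.trans (minpoly_dvd_X_pow_orderOf_sub_one y))
      simpa [sub_eq_zero] using this
    have hne : AdjoinRoot.root f ≠ 0 := by
      intro h; rw [h, zero_pow h0.ne'] at hroot; exact zero_ne_one hroot
    have hq : (AdjoinRoot.root f) ^ (Fintype.card F ^ f.natDegree - 1) = 1 := by
      have h1 := adjoinRoot_root_pow_card hirr (AdjoinRoot.root f)
      have hpos : 0 < Fintype.card F ^ f.natDegree := pow_pos Fintype.card_pos _
      apply mul_right_cancel₀ hne
      rw [← pow_succ, Nat.sub_add_cancel hpos, h1, one_mul]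
    have hd1 := orderOf_dvd_of_pow_eq_one hroot
    have hd2 := orderOf_dvd_of_pow_eq_one hq
    have hd3 : orderOf (AdjoinRoot.root f) ∣ M / ℓ := by
      obtain ⟨c, hc⟩ := hd1
      have : ℓ ∣ c := by
        by_contra hlc
        have hcop : Nat.Coprime (ℓ ^ e) c := Nat.Coprime.pow_left _ ((Nat.Prime.coprime_iff_not_dvd
          hℓ).2 hlc)
        apply hnot
        exact (hcop.dvd_of_dvd_mul_right (hc ▸ h)).trans hd2
      obtain ⟨c', rfl⟩ := this
      refine ⟨c', ?_⟩
      rw [hc]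
      apply Nat.div_eq_of_eq_mul_right hℓ.pos
      ring
    have h4 := orderOf_dvd_iff_pow_eq_one.1 hd3
    rw [← AdjoinRoot.mk_eq_zero]
    simp [h4]
  have hdvd : minpoly F y ∣ (X ^ (M / ℓ) - 1) ^ Multiset.card
      (UniqueFactorizationMonoid.normalizedFactors (minpoly F y)) := by
    have h1 := UniqueFactorizationMonoid.prod_normalizedFactors hm0
    refine h1.symm.dvd.trans ?_
    have h2 := Multiset.prod_dvd_prod_of_dvd (S := UniqueFactorizationMonoid.normalizedFactors
      (minpoly F y)) id (fun _ => (X ^ (M / ℓ) - 1 : F[X])) hfac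
    rwa [Multiset.map_id, Multiset.map_const', Multiset.prod_replicate] at h2
  set s := Multiset.card (UniqueFactorizationMonoid.normalizedFactors (minpoly F y))
  have hz : (y ^ (M / ℓ) - 1) ^ s = 0 := by
    have := Polynomial.aeval_eq_zero_of_dvd_aeval_eq_zero hdvd (minpoly.aeval F y)
    simpa using this
  have hps : s ≤ p ^ s := (Nat.lt_pow_self (Fact.out : p.Prime).one_lt).le
  have hz2 : (y ^ (M / ℓ)) ^ p ^ s = 1 := by
    have h1 := sub_pow_char_pow_of_commute (p := p) (n := s) (Commute.one_right (y ^ (M / ℓ)))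
    rw [pow_eq_zero_of_le hps hz, one_pow] at h1
    exact (sub_eq_zero.1 h1.symm)
  rw [← pow_mul] at hz2
  have hd := orderOf_dvd_of_pow_eq_one hz2
  rw [← hM] at hd
  obtain ⟨M', hM'⟩ := hℓM
  have hM0 : 0 < M' := by
    rcases Nat.eq_zero_or_pos M' with h | h
    · rw [hM', h] at h0; simp at h0
    · exact h
  rw [hM', Nat.mul_div_cancel_left _ hℓ.pos, mul_comm ℓ] at hd
  have := Nat.dvd_of_mul_dvd_mul_left hM0 hd
  exact hℓp ((Nat.prime_dvd_prime_iff_eq hℓ Fact.out).1 (hℓ.dvd_of_dvd_pow this))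

lemma exists_sq_dvd_charpoly_of_dvd_orderOf {F ι : Type*} [Field F] [Fintype ι]
    [DecidableEq ι] (p : ℕ) [Fact p.Prime] [CharP F p] {y : Matrix ι ι F}
    (h0 : 0 < orderOf y) (h : p ∣ orderOf y) :
    ∃ f : F[X], Irreducible f ∧ f.Monic ∧ f * f ∣ y.charpoly := by
  classical
  by_contra! hcon
  have hp : p.Prime := Fact.out
  have hsq : Squarefree y.charpoly := by
    rw [squarefree_iff_irreducible_sq_not_dvd_of_ne_zero (Matrix.charpoly_monic y).ne_zero]
    intro f hf hff
    have hn : Associated (normalize f) f := normalize_associated f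
    exact hcon (normalize f) (hn.symm.irreducible hf) (monic_normalize hf.ne_zero)
      ((hn.mul_mul hn).dvd.trans hff)
  have hsq' := hsq.squarefree_of_dvd (Matrix.minpoly_dvd_charpoly y)
  obtain ⟨M, hM⟩ := h
  have hd := minpoly_dvd_X_pow_orderOf_sub_one y
  have heq : (X ^ orderOf y - 1 : F[X]) = (X ^ M - 1) ^ p := by
    rw [sub_pow_char, hM, one_pow, ← pow_mul, mul_comm]
  rw [heq] at hd
  have hd2 := (hsq'.dvd_pow_iff_dvd hp.ne_zero).1 hd
  have hz := Polynomial.aeval_eq_zero_of_dvd_aeval_eq_zero hd2 (minpoly.aeval F y)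
  have hz2 : y ^ M = 1 := by simpa [sub_eq_zero] using hz
  have hd3 := orderOf_dvd_of_pow_eq_one hz2
  have hM0 : 0 < M := by
    rcases Nat.eq_zero_or_pos M with h | h
    · rw [hM, h] at h0; simp at h0
    · exact h
  have := Nat.le_of_dvd hM0 hd3
  have := hp.two_le
  nlinarith

/-- A set of monic irreducible factors of degree at least two of a non-squarefree polynomial of
degree `n` has total degree at most `n - 2`. -/
lemma sum_natDegree_add_two_le {F : Type*} [Field F] {χ g : F[X]} (hχ : χ ≠ 0) (S : Finset F[X])
    (hS : ∀ f ∈ S, Irreducible f ∧ f.Monic ∧ f ∣ χ ∧ 2 ≤ f.natDegree) (hg : Irreducible g)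
    (hgm : g.Monic) (hgg : g * g ∣ χ) : ∑ f ∈ S, f.natDegree + 2 ≤ χ.natDegree := by
  classical
  have hcop : ∀ f ∈ S, f ≠ g → IsCoprime f g := fun f hf hne => by
    rw [(hS f hf).1.coprime_iff_not_dvd]
    intro h
    exact hne (eq_of_monic_of_associated (hS f hf).2.1 hgm ((hS f hf).1.associated_of_dvd hg h))
  have hpair : ∀ f ∈ S, ∀ f' ∈ S, f ≠ f' → IsCoprime f f' := fun f hf f' hf' hne => by
    rw [(hS f hf).1.coprime_iff_not_dvd]
    intro h
    exact hne (eq_of_monic_of_associated (hS f hf).2.1 (hS f' hf').2.1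
      ((hS f hf).1.associated_of_dvd (hS f' hf').1 h))
  have hd : (∏ f ∈ S.erase g, f) * (g * g) ∣ χ := by
    apply IsCoprime.mul_dvd
    · apply IsCoprime.prod_left
      intro f hf
      have h1 := hcop f (Finset.mem_of_mem_erase hf) (Finset.ne_of_mem_erase hf)
      exact h1.mul_right h1
    · apply Finset.prod_dvd_of_coprime
      · intro f hf f' hf' hne
        exact hpair f (Finset.mem_of_mem_erase hf) f' (Finset.mem_of_mem_erase hf') hne
      · exact fun f hf => (hS f (Finset.mem_of_mem_erase hf)).2.2.1
    · exact hgg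
  have hle := natDegree_le_of_dvd hd hχ
  rw [natDegree_mul, natDegree_mul hg.ne_zero hg.ne_zero, natDegree_prod] at hle
  · by_cases hgS : g ∈ S
    · rw [← Finset.sum_erase_add _ _ hgS]
      have := (hS g hgS).2.2.2
      omega
    · rw [Finset.erase_eq_of_notMem hgS] at hle
      have := hg.natDegree_pos
      omega
  · exact fun f hf => (hS f (Finset.mem_of_mem_erase hf)).1.ne_zero
  · rw [Finset.prod_ne_zero_iff]
    exact fun f hf => (hS f (Finset.mem_of_mem_erase hf)).1.ne_zero
  · exact mul_ne_zero hg.ne_zero hg.ne_zero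

/-- A prime power `P`, coprime to `q`, dividing `q ^ d - 1` only if `N` divides `d`. -/
def IsWitness (q N P : ℕ) : Prop :=
  (∃ ℓ e, ℓ.Prime ∧ 0 < e ∧ ¬ ℓ ∣ q ∧ P = ℓ ^ e) ∧ ∀ d, P ∣ q ^ d - 1 → N ∣ d

lemma IsWitness.one_lt {q N P : ℕ} (h : IsWitness q N P) : 1 < P := by
  obtain ⟨⟨ℓ, e, hℓ, he, -, rfl⟩, -⟩ := h
  exact Nat.one_lt_pow he.ne' hℓ.one_lt

lemma IsWitness.coprime {q N P : ℕ} (h : IsWitness q N P) : P.Coprime q := by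
  obtain ⟨⟨ℓ, e, hℓ, he, h, rfl⟩, -⟩ := h
  exact Nat.Coprime.pow_left _ ((Nat.Prime.coprime_iff_not_dvd hℓ).2 h)

lemma natCast_pow_sub_one {q : ℕ} (hq : 2 ≤ q) (N : ℕ) :
    ((q ^ N - 1 : ℕ) : ℤ) = (q : ℤ) ^ N - 1 := by
  have : 1 ≤ q ^ N := Nat.one_le_pow _ _ (by omega)
  push_cast [this]; ring

lemma isWitness_of_dvd_cyclotomic {q N ℓ e : ℕ} (hq : 2 ≤ q) (hN : 0 < N) (hℓ : ℓ.Prime)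
    (hc : (ℓ : ℤ) ∣ (cyclotomic N ℤ).eval (q : ℤ)) (h1 : ℓ ^ e ∣ q ^ N - 1)
    (h2 : ¬ ℓ ^ (e + 1) ∣ q ^ N - 1) : IsWitness q N (ℓ ^ e) := by
  have hΦ : ℓ ∣ q ^ N - 1 := by
    zify
    rw [natCast_pow_sub_one hq]
    have := eval_dvd (x := (q : ℤ)) (cyclotomic.dvd_X_pow_sub_one N ℤ)
    simp only [eval_sub, eval_pow, eval_X, eval_one] at this
    exact hc.trans this
  refine ⟨⟨ℓ, e, hℓ, ?_, ?_, rfl⟩, ?_⟩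
  · rcases Nat.eq_zero_or_pos e with rfl | h
    · simp only [zero_add, pow_one] at h2; exact absurd hΦ h2
    · exact h
  · intro h
    have h3 : ℓ ∣ q ^ N := dvd_pow h hN.ne'
    have : 1 ≤ q ^ N := Nat.one_le_pow _ _ (by omega)
    have h4 : ℓ ∣ 1 := by
      have := (Nat.dvd_sub_iff_right this h3).1 hΦ
      exact this
    exact hℓ.one_lt.ne' (Nat.dvd_one.1 h4)
  · intro d hd
    have hg : ℓ ^ e ∣ q ^ (Nat.gcd d N) - 1 := by
      rw [← Nat.pow_sub_one_gcd_pow_sub_one]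
      exact Nat.dvd_gcd hd h1
    by_contra hNd
    apply h2
    have hlt : Nat.gcd d N ∈ N.properDivisors := by
      rw [Nat.mem_properDivisors]
      refine ⟨Nat.gcd_dvd_right _ _, lt_of_le_of_ne (Nat.gcd_le_right _ hN) ?_⟩
      intro h
      exact hNd (h ▸ Nat.gcd_dvd_left d N)
    have h5 := eval_dvd (x := (q : ℤ)) (X_pow_sub_one_mul_cyclotomic_dvd_X_pow_sub_one_of_dvd ℤ hlt)
    simp only [eval_sub, eval_pow, eval_X, eval_one, eval_mul] at h5
    rw [← natCast_pow_sub_one hq, ← natCast_pow_sub_one hq] at h5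
    zify
    rw [pow_succ]
    refine (mul_dvd_mul ?_ hc).trans h5
    exact_mod_cast hg

lemma exists_isWitness_of_prime {q N ℓ : ℕ} (hq : 2 ≤ q) (hN : 0 < N) (hℓ : ℓ.Prime)
    (hc : (ℓ : ℤ) ∣ (cyclotomic N ℤ).eval (q : ℤ)) :
    ∃ e, ℓ ^ e ∣ q ^ N - 1 ∧ IsWitness q N (ℓ ^ e) := by
  have hpos : q ^ N - 1 ≠ 0 := by
    have : 2 ^ 1 ≤ q ^ N := Nat.pow_le_pow_left hq 1 |>.trans (Nat.pow_le_pow_right (by omega) hN)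
    omega
  obtain ⟨e, m, hm, he⟩ := Nat.exists_eq_pow_mul_and_not_dvd hpos ℓ hℓ.ne_one
  refine ⟨e, ⟨m, he⟩, isWitness_of_dvd_cyclotomic hq hN hℓ hc ⟨m, he⟩ ?_⟩
  intro h
  rw [he, pow_succ] at h
  exact hm (Nat.dvd_of_mul_dvd_mul_left (pow_pos hℓ.pos e) h)

lemma eq_prime_pow_of_dvd_cyclotomic {q n ℓ : ℕ} (hn : 0 < n) (hℓ : ℓ.Prime)
    (hc : (ℓ : ℤ) ∣ (cyclotomic n ℤ).eval (q : ℤ)) (h1 : (ℓ : ℤ) ∣ (q : ℤ) - 1) :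
    ∃ j, n = ℓ ^ j := by
  have : Fact ℓ.Prime := ⟨hℓ⟩
  obtain ⟨j, m, hm, hj⟩ := Nat.exists_eq_pow_mul_and_not_dvd hn.ne' ℓ hℓ.ne_one
  have hq1 : ((q : ℤ) : ZMod ℓ) = 1 := by
    have := (ZMod.intCast_zmod_eq_zero_iff_dvd ((q : ℤ) - 1) ℓ).2 h1
    push_cast at this ⊢
    exact sub_eq_zero.1 this
  have hroot : (cyclotomic n (ZMod ℓ)).IsRoot 1 := by
    have h2 := (ZMod.intCast_zmod_eq_zero_iff_dvd _ ℓ).2 hc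
    rw [← map_cyclotomic_int n (ZMod ℓ), IsRoot.def, ← hq1]
    have h3 := eval_intCast_map (Int.castRingHom (ZMod ℓ)) (cyclotomic n ℤ) (q : ℤ)
    rw [h3]
    exact h2
  have : NeZero (m : ZMod ℓ) := ⟨by rwa [Ne, ZMod.natCast_eq_zero_iff]⟩
  rw [hj, isRoot_cyclotomic_prime_pow_mul_iff_of_charP] at hroot
  have : m = 1 := by
    have := hroot.eq_orderOf
    simpa using this
  exact ⟨j, by rw [hj, this, mul_one]⟩

/-- A cyclotomic value `Φ_n(q)`, `n ≥ 3`, has a prime factor not dividing `q - 1`. -/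
lemma exists_prime_dvd_cyclotomic {q n : ℕ} (hq : 2 ≤ q) (hn : 3 ≤ n) :
    ∃ ℓ : ℕ, ℓ.Prime ∧ (ℓ : ℤ) ∣ (cyclotomic n ℤ).eval (q : ℤ) ∧ ¬ (ℓ : ℤ) ∣ (q : ℤ) - 1 := by
  by_contra! hcon
  set V := ((cyclotomic n ℤ).eval (q : ℤ)).natAbs with hV
  have hV1 : V ≠ 1 := by
    have := sub_one_lt_natAbs_cyclotomic_eval (n := n) (q := q) (by omega) (by omega)
    omega
  have hpr : ∀ ℓ : ℕ, ℓ.Prime → ℓ ∣ V → (ℓ : ℤ) ∣ (cyclotomic n ℤ).eval (q : ℤ) := fun ℓ _ h => by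
    rwa [← Int.natCast_dvd] at h
  obtain ⟨ℓ, hℓ, hℓV⟩ := Nat.exists_prime_and_dvd hV1
  have hℓq := hcon ℓ hℓ (hpr ℓ hℓ hℓV)
  obtain ⟨j, hj⟩ := eq_prime_pow_of_dvd_cyclotomic (by omega) hℓ (hpr ℓ hℓ hℓV) hℓq
  have hj0 : j ≠ 0 := by rintro rfl; simp at hj; omega
  obtain ⟨i, rfl⟩ := Nat.exists_eq_succ_of_ne_zero hj0
  have : Fact ℓ.Prime := ⟨hℓ⟩
  set Q : ℤ := (q : ℤ) ^ ℓ ^ i with hQ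
  have hVal : (cyclotomic n ℤ).eval (q : ℤ) = ∑ k ∈ Finset.range ℓ, Q ^ k := by
    rw [hj, cyclotomic_prime_pow_eq_geom_sum hℓ]
    simp [eval_finsetSum, hQ]
  have hQ2 : 2 ≤ Q := by
    have h1 : q ^ 1 ≤ q ^ ℓ ^ i := Nat.pow_le_pow_right (by omega) (Nat.one_le_pow _ _ hℓ.pos)
    have : 2 ≤ q ^ ℓ ^ i := by rw [pow_one] at h1; omega
    rw [hQ]; exact_mod_cast this
  have hQ1 : (ℓ : ℤ) ∣ Q - 1 := hℓq.trans (by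
    rw [hQ]; simpa using sub_dvd_pow_sub_pow (q : ℤ) 1 (ℓ ^ i))
  have hgt : (ℓ : ℤ) < (cyclotomic n ℤ).eval (q : ℤ) := by
    rw [hVal]
    have h1 : (∑ k ∈ Finset.range ℓ, (1 : ℤ)) < ∑ k ∈ Finset.range ℓ, Q ^ k := by
      apply Finset.sum_lt_sum
      · intro k _; exact one_le_pow₀ (by omega)
      · exact ⟨1, by simpa using hℓ.one_lt, by simpa using (by omega : (1 : ℤ) < Q)⟩
    simpa using h1
  have hℓ2 : (ℓ : ℤ) ^ 2 ∣ (cyclotomic n ℤ).eval (q : ℤ) := by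
    have honly : ∀ ℓ' : ℕ, ℓ'.Prime → ℓ' ∣ V → ℓ' = ℓ := by
      intro ℓ' hℓ' hd
      obtain ⟨j', hj'⟩ := eq_prime_pow_of_dvd_cyclotomic (by omega) hℓ' (hpr ℓ' hℓ' hd)
        (hcon ℓ' hℓ' (hpr ℓ' hℓ' hd))
      have : ℓ ∣ ℓ' ^ j' := by rw [← hj', hj]; exact dvd_pow_self _ (by simp)
      exact ((Nat.prime_dvd_prime_iff_eq hℓ hℓ').1 (hℓ.dvd_of_dvd_pow this)).symm
    have hV0 : V ≠ 0 := by
      rw [hV, Int.natAbs_ne_zero]; have := hℓ.pos; omega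
    have hVp := Nat.eq_prime_pow_of_unique_prime_dvd hV0 (fun {d} hd hdV => honly d hd hdV)
    set s := V.primeFactorsList.length
    have hVcast : (cyclotomic n ℤ).eval (q : ℤ) = (V : ℤ) := by
      rw [hV, Int.natCast_natAbs, abs_of_pos]; have := hℓ.pos; omega
    rw [hVcast, hVp] at hgt ⊢
    push_cast at hgt ⊢
    apply pow_dvd_pow
    by_contra hs
    have : s = 0 ∨ s = 1 := by omega
    have := hℓ.two_le
    rcases ‹s = 0 ∨ s = 1› with h | h <;> rw [h] at hgt <;> norm_num at hgt
    omega
  rcases hℓ.eq_two_or_odd' with rfl | hodd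
  · have hi : i ≠ 0 := by rintro rfl; simp at hj; omega
    obtain ⟨i', rfl⟩ := Nat.exists_eq_succ_of_ne_zero hi
    rw [hVal] at hℓ2
    simp only [Finset.sum_range_succ, Finset.sum_range_zero, pow_zero, pow_one, zero_add] at hℓ2
    have hQsq : Q = ((q : ℤ) ^ 2 ^ i') * ((q : ℤ) ^ 2 ^ i') := by
      rw [hQ, pow_succ, pow_mul, sq]
    have hoddq : Odd ((q : ℤ) ^ 2 ^ i') := by
      apply Odd.pow
      obtain ⟨c, hc⟩ := hℓq
      exact ⟨c, by push_cast at hc; omega⟩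
    obtain ⟨c, hc⟩ := hoddq
    rw [hQsq, hc] at hℓ2
    have h4 : (4 : ℤ) ∣ 2 := by
      have : (1 + (2 * c + 1) * (2 * c + 1) : ℤ) = 4 * (c * c + c) + 2 := by ring
      rw [this] at hℓ2
      norm_num at hℓ2
    omega
  · have h3 := Int.emultiplicity_pow_sub_pow hℓ hodd (x := Q) (y := 1) (by simpa using hQ1)
      (by
        intro h
        have h4 : (ℓ : ℤ) ∣ 1 := by simpa using dvd_sub h hQ1
        have := Int.eq_one_of_dvd_one (by positivity) h4
        have := hℓ.one_lt
        omega) ℓ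
    rw [one_pow, ← geom_sum_mul, ← hVal, emultiplicity_mul (Nat.prime_iff_prime_int.1 hℓ),
      add_comm] at h3
    have hfin : FiniteMultiplicity (ℓ : ℤ) (Q - 1) := by
      rw [Int.finiteMultiplicity_iff]
      constructor
      · simpa using hℓ.ne_one
      · omega
    rw [hfin.emultiplicity_eq_multiplicity] at h3
    have h5 : emultiplicity ℓ ℓ = 1 := by
      have : FiniteMultiplicity ℓ ℓ := Nat.finiteMultiplicity_iff.2 ⟨hℓ.ne_one, hℓ.pos⟩
      simpa using this.emultiplicity_self
    rw [h5] at h3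
    have h6 := ENat.add_right_injective_of_ne_top (ENat.natCast_ne_top _) h3
    have h7 := le_emultiplicity_of_pow_dvd hℓ2
    rw [h6] at h7
    norm_num at h7

lemma exists_isWitness_coprime {q n : ℕ} (hq : 2 ≤ q) (hn : 3 ≤ n) :
    ∃ P, IsWitness q n P ∧ P ∣ q ^ n - 1 ∧ P.Coprime (q - 1) := by
  obtain ⟨ℓ, hℓ, hc, hnd⟩ := exists_prime_dvd_cyclotomic hq hn
  obtain ⟨e, he, hw⟩ := exists_isWitness_of_prime hq (by omega) hℓ hc
  refine ⟨_, hw, he, Nat.Coprime.pow_left _ ((Nat.Prime.coprime_iff_not_dvd hℓ).2 ?_)⟩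
  intro h
  apply hnd
  zify [show 1 ≤ q by omega] at h
  exact h

lemma exists_isWitness_of_odd_prime {q h ℓ : ℕ} (hq : 2 ≤ q) (hh : 0 < h) (hℓ : ℓ.Prime)
    (hℓ2 : ℓ ≠ 2) (hc : (ℓ : ℤ) ∣ (cyclotomic (2 * h) ℤ).eval (q : ℤ)) :
    ∃ P, IsWitness q (2 * h) P ∧ P ∣ q ^ h + 1 := by
  obtain ⟨e, he, hw⟩ := exists_isWitness_of_prime hq (by omega) hℓ hc
  refine ⟨_, hw, ?_⟩
  have h2 : 2 ≤ q ^ h := hq.trans (Nat.le_self_pow hh.ne' q)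
  have hfac : q ^ (2 * h) - 1 = (q ^ h + 1) * (q ^ h - 1) := by
    rw [mul_comm, pow_mul, ← Nat.sq_sub_sq]
  have h5 := eval_dvd (x := (q : ℤ)) (X_pow_sub_one_mul_cyclotomic_dvd_X_pow_sub_one_of_dvd
    (n := 2 * h) (d := h) ℤ (Nat.mem_properDivisors.2 ⟨dvd_mul_left _ _, by omega⟩))
  simp only [eval_sub, eval_pow, eval_X, eval_one, eval_mul] at h5
  have h6 : (q : ℤ) ^ (2 * h) - 1 = ((q : ℤ) ^ h - 1) * ((q : ℤ) ^ h + 1) := by ring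
  have h7 : ((q : ℤ) ^ h - 1) ≠ 0 := by
    have : (2 : ℤ) ≤ (q : ℤ) ^ h := by exact_mod_cast h2
    omega
  rw [h6] at h5
  have h8 := hc.trans ((mul_dvd_mul_iff_left h7).1 h5)
  have h9 : ℓ ∣ q ^ h + 1 := by exact_mod_cast h8
  rw [hfac] at he
  refine Nat.Coprime.dvd_of_dvd_mul_right (Nat.Coprime.pow_left _ ?_) he
  rw [Nat.Prime.coprime_iff_not_dvd hℓ]
  intro h10
  have h11 := Nat.dvd_sub h9 h10
  rw [show q ^ h + 1 - (q ^ h - 1) = 2 by omega] at h11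
  exact hℓ2 ((Nat.prime_dvd_prime_iff_eq hℓ Nat.prime_two).1 h11)

lemma exists_isWitness_even {q h : ℕ} (hq : 2 ≤ q) (hh : 0 < h) :
    ∃ P, IsWitness q (2 * h) P ∧ P ∣ q ^ h + 1 := by
  rcases Nat.lt_or_ge 1 h with h1 | h1
  · obtain ⟨ℓ, hℓ, hc, hnd⟩ := exists_prime_dvd_cyclotomic (q := q) (n := 2 * h) hq (by omega)
    refine exists_isWitness_of_odd_prime hq hh hℓ ?_ hc
    rintro rfl
    obtain ⟨e, he, hw⟩ := exists_isWitness_of_prime hq (by omega) hℓ hc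
    have hco := hw.coprime
    obtain ⟨⟨ℓ', e', hℓ', he', h', heq⟩, -⟩ := hw
    have hq2 : ¬ 2 ∣ q := by
      intro h2
      apply h'
      have : ℓ' ∣ 2 ^ e := heq ▸ dvd_pow_self _ he'.ne'
      rwa [(Nat.prime_dvd_prime_iff_eq hℓ' hℓ).1 (hℓ'.dvd_of_dvd_pow this)]
    apply hnd
    push_cast
    omega
  · obtain rfl : h = 1 := by omega
    by_cases hodd : ∃ ℓ : ℕ, ℓ.Prime ∧ ℓ ≠ 2 ∧ ℓ ∣ q + 1
    · obtain ⟨ℓ, hℓ, h2, hd⟩ := hodd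
      refine exists_isWitness_of_odd_prime hq hh hℓ h2 ?_
      simp only [mul_one, cyclotomic_two, eval_add, eval_X, eval_one]
      exact_mod_cast hd
    · push Not at hodd
      have h2 := Nat.eq_prime_pow_of_unique_prime_dvd (p := 2) (show q + 1 ≠ 0 by omega)
        (fun {d} hd hdq => by by_contra h; exact hodd d hd h hdq)
      set s := (q + 1).primeFactorsList.length
      have hs : 2 ≤ s := by
        by_contra hs
        have : s = 0 ∨ s = 1 := by omega
        rcases this with h | h <;> rw [h] at h2 <;> omega
      have h4 : 4 ∣ q + 1 := by rw [h2]; exact pow_dvd_pow 2 hs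
      refine ⟨q + 1, ⟨⟨2, s, Nat.prime_two, by omega, by omega, h2⟩, ?_⟩, by simp⟩
      intro d hd
      rw [mul_one, ← even_iff_two_dvd]
      by_contra hdo
      rw [Nat.not_even_iff_odd] at hdo
      have h5 : q + 1 ∣ q ^ d + 1 := by simpa using hdo.nat_add_dvd_pow_add_pow q 1
      have h6 := Nat.dvd_sub h5 hd
      have : 1 ≤ q ^ d := Nat.one_le_pow _ _ (by omega)
      rw [show q ^ d + 1 - (q ^ d - 1) = 2 by omega] at h6
      have := Nat.le_of_dvd (by norm_num) (h4.trans h6)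
      omega

end

section

open Matrix Polynomial

/-- The projection from `SL_n` to `PSL_n`. -/
abbrev toPSL (n : ℕ) (F : Type*) [CommRing F] :
    SpecialLinearGroup (Fin n) F →* ProjectiveSpecialLinearGroup (Fin n) F :=
  QuotientGroup.mk' _

lemma toPSL_surjective (n : ℕ) (F : Type*) [CommRing F] : Function.Surjective (toPSL n F) :=
  QuotientGroup.mk'_surjective _

lemma toPSL_pow_eq_one_iff {n : ℕ} {F : Type*} [CommRing F] (x : SpecialLinearGroup (Fin n) F)
    (k : ℕ) : toPSL n F x ^ k = 1 ↔ ∃ c : F, (x : Matrix (Fin n) (Fin n) F) ^ k =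
      scalar (Fin n) c := by
  rw [← map_pow, ← MonoidHom.mem_ker, QuotientGroup.ker_mk',
    Matrix.SpecialLinearGroup.mem_center_iff]
  constructor
  · rintro ⟨r, -, hr⟩
    exact ⟨r, (Matrix.SpecialLinearGroup.coe_pow x k).symm.trans hr.symm⟩
  · rintro ⟨c, hc⟩
    refine ⟨c, ?_, hc.symm.trans (Matrix.SpecialLinearGroup.coe_pow x k).symm⟩
    have h := congrArg det hc
    rw [det_pow, x.2, one_pow] at h
    rw [h]
    simp

lemma orderOf_coe_SL {n : ℕ} {F : Type*} [CommRing F] (x : SpecialLinearGroup (Fin n) F) :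
    orderOf (x : Matrix (Fin n) (Fin n) F) = orderOf x :=
  orderOf_injective SpecialLinearGroup.coeMonoidHom SpecialLinearGroup.coeMonoidHom_injective x

section Order

variable {n : ℕ} {F : Type*} [Field F] [Fintype F] [NeZero n] (p : ℕ) [Fact p.Prime] [CharP F p]

include p in
lemma exists_factor_of_isWitness {x : SpecialLinearGroup (Fin n) F} {N P : ℕ}
    (hw : IsWitness (Fintype.card F) N P) (hP : P ∣ orderOf (toPSL n F x)) :
    ∃ f : F[X], Irreducible f ∧ f.Monic ∧ f ∣ (x : Matrix (Fin n) (Fin n) F).charpoly ∧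
      N ∣ f.natDegree := by
  obtain ⟨⟨ℓ, e, hℓ, he, hq, rfl⟩, hN⟩ := hw
  have hpos : 0 < orderOf (x : Matrix (Fin n) (Fin n) F) := by
    rw [orderOf_coe_SL]; exact orderOf_pos x
  have hlp : ℓ ≠ p := by
    rintro rfl
    apply hq
    obtain ⟨m, -, hm⟩ := FiniteField.card F ℓ
    rw [hm]
    exact dvd_pow_self _ m.pos.ne'
  obtain ⟨f, h1, h2, h3, h4⟩ := exists_irreducible_factor_of_dvd_orderOf p hpos hℓ hlp he
    (hP.trans ((orderOf_map_dvd _ x).trans (orderOf_coe_SL x).symm.dvd))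
  exact ⟨f, h1, h2, h3, hN _ h4⟩

omit [NeZero n] in
lemma exists_sq_factor {x : SpecialLinearGroup (Fin n) F} (hP : p ∣ orderOf (toPSL n F x)) :
    ∃ f : F[X], Irreducible f ∧ f.Monic ∧ f * f ∣ (x : Matrix (Fin n) (Fin n) F).charpoly := by
  have hpos : 0 < orderOf (x : Matrix (Fin n) (Fin n) F) := by
    rw [orderOf_coe_SL]; exact orderOf_pos x
  exact exists_sq_dvd_charpoly_of_dvd_orderOf p hpos
    (hP.trans ((orderOf_map_dvd _ x).trans (orderOf_coe_SL x).symm.dvd))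

lemma mul_notMem_groupSpectrum_one {k N P : ℕ} (hw : IsWitness (Fintype.card F) N P) (hP : P ∣ k)
    (hN : 2 ≤ N) (hn : n ≤ N + 1) :
    p * k ∉ groupSpectrum (ProjectiveSpecialLinearGroup (Fin n) F) := by
  classical
  rintro ⟨x, hx⟩
  obtain ⟨x, rfl⟩ := toPSL_surjective n F x
  obtain ⟨g, hg, hgm, hgg⟩ := exists_sq_factor p (x := x) (hx ▸ dvd_mul_right p k)
  obtain ⟨f, h1, h2, h3, h4⟩ := exists_factor_of_isWitness p hw (x := x)
    (hx ▸ hP.trans (dvd_mul_left _ _))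
  have hd := Nat.le_of_dvd h1.natDegree_pos h4
  have := sum_natDegree_add_two_le (charpoly_monic x.1).ne_zero {f}
    (by simp only [Finset.mem_singleton]; rintro _ rfl; exact ⟨h1, h2, h3, by omega⟩) hg hgm hgg
  rw [charpoly_natDegree_eq_dim, Fintype.card_fin, Finset.sum_singleton] at this
  omega

lemma mul_notMem_groupSpectrum_two {k N₁ P₁ N₂ P₂ : ℕ} (hw₁ : IsWitness (Fintype.card F) N₁ P₁)
    (hw₂ : IsWitness (Fintype.card F) N₂ P₂) (hP₁ : P₁ ∣ k) (hP₂ : P₂ ∣ k)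
    (hN₁ : 2 ≤ N₁) (hN₂ : 2 ≤ N₂) (hn : n ≤ N₁ + N₂ + 1) (hn' : n ≤ N₁.lcm N₂ + 1) :
    p * k ∉ groupSpectrum (ProjectiveSpecialLinearGroup (Fin n) F) := by
  classical
  rintro ⟨x, hx⟩
  obtain ⟨x, rfl⟩ := toPSL_surjective n F x
  obtain ⟨g, hg, hgm, hgg⟩ := exists_sq_factor p (x := x) (hx ▸ dvd_mul_right p k)
  obtain ⟨f₁, h1, h2, h3, h4⟩ := exists_factor_of_isWitness p hw₁ (x := x)
    (hx ▸ hP₁.trans (dvd_mul_left _ _))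
  obtain ⟨f₂, g1, g2, g3, g4⟩ := exists_factor_of_isWitness p hw₂ (x := x)
    (hx ▸ hP₂.trans (dvd_mul_left _ _))
  have hd₁ := Nat.le_of_dvd h1.natDegree_pos h4
  have hd₂ := Nat.le_of_dvd g1.natDegree_pos g4
  have := sum_natDegree_add_two_le (charpoly_monic x.1).ne_zero {f₁, f₂}
    (by
      simp only [Finset.mem_singleton, Finset.mem_insert]
      rintro _ (rfl | rfl)
      exacts [⟨h1, h2, h3, by omega⟩, ⟨g1, g2, g3, by omega⟩]) hg hgm hgg
  rw [charpoly_natDegree_eq_dim, Fintype.card_fin] at this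
  by_cases hf : f₁ = f₂
  · subst hf
    have := Nat.le_of_dvd h1.natDegree_pos (Nat.lcm_dvd h4 g4)
    simp only [Finset.mem_singleton, Finset.insert_eq_of_mem, Finset.sum_singleton] at *
    omega
  · rw [Finset.sum_pair hf] at this
    omega

lemma mul_notMem_groupSpectrum_three {k N₁ P₁ N₂ P₂ N₃ P₃ : ℕ}
    (hw₁ : IsWitness (Fintype.card F) N₁ P₁) (hw₂ : IsWitness (Fintype.card F) N₂ P₂)
    (hw₃ : IsWitness (Fintype.card F) N₃ P₃) (hP₁ : P₁ ∣ k) (hP₂ : P₂ ∣ k) (hP₃ : P₃ ∣ k)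
    (hN₁ : 2 ≤ N₁) (hN₂ : 2 ≤ N₂) (hN₃ : 2 ≤ N₃) (hn : n ≤ N₁ + N₂ + N₃ + 1)
    (hn₁ : n ≤ N₂.lcm N₃ + N₁ + 1) (hn₂ : n ≤ N₁.lcm N₃ + N₂ + 1)
    (hn₃ : n ≤ N₁.lcm N₂ + N₃ + 1) (hn' : n ≤ (N₁.lcm N₂).lcm N₃ + 1) :
    p * k ∉ groupSpectrum (ProjectiveSpecialLinearGroup (Fin n) F) := by
  classical
  rintro ⟨x, hx⟩
  obtain ⟨x, rfl⟩ := toPSL_surjective n F x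
  obtain ⟨g, hg, hgm, hgg⟩ := exists_sq_factor p (x := x) (hx ▸ dvd_mul_right p k)
  obtain ⟨f₁, h1, h2, h3, h4⟩ := exists_factor_of_isWitness p hw₁ (x := x)
    (hx ▸ hP₁.trans (dvd_mul_left _ _))
  obtain ⟨f₂, g1, g2, g3, g4⟩ := exists_factor_of_isWitness p hw₂ (x := x)
    (hx ▸ hP₂.trans (dvd_mul_left _ _))
  obtain ⟨f₃, k1, k2, k3, k4⟩ := exists_factor_of_isWitness p hw₃ (x := x)
    (hx ▸ hP₃.trans (dvd_mul_left _ _))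
  have hd₁ := Nat.le_of_dvd h1.natDegree_pos h4
  have hd₂ := Nat.le_of_dvd g1.natDegree_pos g4
  have hd₃ := Nat.le_of_dvd k1.natDegree_pos k4
  have := sum_natDegree_add_two_le (charpoly_monic x.1).ne_zero {f₁, f₂, f₃}
    (by
      simp only [Finset.mem_singleton, Finset.mem_insert]
      rintro _ (rfl | rfl | rfl)
      exacts [⟨h1, h2, h3, by omega⟩, ⟨g1, g2, g3, by omega⟩, ⟨k1, k2, k3, by omega⟩]) hg hgm hgg
  rw [charpoly_natDegree_eq_dim, Fintype.card_fin] at this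
  have e12 : f₁ = f₂ → N₁.lcm N₂ ≤ f₁.natDegree := by
    rintro rfl; exact Nat.le_of_dvd h1.natDegree_pos (Nat.lcm_dvd h4 g4)
  have e13 : f₁ = f₃ → N₁.lcm N₃ ≤ f₁.natDegree := by
    rintro rfl; exact Nat.le_of_dvd h1.natDegree_pos (Nat.lcm_dvd h4 k4)
  have e23 : f₂ = f₃ → N₂.lcm N₃ ≤ f₂.natDegree := by
    rintro rfl; exact Nat.le_of_dvd g1.natDegree_pos (Nat.lcm_dvd g4 k4)
  have e123 : f₁ = f₂ → f₁ = f₃ → (N₁.lcm N₂).lcm N₃ ≤ f₁.natDegree := by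
    rintro rfl rfl
    exact Nat.le_of_dvd h1.natDegree_pos (Nat.lcm_dvd (Nat.lcm_dvd h4 g4) k4)
  by_cases a : f₁ = f₂
  · by_cases b : f₁ = f₃
    · have := e123 a b
      subst a b
      simp only [Finset.mem_singleton, Finset.insert_eq_of_mem, Finset.sum_singleton] at *
      omega
    · have := e12 a
      subst a
      simp only [Finset.mem_insert, Finset.mem_singleton, true_or, Finset.insert_eq_of_mem] at *
      rw [Finset.sum_pair b] at *
      omega
  · by_cases b : f₁ = f₃
    · have := e13 b
      subst b
      rw [Finset.insert_eq_of_mem (by simp), Finset.sum_pair (Ne.symm a)] at *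
      omega
    · by_cases c : f₂ = f₃
      · have := e23 c
        subst c
        rw [Finset.pair_eq_singleton, Finset.sum_pair b] at *
        omega
      · rw [Finset.sum_insert (by simp [a, b]), Finset.sum_pair c] at *
        omega

end Order

/-- The Frobenius-fixed elements of an extension field come from the base field. -/
lemma exists_algebraMap_eq_of_pow_card_eq {F K : Type*} [Field F] [Fintype F] [Field K]
    [Algebra F K] {x : K} (hx : x ^ Fintype.card F = x) : ∃ a : F, algebraMap F K a = x := by
  have hq : 1 < Fintype.card F := Fintype.one_lt_card
  have hm : (X ^ Fintype.card F - X : F[X]).Monic := monic_X_pow_sub (by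
    rw [degree_X]
    exact_mod_cast hq)
  have hr := FiniteField.roots_X_pow_card_sub_X F
  have hprod := prod_multiset_X_sub_C_of_monic_of_roots_card_eq hm (by
    rw [hr, FiniteField.X_pow_card_sub_X_natDegree_eq F hq]; rfl)
  rw [hr] at hprod
  have h := congrArg (aeval x) hprod
  rw [map_sub, map_pow, aeval_X, hx, sub_self] at h
  have h' : ∏ a : F, (x - algebraMap F K a) = 0 := by
    rw [← h]
    change _ = aeval x (∏ a : F, (X - C a))
    simp [map_prod]
  obtain ⟨a, -, ha⟩ := Finset.prod_eq_zero_iff.1 h'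
  exact ⟨a, (sub_eq_zero.1 ha).symm⟩

/-- A Frobenius-stable family of distinct elements with product one is the spectrum of a
diagonalisable element of `SL_n(F)`. -/
lemma exists_SL_diagonal {n : ℕ} {F K : Type*} [Field F] [Fintype F] [Field K] [Algebra F K]
    (t : Fin n → K) (ht : Function.Injective t) (hfr : ∀ i, ∃ j, t j = t i ^ Fintype.card F)
    (hdet : ∏ i, t i = 1) :
    ∃ (x : SpecialLinearGroup (Fin n) F) (P P' : Matrix (Fin n) (Fin n) K), P * P' = 1 ∧
      P' * P = 1 ∧ (x : Matrix (Fin n) (Fin n) F).map (algebraMap F K) = P * diagonal t * P' := by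
  choose σ₀ hσ₀ using hfr
  have hinj : Function.Injective σ₀ := by
    intro i j hij
    apply ht
    have h := hσ₀ i
    rw [hij, hσ₀ j] at h
    exact ((FiniteField.frobeniusAlgHom F K).toRingHom.injective h).symm
  let σ := Equiv.ofBijective σ₀ (Finite.injective_iff_bijective.1 hinj)
  set V := vandermonde t with hV
  have hdetV : IsUnit V.det := isUnit_iff_ne_zero.2 (det_vandermonde_ne_zero_iff.2 ht)
  have hVi := nonsing_inv_mul V hdetV
  have hVi' := mul_nonsing_inv V hdetV
  set φ : K →+* K := (FiniteField.frobeniusAlgHom F K).toRingHom with hφ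
  have hφa : ∀ a, φ a = a ^ Fintype.card F := fun a => rfl
  have hVφ : V.map φ = V.submatrix σ id := by
    ext i j
    simp only [map_apply, submatrix_apply, hV, vandermonde_apply, id, hφa]
    rw [← pow_mul, mul_comm, pow_mul, ← hσ₀ i]; rfl
  have hDφ : (diagonal t).map φ = (diagonal t).submatrix σ σ := by
    ext i j
    simp only [map_apply, submatrix_apply, diagonal_apply, EmbeddingLike.apply_eq_iff_eq]
    split_ifs
    · rw [hφa, ← hσ₀ i]; rfl
    · exact map_zero φ
  have hVφ' : (V⁻¹).map φ = V⁻¹.submatrix id σ := by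
    have h1 : (V⁻¹).map φ * V.map φ = 1 := by
      rw [← Matrix.map_mul, hVi]; exact Matrix.map_one _ (map_zero φ) (map_one φ)
    have h2 : V.map φ * V⁻¹.submatrix id σ = 1 := by
      rw [hVφ]
      have := submatrix_mul_equiv V V⁻¹ σ (Equiv.refl _) σ
      simp only [Equiv.coe_refl] at this
      rw [this, hVi']; simp
    calc (V⁻¹).map φ = (V⁻¹).map φ * (V.map φ * V⁻¹.submatrix id σ) := by rw [h2, mul_one]
      _ = _ := by rw [← mul_assoc, h1, one_mul]
  set Y := V⁻¹ * diagonal t * V with hY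
  have hfix : Y.map φ = Y := by
    rw [hY, Matrix.map_mul, Matrix.map_mul, hVφ, hVφ', hDφ, submatrix_mul_equiv,
      submatrix_mul_equiv, submatrix_id_id]
  have hx : ∀ i j, ∃ a : F, algebraMap F K a = Y i j := fun i j =>
    exists_algebraMap_eq_of_pow_card_eq (congrFun (congrFun hfix i) j)
  choose x₀ hx₀ using hx
  have hmap : (Matrix.of x₀).map (algebraMap F K) = Y := by ext i j; exact hx₀ i j
  refine ⟨⟨Matrix.of x₀, ?_⟩, V⁻¹, V, hVi, hVi', hmap⟩
  apply (algebraMap F K).injective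
  rw [RingHom.map_det, RingHom.mapMatrix_apply, hmap, map_one, hY, det_mul_right_comm, hVi]
  simp [hdet]

lemma map_pow_of_diagonal {n : ℕ} {F K : Type*} [Field F] [Field K]
    [Algebra F K] {t : Fin n → K} {x : Matrix (Fin n) (Fin n) F}
    {P P' : Matrix (Fin n) (Fin n) K} (h1 : P * P' = 1) (h2 : P' * P = 1)
    (hx : x.map (algebraMap F K) = P * diagonal t * P') (k : ℕ) :
    (x ^ k).map (algebraMap F K) = P * diagonal (fun i => t i ^ k) * P' := by
  rw [Matrix.map_pow, hx]
  induction k with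
  | zero => simp [h1, ← Pi.one_def]
  | succ k ih =>
    rw [pow_succ, ih]
    calc _ = P * diagonal (fun i => t i ^ k) * (P' * P) * diagonal t * P' := by
          simp only [mul_assoc]
      _ = _ := by
          rw [h2, mul_one, mul_assoc P, diagonal_mul_diagonal]
          simp only [pow_succ]

lemma toPSL_pow_eq_one_iff_of_diagonal {n : ℕ} {F K : Type*} [Field F] [Field K]
    [Algebra F K] {t : Fin n → K} {x : SpecialLinearGroup (Fin n) F}
    {P P' : Matrix (Fin n) (Fin n) K} (h1 : P * P' = 1) (h2 : P' * P = 1)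
    (hx : (x : Matrix (Fin n) (Fin n) F).map (algebraMap F K) = P * diagonal t * P') (k : ℕ) :
    toPSL n F x ^ k = 1 ↔ ∀ i j, t i ^ k = t j ^ k := by
  have hpow : ((x : Matrix (Fin n) (Fin n) F) ^ k).map (algebraMap F K) =
      P * diagonal (fun i => t i ^ k) * P' := map_pow_of_diagonal h1 h2 hx k
  rw [toPSL_pow_eq_one_iff]
  constructor
  · rintro ⟨c, hc⟩
    rw [hc] at hpow
    have h3 : (scalar (Fin n) c).map (algebraMap F K) = scalar (Fin n) (algebraMap F K c) := by
      ext i j; simp [diagonal_apply]; split_ifs <;> simp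
    rw [h3] at hpow
    have h4 : diagonal (fun i => t i ^ k) = scalar (Fin n) (algebraMap F K c) := by
      calc diagonal (fun i => t i ^ k) = (P' * P) * diagonal (fun i => t i ^ k) * (P' * P) := by
            rw [h2]; simp
        _ = P' * (P * diagonal (fun i => t i ^ k) * P') * P := by simp only [mul_assoc]
        _ = _ := by
          rw [← hpow, ← (scalar_commute _ (Commute.all _) P').eq, mul_assoc, h2, mul_one]
    have h5 : ∀ i, t i ^ k = algebraMap F K c := fun i => by
      have := congrFun (congrFun h4 i) i
      simpa using this
    intro i j
    rw [h5, h5]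
  · intro h
    rcases isEmpty_or_nonempty (Fin n) with he | ⟨⟨i⟩⟩
    · exact ⟨1, Subsingleton.elim _ _⟩
    have h6 : diagonal (fun i => t i ^ k) = scalar (Fin n) (t i ^ k) := by
      ext a b; simp [diagonal_apply, h a i]
    rw [h6, ← (scalar_commute _ (Commute.all _) P).eq, mul_assoc, h1, mul_one] at hpow
    refine ⟨((x : Matrix (Fin n) (Fin n) F) ^ k) i i, ?_⟩
    ext a b
    apply (algebraMap F K).injective
    have h7 := congrFun (congrFun hpow a) b
    have h8 := congrFun (congrFun hpow i) i
    simp only [map_apply] at h7 h8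
    rw [h7, scalar_apply, scalar_apply, diagonal_apply, diagonal_apply]
    split_ifs
    · rw [h8]; simp
    · simp

end

section

open Matrix

/-- If `c` normalises `U` and no nontrivial power `c ^ j`, `j < k`, centralises a nontrivial
element of `U`, then a representation in which `1 + c + ⋯ + c ^ (k - 1)` vanishes is trivial on
`U`, provided `|U|` is invertible. -/
lemma map_eq_one_of_frobenius {S V : Type*} [Group S] [AddCommGroup V]
    (ρ : S →* AddMonoid.End V) (U : Subgroup S) [Finite U] (c : S)
    (hU : ∀ u ∈ U, c * u * c⁻¹ ∈ U) {k : ℕ} (hk : 0 < k)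
    (hfree : ∀ j, 0 < j → j < k → ∀ u ∈ U, u * c ^ j = c ^ j * u → u = 1)
    (hnorm : ∀ v, ∑ j ∈ Finset.range k, ρ (c ^ j) v = 0) {r : ℕ} (hr : ∀ v : V, r • v = 0)
    (hcard : (Nat.card U).Coprime r) : ∀ u ∈ U, ρ u = 1 := by
  classical
  have := Fintype.ofFinite U
  have hρ : ∀ a b v, ρ (a * b) v = ρ a (ρ b v) := fun a b v => by rw [map_mul]; rfl
  have hUj : ∀ j : ℕ, ∀ u ∈ U, c ^ j * u * (c ^ j)⁻¹ ∈ U := by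
    intro j
    induction j with
    | zero => intro u hu; simpa using hu
    | succ j ih =>
      intro u hu
      have := hU _ (ih u hu)
      rw [pow_succ']
      simpa [mul_assoc] using this
  have key : ∀ v, ∃ w, Nat.card U • v = ∑ u : U, ρ u w := by
    intro v
    have h1 : ∑ u : U, ∑ j ∈ Finset.range k, ρ (u * c ^ j * (u : S)⁻¹) v = 0 := by
      apply Finset.sum_eq_zero
      intro u _
      have : ∀ j, ρ (u * c ^ j * (u : S)⁻¹) v = ρ u (ρ (c ^ j) (ρ (u : S)⁻¹ v)) := by
        intro j; rw [hρ, hρ]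
      simp only [this]
      rw [← map_sum, hnorm, map_zero]
    obtain ⟨m, rfl⟩ : ∃ m, k = m + 1 := ⟨k - 1, by omega⟩
    have h2 : ∀ u : U, ∑ j ∈ Finset.range (m + 1), ρ (u * c ^ j * (u : S)⁻¹) v =
        ∑ j ∈ Finset.range m, ρ (u * c ^ (j + 1) * (u : S)⁻¹) v + v := by
      intro u
      rw [Finset.sum_range_succ']
      simp
    simp only [h2] at h1
    rw [Finset.sum_add_distrib, Finset.sum_comm, Finset.sum_const, Finset.card_univ,
      ← Nat.card_eq_fintype_card] at h1
    refine ⟨-∑ j ∈ Finset.range m, ρ (c ^ (j + 1)) v, ?_⟩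
    rw [eq_comm, ← sub_eq_zero, ← neg_eq_zero, ← h1]
    have h3 : ∀ j ∈ Finset.range m, ∑ u : U, ρ (u * c ^ (j + 1) * (u : S)⁻¹) v =
        ∑ u : U, ρ u (ρ (c ^ (j + 1)) v) := by
      intro j hj
      let g : U → U := fun u => u * ⟨c ^ (j + 1) * (u : S)⁻¹ * (c ^ (j + 1))⁻¹,
        hUj _ _ (U.inv_mem u.2)⟩
      have hg : Function.Injective g := by
        intro u u' h
        have h' := congrArg Subtype.val h
        simp only [g, Subgroup.coe_mul] at h'
        have := hfree (j + 1) (by omega) (by simpa using hj) ((u' : S)⁻¹ * u)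
          (U.mul_mem (U.inv_mem u'.2) u.2) (by
            have e1 : (u : S) = u' * (c ^ (j + 1) * (u' : S)⁻¹ * (c ^ (j + 1))⁻¹) *
                (c ^ (j + 1) * (u : S)⁻¹ * (c ^ (j + 1))⁻¹)⁻¹ := by
              rw [← h']; group
            calc (u' : S)⁻¹ * u * c ^ (j + 1) = (u' : S)⁻¹ * (u' * (c ^ (j + 1) * (u' : S)⁻¹ *
                (c ^ (j + 1))⁻¹) * (c ^ (j + 1) * (u : S)⁻¹ * (c ^ (j + 1))⁻¹)⁻¹) *
                  c ^ (j + 1) := by rw [← e1]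
              _ = _ := by group)
        exact Subtype.ext (inv_mul_eq_one.1 this).symm
      have hb : Function.Bijective g := Finite.injective_iff_bijective.1 hg
      rw [← hb.sum_comp (fun u : U => ρ u (ρ (c ^ (j + 1)) v))]
      refine Finset.sum_congr rfl fun u _ => ?_
      rw [← hρ]
      congr 2
      simp [g, mul_assoc]
    rw [Finset.sum_congr rfl h3, Finset.sum_comm]
    simp only [map_neg, map_sum, Finset.sum_neg_distrib]
    abel
  intro u hu
  ext v
  obtain ⟨w, hw⟩ := key v
  have h1 : Nat.card U • ρ u v = Nat.card U • v := by
    rw [← map_nsmul, hw, map_sum]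
    simp only [← hρ]
    exact Fintype.sum_equiv (Equiv.mulLeft ⟨u, hu⟩) _ _ fun _ => rfl
  have h2 : Nat.card U • (ρ u v - v) = 0 := by rw [smul_sub, h1, sub_self]
  have h3 := Nat.dvd_gcd (addOrderOf_dvd_of_nsmul_eq_zero h2)
    (addOrderOf_dvd_of_nsmul_eq_zero (hr (ρ u v - v)))
  rw [hcard.gcd_eq_one, Nat.dvd_one, AddMonoid.addOrderOf_eq_one_iff] at h3
  exact sub_eq_zero.1 h3

section Transvections

variable {n : ℕ} {F : Type*} [Field F]

/-- The group of transvections with a given centre `w`. -/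
def transvectionGroup (w : Fin n → F) : Subgroup (SpecialLinearGroup (Fin n) F) where
  carrier := {x | ∃ φ : Fin n → F, φ ⬝ᵥ w = 0 ∧ x.1 = 1 + vecMulVec w φ}
  one_mem' := ⟨0, by simp, by simp⟩
  mul_mem' := by
    rintro x y ⟨φ, hφ, hx⟩ ⟨ψ, hψ, hy⟩
    refine ⟨φ + ψ, by rw [add_dotProduct, hφ, hψ, add_zero], ?_⟩
    change x.1 * y.1 = _
    rw [hx, hy, mul_add, add_mul, mul_one, mul_one, add_mul, one_mul, vecMulVec_mul_vecMulVec, hφ,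
      vecMulVec_add]
    simp; abel
  inv_mem' := by
    rintro x ⟨φ, hφ, hx⟩
    refine ⟨-φ, by rw [neg_dotProduct, hφ, neg_zero], ?_⟩
    have h1 : x.1 * (1 + vecMulVec w (-φ)) = 1 := by
      rw [hx, mul_add, add_mul, mul_one, mul_one, add_mul, one_mul, vecMulVec_mul_vecMulVec, hφ,
        vecMulVec_neg]
      simp
    have h2 : (x⁻¹).1 * x.1 = 1 := congrArg Subtype.val (inv_mul_cancel x)
    calc (x⁻¹).1 = (x⁻¹).1 * (x.1 * (1 + vecMulVec w (-φ))) := by rw [h1, mul_one]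
      _ = _ := by rw [← mul_assoc, h2, one_mul]

end Transvections

section Transvections

variable {n : ℕ} {F : Type*} [Field F]

lemma transvection_mem_transvectionGroup {i j : Fin n} (hij : i ≠ j) (b : F) :
    SpecialLinearGroup.transvection hij b ∈ transvectionGroup (Pi.single i 1 : Fin n → F) := by
  refine ⟨Pi.single j b, by simp [hij], ?_⟩
  change Matrix.transvection i j b = _
  rw [Matrix.transvection]
  congr 1
  ext a c
  simp only [single_apply, vecMulVec_apply, Pi.single_apply]
  grind

lemma diag2n_eq_transvections {i j : Fin n} (hij : i ≠ j) {c : F} (hc : c ≠ 0) :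
    SpecialLinearGroup.diag2n hij c hc =
      SpecialLinearGroup.transvection hij c * SpecialLinearGroup.transvection hij.symm (-c⁻¹) *
      SpecialLinearGroup.transvection hij c * (SpecialLinearGroup.transvection hij (-1) *
      SpecialLinearGroup.transvection hij.symm 1 * SpecialLinearGroup.transvection hij (-1)) := by
  have key : ∀ d : F, d ≠ 0 → Matrix.transvection i j d * Matrix.transvection j i (-d⁻¹) *
      Matrix.transvection i j d = 1 + single i i (-1) + single j j (-1) + single i j d +
        single j i (-d⁻¹) := by
    intro d hd
    simp only [Matrix.transvection, add_mul, mul_add, one_mul, mul_one, single_mul_single_same,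
      single_mul_single_of_ne _ _ _ _ hij.symm]
    ext a b
    simp only [Matrix.add_apply, single_apply, Matrix.zero_apply]
    grind
  apply Subtype.ext
  change diagonal _ = (Matrix.transvection i j c * Matrix.transvection j i (-c⁻¹) *
      Matrix.transvection i j c) * (Matrix.transvection i j (-1) * Matrix.transvection j i 1 *
      Matrix.transvection i j (-1))
  have k1 := key (-1) (neg_ne_zero.2 one_ne_zero)
  rw [inv_neg, inv_one, neg_neg] at k1
  rw [key c hc, k1]
  simp only [add_mul, mul_add, one_mul, mul_one, single_mul_single_same,
      single_mul_single_of_ne _ _ _ _ hij, single_mul_single_of_ne _ _ _ _ hij.symm]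
  ext a b
  simp only [diagonal_apply, Matrix.add_apply, single_apply, one_apply, Matrix.zero_apply]
  grind

/-- A normal subgroup of `SL_n` containing all the transvections with one centre is everything. -/
lemma eq_top_of_transvectionGroup_le (hn : 2 ≤ n) (N : Subgroup (SpecialLinearGroup (Fin n) F))
    [N.Normal] {w : Fin n → F} (hw : w ≠ 0) (h : transvectionGroup w ≤ N) : N = ⊤ := by
  have hsmul : ∀ (a : F) (v : Fin n → F), transvectionGroup (a • v) ≤ transvectionGroup v := by
    rintro a v x ⟨φ, hφ, hx⟩
    rcases eq_or_ne a 0 with rfl | ha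
    · exact ⟨0, by simp, by simp [hx]⟩
    · refine ⟨a • φ, ?_, ?_⟩
      · rw [dotProduct_smul] at hφ
        rw [smul_dotProduct, hφ]
      · rw [hx, smul_vecMulVec, vecMulVec_smul]
  have hall : ∀ v : Fin n → F, transvectionGroup v ≤ N := by
    intro v
    by_cases hind : ∃ i j, w i * v j - w j * v i ≠ 0
    · obtain ⟨i, j, hD⟩ := hind
      set D := w i * v j - w j * v i with hDdef
      let φ : Fin n → F := Pi.single i ((v j - w j) / D) + Pi.single j ((w i - v i) / D)
      have hφw : φ ⬝ᵥ w = 1 := by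
        simp only [φ, add_dotProduct, single_dotProduct]
        field_simp
        rw [hDdef]; ring
      have hφv : φ ⬝ᵥ v = 1 := by
        simp only [φ, add_dotProduct, single_dotProduct]
        field_simp
        rw [hDdef]; ring
      let g : SpecialLinearGroup (Fin n) F := ⟨1 + vecMulVec (v - w) φ, by
        rw [vecMulVec_eq Unit, det_one_add_replicateCol_mul_replicateRow, dotProduct_sub, hφw, hφv]
        ring⟩
      have hg : g.1 *ᵥ w = v := by
        change (1 + vecMulVec (v - w) φ) *ᵥ w = v
        rw [add_mulVec, one_mulVec, vecMulVec_mulVec, hφw]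
        simp
      clear_value g
      rintro x ⟨ψ, hψ, hx⟩
      have hy : g⁻¹ * x * g ∈ transvectionGroup w := by
        refine ⟨ψ ᵥ* g.1, by rw [← dotProduct_mulVec, hg, hψ], ?_⟩
        change (g⁻¹).1 * x.1 * g.1 = _
        have h2 : (g⁻¹).1 * g.1 = 1 := congrArg Subtype.val (inv_mul_cancel g)
        have h3 : (g⁻¹).1 *ᵥ v = w := by rw [← hg, mulVec_mulVec, h2, one_mulVec]
        rw [hx, mul_add, add_mul, mul_one, h2, mul_vecMulVec, vecMulVec_mul, h3]
      have := ‹N.Normal›.conj_mem _ (h hy) g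
      simpa [mul_assoc] using this
    · push Not at hind
      obtain ⟨i, hi⟩ := Function.ne_iff.1 hw
      rw [Pi.zero_apply] at hi
      have : v = (v i / w i) • w := by
        ext j
        have := hind i j
        rw [Pi.smul_apply, smul_eq_mul]
        field_simp
        linear_combination this
      rw [this]
      exact (hsmul _ _).trans h
  have ht : ∀ (i j : Fin n) (hij : i ≠ j) (a : F), SpecialLinearGroup.transvection hij a ∈ N :=
    fun i j hij a => hall _ (transvection_mem_transvectionGroup hij a)
  have : Nontrivial (Fin n) := Fin.nontrivial_iff_two_le.2 hn
  refine eq_top_iff.2 fun x _ => ?_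
  refine SpecialLinearGroup.diagonal_transvection_induction' (· ∈ N) x ?_ ht
    (fun A B => N.mul_mem)
  intro i j hij c hc
  rw [diag2n_eq_transvections hij hc]
  exact N.mul_mem (N.mul_mem (N.mul_mem (ht _ _ _ _) (ht _ _ _ _)) (ht _ _ _ _))
    (N.mul_mem (N.mul_mem (ht _ _ _ _) (ht _ _ _ _)) (ht _ _ _ _))

lemma exists_card_transvectionGroup_eq (p : ℕ) [Fact p.Prime] [CharP F p] [Finite F]
    (w : Fin n → F) : ∃ m, Nat.card (transvectionGroup w) = p ^ m := by
  have : Finite (SpecialLinearGroup (Fin n) F) := inferInstanceAs (Finite {_A // _})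
  rw [← IsPGroup.iff_card]
  rintro ⟨x, φ, hφ, hx⟩
  refine ⟨1, ?_⟩
  rw [pow_one]
  apply Subtype.ext
  apply Subtype.ext
  change (x ^ p).1 = 1
  have : ∀ k : ℕ, (x ^ k).1 = 1 + vecMulVec w ((k : F) • φ) := by
    intro k
    induction k with
    | zero => simp
    | succ k ih =>
      rw [pow_succ]
      change (x ^ k).1 * x.1 = _
      rw [ih, hx, mul_add, add_mul, mul_one, mul_one, add_mul, one_mul, vecMulVec_mul_vecMulVec,
        smul_dotProduct, hφ]
      push_cast
      rw [add_smul, one_smul, vecMulVec_add]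
      simp; abel
  rw [this, CharP.cast_eq_zero]
  simp

/-- The eigenvector group of a diagonalisable element acts as a Frobenius group. -/
lemma eq_one_of_commute_of_diagonal {K : Type*} [Field K] [Algebra F K] {t : Fin n → K}
    {c : SpecialLinearGroup (Fin n) F} {P P' : Matrix (Fin n) (Fin n) K} (h1 : P * P' = 1)
    (h2 : P' * P = 1)
    (hc : (c : Matrix (Fin n) (Fin n) F).map (algebraMap F K) = P * diagonal t * P')
    (i₀ : Fin n) {a : F} (ha : algebraMap F K a = t i₀) {w : Fin n → F} (hw0 : w ≠ 0)
    (hw : c.1 *ᵥ w = a • w)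
    (hw' : ∀ i, i ≠ i₀ → t i ≠ t i₀) {j : ℕ} (hj : ∀ i, i ≠ i₀ → t i ^ j ≠ t i₀ ^ j)
    {u : SpecialLinearGroup (Fin n) F} (hu : u ∈ transvectionGroup w)
    (hcomm : u * c ^ j = c ^ j * u) : u = 1 := by
  obtain ⟨φ, hφ, hu⟩ := hu
  suffices hφ0 : φ = 0 by
    apply Subtype.ext
    rw [hu, hφ0]; simp
  have hwj : ∀ j : ℕ, (c ^ j).1 *ᵥ w = a ^ j • w := by
    intro j
    induction j with
    | zero => rw [pow_zero, pow_zero, one_smul]; exact one_mulVec w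
    | succ j ih =>
      rw [pow_succ']
      change (c.1 * (c ^ j).1) *ᵥ w = _
      rw [← mulVec_mulVec, ih, mulVec_smul, hw, smul_smul, pow_succ]
  have e1 : vecMulVec w (φ ᵥ* (c ^ j).1) = vecMulVec w (a ^ j • φ) := by
    have : u.1 * (c ^ j).1 = (c ^ j).1 * u.1 := congrArg Subtype.val hcomm
    rw [hu, add_mul, mul_add, one_mul, mul_one, add_right_inj, vecMulVec_mul, mul_vecMulVec, hwj,
      smul_vecMulVec] at this
    rw [this, vecMulVec_smul]
  obtain ⟨i, hi⟩ := Function.ne_iff.1 hw0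
  rw [Pi.zero_apply] at hi
  have e2 : φ ᵥ* (c ^ j).1 = a ^ j • φ := by
    ext b
    have := congrFun (congrFun e1 i) b
    rw [vecMulVec_apply, vecMulVec_apply] at this
    exact mul_left_cancel₀ hi this
  have hcK : ∀ m : ℕ, ((c ^ m).1).map (algebraMap F K) = P * diagonal (fun i => t i ^ m) * P' :=
    fun m => (congrArg (fun M : Matrix (Fin n) (Fin n) F => M.map (algebraMap F K))
      (Matrix.SpecialLinearGroup.coe_pow c m)).trans (map_pow_of_diagonal h1 h2 hc m)
  set ψ : Fin n → K := (algebraMap F K ∘ φ) ᵥ* P with hψ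
  set v : Fin n → K := P' *ᵥ (algebraMap F K ∘ w) with hv
  have hPv : P *ᵥ v = algebraMap F K ∘ w := by rw [hv, mulVec_mulVec, h1, one_mulVec]
  have hψP : ψ ᵥ* P' = algebraMap F K ∘ φ := by rw [hψ, vecMul_vecMul, h1, vecMul_one]
  have hψv : ψ ⬝ᵥ v = 0 := by
    rw [hv, dotProduct_mulVec, hψP, ← RingHom.map_dotProduct, hφ, map_zero]
  have hv0 : ∀ i, i ≠ i₀ → v i = 0 := by
    intro i hi
    have e3 : diagonal t *ᵥ v = t i₀ • v := by
      have : (P * diagonal t * P') *ᵥ (algebraMap F K ∘ w) = t i₀ • (algebraMap F K ∘ w) := by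
        rw [← hc, ← ha]
        ext b
        have := congrArg (algebraMap F K) (congrFun hw b)
        rw [RingHom.map_mulVec] at this
        rw [this]
        simp
      rw [← hPv, ← mulVec_smul, mul_assoc, ← mulVec_mulVec, ← mulVec_mulVec] at this
      have := congrArg (P' *ᵥ ·) this
      simp only [mulVec_mulVec, ← mul_assoc, h2, one_mul, mul_one] at this
      simpa only [one_mulVec] using this
    have := congrFun e3 i
    rw [mulVec_diagonal, Pi.smul_apply, smul_eq_mul] at this
    by_contra h
    exact hw' i hi (mul_right_cancel₀ h this)
  have hψ0 : ∀ i, i ≠ i₀ → ψ i = 0 := by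
    intro i hi
    have e3 : ψ ᵥ* diagonal (fun i => t i ^ j) = t i₀ ^ j • ψ := by
      have : (algebraMap F K ∘ φ) ᵥ* (P * diagonal (fun i => t i ^ j) * P') =
          t i₀ ^ j • (algebraMap F K ∘ φ) := by
        rw [← hcK, ← ha]
        ext b
        have := congrArg (algebraMap F K) (congrFun e2 b)
        rw [RingHom.map_vecMul] at this
        rw [this]
        simp
      rw [← hψP, ← smul_vecMul, ← vecMul_vecMul, ← vecMul_vecMul] at this
      have := congrArg (· ᵥ* P) this
      simp only [vecMul_vecMul, h2, one_mul] at this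
      simpa only [mul_assoc, h2, mul_one, vecMul_one] using this
    have := congrFun e3 i
    rw [vecMul_diagonal, Pi.smul_apply, smul_eq_mul, mul_comm] at this
    by_contra h
    exact hj i hi (mul_right_cancel₀ h this)
  have hvi : v i₀ ≠ 0 := by
    intro h
    apply hi
    have hv00 : v = 0 := by
      ext b
      by_cases hb : b = i₀
      · rw [hb, h]; rfl
      · exact hv0 b hb
    have := congrFun hPv i
    rw [hv00, mulVec_zero] at this
    exact (map_eq_zero (algebraMap F K)).1 this.symm
  have hψi : ψ i₀ = 0 := by
    rw [dotProduct, Finset.sum_eq_single i₀ (fun b _ hb => by rw [hψ0 b hb, zero_mul])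
      (fun h => absurd (Finset.mem_univ _) h)] at hψv
    exact (mul_eq_zero.1 hψv).resolve_right hvi
  have hψ00 : ψ = 0 := by
    ext b
    by_cases hb : b = i₀
    · rw [hb, hψi]; rfl
    · exact hψ0 b hb
  ext b
  have := congrFun hψP b
  rw [hψ00, zero_vecMul] at this
  exact (map_eq_zero (algebraMap F K)).1 this.symm

end Transvections

end

section

open Matrix Polynomial

section Torus

variable {F : Type*} [Field F] [Fintype F]

lemma adjoinRoot_root_pow_geomSum {f : F[X]} (hf : Irreducible f) (hm : f.Monic) :
    AdjoinRoot.root f ^ (∑ i ∈ Finset.range f.natDegree, Fintype.card F ^ i) =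
      algebraMap F (AdjoinRoot f) ((-1) ^ f.natDegree * f.coeff 0) := by
  have := Fact.mk hf
  have := hm.finite_adjoinRoot
  have : Finite (AdjoinRoot f) := Module.finite_of_finite F
  have h := FiniteField.algebraMap_norm_eq_pow (K := F) (x := AdjoinRoot.root f)
  have hg : (AdjoinRoot.powerBasis hm.ne_zero).gen = AdjoinRoot.root f :=
    AdjoinRoot.powerBasis_gen hm.ne_zero
  rw [← hg, Algebra.PowerBasis.norm_gen_eq_coeff_zero_minpoly,
    AdjoinRoot.minpoly_powerBasis_gen_of_monic hm,
    AdjoinRoot.powerBasis_dim, hg, Nat.card_eq_fintype_card (α := F)] at h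
  rw [h, Nat.geomSum_eq Fintype.one_lt_card, Module.natCard_eq_pow_finrank (K := F),
    (AdjoinRoot.powerBasis hm.ne_zero).finrank, AdjoinRoot.powerBasis_dim,
    Nat.card_eq_fintype_card]

variable {n : ℕ}

omit [Fintype F] in
lemma toPSL_pow_eq_one_of_charpoly_dvd {y : SpecialLinearGroup (Fin n) F} {k : ℕ} {b : F}
    (h : (y : Matrix (Fin n) (Fin n) F).charpoly ∣ X ^ k - C b) : toPSL n F y ^ k = 1 := by
  rw [toPSL_pow_eq_one_iff]
  refine ⟨b, ?_⟩
  obtain ⟨g, hg⟩ := h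
  have := congrArg (aeval (y : Matrix (Fin n) (Fin n) F)) hg
  rw [map_mul, aeval_self_charpoly, zero_mul, map_sub, map_pow, aeval_X, aeval_C,
    sub_eq_zero] at this
  exact this

omit [Fintype F] in
lemma charpoly_coeff_zero_SL (y : SpecialLinearGroup (Fin n) F) :
    (y : Matrix (Fin n) (Fin n) F).charpoly.coeff 0 = (-1) ^ n := by
  have h := det_eq_sign_charpoly_coeff (y : Matrix (Fin n) (Fin n) F)
  have h1 : (y : Matrix (Fin n) (Fin n) F).det = 1 := y.2
  rw [h1, Fintype.card_fin] at h
  have h2 : ((-1 : F) ^ n) * (-1) ^ n = 1 := by rw [← mul_pow]; simp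
  calc _ = ((-1 : F) ^ n) * (-1) ^ n * (y : Matrix (Fin n) (Fin n) F).charpoly.coeff 0 := by
        rw [h2, one_mul]
    _ = _ := by rw [mul_assoc, ← h, mul_one]

lemma mul_geomSum (N : ℕ) : (Fintype.card F - 1) * ∑ i ∈ Finset.range N, Fintype.card F ^ i =
    Fintype.card F ^ N - 1 := by
  rw [mul_comm]; exact geom_sum_mul_of_one_le Fintype.card_pos N

/-- The exponent in `PSL_n` of the maximal torus with an irreducible block of size `n - 1`. -/
lemma toPSL_pow_eq_one_of_charpoly_eq_mul {y : SpecialLinearGroup (Fin n) F} {N k : ℕ}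
    (hn : n = N + 1) {f : F[X]} {b : F} (hf : Irreducible f) (hm : f.Monic) (hN : f.natDegree = N)
    (hb : IsCoprime f (X - C b)) (hχ : (y : Matrix (Fin n) (Fin n) F).charpoly = f * (X - C b))
    (hk : Fintype.card F ^ N - 1 ∣ k * (1 + ∑ i ∈ Finset.range N, Fintype.card F ^ i)) :
    toPSL n F y ^ k = 1 := by
  have := Fact.mk hf
  set θ := AdjoinRoot.root f with hθ
  set Q := ∑ i ∈ Finset.range N, Fintype.card F ^ i with hQ
  have h0 := charpoly_coeff_zero_SL y
  rw [hχ, mul_coeff_zero, coeff_sub, coeff_X_zero, coeff_C_zero, zero_sub, hn, pow_succ] at h0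
  have h1 : ((-1) ^ N * f.coeff 0) * b = 1 := by
    have h2 : ((-1 : F) ^ N) * (-1) ^ N = 1 := by rw [← mul_pow]; simp
    linear_combination (-(-1) ^ N) * h0 + h2
  have hnorm := adjoinRoot_root_pow_geomSum hf hm
  rw [hN, ← hQ] at hnorm
  have h2 : θ ^ Q * algebraMap F _ b = 1 := by rw [hnorm, ← map_mul, h1, map_one]
  have hb0 : algebraMap F (AdjoinRoot f) b ≠ 0 := right_ne_zero_of_mul_eq_one h2
  have hθ0 : θ ≠ 0 := by
    intro h
    have hQ0 : Q ≠ 0 := by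
      have hN0 : 0 < N := hN ▸ hf.natDegree_pos
      have : Fintype.card F ^ 0 ≤ Q := Finset.single_le_sum (f := fun i => Fintype.card F ^ i)
        (fun _ _ => Nat.zero_le _) (Finset.mem_range.2 hN0)
      rw [pow_zero] at this; omega
    rw [h, zero_pow hQ0, zero_mul] at h2
    exact zero_ne_one h2
  have hq : θ ^ (Fintype.card F ^ N - 1) = 1 := by
    have := adjoinRoot_root_pow_card hf
    rw [hN] at this
    have hp : 0 < Fintype.card F ^ N := Nat.pow_pos Fintype.card_pos
    apply mul_left_cancel₀ hθ0
    rw [← pow_succ', mul_one, Nat.sub_add_cancel hp]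
    exact this θ
  have hkey : θ ^ k = algebraMap F _ (b ^ k) := by
    obtain ⟨m, hm⟩ := hk
    have h3 : θ ^ (k * (1 + Q)) = 1 := by rw [hm, pow_mul, hq, one_pow]
    have h4 : θ ^ k * (θ ^ Q) ^ k = 1 := by rw [← h3, ← pow_mul, ← pow_add]; ring_nf
    have h5 : (θ ^ Q) ^ k * algebraMap F _ (b ^ k) = 1 := by rw [map_pow, ← mul_pow, h2, one_pow]
    calc θ ^ k = θ ^ k * ((θ ^ Q) ^ k * algebraMap F _ (b ^ k)) := by rw [h5, mul_one]
      _ = _ := by rw [← mul_assoc, h4, one_mul]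
  apply toPSL_pow_eq_one_of_charpoly_dvd (b := b ^ k)
  rw [hχ]
  apply hb.mul_dvd
  · rw [← AdjoinRoot.mk_eq_zero, map_sub, map_pow, AdjoinRoot.mk_X, AdjoinRoot.mk_C, ← hθ, hkey]
    exact sub_self _
  · rw [C_pow]; exact sub_dvd_pow_sub_pow _ _ _

/-- The exponent in `PSL_n` of a Singer torus. -/
lemma toPSL_pow_eq_one_of_irreducible_charpoly {y : SpecialLinearGroup (Fin n) F} {k : ℕ}
    (hf : Irreducible (y : Matrix (Fin n) (Fin n) F).charpoly)
    (hk : ∑ i ∈ Finset.range n, Fintype.card F ^ i ∣ k * (Fintype.card F - 1)) :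
    toPSL n F y ^ k = 1 := by
  have := Fact.mk hf
  set f := (y : Matrix (Fin n) (Fin n) F).charpoly with hfd
  set θ := AdjoinRoot.root f with hθ
  have hnorm := adjoinRoot_root_pow_geomSum hf (charpoly_monic _)
  have h2 : ((-1 : F) ^ n) * (-1) ^ n = 1 := by rw [← mul_pow]; simp
  rw [charpoly_natDegree_eq_dim, Fintype.card_fin, charpoly_coeff_zero_SL, h2, map_one] at hnorm
  have h3 : (θ ^ k) ^ (Fintype.card F - 1) = 1 := by
    obtain ⟨m, hm⟩ := hk
    rw [← pow_mul, hm, pow_mul]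
    change (AdjoinRoot.root f ^ _) ^ m = 1
    rw [hnorm, one_pow]
  obtain ⟨b, hb⟩ := exists_algebraMap_eq_of_pow_card_eq (F := F) (x := θ ^ k) (by
    rw [← Nat.sub_add_cancel (Fintype.card_pos (α := F)), pow_succ, h3, one_mul])
  apply toPSL_pow_eq_one_of_charpoly_dvd (b := b)
  rw [← AdjoinRoot.mk_eq_zero, map_sub, map_pow, AdjoinRoot.mk_X, AdjoinRoot.mk_C, ← hθ, ← hb]
  exact sub_self _

end Torus

section Elements

variable {F : Type*} [Field F] [Fintype F]

local notation "qq" => Fintype.card F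

lemma exists_primitiveRoot_algebraicClosure {N : ℕ} (hN : 0 < N) {m : ℕ}
    (hm : m ∣ qq ^ N - 1) : ∃ ζ : AlgebraicClosure F, IsPrimitiveRoot ζ m := by
  have hq : ((qq : ℕ) : AlgebraicClosure F) = 0 := by
    have h : ((qq : ℕ) : F) = 0 := FiniteField.cast_card_eq_zero F
    have := congrArg (algebraMap F (AlgebraicClosure F)) h
    rwa [map_natCast, map_zero] at this
  have hpos : 0 < qq ^ N := Nat.pow_pos Fintype.card_pos
  have : NeZero ((m : ℕ) : AlgebraicClosure F) := by
    refine ⟨fun h => ?_⟩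
    obtain ⟨l, hl⟩ := hm
    have h1 : qq ^ N = m * l + 1 := by omega
    have h2 := congrArg (Nat.cast (R := AlgebraicClosure F)) h1
    push_cast at h2
    rw [hq, h, zero_pow hN.ne', zero_mul, zero_add] at h2
    exact zero_ne_one h2
  exact HasEnoughRootsOfUnity.exists_primitiveRoot (AlgebraicClosure F) m

omit [Fintype F] in
lemma exists_mulVec_eq_smul_of_diagonal {n : ℕ} {K : Type*} [Field K] [Algebra F K] {t : Fin n → K}
    {c : Matrix (Fin n) (Fin n) F} {P P' : Matrix (Fin n) (Fin n) K} (h1 : P * P' = 1)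
    (hc : c.map (algebraMap F K) = P * diagonal t * P')
    (i₀ : Fin n) {a : F} (ha : algebraMap F K a = t i₀) : ∃ w ≠ 0, c *ᵥ w = a • w := by
  have hdet : (c - scalar (Fin n) a).det = 0 := by
    apply (algebraMap F K).injective
    rw [map_zero, RingHom.map_det]
    have : (algebraMap F K).mapMatrix (c - scalar (Fin n) a) =
        P * diagonal (fun i => t i - t i₀) * P' := by
      rw [map_sub]
      change c.map (algebraMap F K) - (scalar (Fin n) a).map (algebraMap F K) = _
      have h2 : (scalar (Fin n) a).map (algebraMap F K) = P * (t i₀ • (1 : Matrix _ _ K)) * P' := by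
        rw [Matrix.mul_smul, Matrix.smul_mul, mul_one, h1, ← ha, scalar_apply,
          diagonal_map (map_zero _),
          smul_one_eq_diagonal]
      rw [hc, h2, ← sub_mul, ← mul_sub, smul_one_eq_diagonal, diagonal_sub]
    rw [this, det_mul, det_mul, det_diagonal, Finset.prod_eq_zero (Finset.mem_univ i₀) (sub_self _),
      mul_zero, zero_mul]
  obtain ⟨w, hw0, hw⟩ := exists_mulVec_eq_zero_iff.2 hdet
  refine ⟨w, hw0, ?_⟩
  rw [sub_mulVec, sub_eq_zero] at hw
  rw [hw]; ext i; simp [scalar_apply, mulVec_diagonal]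

/-- An element of `SL_{N+1}` acting irreducibly on a hyperplane, together with its action on the
group of transvections centred at its remaining eigenvector. -/
lemma exists_hyperplane_element {N k : ℕ} (hN : 0 < N) (h1 : qq ^ (N - 1) < qq ^ N - 1)
    (hk : ∀ j, k ∣ j ↔ qq ^ N - 1 ∣ j * (1 + ∑ i ∈ Finset.range N, qq ^ i)) (hk1 : k ≠ 1) :
    ∃ (c : SpecialLinearGroup (Fin (N + 1)) F) (w : Fin (N + 1) → F) (a : F), w ≠ 0 ∧
      c.1 *ᵥ w = a • w ∧ orderOf (toPSL _ F c) = k ∧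
      ∀ j, 0 < j → j < k → ∀ u ∈ transvectionGroup w, u * c ^ j = c ^ j * u → u = 1 := by
  obtain ⟨ζ, hζ⟩ := exists_primitiveRoot_algebraicClosure (F := F) hN (dvd_refl _)
  set Q := ∑ i ∈ Finset.range N, qq ^ i with hQ
  have hpos : 0 < qq ^ N := Nat.pow_pos Fintype.card_pos
  have hζ0 : ζ ≠ 0 := hζ.ne_zero (by omega)
  have hζN : ζ ^ qq ^ N = ζ := by
    have := hζ.pow_eq_one
    rw [← Nat.sub_add_cancel hpos, pow_succ, this, one_mul]
  have hfrob : ((ζ ^ Q)⁻¹) ^ qq = (ζ ^ Q)⁻¹ := by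
    have : (ζ ^ Q) ^ (qq - 1) = 1 := by
      rw [← pow_mul, mul_comm, hQ, mul_geomSum]; exact hζ.pow_eq_one
    rw [inv_pow, ← Nat.sub_add_cancel (Fintype.card_pos (α := F)), pow_succ, this, one_mul]
  obtain ⟨a, ha⟩ := exists_algebraMap_eq_of_pow_card_eq (F := F) hfrob
  have hfrob' : ∀ i j, (((ζ ^ Q)⁻¹) ^ j) ^ (qq ^ i) = ((ζ ^ Q)⁻¹) ^ j := by
    intro i j
    rw [← pow_mul, mul_comm, pow_mul]
    congr 1
    induction i with
    | zero => simp
    | succ i ih => rw [pow_succ, pow_mul, ih, hfrob]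
  have hinjq : ∀ i, Function.Injective fun x : AlgebraicClosure F => x ^ qq ^ i := by
    intro i
    obtain ⟨p, hp⟩ := CharP.exists F
    have := Fact.mk (CharP.char_is_prime F p)
    have : CharP (AlgebraicClosure F) p := charP_of_injective_algebraMap
      (algebraMap F (AlgebraicClosure F)).injective p
    obtain ⟨m, -, hm⟩ := FiniteField.card F p
    intro x y hxy
    simp only [hm, ← pow_mul] at hxy
    exact iterateFrobenius_inj (AlgebraicClosure F) p _ hxy
  have hkey : ∀ i j, (ζ ^ qq ^ i) ^ j = ((ζ ^ Q)⁻¹) ^ j ↔ k ∣ j := by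
    intro i j
    rw [hk, ← hζ.pow_eq_one_iff_dvd, ← hfrob' i j, ← pow_mul, mul_comm (qq ^ i), pow_mul,
      (hinjq i).eq_iff, inv_pow, ← mul_eq_one_iff_eq_inv₀ (pow_ne_zero _ (pow_ne_zero _ hζ0)),
        ← pow_mul, ← pow_add]
    ring_nf
  set t : Fin (N + 1) → AlgebraicClosure F :=
    Fin.cons ((ζ ^ Q)⁻¹) (fun i : Fin N => ζ ^ qq ^ (i : ℕ)) with ht
  have ht0 : t 0 = (ζ ^ Q)⁻¹ := rfl
  have hts : ∀ i : Fin N, t i.succ = ζ ^ qq ^ (i : ℕ) := fun i => rfl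
  have htj : ∀ i, i ≠ 0 → ∀ j, t i ^ j = t 0 ^ j ↔ k ∣ j := by
    intro i hi j
    obtain ⟨i, rfl⟩ := Fin.exists_succ_eq.2 hi
    rw [hts, ht0, hkey]
  have ht1 : ∀ i, i ≠ 0 → t i ≠ t 0 := by
    intro i hi h
    have := (htj i hi 1).1 (by rw [pow_one, pow_one, h])
    exact hk1 (Nat.dvd_one.1 this)
  have hinj : Function.Injective t := by
    intro i j hij
    by_cases hi : i = 0
    · by_contra hne
      subst hi
      exact ht1 j (Ne.symm hne) hij.symm
    by_cases hj : j = 0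
    · subst hj; exact absurd hij (ht1 i hi)
    obtain ⟨i, rfl⟩ := Fin.exists_succ_eq.2 hi
    obtain ⟨j, rfl⟩ := Fin.exists_succ_eq.2 hj
    rw [hts, hts] at hij
    have hlt : ∀ i : Fin N, qq ^ (i : ℕ) < qq ^ N - 1 := fun i =>
      (Nat.pow_le_pow_right Fintype.card_pos (by omega)).trans_lt h1
    have := Nat.pow_right_injective (Fintype.one_lt_card (α := F)) (hζ.pow_inj (hlt i) (hlt j) hij)
    rw [Fin.ext this]
  obtain ⟨c, P, P', hP, hP', hc⟩ := exists_SL_diagonal (F := F) t hinj (by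
    intro i
    induction i using Fin.cases with
    | zero => exact ⟨0, hfrob.symm⟩
    | succ i =>
      by_cases hi : (i : ℕ) + 1 < N
      · refine ⟨Fin.succ ⟨i + 1, hi⟩, ?_⟩
        rw [hts, hts, ← pow_mul, ← pow_succ]
      · refine ⟨Fin.succ ⟨0, hN⟩, ?_⟩
        rw [hts, hts, ← pow_mul, ← pow_succ, pow_zero, pow_one]
        have : (i : ℕ) + 1 = N := by omega
        rw [this, hζN]) (by
    rw [Fin.prod_univ_succ, ht0]
    simp only [hts]
    rw [Fin.prod_univ_eq_prod_range (fun i => ζ ^ qq ^ i) N, Finset.prod_pow_eq_pow_sum, ← hQ,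
      inv_mul_cancel₀ (pow_ne_zero _ hζ0)])
  obtain ⟨w, hw0, hw⟩ := exists_mulVec_eq_smul_of_diagonal hP hc 0 ha
  refine ⟨c, w, a, hw0, hw, ?_, ?_⟩
  · apply Nat.dvd_antisymm
    · rw [orderOf_dvd_iff_pow_eq_one, toPSL_pow_eq_one_iff_of_diagonal hP hP' hc]
      have : ∀ i, t i ^ k = t 0 ^ k := fun i => by
        by_cases hi : i = 0
        · rw [hi]
        · exact (htj i hi k).2 dvd_rfl
      intro i j
      rw [this, this j]
    · have h := pow_orderOf_eq_one (toPSL _ F c)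
      rw [toPSL_pow_eq_one_iff_of_diagonal hP hP' hc] at h
      exact (htj (Fin.succ ⟨0, hN⟩) (Fin.succ_ne_zero _) _).1 (h _ _)
  · intro j hj hjk u hu hcomm
    exact eq_one_of_commute_of_diagonal hP hP' hc 0 ha hw0 hw ht1
      (fun i hi h => Nat.not_dvd_of_pos_of_lt hj hjk ((htj i hi j).1 h)) hu hcomm

/-- A generator of a Singer torus. -/
lemma exists_singer_element {n k : ℕ} (hn : 2 ≤ n)
    (hk : ∀ j, k ∣ j ↔ ∑ i ∈ Finset.range n, qq ^ i ∣ j * (qq - 1)) :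
    ∃ x : SpecialLinearGroup (Fin n) F, orderOf (toPSL n F x) = k := by
  set Q := ∑ i ∈ Finset.range n, qq ^ i with hQ
  have hdvd : Q ∣ qq ^ n - 1 := ⟨qq - 1, by rw [mul_comm, mul_geomSum]⟩
  obtain ⟨ζ, hζ⟩ := exists_primitiveRoot_algebraicClosure (F := F) (by omega) hdvd
  have hpos : 0 < qq ^ n := Nat.pow_pos Fintype.card_pos
  have hζn : ζ ^ qq ^ n = ζ := by
    rw [← Nat.sub_add_cancel hpos, pow_succ, (hζ.pow_eq_one_iff_dvd _).2 hdvd, one_mul]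
  have hQ0 : Q ≠ 0 := by
    intro h
    rw [h, zero_dvd_iff] at hdvd
    have := Nat.one_lt_pow (by omega : n ≠ 0) (Fintype.one_lt_card (α := F))
    omega
  have hζ0 : ζ ≠ 0 := hζ.ne_zero hQ0
  set t : Fin n → AlgebraicClosure F := fun i => ζ ^ qq ^ (i : ℕ) with ht
  have hlt : ∀ i : Fin n, qq ^ (i : ℕ) < Q := by
    intro i
    have h2 : ∃ j : Fin n, j ≠ i := by
      have : Nontrivial (Fin n) := Fin.nontrivial_iff_two_le.2 hn
      exact exists_ne i
    obtain ⟨j, hj⟩ := h2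
    have : ∑ l ∈ ({(i : ℕ), (j : ℕ)} : Finset ℕ), qq ^ l ≤ Q :=
      Finset.sum_le_sum_of_subset (by
        intro l hl
        simp only [Finset.mem_insert, Finset.mem_singleton] at hl
        rw [Finset.mem_range]; omega)
    rw [Finset.sum_pair (by intro h; exact hj (Fin.ext h.symm))] at this
    have h3 : 0 < qq ^ (j : ℕ) := Nat.pow_pos Fintype.card_pos
    omega
  have hinj : Function.Injective t := fun i j hij =>
    Fin.ext (Nat.pow_right_injective (Fintype.one_lt_card (α := F))
      (hζ.pow_inj (hlt i) (hlt j) hij))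
  obtain ⟨x, P, P', hP, hP', hx⟩ := exists_SL_diagonal (F := F) t hinj (by
    intro i
    by_cases hi : (i : ℕ) + 1 < n
    · exact ⟨⟨i + 1, hi⟩, by simp only [ht]; rw [← pow_mul, ← pow_succ]⟩
    · refine ⟨⟨0, by omega⟩, ?_⟩
      simp only [ht]
      rw [← pow_mul, ← pow_succ, pow_zero, pow_one]
      have : (i : ℕ) + 1 = n := by omega
      rw [this, hζn]) (by
    simp only [ht]
    rw [Fin.prod_univ_eq_prod_range (fun i => ζ ^ qq ^ i) n, Finset.prod_pow_eq_pow_sum]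
    exact hζ.pow_eq_one)
  have key : ∀ j, k ∣ j ↔ (ζ ^ j) ^ qq = ζ ^ j := by
    intro j
    have h0 : ζ ^ j ≠ 0 := pow_ne_zero _ hζ0
    rw [hk, ← hζ.pow_eq_one_iff_dvd, pow_mul]
    conv_rhs => rw [← Nat.sub_add_cancel (Fintype.card_pos (α := F)), pow_succ]
    exact ⟨fun h => by rw [h, one_mul], fun h => mul_right_cancel₀ h0 (by rw [h, one_mul])⟩
  refine ⟨x, Nat.dvd_antisymm ?_ ?_⟩
  · rw [orderOf_dvd_iff_pow_eq_one, toPSL_pow_eq_one_iff_of_diagonal hP hP' hx]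
    have h := (key k).1 dvd_rfl
    have : ∀ i : ℕ, (ζ ^ qq ^ i) ^ k = ζ ^ k := by
      intro i
      rw [← pow_mul, mul_comm, pow_mul]
      induction i with
      | zero => simp
      | succ i ih => rw [pow_succ, pow_mul, ih, h]
    intro i j
    simp only [ht]
    rw [this, this]
  · have h := pow_orderOf_eq_one (toPSL _ F x)
    rw [toPSL_pow_eq_one_iff_of_diagonal hP hP' hx] at h
    rw [key]
    have := h ⟨1, by omega⟩ ⟨0, by omega⟩
    simp only [ht, pow_zero, pow_one] at this
    rw [← pow_mul, mul_comm, pow_mul, this]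

end Elements

section CoprimeCharacteristic

lemma div_gcd_dvd_iff {a b : ℕ} (ha : 0 < a) (j : ℕ) : a / a.gcd b ∣ j ↔ a ∣ j * b := by
  have hg : 0 < a.gcd b := Nat.gcd_pos_of_pos_left _ ha
  obtain ⟨a', b', hc, h1, h2⟩ := Nat.exists_coprime a b
  have h3 : a / a.gcd b = a' := Nat.div_eq_of_eq_mul_left hg h1
  rw [h3]
  calc a' ∣ j ↔ a' ∣ j * b' := hc.dvd_mul_right.symm
    _ ↔ a' * a.gcd b ∣ (j * b') * a.gcd b := (Nat.mul_dvd_mul_iff_right hg).symm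
    _ ↔ a ∣ j * b := by rw [← h1, mul_assoc, ← h2]

lemma exists_isWitness_hyperplane {q N : ℕ} (hq : 2 ≤ q) (hN : 2 ≤ N) :
    ∃ P, IsWitness q N P ∧ P ∣ q ^ N - 1 ∧ P.Coprime (1 + ∑ i ∈ Finset.range N, q ^ i) := by
  rcases hN.eq_or_lt with rfl | hN
  · obtain ⟨P, hP, hd⟩ := exists_isWitness_even hq one_pos
    rw [pow_one] at hd
    refine ⟨P, hP, hd.trans ⟨q - 1, ?_⟩, ?_⟩
    · zify [hq, Nat.one_le_pow 2 q (by omega)]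
      rw [Nat.cast_sub (by omega)]; push_cast; ring
    · have : 1 + ∑ i ∈ Finset.range 2, q ^ i = (q + 1) + 1 := by
        rw [Finset.sum_range_succ, Finset.sum_range_one]; ring
      rw [this]
      exact Nat.Coprime.coprime_dvd_left hd (by simp)
  · obtain ⟨P, hP, hd, hc⟩ := exists_isWitness_coprime hq hN
    refine ⟨P, hP, hd, ?_⟩
    have hgeom : (∑ i ∈ Finset.range N, q ^ i) * (q - 1) = q ^ N - 1 :=
      geom_sum_mul_of_one_le (by omega) N
    set Q := ∑ i ∈ Finset.range N, q ^ i
    have h1 : P.gcd (1 + Q) ∣ q - 1 := by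
      have h2 : P.gcd (1 + Q) ∣ (1 + Q) * (q - 1) := (Nat.gcd_dvd_right _ _).mul_right _
      rw [add_mul, one_mul, hgeom] at h2
      exact (Nat.dvd_add_left ((Nat.gcd_dvd_left _ _).trans hd)).1 h2
    exact Nat.eq_one_of_dvd_coprimes hc (Nat.gcd_dvd_left _ _) h1

variable {F : Type*} [Field F] [Fintype F] {r : ℕ}

local notation "qq" => Fintype.card F

lemma prime_mul_notMem_of_hyperplane (p : ℕ) [Fact p.Prime] [CharP F p] {N k : ℕ} (hN : 2 ≤ N)
    (hr : r.Prime) (hk0 : 0 < k)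
    (hk : ∀ j, k ∣ j ↔ qq ^ N - 1 ∣ j * (1 + ∑ i ∈ Finset.range N, qq ^ i)) :
    r * k ∉ groupSpectrum (ProjectiveSpecialLinearGroup (Fin (N + 1)) F) := by
  rintro ⟨g, hg⟩
  obtain ⟨y, rfl⟩ := toPSL_surjective _ _ g
  obtain ⟨P, hP, hd, hc⟩ := exists_isWitness_hyperplane (Fintype.one_lt_card (α := F)) hN
  have hPk : P ∣ k := hc.dvd_of_dvd_mul_right (hd.trans ((hk k).1 dvd_rfl))
  obtain ⟨f, hf, hm, hfχ, hNf⟩ := exists_factor_of_isWitness p hP (x := y) (hg ▸ hPk.mul_left _)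
  have hdeg := natDegree_le_of_dvd hfχ (charpoly_monic _).ne_zero
  rw [charpoly_natDegree_eq_dim, Fintype.card_fin] at hdeg
  have hfN : f.natDegree = N := by
    obtain ⟨c, hc⟩ := hNf
    have := hf.natDegree_pos
    have : 0 < c := by
      rcases Nat.eq_zero_or_pos c with h | h
      · rw [h] at hc; omega
      · exact h
    have : c < 2 := by
      by_contra h
      have := Nat.mul_le_mul_left N (not_lt.1 h)
      omega
    have : c = 1 := by omega
    rw [hc, this, mul_one]
  obtain ⟨g, hg'⟩ := hfχ
  have hgm : g.Monic := hm.of_mul_monic_left (hg' ▸ charpoly_monic _)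
  have hgd : g.natDegree = 1 := by
    have := congrArg natDegree hg'
    rw [hm.natDegree_mul hgm, charpoly_natDegree_eq_dim, Fintype.card_fin, hfN] at this
    omega
  have hgX : g = X - C (-g.coeff 0) := by
    rw [C_neg, sub_neg_eq_add]; exact hgm.eq_X_add_C hgd
  have h1 := toPSL_pow_eq_one_of_charpoly_eq_mul (k := k) rfl hf hm hfN (b := -g.coeff 0)
    ((hf.coprime_iff_not_dvd).2 fun h => by
      have := natDegree_le_of_dvd h (X_sub_C_ne_zero _)
      rw [natDegree_X_sub_C] at this; omega) (hgX ▸ hg') ((hk k).1 dvd_rfl)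
  rw [← orderOf_dvd_iff_pow_eq_one, hg] at h1
  have := Nat.le_of_dvd hk0 h1
  have := hr.two_le
  nlinarith

lemma prime_mul_notMem_of_singer (p : ℕ) [Fact p.Prime] [CharP F p] {n k : ℕ} (hn : 3 ≤ n)
    (hr : r.Prime) (hk0 : 0 < k)
    (hk : ∀ j, k ∣ j ↔ ∑ i ∈ Finset.range n, qq ^ i ∣ j * (qq - 1)) :
    r * k ∉ groupSpectrum (ProjectiveSpecialLinearGroup (Fin n) F) := by
  have : NeZero n := ⟨by omega⟩
  rintro ⟨g, hg⟩
  obtain ⟨y, rfl⟩ := toPSL_surjective _ _ g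
  obtain ⟨P, hP, hd, hc⟩ := exists_isWitness_coprime (Fintype.one_lt_card (α := F)) hn
  have hPk : P ∣ k := by
    rw [← mul_geomSum] at hd
    exact hc.dvd_of_dvd_mul_right ((hc.dvd_of_dvd_mul_left hd).trans ((hk k).1 dvd_rfl))
  obtain ⟨f, hf, hm, hfχ, hNf⟩ := exists_factor_of_isWitness p hP (x := y) (hg ▸ hPk.mul_left _)
  have hfe : f = (y : Matrix (Fin n) (Fin n) F).charpoly := by
    symm
    apply eq_of_monic_of_dvd_of_natDegree_le hm (charpoly_monic _) hfχ
    rw [charpoly_natDegree_eq_dim, Fintype.card_fin]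
    exact Nat.le_of_dvd hf.natDegree_pos hNf
  have h1 := toPSL_pow_eq_one_of_irreducible_charpoly (y := y) (hfe ▸ hf) ((hk k).1 dvd_rfl)
  rw [← orderOf_dvd_iff_pow_eq_one, hg] at h1
  have := Nat.le_of_dvd hk0 h1
  have := hr.two_le
  nlinarith

omit [Fintype F] in
lemma charpoly_fin_two_dichotomy (y : Matrix (Fin 2) (Fin 2) F) :
    Irreducible y.charpoly ∨ ∃ a b, y.charpoly = (X - C a) * (X - C b) := by
  have hd : y.charpoly.natDegree = 2 := by rw [charpoly_natDegree_eq_dim, Fintype.card_fin]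
  refine or_iff_not_imp_left.2 fun h => ?_
  have h0 : y.charpoly.roots ≠ 0 := fun h0 =>
    h ((charpoly_monic y).irreducible_iff_roots_eq_zero_of_degree_le_three hd.ge (by omega) |>.2 h0)
  obtain ⟨a, ha⟩ := Multiset.exists_mem_of_ne_zero h0
  obtain ⟨g, hg⟩ := dvd_iff_isRoot.2 (isRoot_of_mem_roots ha)
  have hgm : g.Monic := (monic_X_sub_C a).of_mul_monic_left (hg ▸ charpoly_monic _)
  have hgd : g.natDegree = 1 := by
    have := congrArg natDegree hg
    rw [(monic_X_sub_C a).natDegree_mul hgm, hd, natDegree_X_sub_C] at this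
    omega
  refine ⟨a, -g.coeff 0, ?_⟩
  rw [hg, C_neg, sub_neg_eq_add, ← hgm.eq_X_add_C hgd]

omit [Fintype F] in
lemma toPSL_pow_char_eq_one {n : ℕ} (p : ℕ) [hp : Fact p.Prime] [CharP F p]
    {y : SpecialLinearGroup (Fin n) F} {a : F}
    (h : (y : Matrix (Fin n) (Fin n) F).charpoly = (X - C a) * (X - C a)) :
    toPSL n F y ^ p = 1 := by
  apply toPSL_pow_eq_one_of_charpoly_dvd (b := a ^ p)
  rw [C_pow, ← sub_pow_char, h, ← pow_two]
  exact pow_dvd_pow _ hp.1.two_le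

lemma prime_mul_notMem_of_fin_two (p : ℕ) [hp : Fact p.Prime] [CharP F p] (hq : 3 < qq) {k : ℕ}
    (hr : r.Prime) (hrp : r ≠ p) (hk0 : 0 < k) (hk : qq - 1 ∣ k * 2) :
    r * k ∉ groupSpectrum (ProjectiveSpecialLinearGroup (Fin 2) F) := by
  rintro ⟨g, hg⟩
  obtain ⟨y, rfl⟩ := toPSL_surjective _ _ g
  rcases charpoly_fin_two_dichotomy (y : Matrix (Fin 2) (Fin 2) F) with h | ⟨a, b, h⟩
  · have hs : ∑ i ∈ Finset.range 2, qq ^ i = qq + 1 := by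
      rw [Finset.sum_range_succ, Finset.sum_range_one]; ring
    rcases Nat.even_or_odd qq with he | ho
    · have h1 := toPSL_pow_eq_one_of_irreducible_charpoly (k := qq + 1) h (by rw [hs]; simp)
      rw [← orderOf_dvd_iff_pow_eq_one, hg] at h1
      have h2 : qq - 1 ∣ k := by
        refine Nat.Coprime.dvd_of_dvd_mul_right ?_ hk
        rw [Nat.coprime_two_right]
        exact Nat.Even.sub_odd (by omega) he odd_one
      have h3 : qq - 1 ∣ (qq - 1) + 2 := by
        rw [show qq - 1 + 2 = qq + 1 by omega]; exact (h2.mul_left r).trans h1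
      have := Nat.le_of_dvd two_pos ((Nat.dvd_add_right dvd_rfl).1 h3)
      omega
    · obtain ⟨s, hs'⟩ := ho
      have h1 := toPSL_pow_eq_one_of_irreducible_charpoly (k := s + 1) h (by
        rw [hs, hs']; exact ⟨s, by rw [Nat.add_sub_cancel]; ring⟩)
      rw [← orderOf_dvd_iff_pow_eq_one, hg] at h1
      have h2 : s ∣ k := by
        rw [hs', Nat.add_sub_cancel, mul_comm k] at hk
        exact Nat.dvd_of_mul_dvd_mul_left two_pos hk
      have := Nat.le_of_dvd one_pos ((Nat.dvd_add_right dvd_rfl).1 ((h2.mul_left r).trans h1))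
      omega
  · by_cases hab : a = b
    · subst hab
      have h1 := toPSL_pow_char_eq_one p h
      rw [← orderOf_dvd_iff_pow_eq_one, hg] at h1
      exact hrp ((Nat.prime_dvd_prime_iff_eq hr hp.1).1 ((dvd_mul_right r k).trans h1))
    · have h1 := toPSL_pow_eq_one_of_charpoly_eq_mul (N := 1) (k := k) rfl (irreducible_X_sub_C a)
        (monic_X_sub_C a) (natDegree_X_sub_C a) (isCoprime_X_sub_C_of_isUnit_sub
          (sub_ne_zero.2 hab).isUnit) h (by simpa using hk)
      rw [← orderOf_dvd_iff_pow_eq_one, hg] at h1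
      have := Nat.le_of_dvd hk0 h1
      have := hr.two_le
      nlinarith

end CoprimeCharacteristic

section CoprimeCharacteristic

variable {F : Type*} [Field F] [Fintype F] {r : ℕ}

local notation "qq" => Fintype.card F

lemma not_dvd_hyperplane_and_singer {q N k K : ℕ} (hq : 2 ≤ q) (hr : r.Prime)
    (hk : ∀ j, k ∣ j ↔ q ^ N - 1 ∣ j * (1 + ∑ i ∈ Finset.range N, q ^ i))
    (hK : ∀ j, K ∣ j ↔ ∑ i ∈ Finset.range (N + 1), q ^ i ∣ j * (q - 1)) (hrk : r ∣ k) :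
    ¬ r ∣ K := by
  intro hrK
  have hgeom : (∑ i ∈ Finset.range N, q ^ i) * (q - 1) = q ^ N - 1 :=
    geom_sum_mul_of_one_le (by omega) N
  have hQ : ∑ i ∈ Finset.range (N + 1), q ^ i = 1 + q * ∑ i ∈ Finset.range N, q ^ i := by
    rw [Finset.sum_range_succ', Finset.mul_sum, pow_zero, add_comm]
    simp [pow_succ']
  rw [← hgeom] at hk
  rw [hQ] at hK
  set Q' := ∑ i ∈ Finset.range N, q ^ i
  set g := (1 + q * Q').gcd (q - 1) with hg
  have hg0 : 0 < g := Nat.gcd_pos_of_pos_right _ (by omega)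
  have hg1 : g ∣ 1 + q * Q' := Nat.gcd_dvd_left _ _
  have hg2 : g ∣ q - 1 := Nat.gcd_dvd_right _ _
  have hg3 : g ∣ 1 + Q' := by
    have h1 : 1 + q * Q' = (1 + Q') + (q - 1) * Q' := by
      obtain ⟨s, rfl⟩ := Nat.exists_eq_add_of_le' (show 1 ≤ q by omega)
      rw [Nat.add_sub_cancel]; ring
    rw [h1] at hg1
    exact (Nat.dvd_add_left (hg2.mul_right _)).1 hg1
  obtain ⟨a, ha⟩ := hg1
  obtain ⟨b, hb⟩ := hg2
  obtain ⟨c, hc⟩ := hg3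
  have h1 : K ∣ a := (hK a).2 ⟨b, by rw [ha, hb]; ring⟩
  have h2 : k ∣ Q' * b := (hk _).2 ⟨c, by rw [hc, hb]; ring⟩
  have h3 : r * g ∣ 1 + q * Q' := by
    rw [ha, mul_comm r]; exact Nat.mul_dvd_mul_left _ (hrK.trans h1)
  have h4 : r * g ∣ Q' * (q - 1) := by
    rw [hb, mul_comm r, Nat.mul_left_comm]; exact Nat.mul_dvd_mul_left _ (hrk.trans h2)
  have h5 : (r * g).Coprime Q' := by
    refine Nat.Coprime.coprime_dvd_left h3 ?_
    simp
  have h6 : r * g ∣ g := Nat.dvd_gcd h3 (h5.dvd_of_dvd_mul_left h4)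
  have := Nat.le_of_dvd hg0 h6
  have := hr.two_le
  nlinarith

lemma false_of_action_of_ne_char (p : ℕ) [hp : Fact p.Prime] [CharP F p] {n : ℕ} (hn : 2 ≤ n)
    (hnq : n = 2 → 3 < qq) {V : Type*} [AddCommGroup V] [Nontrivial V]
    (ρ : SpecialLinearGroup (Fin n) F →* AddMonoid.End V) (hr : r.Prime) (hrp : r ≠ p)
    (hrV : ∀ v : V, r • v = 0)
    (hnorm : ∀ x, r * orderOf (toPSL n F x) ∉ groupSpectrum (ProjectiveSpecialLinearGroup (Fin n)
      F) →
      ∀ v, ∑ j ∈ Finset.range (orderOf (toPSL n F x)), ρ (x ^ j) v = 0) : False := by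
  obtain ⟨N, rfl⟩ : ∃ N, n = N + 1 := ⟨n - 1, by omega⟩
  have hq := Fintype.one_lt_card (α := F)
  have hN : 0 < N := by omega
  have hgeom : (qq - 1) * (∑ i ∈ Finset.range N, qq ^ i) = qq ^ N - 1 := mul_geomSum N
  set k := (qq ^ N - 1) / (qq ^ N - 1).gcd (1 + ∑ i ∈ Finset.range N, qq ^ i) with hkdef
  have hqN : 0 < qq ^ N - 1 := by
    have := Nat.one_lt_pow hN.ne' hq
    omega
  have hk : ∀ j, k ∣ j ↔ _ := div_gcd_dvd_iff hqN
  have hk0 : 0 < k := by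
    refine Nat.pos_of_ne_zero fun h => ?_
    have := (hk (qq ^ N - 1)).2 (Nat.dvd_mul_right _ _)
    rw [h, zero_dvd_iff] at this
    omega
  have hbig : qq ^ (N - 1) < qq ^ N - 1 := by
    obtain ⟨M, rfl⟩ : ∃ M, N = M + 1 := ⟨N - 1, by omega⟩
    rw [Nat.add_sub_cancel, pow_succ]
    rcases Nat.eq_zero_or_pos M with rfl | hM
    · have := hnq rfl
      rw [pow_zero, one_mul]; omega
    · have h1 := Nat.one_lt_pow hM.ne' hq
      have := Nat.mul_le_mul_left (qq ^ M) hq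
      omega
  have hk1 : k ≠ 1 := by
    intro h
    have h1 := (hk 1).1 (by rw [h])
    rw [one_mul] at h1
    have h2 : qq ^ N - 1 ∣ qq - 1 := by
      have h2 := h1.mul_left (qq - 1)
      rw [mul_add, mul_one, hgeom] at h2
      exact (Nat.dvd_add_left dvd_rfl).1 h2
    have h3 := Nat.le_of_dvd (by omega) h2
    have h4 : qq ^ N ≤ qq ^ 1 := by rw [pow_one]; omega
    have h5 : N = 1 := by have := (Nat.pow_le_pow_iff_right hq).1 h4; omega
    subst h5
    have := hnq rfl
    rw [Finset.sum_range_one, pow_zero, pow_one] at h1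
    have := Nat.le_of_dvd two_pos h1
    omega
  have hrk : r * k ∉ groupSpectrum (ProjectiveSpecialLinearGroup (Fin (N + 1)) F) := by
    rcases (show 1 ≤ N from hN).eq_or_lt with rfl | h
    · exact prime_mul_notMem_of_fin_two p (hnq rfl) hr hrp hk0 (by simpa using (hk k).1 dvd_rfl)
    · exact prime_mul_notMem_of_hyperplane p h hr hk0 hk
  obtain ⟨c, w, a, hw0, hw, hc, hfree⟩ := exists_hyperplane_element hN hbig hk hk1
  have htriv : ∀ s, ρ s = 1 := by
    have hU := map_eq_one_of_frobenius ρ (transvectionGroup w) c ?_ hk0 hfree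
      (hc ▸ hnorm c (hc ▸ hrk)) hrV ?_
    · have hle : transvectionGroup w ≤ ρ.ker := fun u hu => hU u hu
      have := eq_top_of_transvectionGroup_le hn ρ.ker hw0 hle
      intro s
      exact (this ▸ Subgroup.mem_top s : s ∈ ρ.ker)
    · rintro u ⟨φ, hφ, hu⟩
      have ha : a ≠ 0 := by
        intro ha
        rw [ha, zero_smul] at hw
        exact hw0 (by
          have h1 : (c⁻¹).1 * c.1 = 1 := congrArg Subtype.val (inv_mul_cancel c)
          rw [← one_mulVec w, ← h1, ← mulVec_mulVec, hw, mulVec_zero])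
      have h1 : c.1 * (c⁻¹).1 = 1 := congrArg Subtype.val (mul_inv_cancel c)
      have h2 : (c⁻¹).1 * c.1 = 1 := congrArg Subtype.val (inv_mul_cancel c)
      have h3 : (c⁻¹).1 *ᵥ w = a⁻¹ • w := by
        have : w = a⁻¹ • c.1 *ᵥ w := by rw [hw, smul_smul, inv_mul_cancel₀ ha, one_smul]
        conv_lhs => rw [this]
        rw [mulVec_smul, mulVec_mulVec, h2, one_mulVec]
      refine ⟨a • φ ᵥ* (c⁻¹).1, ?_, ?_⟩
      · rw [smul_dotProduct, ← dotProduct_mulVec, h3, dotProduct_smul, hφ]; simp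
      · change c.1 * u.1 * (c⁻¹).1 = _
        rw [hu, mul_add, mul_one, add_mul, h1, mul_vecMulVec, vecMulVec_mul, hw,
          smul_vecMulVec, vecMulVec_smul]
    · obtain ⟨m, hm⟩ := exists_card_transvectionGroup_eq p w
      rw [hm]
      exact Nat.Coprime.pow_left _ ((Nat.coprime_primes hp.1 hr).2 hrp.symm)
  have hdvd : ∀ x, r * orderOf (toPSL (N + 1) F x) ∉
      groupSpectrum (ProjectiveSpecialLinearGroup (Fin (N + 1)) F) →
      r ∣ orderOf (toPSL (N + 1) F x) := by
    intro x hx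
    have h := hnorm x hx
    obtain ⟨v, hv⟩ := exists_ne (0 : V)
    have h1 := h v
    simp only [htriv, AddMonoid.End.coe_one, id, Finset.sum_const, Finset.card_range] at h1
    have h2 : addOrderOf v = r := addOrderOf_eq_prime (hp := ⟨hr⟩) (hrV v) hv
    rw [← h2]
    exact addOrderOf_dvd_of_nsmul_eq_zero h1
  rcases (show 1 ≤ N from hN).eq_or_lt with rfl | hN2
  · set x : SpecialLinearGroup (Fin 2) F :=
      SpecialLinearGroup.transvection (show (0 : Fin 2) ≠ 1 by decide) 1 with hx
    obtain ⟨m, hm⟩ := exists_card_transvectionGroup_eq p (Pi.single (0 : Fin 2) (1 : F))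
    have h1 : toPSL 2 F x ^ p ^ m = 1 := by
      have hmem := transvection_mem_transvectionGroup (F := F) (show (0 : Fin 2) ≠ 1 by decide) 1
      rw [← map_pow, ← hm]
      have h1 := congrArg Subtype.val (pow_card_eq_one' (x := (⟨x, hmem⟩ : transvectionGroup _)))
      rw [← map_one (toPSL 2 F)]
      exact congrArg _ h1
    obtain ⟨j, -, hj⟩ := (Nat.dvd_prime_pow hp.1).1 (orderOf_dvd_of_pow_eq_one h1)
    have hj0 : j ≠ 0 := by
      rintro rfl
      rw [pow_zero, orderOf_eq_one_iff, ← pow_one (toPSL 2 F x), toPSL_pow_eq_one_iff] at hj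
      obtain ⟨c, hc⟩ := hj
      rw [pow_one] at hc
      have h01 := congrFun (congrFun hc 0) 1
      change Matrix.transvection 0 1 1 0 1 = _ at h01
      simp [Matrix.transvection] at h01
    have h2 := hdvd x (by
      rintro ⟨g, hg⟩
      obtain ⟨y, rfl⟩ := toPSL_surjective _ _ g
      rw [hj] at hg
      obtain ⟨f, hf, hm, hfχ⟩ := exists_sq_factor p (x := y)
        (hg ▸ (dvd_pow_self p hj0).mul_left r)
      have hd := natDegree_le_of_dvd hfχ (charpoly_monic _).ne_zero
      rw [hm.natDegree_mul hm, charpoly_natDegree_eq_dim, Fintype.card_fin] at hd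
      have hpos := hf.natDegree_pos
      have hfd : f.natDegree = 1 := by omega
      have hχ := eq_of_monic_of_dvd_of_natDegree_le (hm.mul hm) (charpoly_monic y.1) hfχ
        (by rw [charpoly_natDegree_eq_dim, Fintype.card_fin, hm.natDegree_mul hm, hfd])
      have hfX : f = X - C (-f.coeff 0) := by
        rw [C_neg, sub_neg_eq_add]; exact hm.eq_X_add_C hfd
      rw [hfX] at hχ
      have h3 := toPSL_pow_char_eq_one p hχ
      rw [← orderOf_dvd_iff_pow_eq_one, hg] at h3
      exact hrp ((Nat.prime_dvd_prime_iff_eq hr hp.1).1 ((Nat.dvd_mul_right r _).trans h3)))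
    rw [hj] at h2
    exact hrp ((Nat.prime_dvd_prime_iff_eq hr hp.1).1 (hr.dvd_of_dvd_pow h2))
  · have hK := div_gcd_dvd_iff (a := ∑ i ∈ Finset.range (N + 1), qq ^ i) (b := qq - 1)
      (Finset.sum_pos (fun i _ => Nat.pow_pos Fintype.card_pos) (by simp))
    set K := (∑ i ∈ Finset.range (N + 1), qq ^ i) / _ with hKdef
    obtain ⟨x, hx⟩ := exists_singer_element hn hK
    have hK0 : 0 < K := hx ▸ orderOf_pos _
    refine not_dvd_hyperplane_and_singer hq hr hk hK (hc ▸ hdvd c (hc ▸ hrk))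
      (hx ▸ hdvd x (hx ▸ prime_mul_notMem_of_singer p (by omega) hr hK0 hK))

end CoprimeCharacteristic

end

section

open Matrix

section CornerMinors

variable {n : ℕ} {R : Type*} [CommRing R]

/-- The matrix `g` with everything outside the leading `(r + 1) × (r + 1)` block replaced by the
identity matrix. -/
def corner (r : Fin n) (g : Matrix (Fin n) (Fin n) R) : Matrix (Fin n) (Fin n) R :=
  of fun i j => if i ≤ r ∧ j ≤ r then g i j else if i = j then 1 else 0

/-- The leading principal minor with rows and columns `≤ r`. -/
def cornerMinor (r : Fin n) (g : Matrix (Fin n) (Fin n) R) : R := (corner r g).det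

/-- Lower triangular matrices with ones on the diagonal. -/
def IsLowerUni (l : Matrix (Fin n) (Fin n) R) : Prop :=
  (∀ i, l i i = 1) ∧ ∀ i j, i < j → l i j = 0

lemma corner_transpose (r : Fin n) (g : Matrix (Fin n) (Fin n) R) :
    corner r gᵀ = (corner r g)ᵀ := by
  ext i j
  simp only [corner, of_apply, transpose_apply, and_comm, eq_comm]

lemma cornerMinor_transpose (r : Fin n) (g : Matrix (Fin n) (Fin n) R) :
    cornerMinor r gᵀ = cornerMinor r g := by
  rw [cornerMinor, corner_transpose, det_transpose, cornerMinor]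

lemma corner_mul_of_left {r : Fin n} {a : Matrix (Fin n) (Fin n) R}
    (h : ∀ i j, i ≤ r → r < j → a i j = 0) (b : Matrix (Fin n) (Fin n) R) :
    corner r (a * b) = corner r a * corner r b := by
  ext i j
  rw [mul_apply]
  by_cases hi : i ≤ r
  · by_cases hj : j ≤ r
    · simp only [corner, of_apply, hi, hj, and_self, if_true, true_and, and_true, mul_apply]
      refine Finset.sum_congr rfl fun k _ => ?_
      by_cases hk : k ≤ r
      · simp [hk]
      · rw [h i k hi (not_le.1 hk), if_neg hk, if_neg (by rintro rfl; exact hk hi)]; simp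
    · have hij : i ≠ j := by rintro rfl; exact hj hi
      simp [corner, hj, hi, hij]
  · rw [Finset.sum_eq_single i]
    · simp [corner, hi]
    · intro k _ hk
      simp [corner, hi, hk.symm]
    · simp

lemma corner_mul_of_right {r : Fin n} (a : Matrix (Fin n) (Fin n) R) {b : Matrix (Fin n) (Fin n) R}
    (h : ∀ i j, j ≤ r → r < i → b i j = 0) : corner r (a * b) = corner r a * corner r b := by
  have := corner_mul_of_left (a := bᵀ) (r := r) (fun i j hi hj => h j i hi hj) aᵀ
  rw [← transpose_mul, corner_transpose, corner_transpose, corner_transpose,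
    ← transpose_mul] at this
  exact transpose_injective this

lemma IsLowerUni.det_eq_one {l : Matrix (Fin n) (Fin n) R} (h : IsLowerUni l) : l.det = 1 := by
  rw [det_of_isLowerTriangular l (fun i j hij => h.2 _ _ hij)]
  simp [h.1]

lemma IsLowerUni.corner {l : Matrix (Fin n) (Fin n) R} (h : IsLowerUni l) (r : Fin n) :
    IsLowerUni (corner r l) := by
  refine ⟨fun i => ?_, fun i j hij => ?_⟩
  · simp [_root_.corner, h.1]
  · simp [_root_.corner, h.2 _ _ hij, hij.ne]

lemma IsLowerUni.one : IsLowerUni (1 : Matrix (Fin n) (Fin n) R) :=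
  ⟨fun i => one_apply_eq i, fun _ _ h => one_apply_ne h.ne⟩

lemma IsLowerUni.mul {a b : Matrix (Fin n) (Fin n) R} (ha : IsLowerUni a) (hb : IsLowerUni b) :
    IsLowerUni (a * b) := by
  refine ⟨fun i => ?_, fun i j hij => ?_⟩
  · rw [mul_apply, Finset.sum_eq_single i, ha.1, hb.1, one_mul]
    · intro k _ hk
      rcases lt_or_gt_of_ne hk with h | h
      · rw [hb.2 _ _ h, mul_zero]
      · rw [ha.2 _ _ h, zero_mul]
    · simp
  · rw [mul_apply]
    refine Finset.sum_eq_zero fun k _ => ?_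
    rcases lt_or_ge k j with h | h
    · rw [hb.2 _ _ h, mul_zero]
    · rw [ha.2 _ _ (hij.trans_le h), zero_mul]

lemma IsLowerUni.map {S : Type*} [CommRing S] (φ : R →+* S) {a : Matrix (Fin n) (Fin n) R}
    (ha : IsLowerUni a) : IsLowerUni (a.map φ) :=
  ⟨fun i => by simp [ha.1], fun i j h => by simp [ha.2 i j h]⟩

lemma IsLowerUni.transvection {i j : Fin n} (h : j < i) (c : R) :
    IsLowerUni (transvection i j c) := by
  refine ⟨fun k => ?_, fun k l hkl => ?_⟩
  · rw [Matrix.transvection, Matrix.add_apply, one_apply_eq, single_apply_of_ne, add_zero]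
    rintro ⟨rfl, rfl⟩; exact h.ne rfl
  · rw [Matrix.transvection, Matrix.add_apply, one_apply_ne hkl.ne, single_apply_of_ne, add_zero]
    rintro ⟨rfl, rfl⟩; exact hkl.not_gt h

lemma cornerMinor_lower_mul {l : Matrix (Fin n) (Fin n) R} (h : IsLowerUni l) (r : Fin n)
    (g : Matrix (Fin n) (Fin n) R) : cornerMinor r (l * g) = cornerMinor r g := by
  rw [cornerMinor, corner_mul_of_left (fun i j hi hj => h.2 _ _ (hi.trans_lt hj)), det_mul,
    (h.corner r).det_eq_one, one_mul, cornerMinor]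

lemma cornerMinor_mul_upper {u : Matrix (Fin n) (Fin n) R} (h : IsLowerUni uᵀ) (r : Fin n)
    (g : Matrix (Fin n) (Fin n) R) : cornerMinor r (g * u) = cornerMinor r g := by
  rw [← cornerMinor_transpose, transpose_mul, cornerMinor_lower_mul h, cornerMinor_transpose]

lemma cornerMinor_diagonal (r : Fin n) (d : Fin n → R) :
    cornerMinor r (diagonal d) = ∏ i ∈ Finset.Iic r, d i := by
  have : corner r (diagonal d) = diagonal fun i => if i ≤ r then d i else 1 := by
    ext i j
    by_cases hij : i = j
    · subst hij; simp [corner]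
    · simp [corner, hij]
  rw [cornerMinor, this, det_diagonal, ← Finset.prod_filter]
  congr 1
  ext i; simp

lemma cornerMinor_diagonal_mul (r : Fin n) (d : Fin n → R) (g : Matrix (Fin n) (Fin n) R) :
    cornerMinor r (diagonal d * g) = (∏ i ∈ Finset.Iic r, d i) * cornerMinor r g := by
  rw [cornerMinor, corner_mul_of_left (fun i j hi hj => diagonal_apply_ne _ (hi.trans_lt hj).ne),
    det_mul, ← cornerMinor_diagonal, cornerMinor, cornerMinor]

lemma cornerMinor_map {S : Type*} [CommRing S] (φ : R →+* S) (r : Fin n)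
    (g : Matrix (Fin n) (Fin n) R) : cornerMinor r (g.map φ) = φ (cornerMinor r g) := by
  rw [cornerMinor, cornerMinor, RingHom.map_det]
  congr 1
  ext i j
  simp only [corner, of_apply, map_apply, RingHom.mapMatrix_apply]
  split_ifs <;> simp

lemma cornerMinor_mul_transvection {r i j : Fin n} (hij : i ≠ j) (h : j ≤ r → i ≤ r) (c : R)
    (g : Matrix (Fin n) (Fin n) R) :
    cornerMinor r (g * transvection i j c) = cornerMinor r g := by
  have h1 : corner r (g * transvection i j c) = corner r g * corner r (transvection i j c) := by
    refine corner_mul_of_right _ fun k l hl hk => ?_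
    rw [transvection, Matrix.add_apply, one_apply_ne (hl.trans_lt hk).ne', single_apply_of_ne,
      add_zero]
    rintro ⟨rfl, rfl⟩
    exact (h hl).not_gt hk
  have h2 : (corner r (transvection i j c)).det = 1 := by
    by_cases hr : i ≤ r ∧ j ≤ r
    · have : corner r (transvection i j c) = transvection i j c := by
        ext k l
        simp only [corner, of_apply]
        split_ifs with h3 h4
        · rfl
        · subst h4
          rw [transvection, Matrix.add_apply, one_apply_eq, single_apply_of_ne, add_zero]
          rintro ⟨rfl, h5⟩; exact hij h5.symm
        · rw [transvection, Matrix.add_apply, one_apply_ne h4, single_apply_of_ne, add_zero]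
          rintro ⟨rfl, rfl⟩; exact h3 hr
      rw [this, det_transvection_of_ne _ _ hij]
    · have : corner r (transvection i j c) = 1 := by
        ext k l
        simp only [corner, of_apply]
        split_ifs with h3 h4
        · rw [transvection, Matrix.add_apply, single_apply_of_ne, add_zero]
          rintro ⟨rfl, rfl⟩; exact hr h3
        · subst h4; rw [one_apply_eq]
        · rw [one_apply_ne h4]
      rw [this, det_one]
  rw [cornerMinor, h1, det_mul, h2, mul_one, cornerMinor]

end CornerMinors

section MinorProd

variable {N : ℕ} {R : Type*} [CommRing R]

/-- The highest weight function `∏ Δ_r ^ a_r`. -/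
def minorProd (a : Fin N → ℕ) (g : Matrix (Fin (N + 1)) (Fin (N + 1)) R) : R :=
  ∏ r, cornerMinor r.castSucc g ^ a r

variable (a : Fin N → ℕ)

lemma minorProd_transpose (g : Matrix (Fin (N + 1)) (Fin (N + 1)) R) :
    minorProd a gᵀ = minorProd a g := by simp [minorProd, cornerMinor_transpose]

lemma minorProd_lower_mul {l : Matrix (Fin (N + 1)) (Fin (N + 1)) R} (h : IsLowerUni l)
    (g : Matrix (Fin (N + 1)) (Fin (N + 1)) R) : minorProd a (l * g) = minorProd a g := by
  simp [minorProd, cornerMinor_lower_mul h]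

lemma minorProd_mul_upper {u : Matrix (Fin (N + 1)) (Fin (N + 1)) R} (h : IsLowerUni uᵀ)
    (g : Matrix (Fin (N + 1)) (Fin (N + 1)) R) : minorProd a (g * u) = minorProd a g := by
  simp [minorProd, cornerMinor_mul_upper h]

lemma minorProd_diagonal_mul (d : Fin (N + 1) → R) (g : Matrix (Fin (N + 1)) (Fin (N + 1)) R) :
    minorProd a (diagonal d * g) = minorProd a (diagonal d) * minorProd a g := by
  simp [minorProd, cornerMinor_diagonal_mul, cornerMinor_diagonal, mul_pow, Finset.prod_mul_distrib]

lemma minorProd_map {S : Type*} [CommRing S] (φ : R →+* S)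
    (g : Matrix (Fin (N + 1)) (Fin (N + 1)) R) : minorProd a (g.map φ) = φ (minorProd a g) := by
  simp [minorProd, cornerMinor_map]

end MinorProd

section Monomial

variable {n : ℕ} {K : Type*} [Field K]

/-- The monomial matrix with entry `d j` at `(w j, j)`. -/
def monomialMatrix (w : Equiv.Perm (Fin n)) (d : Fin n → Kˣ) : Matrix (Fin n) (Fin n) K :=
  of fun i j => if i = w j then (d j : K) else 0

lemma monomialMatrix_apply_self (w : Equiv.Perm (Fin n)) (d : Fin n → Kˣ) (j : Fin n) :
    monomialMatrix w d (w j) j = d j := by simp [monomialMatrix]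

lemma mul_monomialMatrix_apply (v : Matrix (Fin n) (Fin n) K) (w : Equiv.Perm (Fin n))
    (d : Fin n → Kˣ) (i j : Fin n) : (v * monomialMatrix w d) i j = v i (w j) * d j := by
  simp [mul_apply, monomialMatrix]

lemma monomialMatrix_mul_apply (v : Matrix (Fin n) (Fin n) K) (w : Equiv.Perm (Fin n))
    (d : Fin n → Kˣ) (i j : Fin n) :
    (monomialMatrix w d * v) (w i) j = d i * v i j := by
  simp [mul_apply, monomialMatrix]

lemma monomialMatrix_one_eq_diagonal (d : Fin n → Kˣ) :
    monomialMatrix 1 d = diagonal fun i => (d i : K) := by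
  ext i j
  by_cases h : i = j
  · subst h; simp [monomialMatrix]
  · simp [monomialMatrix, h]

lemma monomialMatrix_mul_monomialMatrix (w v : Equiv.Perm (Fin n)) (d e : Fin n → Kˣ) :
    monomialMatrix w d * monomialMatrix v e = monomialMatrix (w * v) fun j => d (v j) * e j := by
  ext i j
  rw [mul_monomialMatrix_apply]
  by_cases h : i = w (v j)
  · subst h; simp [monomialMatrix]
  · simp [monomialMatrix, h]

lemma monomialMatrix_mul_diagonal (w : Equiv.Perm (Fin n)) (d e : Fin n → Kˣ) :
    monomialMatrix w d * diagonal (fun i => (e i : K)) = monomialMatrix w (d * e) := by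
  rw [← monomialMatrix_one_eq_diagonal, monomialMatrix_mul_monomialMatrix]
  rfl

lemma mul_monomialMatrix_eq (v : Matrix (Fin n) (Fin n) K) (w : Equiv.Perm (Fin n))
    (d : Fin n → Kˣ) : v * monomialMatrix w d =
      monomialMatrix w d * of fun i j => (d i : K)⁻¹ * d j * v (w i) (w j) := by
  ext i j
  obtain ⟨i, rfl⟩ := w.surjective i
  rw [mul_monomialMatrix_apply, monomialMatrix_mul_apply, of_apply, ← mul_assoc, ← mul_assoc,
    mul_inv_cancel₀ (d i).ne_zero, one_mul, mul_comm]

lemma monomialMatrix_mul_transvection (w : Equiv.Perm (Fin n)) (d : Fin n → Kˣ) {i j : Fin n}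
    (hij : i ≠ j) (c : K) : monomialMatrix w d * transvection i j c =
      transvection (w i) (w j) (d i * c * (d j : K)⁻¹) * monomialMatrix w d := by
  ext k l
  obtain ⟨k, rfl⟩ := w.surjective k
  rw [mul_monomialMatrix_apply, monomialMatrix_mul_apply]
  simp only [transvection, Matrix.add_apply, one_apply, single_apply, w.injective.eq_iff]
  by_cases h1 : i = k ∧ j = l
  · obtain ⟨rfl, rfl⟩ := h1
    simp [hij]
  · by_cases h2 : k = l
    · subst h2; simp [h1]
    · simp [h1, h2]

end Monomial

section Bruhat

variable {n : ℕ} {K : Type*} [Field K]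

lemma exists_perm_monomialMatrix_eq {g : Matrix (Fin n) (Fin n) K}
    (hg : ∀ i, ∃ j, g i j ≠ 0 ∧ (∀ j', j' ≠ j → g i j' = 0) ∧ ∀ i', i' ≠ i → g i' j = 0) :
    ∃ w d, g = monomialMatrix w d := by
  choose c h0 h1 h2 using hg
  have hc : Function.Injective c := by
    intro i i' h
    by_contra hne
    exact h0 i (h ▸ h2 i' i hne)
  set e := Equiv.ofBijective c hc.bijective_of_finite with he
  have hce : ∀ i, c i = e i := fun i => rfl
  refine ⟨e.symm, fun j => Units.mk0 (g (e.symm j) j) ?_, ?_⟩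
  · have := h0 (e.symm j)
    rwa [hce, Equiv.apply_symm_apply] at this
  · ext i j
    rw [monomialMatrix, of_apply]
    split_ifs with h
    · subst h; rfl
    · refine h1 i j fun hj => h ?_
      rw [hj, hce, Equiv.symm_apply_apply]

/-- Bruhat decomposition as an induction principle. -/
theorem bruhat_induction {P : Matrix (Fin n) (Fin n) K → Prop}
    (hl : ∀ l g, IsLowerUni l → P (l * g) → P g) (hr : ∀ u g, IsLowerUni uᵀ → P (g * u) → P g)
    (hm : ∀ w d, P (monomialMatrix w d)) {g : Matrix (Fin n) (Fin n) K} (hg : g.det ≠ 0) :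
    P g := by
  suffices H : ∀ m k : ℕ, n ≤ k + m → ∀ g : Matrix (Fin n) (Fin n) K, g.det ≠ 0 →
      (∀ i : Fin n, (i : ℕ) < k → ∃ j, g i j ≠ 0 ∧ (∀ j', j' ≠ j → g i j' = 0) ∧
        ∀ i', i' ≠ i → g i' j = 0) → P g from
    H n 0 (by omega) g hg fun i hi => absurd hi (Nat.not_lt_zero _)
  intro m
  induction m with
  | zero =>
    intro k hk g _ h
    obtain ⟨w, d, rfl⟩ := exists_perm_monomialMatrix_eq fun i => h i (i.2.trans_le hk)
    exact hm w d
  | succ m ih =>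
    intro k hk g hg h
    by_cases hkn : n ≤ k
    · exact ih k (by omega) g hg h
    set κ : Fin n := ⟨k, not_le.1 hkn⟩ with hκ
    have hne : ∃ j, g κ j ≠ 0 := by
      by_contra! h0
      exact hg (det_eq_zero_of_row_eq_zero κ h0)
    obtain ⟨j, hj, hjmin⟩ : ∃ j, g κ j ≠ 0 ∧ ∀ j' < j, g κ j' = 0 := by
      classical
      refine ⟨Fin.find (fun j => g κ j ≠ 0) hne, Fin.find_spec hne, fun j' h' => ?_⟩
      by_contra h2
      exact Fin.find_min hne h' h2
    have hcol : ∀ i : Fin n, (i : ℕ) < k → g i j = 0 := by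
      intro i hi
      obtain ⟨j₁, _, h2, h3⟩ := h i hi
      refine h2 j ?_
      rintro rfl
      exact hj (h3 κ fun h4 => by rw [← h4] at hi; exact lt_irrefl _ hi)
    set u : Matrix (Fin n) (Fin n) K :=
      1 + of fun a b => if a = j ∧ j < b then -(g κ b / g κ j) else 0 with hu
    have hgu : ∀ a b, (g * u) a b = g a b + if j < b then g a j * -(g κ b / g κ j) else 0 := by
      intro a b
      rw [hu, mul_add, mul_one, Matrix.add_apply, mul_apply, Finset.sum_eq_single j]
      · by_cases hb : j < b <;> simp [hb]
      · intro c _ hc; simp [hc]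
      · simp
    have hU : IsLowerUni uᵀ := by
      refine ⟨fun i => ?_, fun a b hab => ?_⟩
      · simp only [hu, transpose_apply, Matrix.add_apply, one_apply_eq, of_apply]
        rw [if_neg, add_zero]
        rintro ⟨rfl, h2⟩; exact lt_irrefl _ h2
      · simp only [hu, transpose_apply, Matrix.add_apply, one_apply_ne hab.ne', of_apply]
        rw [if_neg, add_zero]
        rintro ⟨rfl, h2⟩; exact hab.not_gt h2
    have hrow : ∀ b, b ≠ j → (g * u) κ b = 0 := by
      intro b hb
      rw [hgu]
      rcases lt_or_gt_of_ne hb with h2 | h2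
      · rw [if_neg h2.not_gt, hjmin b h2, add_zero]
      · rw [if_pos h2]; field_simp; ring
    have hrow' : (g * u) κ j = g κ j := by rw [hgu, if_neg (lt_irrefl j), add_zero]
    have hold : ∀ i : Fin n, (i : ℕ) < k → ∀ b, (g * u) i b = g i b := by
      intro i hi b
      rw [hgu, hcol i hi]; simp
    refine hr u g hU ?_
    set g₁ := g * u with hg₁
    set l : Matrix (Fin n) (Fin n) K :=
      1 + of fun a b => if b = κ ∧ κ < a then -(g₁ a j / g₁ κ j) else 0 with hl'
    have hlg : ∀ a b, (l * g₁) a b = g₁ a b + if κ < a then -(g₁ a j / g₁ κ j) * g₁ κ b else 0 := by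
      intro a b
      rw [hl', add_mul, one_mul, Matrix.add_apply, mul_apply, Finset.sum_eq_single κ]
      · by_cases hb : κ < a <;> simp [hb]
      · intro c _ hc; simp [hc]
      · simp
    have hL : IsLowerUni l := by
      refine ⟨fun i => ?_, fun a b hab => ?_⟩
      · simp only [hl', Matrix.add_apply, one_apply_eq, of_apply]
        rw [if_neg, add_zero]
        rintro ⟨rfl, h2⟩; exact lt_irrefl _ h2
      · simp only [hl', Matrix.add_apply, one_apply_ne hab.ne, of_apply]
        rw [if_neg, add_zero]
        rintro ⟨rfl, h2⟩; exact hab.not_gt h2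
    refine hl l g₁ hL (ih (k + 1) (by omega) _ ?_ ?_)
    · rw [det_mul, hL.det_eq_one, one_mul, hg₁, det_mul, ← det_transpose u, hU.det_eq_one, mul_one]
      exact hg
    · have hcol' : ∀ a, a ≠ κ → (l * g₁) a j = 0 := by
        intro a ha
        rw [hlg]
        rcases lt_or_gt_of_ne ha with h2 | h2
        · rw [if_neg h2.not_gt, add_zero, hold a h2, hcol a h2]
        · rw [if_pos h2, hrow']; field_simp; ring
      have hother : ∀ a b, b ≠ j → (l * g₁) a b = g₁ a b := by
        intro a b hb
        rw [hlg, hrow b hb]; simp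
      have hκrow : ∀ b, (l * g₁) κ b = g₁ κ b := by
        intro b; rw [hlg, if_neg (lt_irrefl κ), add_zero]
      intro i hi
      by_cases hik : i = κ
      · refine ⟨j, ?_, ?_, ?_⟩
        · rw [hik, hκrow, hrow']; exact hj
        · intro b hb; rw [hik, hκrow]; exact hrow b hb
        · rw [hik]; exact hcol'
      · have hik' : (i : ℕ) < k := by
          have : (i : ℕ) ≠ k := fun h3 => hik (Fin.ext h3)
          omega
        obtain ⟨b, hb0, hb1, hb2⟩ := h i hik'
        have hbj : b ≠ j := by rintro rfl; exact hb0 (hcol i hik')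
        refine ⟨b, ?_, ?_, ?_⟩
        · rw [hother i b hbj, hold i hik']; exact hb0
        · intro b' hb'
          by_cases h3 : b' = j
          · rw [h3]; exact hcol' i hik
          · rw [hother i b' h3, hold i hik']; exact hb1 b' hb'
        · intro i' hi'
          rw [hother i' b hbj]
          rw [hgu, hb2 i' hi']
          by_cases h3 : j < b
          · have : g κ b = 0 := hb2 κ fun h4 => hik h4.symm
            simp [this]
          · simp [h3]

end Bruhat

section FixedPoints

/-- A `p`-group acting on an abelian group of exponent `p` has nonzero fixed points in every
nonzero stable subgroup. -/
lemma exists_ne_zero_fixed_of_isPGroup {H : Type*} [Group H] [Finite H] {p : ℕ} [Fact p.Prime]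
    (hH : IsPGroup p H) {M : Type*} [AddCommGroup M] (hM : ∀ m : M, p • m = 0)
    (σ : H →* AddMonoid.End M) {Z : AddSubgroup M} (hZ : ∀ h, ∀ m ∈ Z, σ h m ∈ Z)
    {z : M} (hz : z ∈ Z) (hz0 : z ≠ 0) : ∃ m ∈ Z, m ≠ 0 ∧ ∀ h, σ h m = m := by
  set W := AddSubgroup.closure (Set.range fun h => σ h z) with hW
  have hWZ : W ≤ Z := by
    rw [hW, AddSubgroup.closure_le]
    rintro _ ⟨h, rfl⟩
    exact hZ h z hz
  have hstab : ∀ h, ∀ m ∈ W, σ h m ∈ W := by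
    intro h m hm
    have : W ≤ W.comap (σ h) := by
      rw [hW, AddSubgroup.closure_le]
      rintro _ ⟨h', rfl⟩
      refine AddSubgroup.subset_closure ⟨h * h', ?_⟩
      simp only [map_mul]; rfl
    exact this hm
  have hfin : Finite W := by
    have hfg : AddGroup.FG W :=
      (AddGroup.fg_iff_addSubgroup_fg W).2 ⟨(Set.finite_range fun h => σ h z).toFinset,
      by simp [hW]⟩
    refine AddCommGroup.finite_of_fg_isAddTorsion W fun m => ?_
    rw [isOfFinAddOrder_iff_nsmul_eq_zero]
    exact ⟨p, (Fact.out : p.Prime).pos, Subtype.ext (hM m)⟩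
  let act : MulAction H W :=
    { smul := fun h m => ⟨σ h m, hstab h m m.2⟩
      one_smul := fun m => Subtype.ext (by change σ 1 (m : M) = m; rw [map_one]; rfl)
      mul_smul := fun h h' m =>
        Subtype.ext (by change σ (h * h') (m : M) = σ h (σ h' m); rw [map_mul]; rfl) }
  have hmod := hH.card_modEq_card_fixedPoints W
  have hzW : z ∈ W := AddSubgroup.subset_closure ⟨1, by simp only [map_one]; rfl⟩
  have hdvd : p ∣ Nat.card W := by
    have : addOrderOf (⟨z, hzW⟩ : W) = p :=
      addOrderOf_eq_prime (Subtype.ext (hM z)) (by simpa [Subtype.ext_iff] using hz0)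
    rw [← this]
    exact addOrderOf_dvd_natCard _
  have h0 : (0 : W) ∈ MulAction.fixedPoints H W := fun h => Subtype.ext (map_zero (σ h))
  have hcard : p ∣ Nat.card (MulAction.fixedPoints H W) := (hmod.dvd_iff dvd_rfl).1 hdvd
  have hlt : 1 < Nat.card (MulAction.fixedPoints H W) :=
    (Fact.out : p.Prime).one_lt.trans_le
      (Nat.le_of_dvd (Nat.card_pos_iff.2 ⟨⟨⟨0, h0⟩⟩, inferInstance⟩) hcard)
  have hnt : Nontrivial (MulAction.fixedPoints H W) := Finite.one_lt_card_iff_nontrivial.1 hlt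
  obtain ⟨⟨m, hm⟩, hne⟩ := exists_ne (⟨0, h0⟩ : MulAction.fixedPoints H W)
  refine ⟨m, hWZ m.2, fun h => hne (Subtype.ext (Subtype.ext h)), fun h => ?_⟩
  exact congrArg Subtype.val (hm h)

end FixedPoints

section Eigenvectors

variable {F : Type*} [Field F] [Fintype F] {M : Type*} [AddCommGroup M] [Module F M]

lemma exists_mem_eigenvector_of_pow_card_sub_one [FiniteDimensional F M] {A : Module.End F M}
    (hA : A ^ (Fintype.card F - 1) = 1) {W : Submodule F M} (hW : W ≠ ⊥)
    (hAW : ∀ m ∈ W, A m ∈ W) : ∃ c : F, ∃ m ∈ W, m ≠ 0 ∧ A m = c • m := by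
  set B := A.restrict hAW with hB
  have hnt : Nontrivial W := Submodule.nontrivial_iff_ne_bot.2 hW
  have hBpow : B ^ (Fintype.card F - 1) = 1 := by
    rw [hB, Module.End.pow_restrict]
    ext m
    simp [hA]
  have hroot : Polynomial.aeval B (Polynomial.X ^ Fintype.card F - Polynomial.X : Polynomial F) =
    0 := by
    have h1 : Fintype.card F = Fintype.card F - 1 + 1 := (Nat.sub_add_cancel Fintype.card_pos).symm
    rw [map_sub, map_pow, Polynomial.aeval_X]
    nth_rewrite 1 [h1]
    rw [pow_succ, hBpow, one_mul, sub_self]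
  have hsplit : (minpoly F B).Splits := by
    have h2 : (Polynomial.X ^ Fintype.card F - Polynomial.X : Polynomial F).Splits := by
      rw [Polynomial.splits_iff_card_roots, FiniteField.roots_X_pow_card_sub_X,
        FiniteField.X_pow_card_sub_X_natDegree_eq F Fintype.one_lt_card]
      rfl
    exact h2.of_dvd (FiniteField.X_pow_card_sub_X_ne_zero F Fintype.one_lt_card)
      (minpoly.dvd F B hroot)
  have hdeg : (minpoly F B).degree ≠ 0 :=
    (minpoly.degree_pos (Algebra.IsIntegral.isIntegral B)).ne'
  obtain ⟨c, hc⟩ := hsplit.exists_eval_eq_zero hdeg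
  obtain ⟨v, hv⟩ := (Module.End.hasEigenvalue_of_isRoot hc).exists_hasEigenvector
  refine ⟨c, v, v.2, fun h => hv.2 (Subtype.ext h), ?_⟩
  exact congrArg Subtype.val hv.apply_eq_smul

lemma exists_common_eigenvector [FiniteDimensional F M] {ι : Type*} [Finite ι]
    {A : ι → Module.End F M} (hA : ∀ i, A i ^ (Fintype.card F - 1) = 1)
    (hcomm : ∀ i j, Commute (A i) (A j)) {W : Submodule F M} (hW : W ≠ ⊥)
    (hAW : ∀ i, ∀ m ∈ W, A i m ∈ W) : ∃ m ∈ W, m ≠ 0 ∧ ∀ i, ∃ c : F, A i m = c • m := by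
  classical
  have := Fintype.ofFinite ι
  suffices H : ∀ s : Finset ι, ∃ W' : Submodule F M, W' ≤ W ∧ W' ≠ ⊥ ∧
      (∀ i, ∀ m ∈ W', A i m ∈ W') ∧ ∀ i ∈ s, ∃ c : F, ∀ m ∈ W', A i m = c • m by
    obtain ⟨W', h1, h2, -, h3⟩ := H Finset.univ
    obtain ⟨m, hm, hm0⟩ := Submodule.exists_mem_ne_zero_of_ne_bot h2
    refine ⟨m, h1 hm, hm0, fun i => ?_⟩
    obtain ⟨c, hc⟩ := h3 i (Finset.mem_univ i)
    exact ⟨c, hc m hm⟩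
  intro s
  induction s using Finset.induction_on with
  | empty => exact ⟨W, le_rfl, hW, hAW, by simp⟩
  | insert i s _ ih =>
    obtain ⟨W', h1, h2, h3, h4⟩ := ih
    obtain ⟨c, m, hm, hm0, hmc⟩ := exists_mem_eigenvector_of_pow_card_sub_one (hA i) h2 (h3 i)
    refine ⟨W' ⊓ Module.End.eigenspace (A i) c, inf_le_left.trans h1, fun h => ?_, ?_, ?_⟩
    · have : m ∈ W' ⊓ Module.End.eigenspace (A i) c := ⟨hm, Module.End.mem_eigenspace_iff.2 hmc⟩
      rw [h] at this
      exact hm0 this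
    · rintro j x ⟨hx, hxc⟩
      refine ⟨h3 j x hx, Module.End.mem_eigenspace_iff.2 ?_⟩
      have h5 := LinearMap.congr_fun (hcomm i j) x
      rw [Module.End.mul_apply, Module.End.mul_apply, Module.End.mem_eigenspace_iff.1 hxc,
        map_smul] at h5
      exact h5
    · intro j hj
      rcases Finset.mem_insert.1 hj with rfl | hj
      · exact ⟨c, fun x hx => Module.End.mem_eigenspace_iff.1 hx.2⟩
      · obtain ⟨c', hc'⟩ := h4 j hj
        exact ⟨c', fun x hx => hc' x hx.1⟩

end Eigenvectors

section LowerUniGroup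

variable {n : ℕ} {F : Type*} [Field F]

lemma IsLowerUni.exists_pow_eq_one (p : ℕ) [Fact p.Prime] [CharP F p]
    {l : Matrix (Fin n) (Fin n) F} (h : IsLowerUni l) : ∃ k, l ^ p ^ k = 1 := by
  have hχ : l.charpoly = (Polynomial.X - Polynomial.C 1) ^ n := by
    rw [← charpoly_transpose, charpoly_of_isUpperTriangular]
    · simp [h.1]
    · exact fun i j hij => h.2 _ _ hij
  have h0 : (l - 1) ^ n = 0 := by
    have := aeval_self_charpoly l
    rw [hχ] at this
    simpa using this
  obtain ⟨k, hk⟩ : ∃ k, n ≤ p ^ k := ⟨n, (Nat.lt_pow_self (Fact.out : p.Prime).one_lt).le⟩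
  refine ⟨k, ?_⟩
  rcases isEmpty_or_nonempty (Fin n) with he | he
  · exact Subsingleton.elim _ _
  have := sub_pow_char_pow_of_commute (p := p) k (Commute.one_right l)
  rw [one_pow, pow_eq_zero_of_le hk h0] at this
  exact (sub_eq_zero.1 this.symm)

variable [Finite F]

/-- The group of lower unitriangular matrices. -/
def lowerUniGroup (n : ℕ) (F : Type*) [Field F] [Finite F] :
    Subgroup (SpecialLinearGroup (Fin n) F) where
  carrier := {x | IsLowerUni (x : Matrix (Fin n) (Fin n) F)}
  one_mem' := IsLowerUni.one
  mul_mem' := fun ha hb => IsLowerUni.mul ha hb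
  inv_mem' := by
    intro x hx
    have hpow : ∀ k : ℕ, IsLowerUni (x ^ k : SpecialLinearGroup (Fin n) F).1 := by
      intro k
      induction k with
      | zero => rw [pow_zero]; exact IsLowerUni.one
      | succ k ih => rw [pow_succ]; exact IsLowerUni.mul ih hx
    obtain ⟨k, hk⟩ := (mem_powers_iff_mem_zpowers (x := x) (y := x⁻¹)).2
      (Subgroup.inv_mem _ (Subgroup.mem_zpowers x))
    exact hk ▸ hpow k

lemma isPGroup_lowerUniGroup (p : ℕ) [Fact p.Prime] [CharP F p] :
    IsPGroup p (lowerUniGroup n F) := by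
  rintro ⟨x, hx⟩
  obtain ⟨k, hk⟩ := IsLowerUni.exists_pow_eq_one p hx
  refine ⟨k, Subtype.ext (Subtype.ext ?_)⟩
  exact (Matrix.SpecialLinearGroup.coe_pow x _).trans hk

end LowerUniGroup

section Translation

variable {n : ℕ} {F : Type*} [Field F]

/-- The operator `f ↦ f (a * · * b)` on functions of a matrix. -/
def mulTranslate (a b : Matrix (Fin n) (Fin n) F) :
    Module.End F (Matrix (Fin n) (Fin n) F → F) :=
  LinearMap.funLeft F F fun g => a * g * b

lemma mulTranslate_apply (a b : Matrix (Fin n) (Fin n) F) (f : Matrix (Fin n) (Fin n) F → F)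
    (g : Matrix (Fin n) (Fin n) F) : mulTranslate a b f g = f (a * g * b) := rfl

lemma mulTranslate_mul (a b a' b' : Matrix (Fin n) (Fin n) F) :
    mulTranslate a b * mulTranslate a' b' = mulTranslate (a' * a) (b * b') := by
  ext f g
  simp only [Module.End.mul_apply, mulTranslate_apply, mul_assoc]

lemma mulTranslate_one : mulTranslate (1 : Matrix (Fin n) (Fin n) F) 1 = 1 := by
  ext f g
  simp [mulTranslate_apply]

/-- Functions on `SL_n(F)` (extended by zero), invariant under the centre and killed by the norm
elements `∑ x ^ j` of all `Good x k`. -/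
def normFun (Good : Matrix (Fin n) (Fin n) F → ℕ → Prop) :
    Submodule F (Matrix (Fin n) (Fin n) F → F) where
  carrier := {f | (∀ g, g.det ≠ 1 → f g = 0) ∧ (∀ (c : F) g, c ^ n = 1 → f (c • g) = f g) ∧
    ∀ x k, Good x k → ∀ g h, g.det = 1 → h.det = 1 → ∑ j ∈ Finset.range k, f (g * x ^ j * h) = 0}
  add_mem' := by
    rintro f f' ⟨h1, h2, h3⟩ ⟨h1', h2', h3'⟩
    refine ⟨fun g hg => ?_, fun c g hc => ?_, fun x k hx g h hg hh => ?_⟩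
    · simp [h1 g hg, h1' g hg]
    · simp [h2 c g hc, h2' c g hc]
    · simp [Finset.sum_add_distrib, h3 x k hx g h hg hh, h3' x k hx g h hg hh]
  zero_mem' := by simp
  smul_mem' := by
    rintro a f ⟨h1, h2, h3⟩
    refine ⟨fun g hg => ?_, fun c g hc => ?_, fun x k hx g h hg hh => ?_⟩
    · simp [h1 g hg]
    · simp [h2 c g hc]
    · simp [← Finset.mul_sum, h3 x k hx g h hg hh]

variable {Good : Matrix (Fin n) (Fin n) F → ℕ → Prop}

lemma mulTranslate_mem_normFun {a b : Matrix (Fin n) (Fin n) F} (ha : a.det = 1) (hb : b.det = 1)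
    {f : Matrix (Fin n) (Fin n) F → F} (hf : f ∈ normFun Good) :
    mulTranslate a b f ∈ normFun Good := by
  obtain ⟨h1, h2, h3⟩ := hf
  refine ⟨fun g hg => ?_, fun c g hc => ?_, fun x k hx g h hg hh => ?_⟩
  · rw [mulTranslate_apply, h1]
    rwa [det_mul, det_mul, ha, hb, one_mul, mul_one]
  · rw [mulTranslate_apply, Matrix.mul_smul, Matrix.smul_mul, h2 c _ hc, mulTranslate_apply]
  · rw [← h3 x k hx (a * g) (h * b) (by rw [det_mul, ha, hg, one_mul])
      (by rw [det_mul, hh, hb, one_mul])]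
    simp only [mulTranslate_apply, mul_assoc]

/-- The functions in `normFun Good` that are invariant under lower unitriangular matrices on the
left and upper unitriangular matrices on the right. -/
def unipotentInvariants (Good : Matrix (Fin n) (Fin n) F → ℕ → Prop) :
    Submodule F (Matrix (Fin n) (Fin n) F → F) where
  carrier := {f | f ∈ normFun Good ∧ (∀ l g, IsLowerUni l → f (l * g) = f g) ∧
    ∀ u g, IsLowerUni uᵀ → f (g * u) = f g}
  add_mem' := by
    rintro f f' ⟨h1, h2, h3⟩ ⟨h1', h2', h3'⟩
    refine ⟨add_mem h1 h1', fun l g hl => ?_, fun u g hu => ?_⟩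
    · simp [h2 l g hl, h2' l g hl]
    · simp [h3 u g hu, h3' u g hu]
  zero_mem' := ⟨zero_mem _, by simp, by simp⟩
  smul_mem' := by
    rintro a f ⟨h1, h2, h3⟩
    refine ⟨Submodule.smul_mem _ a h1, fun l g hl => ?_, fun u g hu => ?_⟩
    · simp [h2 l g hl]
    · simp [h3 u g hu]

lemma unipotentInvariants_ne_bot [Finite F] (p : ℕ) [Fact p.Prime] [CharP F p]
    {f : Matrix (Fin n) (Fin n) F → F} (hf : f ∈ normFun Good) (hf0 : f ≠ 0) :
    unipotentInvariants Good ≠ ⊥ := by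
  have hM : ∀ m : Matrix (Fin n) (Fin n) F → F, p • m = 0 := fun m => by
    ext g; simp
  have hdet : ∀ l : lowerUniGroup n F, (l.1.1).det = 1 := fun l => l.2.det_eq_one
  let σ₁ : lowerUniGroup n F →* AddMonoid.End (Matrix (Fin n) (Fin n) F → F) :=
    { toFun := fun h => (mulTranslate (h⁻¹).1.1 1).toAddMonoidHom
      map_one' := by
        have h1 : ((1 : lowerUniGroup n F)⁻¹).1.1 = 1 := by rw [inv_one]; rfl
        rw [h1, mulTranslate_one]; rfl
      map_mul' := fun h h' => by
        have h1 : ((h * h')⁻¹).1.1 = (h'⁻¹).1.1 * (h⁻¹).1.1 := by rw [_root_.mul_inv_rev]; rfl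
        rw [h1]
        nth_rewrite 1 [← one_mul (1 : Matrix (Fin n) (Fin n) F)]
        rw [← mulTranslate_mul]; rfl }
  let σ₂ : lowerUniGroup n F →* AddMonoid.End (Matrix (Fin n) (Fin n) F → F) :=
    { toFun := fun h => (mulTranslate 1 (h⁻¹).1.1ᵀ).toAddMonoidHom
      map_one' := by
        have h1 : ((1 : lowerUniGroup n F)⁻¹).1.1 = 1 := by rw [inv_one]; rfl
        rw [h1, transpose_one, mulTranslate_one]; rfl
      map_mul' := fun h h' => by
        have h1 : ((h * h')⁻¹).1.1 = (h'⁻¹).1.1 * (h⁻¹).1.1 := by rw [_root_.mul_inv_rev]; rfl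
        rw [h1, transpose_mul]
        nth_rewrite 1 [← one_mul (1 : Matrix (Fin n) (Fin n) F)]
        rw [← mulTranslate_mul]; rfl }
  have hP := isPGroup_lowerUniGroup (n := n) (F := F) p
  obtain ⟨f₁, hf₁, hf₁0, hinv₁⟩ := exists_ne_zero_fixed_of_isPGroup hP hM σ₁
    (Z := (normFun Good).toAddSubgroup)
    (fun h m hm => mulTranslate_mem_normFun (hdet h⁻¹) det_one hm) hf hf0
  have hleft : ∀ l g, IsLowerUni l → f₁ (l * g) = f₁ g := by
    intro l g hl
    have h1 := congrFun (hinv₁ (⟨⟨l, hl.det_eq_one⟩, hl⟩ : lowerUniGroup n F)⁻¹) g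
    change f₁ ((⟨⟨l, hl.det_eq_one⟩, hl⟩ : lowerUniGroup n F)⁻¹⁻¹.1.1 * g * 1) = f₁ g at h1
    rwa [inv_inv, mul_one] at h1
  let Z : AddSubgroup (Matrix (Fin n) (Fin n) F → F) :=
    { carrier := {f | f ∈ normFun Good ∧ ∀ l g, IsLowerUni l → f (l * g) = f g}
      add_mem' := fun h h' => ⟨add_mem h.1 h'.1, fun l g hl => by simp [h.2 l g hl, h'.2 l g hl]⟩
      zero_mem' := ⟨zero_mem _, by simp⟩
      neg_mem' := fun h => ⟨neg_mem h.1, fun l g hl => by simp [h.2 l g hl]⟩ }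
  obtain ⟨f₂, hf₂, hf₂0, hinv₂⟩ := exists_ne_zero_fixed_of_isPGroup hP hM σ₂ (Z := Z)
    (fun h m hm => ⟨mulTranslate_mem_normFun det_one ((det_transpose _).trans (hdet h⁻¹)) hm.1,
      fun l g hl => by
        change m (1 * (l * g) * _) = m (1 * g * _)
        rw [one_mul, one_mul, mul_assoc, hm.2 _ _ hl]⟩) (z := f₁) ⟨hf₁, hleft⟩ hf₁0
  have hright : ∀ u g, IsLowerUni uᵀ → f₂ (g * u) = f₂ g := by
    intro u g hu
    have h1 := congrFun (hinv₂ (⟨⟨uᵀ, hu.det_eq_one⟩, hu⟩ : lowerUniGroup n F)⁻¹) g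
    change f₂ (1 * g * (⟨⟨uᵀ, hu.det_eq_one⟩, hu⟩ : lowerUniGroup n F)⁻¹⁻¹.1.1ᵀ) = f₂ g at h1
    rw [inv_inv, one_mul] at h1
    exact h1
  intro hbot
  have : f₂ ∈ unipotentInvariants Good := ⟨hf₂.1, hf₂.2, hright⟩
  rw [hbot] at this
  exact hf₂0 this

/-- A joint eigenvector for the diagonal torus in `unipotentInvariants Good`. -/
structure IsHighestWeight (Good : Matrix (Fin n) (Fin n) F → ℕ → Prop)
    (f : Matrix (Fin n) (Fin n) F → F) (χ : (Fin n → Fˣ) → F) : Prop where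
  mem : f ∈ normFun Good
  left : ∀ l g, IsLowerUni l → f (l * g) = f g
  right : ∀ u g, IsLowerUni uᵀ → f (g * u) = f g
  torus : ∀ d, ∏ i, d i = 1 → ∀ g, f (g * diagonal fun i => (d i : F)) = χ d * f g

lemma isLowerUni_conj_diagonal {u : Matrix (Fin n) (Fin n) F} (hu : IsLowerUni uᵀ)
    (d : Fin n → Fˣ) : ∃ u', IsLowerUni u'ᵀ ∧
      u * diagonal (fun i => (d i : F)) = diagonal (fun i => (d i : F)) * u' := by
  refine ⟨of fun i j => (d i : F)⁻¹ * d j * u i j, ?_, ?_⟩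
  rotate_left
  · rw [← monomialMatrix_one_eq_diagonal, mul_monomialMatrix_eq]
    rfl
  · refine ⟨fun i => ?_, fun i j hij => ?_⟩
    · have := hu.1 i
      rw [transpose_apply] at this
      simp [this]
    · have := hu.2 i j hij
      rw [transpose_apply] at this
      simp [this]

lemma exists_isHighestWeight [Fintype F] (p : ℕ) [Fact p.Prime] [CharP F p]
    {f : Matrix (Fin n) (Fin n) F → F} (hf : f ∈ normFun Good) (hf0 : f ≠ 0) :
    ∃ f χ, IsHighestWeight Good f χ ∧ f ≠ 0 := by
  classical
  have hbot := unipotentInvariants_ne_bot p hf hf0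
  let A : {d : Fin n → Fˣ // ∏ i, d i = 1} → Module.End F (Matrix (Fin n) (Fin n) F → F) :=
    fun d => mulTranslate 1 (diagonal fun i => (d.1 i : F))
  have hApow : ∀ d k, A d ^ k = mulTranslate 1 (diagonal fun i => (d.1 i : F) ^ k) := by
    intro d k
    induction k with
    | zero => simp [← mulTranslate_one]
    | succ k ih =>
      rw [pow_succ, ih, mulTranslate_mul, diagonal_mul_diagonal, one_mul]
      simp only [pow_succ]
  obtain ⟨f', hf', hf'0, hc⟩ := exists_common_eigenvector (A := A) (W := unipotentInvariants Good)
    (fun d => by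
      rw [hApow, ← mulTranslate_one]
      congr 1
      ext i j
      simp [FiniteField.pow_card_sub_one_eq_one, one_apply, diagonal_apply])
    (fun d e => by
      change mulTranslate _ _ * mulTranslate _ _ = mulTranslate _ _ * mulTranslate _ _
      rw [mulTranslate_mul, mulTranslate_mul, diagonal_mul_diagonal, diagonal_mul_diagonal]
      simp only [mul_comm])
    hbot
    (fun d m hm => ⟨mulTranslate_mem_normFun det_one
        (by rw [det_diagonal, ← Units.coe_prod, d.2, Units.val_one]) hm.1,
      fun l g hl => by
        change m (1 * (l * g) * _) = m (1 * g * _)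
        rw [one_mul, one_mul, mul_assoc, hm.2.1 _ _ hl],
      fun u g hu => by
        obtain ⟨u', hu', h1⟩ := isLowerUni_conj_diagonal hu d.1
        change m (1 * (g * u) * _) = m (1 * g * _)
        rw [one_mul, one_mul, mul_assoc, h1, ← mul_assoc, hm.2.2 _ _ hu']⟩)
  choose c hc using hc
  refine ⟨f', fun d => if h : ∏ i, d i = 1 then c ⟨d, h⟩ else 0, ⟨hf'.1, hf'.2.1, hf'.2.2, ?_⟩,
    hf'0⟩
  intro d hd g
  rw [dif_pos hd]
  have := congrFun (hc ⟨d, hd⟩) g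
  change f' (1 * g * _) = _ at this
  rw [one_mul] at this
  exact this

end Translation

section Reflection

variable {N : ℕ} {F : Type*} [Field F]

/-- The monomial matrix in `SL_n` lifting the simple reflection `(r, r + 1)`. -/
def reflMatrix (F : Type*) [Field F] (r : Fin N) : Matrix (Fin (N + 1)) (Fin (N + 1)) F :=
  monomialMatrix (Equiv.swap r.castSucc r.succ) (Pi.mulSingle r.castSucc (-1))

/-- The simple coroot. -/
def coroot (r : Fin N) (t : Fˣ) : Fin (N + 1) → Fˣ :=
  Pi.mulSingle r.castSucc t * Pi.mulSingle r.succ t⁻¹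

lemma prod_coroot (r : Fin N) (t : Fˣ) : ∏ i, coroot r t i = 1 := by
  simp [coroot, Finset.prod_mul_distrib]

lemma coroot_mul (r : Fin N) (t s : Fˣ) : coroot r (t * s) = coroot r t * coroot r s := by
  rw [coroot, coroot, coroot, Pi.mulSingle_mul, mul_inv, Pi.mulSingle_mul]
  exact mul_mul_mul_comm _ _ _ _

variable (r : Fin N)

lemma reflMatrix_eq_transvection : reflMatrix F r = transvection r.castSucc r.succ 1 *
    transvection r.succ r.castSucc (-1) * transvection r.castSucc r.succ 1 := by
  have hab : r.castSucc ≠ r.succ := (Fin.castSucc_lt_succ).ne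
  have hba := hab.symm
  ext i j
  rw [reflMatrix, monomialMatrix, of_apply]
  rcases eq_or_ne j r.succ with rfl | hj
  · rw [mul_transvection_apply_same]
    rcases eq_or_ne i r.castSucc with rfl | hi
    · rw [transvection_mul_apply_same, transvection_mul_apply_same]
      simp [transvection, hab, hba]
    · rw [transvection_mul_apply_of_ne _ _ _ _ hi, transvection_mul_apply_of_ne _ _ _ _ hi]
      rcases eq_or_ne i r.succ with rfl | hi'
      · simp [transvection, hab, hba]
      · simp [transvection, hi, hi'.symm, hi']
  · rw [mul_transvection_apply_of_ne _ _ _ _ hj]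
    rcases eq_or_ne i r.castSucc with rfl | hi
    · rw [transvection_mul_apply_same]
      rcases eq_or_ne j r.castSucc with rfl | hj'
      · simp [transvection, hab, hba]
      · simp [transvection, hba, hj.symm, hj'.symm,
          Equiv.swap_apply_of_ne_of_ne hj' hj, one_apply]
    · rw [transvection_mul_apply_of_ne _ _ _ _ hi]
      rcases eq_or_ne j r.castSucc with rfl | hj'
      · rcases eq_or_ne i r.succ with rfl | hi'
        · simp [transvection, hba]
        · simp [transvection, hi, hi', hi'.symm]
      · simp [transvection, hj'.symm, hj', Equiv.swap_apply_of_ne_of_ne hj' hj, one_apply]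

lemma det_reflMatrix : (reflMatrix F r).det = 1 := by
  have hab : r.castSucc ≠ r.succ := (Fin.castSucc_lt_succ).ne
  rw [reflMatrix_eq_transvection, det_mul, det_mul, det_transvection_of_ne _ _ hab,
    det_transvection_of_ne _ _ hab.symm]
  simp

lemma transvection_mul_reflMatrix (t : Fˣ) :
    transvection r.castSucc r.succ (t : F) * reflMatrix F r =
      transvection r.succ r.castSucc (t : F)⁻¹ * diagonal (fun i => (coroot r (-t) i : F)) *
        transvection r.castSucc r.succ (-(t : F)⁻¹) := by
  have hab : r.castSucc ≠ r.succ := (Fin.castSucc_lt_succ).ne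
  have hba := hab.symm
  ext i j
  rcases eq_or_ne j r.succ with rfl | hj
  · rw [mul_transvection_apply_same]
    rcases eq_or_ne i r.castSucc with rfl | hi
    · rw [transvection_mul_apply_same, transvection_mul_apply_of_ne _ _ _ _ hab,
        transvection_mul_apply_of_ne _ _ _ _ hab]
      simp [reflMatrix, monomialMatrix, coroot, hab, hba]
    · rw [transvection_mul_apply_of_ne _ _ _ _ hi]
      rcases eq_or_ne i r.succ with rfl | hi'
      · rw [transvection_mul_apply_same, transvection_mul_apply_same]
        simp [reflMatrix, monomialMatrix, coroot, hab, hba]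
      · rw [transvection_mul_apply_of_ne _ _ _ _ hi', transvection_mul_apply_of_ne _ _ _ _ hi']
        simp [reflMatrix, monomialMatrix, hi, hi']
  · rw [mul_transvection_apply_of_ne _ _ _ _ hj]
    rcases eq_or_ne i r.castSucc with rfl | hi
    · rw [transvection_mul_apply_same, transvection_mul_apply_of_ne _ _ _ _ hab]
      rcases eq_or_ne j r.castSucc with rfl | hj'
      · simp [reflMatrix, monomialMatrix, coroot, hab]
      · simp [reflMatrix, monomialMatrix, hj'.symm, hj.symm, Equiv.swap_apply_of_ne_of_ne hj' hj]
    · rw [transvection_mul_apply_of_ne _ _ _ _ hi]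
      rcases eq_or_ne i r.succ with rfl | hi'
      · rw [transvection_mul_apply_same]
        rcases eq_or_ne j r.castSucc with rfl | hj'
        · simp [reflMatrix, monomialMatrix, coroot, hab, hba]
        · simp [reflMatrix, monomialMatrix, hj'.symm, hj.symm, Equiv.swap_apply_of_ne_of_ne hj' hj]
      · rw [transvection_mul_apply_of_ne _ _ _ _ hi']
        rcases eq_or_ne j r.castSucc with rfl | hj'
        · simp [reflMatrix, monomialMatrix, hi, hi']
        · rcases eq_or_ne i j with rfl | hij
          · simp [reflMatrix, monomialMatrix, coroot, hi, hi', Equiv.swap_apply_of_ne_of_ne hj' hj]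
          · simp [reflMatrix, monomialMatrix, hij, Equiv.swap_apply_of_ne_of_ne hj' hj]

lemma eq_of_swap_le {i j : Fin (N + 1)} (hij : i < j)
    (h : ¬ Equiv.swap r.castSucc r.succ i < Equiv.swap r.castSucc r.succ j) :
    i = r.castSucc ∧ j = r.succ := by
  rw [Equiv.swap_apply_def, Equiv.swap_apply_def] at h
  simp only [Fin.ext_iff, Fin.lt_def, Fin.val_castSucc, Fin.val_succ] at hij h ⊢
  split_ifs at h <;> first | omega | (simp only [Fin.val_castSucc, Fin.val_succ] at h; omega)

lemma isLowerUni_conj_reflMatrix {v : Matrix (Fin (N + 1)) (Fin (N + 1)) F} (hv : IsLowerUni vᵀ)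
    (h0 : v r.castSucc r.succ = 0) :
    ∃ v', IsLowerUni v'ᵀ ∧ v * reflMatrix F r = reflMatrix F r * v' := by
  refine ⟨_, ?_, mul_monomialMatrix_eq _ _ _⟩
  refine ⟨fun i => ?_, fun i j hij => ?_⟩
  · have := hv.1 (Equiv.swap r.castSucc r.succ i)
    rw [transpose_apply] at this
    simp [this]
  · rw [transpose_apply, of_apply]
    by_cases h : Equiv.swap r.castSucc r.succ i < Equiv.swap r.castSucc r.succ j
    · have := hv.2 _ _ h
      rw [transpose_apply] at this
      rw [this, mul_zero]
    · obtain ⟨rfl, rfl⟩ := eq_of_swap_le r hij h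
      rw [Equiv.swap_apply_left, Equiv.swap_apply_right, h0, mul_zero]

end Reflection

section ReflSum

variable {N : ℕ} {F : Type*} [Field F] [Fintype F]
  {Good : Matrix (Fin (N + 1)) (Fin (N + 1)) F → ℕ → Prop}
  {f : Matrix (Fin (N + 1)) (Fin (N + 1)) F → F} {χ : (Fin (N + 1) → Fˣ) → F}

/-- The Hecke operator attached to a simple reflection. -/
def reflSum (r : Fin N) (f : Matrix (Fin (N + 1)) (Fin (N + 1)) F → F) :
    Matrix (Fin (N + 1)) (Fin (N + 1)) F → F :=
  fun g => ∑ t : F, f (g * transvection r.castSucc r.succ t * reflMatrix F r)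

lemma IsHighestWeight.reflSum (hf : IsHighestWeight Good f χ) (r : Fin N) :
    IsHighestWeight Good (reflSum r f)
      (fun d => χ fun i => d (Equiv.swap r.castSucc r.succ i)) := by
  have hab : r.castSucc ≠ r.succ := (Fin.castSucc_lt_succ).ne
  refine ⟨?_, fun l g hl => ?_, fun u g hu => ?_, fun d hd g => ?_⟩
  · have h1 : _root_.reflSum r f = ∑ t : F,
        mulTranslate 1 (transvection r.castSucc r.succ t * reflMatrix F r) f := by
      ext g
      simp [_root_.reflSum, mulTranslate_apply, mul_assoc]
    rw [h1]
    refine Submodule.sum_mem _ fun t _ => mulTranslate_mem_normFun det_one ?_ hf.mem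
    rw [det_mul, det_reflMatrix, det_transvection_of_ne _ _ hab, mul_one]
  · simp only [_root_.reflSum, mul_assoc, hf.left l _ hl]
  · have hu1 : ∀ i, u i i = 1 := hu.1
    have hu2 : ∀ i j, i < j → u j i = 0 := hu.2
    set c := u r.castSucc r.succ with hc
    have key : ∀ t, f (g * u * transvection r.castSucc r.succ t * reflMatrix F r) =
        f (g * transvection r.castSucc r.succ (t + c) * reflMatrix F r) := by
      intro t
      have hT : ∀ s : F, IsLowerUni (transvection r.castSucc r.succ s)ᵀ := fun s => by
        rw [transvection, transpose_add, transpose_one, transpose_single]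
        exact IsLowerUni.transvection Fin.castSucc_lt_succ s
      set v := transvection r.castSucc r.succ (-(t + c)) * (u * transvection r.castSucc r.succ t)
        with hv
      obtain ⟨v', hv', h1⟩ := isLowerUni_conj_reflMatrix (F := F) r (v := v)
        (by rw [hv, transpose_mul, transpose_mul]; exact ((hT t).mul hu).mul (hT _))
        (by
          rw [hv, transvection_mul_apply_same, mul_transvection_apply_same,
            mul_transvection_apply_same, hu1, hu1, hu2 _ _ Fin.castSucc_lt_succ, ← hc]
          ring)
      have h2 : transvection r.castSucc r.succ (t + c) * v =
          u * transvection r.castSucc r.succ t := by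
        rw [hv, ← mul_assoc, transvection_mul_transvection_same _ _ hab, add_neg_cancel,
          transvection_zero, one_mul]
      rw [mul_assoc g u, ← h2, mul_assoc, mul_assoc, h1, ← mul_assoc, ← mul_assoc,
        hf.right _ _ hv']
    simp only [_root_.reflSum, key]
    exact Equiv.sum_comp (Equiv.addRight c)
      fun t => f (g * transvection r.castSucc r.succ t * reflMatrix F r)
  · have hd' : ∏ i, d (Equiv.swap r.castSucc r.succ i) = 1 := by
      rw [Equiv.prod_comp]; exact hd
    have key : ∀ t, f (g * diagonal (fun i => (d i : F)) * transvection r.castSucc r.succ t *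
        reflMatrix F r) = χ (fun i => d (Equiv.swap r.castSucc r.succ i)) *
          f (g * transvection r.castSucc r.succ
            (((d r.castSucc * (d r.succ)⁻¹ : Fˣ) : F) * t) * reflMatrix F r) := by
      intro t
      have h1 : diagonal (fun i => (d i : F)) * reflMatrix F r =
          reflMatrix F r * diagonal fun i => (d (Equiv.swap r.castSucc r.succ i) : F) := by
        rw [reflMatrix, monomialMatrix_mul_diagonal, ← monomialMatrix_one_eq_diagonal,
          monomialMatrix_mul_monomialMatrix, one_mul]
        congr 1
        ext i
        simp [mul_comm]
      rw [← hf.torus _ hd', mul_assoc g, ← monomialMatrix_one_eq_diagonal d,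
        monomialMatrix_mul_transvection _ _ hab, monomialMatrix_one_eq_diagonal,
        ← mul_assoc g, mul_assoc _ _ (reflMatrix F r), h1, ← mul_assoc]
      congr 4
      simp only [Equiv.Perm.coe_one, id, Units.val_mul, Units.val_inv_eq_inv_val]
      congr 1
      ring
    simp only [_root_.reflSum, key, ← Finset.mul_sum]
    congr 1
    exact Equiv.sum_comp (Units.mulLeft (d r.castSucc * (d r.succ)⁻¹))
      fun t => f (g * transvection r.castSucc r.succ t * reflMatrix F r)

/-- At a descent the Hecke operator vanishes. -/
lemma IsHighestWeight.reflSum_descent (hf : IsHighestWeight Good f χ) {r : Fin N}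
    {w : Equiv.Perm (Fin (N + 1))} (hw : w r.succ < w r.castSucc) (d : Fin (N + 1) → Fˣ) :
    _root_.reflSum r f (monomialMatrix w d) = 0 := by
  have hab : r.castSucc ≠ r.succ := (Fin.castSucc_lt_succ).ne
  have key : ∀ t, f (monomialMatrix w d * transvection r.castSucc r.succ t * reflMatrix F r) =
      f (monomialMatrix w d * reflMatrix F r) := fun t => by
    rw [monomialMatrix_mul_transvection _ _ hab, mul_assoc, hf.left _ _ (IsLowerUni.transvection hw
      _)]
  simp [_root_.reflSum, key]

lemma IsHighestWeight.reflSum_ascent [DecidableEq F] (hf : IsHighestWeight Good f χ) {r : Fin N}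
    {w : Equiv.Perm (Fin (N + 1))} (hw : w r.castSucc < w r.succ) (d : Fin (N + 1) → Fˣ) :
    _root_.reflSum r f (monomialMatrix w d) = f (monomialMatrix w d * reflMatrix F r) +
      (∑ t : Fˣ, χ (coroot r t)) * f (monomialMatrix w d) := by
  have hab : r.castSucc ≠ r.succ := (Fin.castSucc_lt_succ).ne
  have key : ∀ t : Fˣ, f (monomialMatrix w d * transvection r.castSucc r.succ (t : F) *
      reflMatrix F r) = χ (coroot r (-t)) * f (monomialMatrix w d) := fun t => by
    have hT : IsLowerUni (transvection r.castSucc r.succ (-(t : F)⁻¹))ᵀ := by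
      rw [transvection, transpose_add, transpose_one, transpose_single]
      exact IsLowerUni.transvection Fin.castSucc_lt_succ _
    rw [mul_assoc, transvection_mul_reflMatrix, ← mul_assoc, ← mul_assoc, hf.right _ _ hT,
      hf.torus _ (prod_coroot _ _), monomialMatrix_mul_transvection _ _ hab.symm,
      hf.left _ _ (IsLowerUni.transvection hw _)]
  rw [_root_.reflSum, ← Finset.add_sum_erase _ _ (Finset.mem_univ (0 : F)), transvection_zero,
    mul_one]
  congr 1
  rw [← Equiv.sum_comp (Equiv.neg Fˣ) fun t => χ (coroot r t), Finset.sum_mul]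
  symm
  refine Finset.sum_bij (fun t _ => (t : F)) ?_ ?_ ?_ ?_
  · simp
  · intro a _ b _ h; exact Units.ext h
  · intro b hb
    exact ⟨Units.mk0 b (Finset.ne_of_mem_erase hb), Finset.mem_univ _, rfl⟩
  · intro t _
    rw [key]; rfl

end ReflSum

section Support

variable {N : ℕ} {F : Type*} [Field F]

/-- The monomial support of a function of a matrix. -/
def IsInSupport (f : Matrix (Fin (N + 1)) (Fin (N + 1)) F → F) (w : Equiv.Perm (Fin (N + 1))) :
    Prop := ∃ d, f (monomialMatrix w d) ≠ 0

/-- A height function on permutations, monotone for the weak Bruhat order. -/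
def permHeight (w : Equiv.Perm (Fin (N + 1))) : ℕ := 1 + ∑ j : Fin (N + 1), (j : ℕ) * (N - w j)

lemma permHeight_lt {w : Equiv.Perm (Fin (N + 1))} {r : Fin N} (h : w r.castSucc < w r.succ) :
    permHeight w < permHeight (w * Equiv.swap r.castSucc r.succ) := by
  have hab : r.castSucc ≠ r.succ := (Fin.castSucc_lt_succ).ne
  set s := Equiv.swap r.castSucc r.succ with hs
  have h1 : ∑ j : Fin (N + 1), (j : ℕ) * (N - (w * s) j) =
      ∑ j : Fin (N + 1), (s j : ℕ) * (N - w j) := by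
    rw [← Equiv.sum_comp s fun j : Fin (N + 1) => (j : ℕ) * (N - (w * s) j)]
    refine Finset.sum_congr rfl fun j _ => ?_
    rw [Equiv.Perm.mul_apply, hs, Equiv.swap_apply_self]
  rw [permHeight, permHeight, h1]
  have h2 : ∀ j : Fin (N + 1), ((s j : ℕ) : ℤ) =
      j + (if j = r.castSucc then 1 else 0) - if j = r.succ then 1 else 0 := by
    intro j
    rw [hs, Equiv.swap_apply_def]
    split_ifs with h3 h4 h4
    · exact absurd (h3.symm.trans h4) hab
    · subst h3; simp
    · subst h4; simp
    · simp
  zify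
  simp only [h2, sub_mul, add_mul, Finset.sum_sub_distrib, Finset.sum_add_distrib, ite_mul, one_mul,
    zero_mul, Finset.sum_ite_eq', Finset.mem_univ, if_true]
  have h3 : ((w r.castSucc : ℕ)) < w r.succ := h
  have h4 := (w r.succ).2
  omega

lemma permHeight_lt_of_descent {w : Equiv.Perm (Fin (N + 1))} {r : Fin N}
    (h : w r.succ < w r.castSucc) :
    permHeight (w * Equiv.swap r.castSucc r.succ) < permHeight w := by
  have := permHeight_lt (w := w * Equiv.swap r.castSucc r.succ) (r := r) (by simpa using h)
  rwa [mul_assoc, Equiv.swap_mul_self, mul_one] at this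

lemma monomialMatrix_mul_reflMatrix (w : Equiv.Perm (Fin (N + 1))) (d : Fin (N + 1) → Fˣ)
    (r : Fin N) : ∃ e, monomialMatrix w d * reflMatrix F r =
      monomialMatrix (w * Equiv.swap r.castSucc r.succ) e :=
  ⟨_, monomialMatrix_mul_monomialMatrix _ _ _ _⟩

lemma exists_eq_monomialMatrix_mul_reflMatrix (w : Equiv.Perm (Fin (N + 1)))
    (d : Fin (N + 1) → Fˣ) (r : Fin N) : ∃ e, monomialMatrix w d =
      monomialMatrix (w * Equiv.swap r.castSucc r.succ) e * reflMatrix F r := by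
  set s := Equiv.swap r.castSucc r.succ with hs
  refine ⟨fun k => d (s k) * (Pi.mulSingle (M := fun _ => Fˣ) r.castSucc (-1) (s k))⁻¹, ?_⟩
  rw [reflMatrix, monomialMatrix_mul_monomialMatrix, mul_assoc, ← hs, Equiv.swap_mul_self, mul_one]
  congr 1
  ext j
  rw [hs, Equiv.swap_apply_self, inv_mul_cancel_right]

variable {Good : Matrix (Fin (N + 1)) (Fin (N + 1)) F → ℕ → Prop}
  {f : Matrix (Fin (N + 1)) (Fin (N + 1)) F → F} {χ : (Fin (N + 1) → Fˣ) → F}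

variable [Fintype F]

open Classical in
lemma IsHighestWeight.sum_permHeight_reflSum_lt (hf : IsHighestWeight Good f χ) {r : Fin N}
    {v : Equiv.Perm (Fin (N + 1))} (hv : v r.succ < v r.castSucc) (hvf : IsInSupport f v) :
    ∑ w, (if IsInSupport (_root_.reflSum r f) w then permHeight w else 0) <
      ∑ w, if IsInSupport f w then permHeight w else 0 := by
  set s := Equiv.swap r.castSucc r.succ with hs
  have hss : s * s = 1 := Equiv.swap_mul_self _ _
  have hdesc : ∀ w : Equiv.Perm (Fin (N + 1)), w r.succ < w r.castSucc →
      ¬ IsInSupport (_root_.reflSum r f) w := by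
    rintro w hw ⟨d, hd⟩
    exact hd (hf.reflSum_descent hw d)
  have hasc : ∀ w : Equiv.Perm (Fin (N + 1)), w r.castSucc < w r.succ →
      IsInSupport (_root_.reflSum r f) w → IsInSupport f w ∨ IsInSupport f (w * s) := by
    rintro w hw ⟨d, hd⟩
    rw [hf.reflSum_ascent hw d] at hd
    by_contra! h
    refine hd ?_
    obtain ⟨e, he⟩ := monomialMatrix_mul_reflMatrix w d r
    have h1 : f (monomialMatrix w d) = 0 := by
      by_contra h2; exact h.1 ⟨d, h2⟩
    have h3 : f (monomialMatrix (w * s) e) = 0 := by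
      by_contra h2; exact h.2 ⟨e, h2⟩
    rw [he, h1, h3, mul_zero, add_zero]
  have hpair : ∀ w : Equiv.Perm (Fin (N + 1)), w r.castSucc < w r.succ →
      ((if IsInSupport (_root_.reflSum r f) w then permHeight w else 0) +
        if IsInSupport (_root_.reflSum r f) (w * s) then permHeight (w * s) else 0) ≤
      (if IsInSupport f w then permHeight w else 0) +
        (if IsInSupport f (w * s) then permHeight (w * s) else 0) ∧
      (IsInSupport f (w * s) →
      ((if IsInSupport (_root_.reflSum r f) w then permHeight w else 0) +
        if IsInSupport (_root_.reflSum r f) (w * s) then permHeight (w * s) else 0) <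
      (if IsInSupport f w then permHeight w else 0) +
        (if IsInSupport f (w * s) then permHeight (w * s) else 0)) := by
    intro w hw
    have h1 := permHeight_lt hw
    rw [← hs] at h1
    have h2 := hdesc (w * s) (by simpa [hs] using hw)
    have h3 := hasc w hw
    rw [if_neg h2]
    split_ifs <;> first | (simp_all; done) | (refine ⟨?_, ?_⟩ <;> intros <;> omega)
  have hle : ∀ w : Equiv.Perm (Fin (N + 1)), w r.castSucc < w r.succ ∨ w r.succ < w r.castSucc :=
    fun w => lt_or_gt_of_ne fun h => (Fin.castSucc_lt_succ).ne (w.injective h)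
  have hdouble : ∀ φ : Equiv.Perm (Fin (N + 1)) → ℕ, ∑ w, (φ w + φ (w * s)) = 2 * ∑ w, φ w := by
    intro φ
    rw [Finset.sum_add_distrib, two_mul]
    congr 1
    exact Equiv.sum_comp (Equiv.mulRight s) φ
  refine lt_of_mul_lt_mul_left (a := 2) ?_ (by norm_num)
  rw [← hdouble, ← hdouble]
  have hswap : ∀ w : Equiv.Perm (Fin (N + 1)), w r.succ < w r.castSucc →
      (w * s) r.castSucc < (w * s) r.succ := fun w hw => by simpa [hs] using hw
  refine Finset.sum_lt_sum (fun w _ => ?_) ⟨v, Finset.mem_univ _, ?_⟩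
  · rcases hle w with h | h
    · exact (hpair w h).1
    · have := (hpair (w * s) (hswap w h)).1
      rw [mul_assoc, hss, mul_one] at this
      linarith
  · have := (hpair (v * s) (hswap v hv)).2
    rw [mul_assoc, hss, mul_one] at this
    have := this hvf
    linarith

lemma exists_isHighestWeight_extremal (hf : IsHighestWeight Good f χ) (hf0 : f ≠ 0) :
    ∃ f χ, IsHighestWeight Good f χ ∧ f ≠ 0 ∧ ∀ r : Fin N, reflSum r f = 0 ∨
      ∀ w : Equiv.Perm (Fin (N + 1)), w r.succ < w r.castSucc → ¬ IsInSupport f w := by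
  classical
  induction hm : ∑ w, (if IsInSupport f w then permHeight w else 0) using Nat.strong_induction_on
    generalizing f χ with
  | _ m ih =>
    by_cases h : ∀ r : Fin N, reflSum r f = 0 ∨
      ∀ w : Equiv.Perm (Fin (N + 1)), w r.succ < w r.castSucc → ¬ IsInSupport f w
    · exact ⟨f, χ, hf, hf0, h⟩
    · push Not at h
      obtain ⟨r, hr, w, hw, hwf⟩ := h
      exact ih _ (hm ▸ hf.sum_permHeight_reflSum_lt hw hwf) (hf.reflSum r) hr rfl

end Support

section Extremal

variable {N : ℕ} {F : Type*} [Field F] {Good : Matrix (Fin (N + 1)) (Fin (N + 1)) F → ℕ → Prop}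
  {f : Matrix (Fin (N + 1)) (Fin (N + 1)) F → F} {χ : (Fin (N + 1) → Fˣ) → F}

lemma IsHighestWeight.char_mul (hf : IsHighestWeight Good f χ) (hf0 : f ≠ 0)
    {d e : Fin (N + 1) → Fˣ} (hd : ∏ i, d i = 1) (he : ∏ i, e i = 1) :
    χ (d * e) = χ d * χ e := by
  obtain ⟨g, hg⟩ := Function.ne_iff.mp hf0
  refine mul_right_cancel₀ hg ?_
  have h1 := hf.torus (d * e) (by simp [Finset.prod_mul_distrib, hd, he]) g
  have h2 := hf.torus e he (g * diagonal fun i => (d i : F))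
  rw [hf.torus d hd, mul_assoc, diagonal_mul_diagonal] at h2
  have h3 : (fun i => ((d i : F) * (e i : F))) = fun i => (((d * e) i : Fˣ) : F) := by
    ext i; simp
  rw [← h1, ← h3, h2]
  ring

lemma IsHighestWeight.char_one (hf : IsHighestWeight Good f χ) (hf0 : f ≠ 0) : χ 1 = 1 := by
  obtain ⟨g, hg⟩ := Function.ne_iff.mp hf0
  refine mul_right_cancel₀ hg ?_
  rw [← hf.torus 1 (by simp)]
  simp

lemma IsHighestWeight.char_prod (hf : IsHighestWeight Good f χ) (hf0 : f ≠ 0) {ι : Type*}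
    (s : Finset ι) (d : ι → Fin (N + 1) → Fˣ) (hd : ∀ r, ∏ i, d r i = 1) :
    χ (∏ r ∈ s, d r) = ∏ r ∈ s, χ (d r) := by
  classical
  induction s using Finset.induction_on with
  | empty => simpa using hf.char_one hf0
  | insert r s hr ih =>
    rw [Finset.prod_insert hr, Finset.prod_insert hr, hf.char_mul hf0 (hd r), ih]
    simp only [Finset.prod_apply]
    rw [Finset.prod_comm]
    exact Finset.prod_eq_one fun r _ => hd r

lemma IsHighestWeight.exists_char_coroot [Fintype F] (hf : IsHighestWeight Good f χ) (hf0 : f ≠ 0)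
    (r : Fin N) : ∃ b < Fintype.card F - 1, ∀ t : Fˣ, χ (coroot r t) = (t : F) ^ b := by
  classical
  let ψ : Fˣ →* F :=
    { toFun := fun t => χ (coroot r t)
      map_one' := by
        rw [← hf.char_one hf0]
        congr 1
        simp [coroot]
      map_mul' := fun t s => by
        rw [coroot_mul, hf.char_mul hf0 (prod_coroot r t) (prod_coroot r s)] }
  obtain ⟨m, hm⟩ := MonoidHom.map_cyclic ψ.toHomUnits
  have hq : 0 < Fintype.card F - 1 := Nat.sub_pos_of_lt Fintype.one_lt_card
  have hq' : (0 : ℤ) < (Fintype.card F - 1 : ℕ) := by exact_mod_cast hq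
  obtain ⟨b, hb⟩ := Int.eq_ofNat_of_zero_le (Int.emod_nonneg m hq'.ne')
  refine ⟨b, by have := Int.emod_lt_of_pos m hq'; omega, fun t => ?_⟩
  have h1 : χ (coroot r t) = ((t ^ m : Fˣ) : F) := by
    rw [← hm t]; rfl
  have h2 : t ^ ((Fintype.card F - 1 : ℕ) : ℤ) = 1 := by
    rw [zpow_natCast, ← Fintype.card_units, pow_card_eq_one]
  have h3 : t ^ m = t ^ b := by
    conv_lhs => rw [← Int.emod_add_mul_ediv m ((Fintype.card F - 1 : ℕ) : ℤ)]
    rw [_root_.zpow_add, _root_.zpow_mul, h2, _root_.one_zpow, mul_one, hb]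
    exact zpow_natCast t b
  rw [h1, h3, Units.val_pow_eq_pow_val]

lemma IsHighestWeight.exists_exponent [Fintype F] (hf : IsHighestWeight Good f χ) (hf0 : f ≠ 0)
    {r : Fin N} (hr : _root_.reflSum r f = 0 ∨
      ∀ w : Equiv.Perm (Fin (N + 1)), w r.succ < w r.castSucc → ¬ IsInSupport f w) :
    ∃ a ≤ Fintype.card F - 1, (∀ t : Fˣ, χ (coroot r t) = (t : F) ^ a) ∧
      ((a = 0 ∧ ∀ w : Equiv.Perm (Fin (N + 1)), w r.castSucc < w r.succ → ∀ d,
        f (monomialMatrix w d * reflMatrix F r) = f (monomialMatrix w d)) ∨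
      (a ≠ 0 ∧ ∀ w : Equiv.Perm (Fin (N + 1)), w r.succ < w r.castSucc → ¬ IsInSupport f w)) := by
  classical
  obtain ⟨b, hb, hχ⟩ := hf.exists_char_coroot hf0 r
  have hsum := FiniteField.sum_pow_units F b
  have hdvd : Fintype.card F - 1 ∣ b ↔ b = 0 :=
    ⟨fun h => Nat.eq_zero_of_dvd_of_lt h hb, fun h => h ▸ dvd_zero _⟩
  by_cases hr0 : _root_.reflSum r f = 0
  · have hasc : ∀ w : Equiv.Perm (Fin (N + 1)), w r.castSucc < w r.succ → ∀ d,
        f (monomialMatrix w d * reflMatrix F r) +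
          (if b = 0 then -1 else 0) * f (monomialMatrix w d) = 0 := by
      intro w hw d
      have := hf.reflSum_ascent hw d
      rw [hr0, Pi.zero_apply] at this
      simp only [hχ, hsum, hdvd] at this
      exact this.symm
    by_cases hb0 : b = 0
    · refine ⟨b, hb.le, hχ, Or.inl ⟨hb0, fun w hw d => ?_⟩⟩
      have := hasc w hw d
      rw [if_pos hb0] at this
      linear_combination this
    · refine ⟨b, hb.le, hχ, Or.inr ⟨hb0, ?_⟩⟩
      rintro w hw ⟨d, hd⟩
      obtain ⟨e, he⟩ := exists_eq_monomialMatrix_mul_reflMatrix w d r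
      have := hasc (w * Equiv.swap r.castSucc r.succ) (by simpa using hw) e
      rw [if_neg hb0, zero_mul, add_zero] at this
      exact hd (he ▸ this)
  · have hr1 := hr.resolve_left hr0
    by_cases hb0 : b = 0
    · refine ⟨Fintype.card F - 1, le_rfl, fun t => ?_, Or.inr ⟨by omega, hr1⟩⟩
      rw [hχ, hb0, pow_zero, FiniteField.pow_card_sub_one_eq_one _ t.ne_zero]
    · exact ⟨b, hb.le, hχ, Or.inr ⟨hb0, hr1⟩⟩

lemma cornerMinor_monomialMatrix_of_descent {w : Equiv.Perm (Fin (N + 1))} {r : Fin N}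
    (hw : w r.succ < w r.castSucc) (d : Fin (N + 1) → Fˣ) :
    cornerMinor r.castSucc (monomialMatrix w d) = 0 := by
  classical
  by_cases h : w r.castSucc ≤ r.castSucc
  · refine det_eq_zero_of_row_eq_zero (w r.succ) fun j => ?_
    have h1 : w r.succ ≤ r.castSucc := hw.le.trans h
    by_cases hj : j ≤ r.castSucc
    · rw [corner, of_apply, if_pos ⟨h1, hj⟩, monomialMatrix, of_apply, if_neg]
      intro h2
      have := w.injective h2
      rw [← this] at hj
      exact absurd hj (not_le.mpr Fin.castSucc_lt_succ)
    · rw [corner, of_apply, if_neg (fun h2 => hj h2.2), if_neg]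
      rintro rfl
      exact hj h1
  · refine det_eq_zero_of_column_eq_zero r.castSucc fun i => ?_
    by_cases hi : i ≤ r.castSucc
    · rw [corner, of_apply, if_pos ⟨hi, le_rfl⟩, monomialMatrix, of_apply, if_neg]
      rintro rfl
      exact h hi
    · rw [corner, of_apply, if_neg (fun h2 => hi h2.1), if_neg]
      rintro rfl
      exact hi le_rfl

lemma cornerMinor_mul_reflMatrix {r s : Fin N} (h : s ≠ r)
    (g : Matrix (Fin (N + 1)) (Fin (N + 1)) F) :
    cornerMinor s.castSucc (g * reflMatrix F r) = cornerMinor s.castSucc g := by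
  have hab : r.castSucc ≠ r.succ := (Fin.castSucc_lt_succ).ne
  have h1 : r.succ ≤ s.castSucc → r.castSucc ≤ s.castSucc := fun h => Fin.castSucc_lt_succ.le.trans
    h
  have h2 : r.castSucc ≤ s.castSucc → r.succ ≤ s.castSucc := by
    intro h3
    have : (r : ℕ) ≠ s := fun h4 => h (Fin.ext h4.symm)
    simp only [Fin.le_def, Fin.val_castSucc, Fin.val_succ] at h3 ⊢
    omega
  rw [reflMatrix_eq_transvection, ← mul_assoc, ← mul_assoc, cornerMinor_mul_transvection hab h1,
    cornerMinor_mul_transvection hab.symm h2, cornerMinor_mul_transvection hab h1]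

lemma minorProd_mul_reflMatrix {a : Fin N → ℕ} {r : Fin N} (h : a r = 0)
    (g : Matrix (Fin (N + 1)) (Fin (N + 1)) F) :
    minorProd a (g * reflMatrix F r) = minorProd a g := by
  refine Finset.prod_congr rfl fun s _ => ?_
  by_cases hs : s = r
  · rw [hs, h, pow_zero, pow_zero]
  · rw [cornerMinor_mul_reflMatrix hs]

lemma eq_prod_coroot {d : Fin (N + 1) → Fˣ} (hd : ∏ i, d i = 1) :
    d = ∏ r : Fin N, coroot r (∏ i ∈ Finset.Iic r.castSucc, d i) := by
  classical
  set C : Fin (N + 1) → Fˣ := fun k => ∏ i ∈ Finset.Iic k, d i with hC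
  have hlast : C (Fin.last N) = 1 := by
    rw [← hd, hC]
    exact Finset.prod_congr (by ext i; simp [Fin.le_last]) fun _ _ => rfl
  set D : Fin (N + 1) → Fˣ := Fin.cases 1 fun r => (C r.castSucc)⁻¹ with hD
  have hCD : ∀ k, d k = C k * D k := by
    refine Fin.cases ?_ fun r => ?_
    · have : Finset.Iic (0 : Fin (N + 1)) = {0} := by ext i; simp
      simp [hC, hD, this]
    · have : Finset.Iic r.succ = insert r.succ (Finset.Iic r.castSucc) := by
        ext i
        simp only [Finset.mem_Iic, Finset.mem_insert, Fin.le_def, Fin.ext_iff, Fin.val_succ,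
          Fin.val_castSucc]
        omega
      have h2 : r.succ ∉ Finset.Iic r.castSucc := by simp
      simp [hC, hD, this, Finset.prod_insert h2]
  ext k
  congr 1
  have h1 : ∏ r : Fin N, (if k = r.castSucc then C r.castSucc else 1) = C k := by
    have := Fin.prod_univ_castSucc fun i => if k = i then C i else 1
    rw [Finset.prod_ite_eq, if_pos (Finset.mem_univ _), hlast, ite_self, mul_one] at this
    exact this.symm
  have h2 : ∏ r : Fin N, (if k = r.succ then (C r.castSucc)⁻¹ else 1) = D k := by
    have := Fin.prod_univ_succ fun i => if k = i then D i else 1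
    rw [Finset.prod_ite_eq, if_pos (Finset.mem_univ _)] at this
    rw [this]
    have h3 : D 0 = 1 := rfl
    rw [h3, ite_self, one_mul]
    rfl
  rw [hCD k, ← h1, ← h2, ← Finset.prod_mul_distrib, Finset.prod_apply]
  refine Finset.prod_congr rfl fun r _ => ?_
  simp [coroot, Pi.mulSingle_apply, hC]

lemma minorProd_diagonal_units (a : Fin N → ℕ) (d : Fin (N + 1) → Fˣ) :
    minorProd a (diagonal fun i => (d i : F)) =
      ∏ r : Fin N, ((∏ i ∈ Finset.Iic r.castSucc, d i : Fˣ) : F) ^ a r := by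
  simp [minorProd, cornerMinor_diagonal]

theorem exists_minorProd [Fintype F] (p : ℕ) [Fact p.Prime] [CharP F p]
    (hGood : ∀ x k, Good x k → x.det = 1) (hf : f ∈ normFun Good) (hf0 : f ≠ 0) :
    ∃ a : Fin N → ℕ, (∀ r, a r ≤ Fintype.card F - 1) ∧
      (∀ x k, Good x k → ∀ g h, g.det = 1 → h.det = 1 →
        ∑ j ∈ Finset.range k, minorProd a (g * x ^ j * h) = 0) ∧
      ∀ c : F, c ^ (N + 1) = 1 →
        minorProd a (c • (1 : Matrix (Fin (N + 1)) (Fin (N + 1)) F)) = 1 := by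
  classical
  obtain ⟨f, χ, hf, hf0⟩ := exists_isHighestWeight p hf hf0
  obtain ⟨f, χ, hf, hf0, hext⟩ := exists_isHighestWeight_extremal hf hf0
  choose a ha hχ hcase using fun r => hf.exists_exponent hf0 (hext r)
  have hmon : ∀ m : ℕ, ∀ (w : Equiv.Perm (Fin (N + 1))) d, permHeight w = m →
      (monomialMatrix w d).det = 1 →
      f (monomialMatrix w d) = f 1 * minorProd a (monomialMatrix w d) := by
    intro m
    induction m using Nat.strong_induction_on with
    | _ m ih =>
    intro w d hm hdet
    by_cases hw : ∃ r : Fin N, w r.succ < w r.castSucc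
    · obtain ⟨r, hr⟩ := hw
      rcases hcase r with ⟨har, h⟩ | ⟨har, h⟩
      · obtain ⟨e, he⟩ := exists_eq_monomialMatrix_mul_reflMatrix w d r
        have hlt := permHeight_lt_of_descent hr
        rw [he, h _ (by simpa using hr), minorProd_mul_reflMatrix har]
        refine ih _ (hm ▸ hlt) _ _ rfl ?_
        rw [he, det_mul, det_reflMatrix, mul_one] at hdet
        exact hdet
      · rw [not_not.mp fun h1 => h w hr ⟨d, h1⟩, minorProd, Finset.prod_eq_zero (Finset.mem_univ r),
          mul_zero]
        rw [cornerMinor_monomialMatrix_of_descent hr, zero_pow har]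
    · push Not at hw
      have hmono : StrictMono w := Fin.strictMono_iff_lt_succ.mpr fun r =>
        lt_of_le_of_ne (hw r) fun h => (Fin.castSucc_lt_succ).ne (w.injective h)
      have hw1 : w = 1 := by
        ext i
        have := (StrictMono.range_inj hmono strictMono_id).mp (by
          rw [w.surjective.range_eq, Set.range_id])
        rw [this]; rfl
      subst hw1
      rw [monomialMatrix_one_eq_diagonal] at hdet ⊢
      have hd : ∏ i, d i = 1 := by
        rw [det_diagonal] at hdet
        exact Units.ext (by simpa using hdet)
      have h1 := hf.torus d hd 1
      rw [one_mul] at h1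
      rw [h1, minorProd_diagonal_units, mul_comm]
      congr 1
      conv_lhs => rw [eq_prod_coroot hd]
      rw [hf.char_prod hf0 _ _ fun r => prod_coroot _ _]
      exact Finset.prod_congr rfl fun r _ => hχ r _
  have hall : ∀ g, g.det = 1 → f g = f 1 * minorProd a g := by
    intro g hg
    refine bruhat_induction (P := fun g => g.det = 1 → f g = f 1 * minorProd a g) ?_ ?_ ?_
      (by rw [hg]; exact one_ne_zero) hg
    · intro l g hl h hg
      rw [← hf.left l g hl, ← minorProd_lower_mul a hl]
      exact h (by rw [det_mul, hl.det_eq_one, one_mul, hg])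
    · intro u g hu h hg
      rw [← hf.right u g hu, ← minorProd_mul_upper a hu]
      exact h (by rw [det_mul, ← det_transpose u, hu.det_eq_one, mul_one, hg])
    · exact fun w d h => hmon _ w d rfl h
  have hf1 : f 1 ≠ 0 := by
    intro h
    refine hf0 (funext fun g => ?_)
    by_cases hg : g.det = 1
    · rw [hall g hg, h, zero_mul]; rfl
    · exact hf.mem.1 g hg
  refine ⟨a, ha, fun x k hx g h hg hh => ?_, fun c hc => ?_⟩
  · have := hf.mem.2.2 x k hx g h hg hh
    refine mul_left_cancel₀ hf1 ?_
    rw [mul_zero, ← this, Finset.mul_sum]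
    refine Finset.sum_congr rfl fun j _ => (hall _ ?_).symm
    rw [det_mul, det_mul, det_pow, hGood x k hx, hg, hh, one_pow, one_mul, one_mul]
  · have h1 := hf.mem.2.1 c 1 hc
    rw [hall _ (by simp [hc])] at h1
    exact mul_left_cancel₀ hf1 (h1.trans (mul_one _).symm)

end Extremal

section ActionFunction

variable {N : ℕ} {F : Type*} [Field F] [Fintype F]

lemma exists_addMonoidHom_ne_zero (p : ℕ) [Fact p.Prime] (F : Type*) [Field F] [CharP F p]
    {V : Type*} [AddCommGroup V] (hpV : ∀ v : V, p • v = 0) {v : V} (hv : v ≠ 0) :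
    ∃ ψ : V →+ F, ψ v ≠ 0 := by
  have : Module (ZMod p) V := AddCommGroup.zmodModule hpV
  by_contra! h
  refine hv ((Module.forall_dual_apply_eq_zero_iff (ZMod p) v).mp fun φ => ?_)
  have := h ((ZMod.castHom dvd_rfl F : ZMod p →+* F).toAddMonoidHom.comp (LinearMap.toAddMonoidHom
    φ))
  exact (map_eq_zero_iff _ (ZMod.castHom dvd_rfl F).injective).mp this

theorem exists_minorProd_of_action (p : ℕ) [Fact p.Prime] [CharP F p]
    {V : Type*} [AddCommGroup V] [Nontrivial V]
    (ρ : SpecialLinearGroup (Fin (N + 1)) F →* AddMonoid.End V) (hpV : ∀ v : V, p • v = 0)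
    (hker : ∀ z ∈ (toPSL (N + 1) F).ker, ρ z = 1)
    (hnorm : ∀ x, p * orderOf (toPSL (N + 1) F x) ∉
        groupSpectrum (ProjectiveSpecialLinearGroup (Fin (N + 1)) F) →
      ∀ v, ∑ j ∈ Finset.range (orderOf (toPSL (N + 1) F x)), ρ (x ^ j) v = 0) :
    ∃ a : Fin N → ℕ, (∀ r, a r ≤ Fintype.card F - 1) ∧
      (∀ x, p * orderOf (toPSL (N + 1) F x) ∉
          groupSpectrum (ProjectiveSpecialLinearGroup (Fin (N + 1)) F) →
        ∀ g h : Matrix (Fin (N + 1)) (Fin (N + 1)) F, g.det = 1 → h.det = 1 →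
        ∑ j ∈ Finset.range (orderOf (toPSL (N + 1) F x)), minorProd a (g * x.1 ^ j * h) = 0) ∧
      ∀ c : F, c ^ (N + 1) = 1 →
        minorProd a (c • (1 : Matrix (Fin (N + 1)) (Fin (N + 1)) F)) = 1 := by
  classical
  obtain ⟨v, hv⟩ := exists_ne (0 : V)
  obtain ⟨ψ, hψ⟩ := exists_addMonoidHom_ne_zero p F hpV hv
  let f : Matrix (Fin (N + 1)) (Fin (N + 1)) F → F := fun g =>
    if h : g.det = 1 then ψ (ρ ⟨g, h⟩ v) else 0
  have hf1 : ∀ g (h : g.det = 1), f g = ψ (ρ ⟨g, h⟩ v) := fun g h => dif_pos h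
  let Good : Matrix (Fin (N + 1)) (Fin (N + 1)) F → ℕ → Prop := fun x k =>
    ∃ y : SpecialLinearGroup (Fin (N + 1)) F, y.1 = x ∧ k = orderOf (toPSL (N + 1) F y) ∧
      p * orderOf (toPSL (N + 1) F y) ∉
        groupSpectrum (ProjectiveSpecialLinearGroup (Fin (N + 1)) F)
  have hf : f ∈ normFun Good := by
    refine ⟨fun g hg => dif_neg hg, fun c g hc => ?_, ?_⟩
    · have hdet : (c • g).det = g.det := by
        rw [det_smul, Fintype.card_fin, hc, one_mul]
      by_cases hg : g.det = 1
      · rw [hf1 g hg, hf1 (c • g) (hdet.trans hg)]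
        have hz : (c • (1 : Matrix (Fin (N + 1)) (Fin (N + 1)) F)).det = 1 := by
          rw [det_smul, Fintype.card_fin, hc, det_one, one_mul]
        obtain ⟨z, hz'⟩ : ∃ z : SpecialLinearGroup (Fin (N + 1)) F, z.1 = c • 1 := ⟨⟨_, hz⟩, rfl⟩
        have hzk : z ∈ (toPSL (N + 1) F).ker := by
          rw [MonoidHom.mem_ker, ← pow_one (toPSL _ _ _), toPSL_pow_eq_one_iff]
          exact ⟨c, by rw [pow_one]; exact hz'.trans (smul_one_eq_diagonal c)⟩
        have hmul : (⟨c • g, hdet.trans hg⟩ : SpecialLinearGroup (Fin (N + 1)) F) =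
            z * ⟨g, hg⟩ := by
          refine Subtype.ext ?_
          change c • g = z.1 * g
          rw [hz', smul_mul_assoc, one_mul]
        rw [hmul]
        have h1 := map_mul ρ z ⟨g, hg⟩
        rw [hker z hzk, one_mul] at h1
        exact congrArg (fun φ : AddMonoid.End V => ψ (φ v)) h1
      · have hg' : (c • g).det ≠ 1 := by rwa [hdet]
        simp only [f, dif_neg hg, dif_neg hg']
    · have hρ3 : ∀ A B C : SpecialLinearGroup (Fin (N + 1)) F,
          ρ (A * B * C) v = ρ A (ρ B (ρ C v)) := fun A B C => by
        rw [map_mul, map_mul]; rfl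
      rintro _ _ ⟨y, rfl, rfl, hy⟩ g h hg hh
      have h1 : ∀ j, f (g * y.1 ^ j * h) = ψ (ρ ⟨g, hg⟩ (ρ (y ^ j) (ρ ⟨h, hh⟩ v))) := by
        intro j
        have hm : g * y.1 ^ j * h =
            ((⟨g, hg⟩ * y ^ j * ⟨h, hh⟩ : SpecialLinearGroup (Fin (N + 1)) F)).1 := by
          change _ = g * (y ^ j).1 * h
          rw [show (y ^ j).1 = y.1 ^ j from Matrix.SpecialLinearGroup.coe_pow y j]
        rw [hm, hf1 _ (⟨g, hg⟩ * y ^ j * ⟨h, hh⟩ : SpecialLinearGroup (Fin (N + 1)) F).2]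
        change ψ (ρ (⟨g, hg⟩ * y ^ j * ⟨h, hh⟩) v) = _
        exact congrArg ψ (hρ3 ⟨g, hg⟩ (y ^ j) ⟨h, hh⟩)
      rw [Finset.sum_congr rfl fun j _ => h1 j, ← map_sum, ← map_sum, hnorm y hy, map_zero,
        map_zero]
  have hf0 : f ≠ 0 := by
    intro h
    have := congrFun h 1
    rw [hf1 1 det_one] at this
    refine hψ (Eq.trans ?_ this)
    change _ = ψ (ρ 1 v)
    rw [map_one]
    rfl
  obtain ⟨a, ha, hsum, hc⟩ := exists_minorProd p (by rintro _ _ ⟨y, rfl, -⟩; exact y.2) hf hf0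
  exact ⟨a, ha, fun x hx g h hg hh => hsum _ _ ⟨x, rfl, rfl, hx⟩ g h hg hh, hc⟩

end ActionFunction

end

section

open Matrix Polynomial

section GenericLower

variable {n : ℕ} {K : Type u} [Field K]

/-- The strictly lower triangular positions. -/
abbrev LowerIdx (n : ℕ) := {s : Fin n × Fin n // s.2 < s.1}

variable (n K) in
/-- The generic lower unitriangular matrix. -/
noncomputable def genericLower : Matrix (Fin n) (Fin n) (MvPolynomial (LowerIdx n) K) :=
  of fun i j => if h : j < i then MvPolynomial.X ⟨(i, j), h⟩ else if i = j then 1 else 0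

lemma isLowerUni_genericLower : IsLowerUni (genericLower n K) := by
  refine ⟨fun i => by simp [genericLower], fun i j h => ?_⟩
  rw [genericLower, of_apply, dif_neg h.le.not_gt, if_neg h.ne]

section Eval

variable {B : Type*} [CommRing B] [Algebra K B]

variable (K) in
/-- Evaluation of a polynomial at the entries below the diagonal. -/
noncomputable def lowerEval (M : Matrix (Fin n) (Fin n) B) :
    MvPolynomial (LowerIdx n) K →ₐ[K] B :=
  MvPolynomial.aeval fun s => M s.1.1 s.1.2

lemma genericLower_map {M : Matrix (Fin n) (Fin n) B} (hM : IsLowerUni M) :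
    (genericLower n K).map (lowerEval K M) = M := by
  ext i j
  rw [map_apply, genericLower, of_apply]
  rcases lt_trichotomy i j with h | rfl | h
  · rw [dif_neg h.le.not_gt, if_neg h.ne, map_zero, hM.2 i j h]
  · rw [dif_neg (lt_irrefl i), if_pos rfl, map_one, hM.1]
  · rw [dif_pos h, lowerEval, MvPolynomial.aeval_X]

lemma lowerEval_map {C : Type*} [CommRing C] [Algebra K C] (φ : B →ₐ[K] C)
    (M : Matrix (Fin n) (Fin n) B) (f : MvPolynomial (LowerIdx n) K) :
    lowerEval K (M.map φ) f = φ (lowerEval K M f) := by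
  have : lowerEval K (M.map φ) = φ.comp (lowerEval K M) := by
    refine MvPolynomial.algHom_ext fun s => ?_
    simp [lowerEval]
  rw [this]; rfl

lemma lowerEval_genericLower (f : MvPolynomial (LowerIdx n) K) :
    lowerEval K (genericLower n K) f = f := by
  have : lowerEval K (genericLower n K) = AlgHom.id K _ := by
    refine MvPolynomial.algHom_ext fun s => ?_
    simp [lowerEval, genericLower, s.2]
  rw [this]; rfl

/-- Rescaling of the root subgroups according to their heights. -/
noncomputable def gradeScale (M : Matrix (Fin n) (Fin n) B) : Matrix (Fin n) (Fin n) B[X] :=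
  of fun i j => C (M i j) * X ^ ((i : ℕ) - j)

lemma IsLowerUni.gradeScale {M : Matrix (Fin n) (Fin n) B} (hM : IsLowerUni M) :
    IsLowerUni (gradeScale M) :=
  ⟨fun i => by simp [_root_.gradeScale, hM.1], fun i j h => by simp [_root_.gradeScale, hM.2 i j h]⟩

lemma gradeScale_mul {M M' : Matrix (Fin n) (Fin n) B} (hM : IsLowerUni M) (hM' : IsLowerUni M') :
    gradeScale (M * M') = gradeScale M * gradeScale M' := by
  ext1 i j
  simp only [gradeScale, mul_apply, of_apply, map_sum, Finset.sum_mul]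
  refine Finset.sum_congr rfl fun k _ => ?_
  by_cases h1 : i < k
  · simp [hM.2 i k h1]
  by_cases h2 : k < j
  · simp [hM'.2 k j h2]
  have : (i : ℕ) - j = (i - k) + (k - j) := by
    rw [Fin.lt_def] at h1 h2
    omega
  rw [this, pow_add, C_mul]
  ring

lemma gradeScale_transvection (i j : Fin n) (c : B) :
    gradeScale (transvection i j c) = transvection i j (C c * X ^ ((i : ℕ) - j)) := by
  ext1 k l
  simp only [gradeScale, transvection, of_apply, Matrix.add_apply, one_apply, single_apply, C_add,
    add_mul]
  congr 1
  · split_ifs with h1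
    · subst h1; simp
    · simp
  · split_ifs with h1
    · rw [h1.1, h1.2]
    · simp

lemma gradeScale_map {C : Type*} [CommRing C] [Algebra K C] (φ : B →ₐ[K] C)
    (M : Matrix (Fin n) (Fin n) B) :
    gradeScale (M.map φ) = (gradeScale M).map (Polynomial.mapAlgHom φ) := by
  ext1 i j
  simp [gradeScale]

end Eval

/-- The universal rescaled value of `f`. -/
noncomputable def gradePoly (f : MvPolynomial (LowerIdx n) K) :
    (MvPolynomial (LowerIdx n) K)[X] :=
  lowerEval K (gradeScale (genericLower n K)) f

lemma lowerEval_gradeScale {B : Type*} [CommRing B] [Algebra K B] {M : Matrix (Fin n) (Fin n) B}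
    (hM : IsLowerUni M) (f : MvPolynomial (LowerIdx n) K) :
    lowerEval K (gradeScale M) f = (gradePoly f).map (lowerEval K M : _ →+* B) := by
  conv_lhs => rw [← genericLower_map (K := K) hM, gradeScale_map, lowerEval_map]
  rfl

lemma gradePoly_ne_zero {f : MvPolynomial (LowerIdx n) K} (hf : f ≠ 0) : gradePoly f ≠ 0 := by
  intro h
  let φ := (Polynomial.aeval (R := MvPolynomial (LowerIdx n) K)
    (1 : MvPolynomial (LowerIdx n) K)).restrictScalars K
  have h1 := lowerEval_map φ (gradeScale (genericLower n K)) f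
  have h2 : (gradeScale (genericLower n K)).map φ = genericLower n K := by
    ext1 i j
    simp [φ, gradeScale]
  rw [h2, lowerEval_genericLower] at h1
  rw [h1] at hf
  exact hf ((congrArg φ h).trans (map_zero φ))

end GenericLower

section LowerUniInverse

variable {n : ℕ} {B : Type*} [CommRing B] {M : Matrix (Fin n) (Fin n) B}

lemma IsLowerUni.mul_inv (hM : IsLowerUni M) : M * M⁻¹ = 1 :=
  mul_nonsing_inv M (by rw [hM.det_eq_one]; exact isUnit_one)

lemma IsLowerUni.inv_mul (hM : IsLowerUni M) : M⁻¹ * M = 1 :=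
  nonsing_inv_mul M (by rw [hM.det_eq_one]; exact isUnit_one)

lemma IsLowerUni.inv (hM : IsLowerUni M) : IsLowerUni M⁻¹ := by
  have : Invertible M := invertibleOfIsUnitDet M (by rw [hM.det_eq_one]; exact isUnit_one)
  have h1 : BlockTriangular M OrderDual.toDual := fun i j h => hM.2 i j h
  have h2 := blockTriangular_inv_of_blockTriangular h1
  refine ⟨fun i => ?_, fun i j h => h2 h⟩
  have h3 := congrFun (congrFun hM.mul_inv i) i
  rw [mul_apply, one_apply_eq, Finset.sum_eq_single i, hM.1, one_mul] at h3
  · exact h3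
  · intro k _ hk
    rcases lt_or_gt_of_ne hk with h | h
    · rw [h2 h, mul_zero]
    · rw [hM.2 i k h, zero_mul]
  · simp

lemma transvection_eq_commutator {i j k : Fin n} (hij : i ≠ j) (hik : i ≠ k) (hkj : k ≠ j) (t : B) :
    transvection i j t = transvection i k t * transvection k j 1 * transvection i k (-t) *
      transvection k j (-1) := by
  have h1 : single i k (-t) = -single i k t := (single_neg i k t).symm
  have h2 : single k j (-1 : B) = -single k j 1 := (single_neg k j 1).symm
  simp only [transvection, h1, h2, mul_add, add_mul, mul_one, one_mul, mul_neg, neg_mul,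
    single_mul_single_same, single_mul_single_of_ne _ _ _ _ hij.symm,
    single_mul_single_of_ne _ _ _ _ hik.symm, single_mul_single_of_ne _ _ _ _ hkj.symm, zero_mul]
  abel

end LowerUniInverse

section Invariance

variable {n : ℕ} {K : Type u} [Field K] {g : MvPolynomial (LowerIdx n) K}

lemma dvd_lowerEval_mul_transvection {q : ℕ}
    (hg : ∀ (B : Type u) [CommRing B] [Algebra K B] (M : Matrix (Fin n) (Fin n) B) (i j : Fin n)
      (y : B), IsLowerUni M → j < i →
      y ^ q ∣ lowerEval K (transvection i j y * M) g - lowerEval K M g)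
    {B : Type u} [CommRing B] [Algebra K B] {M : Matrix (Fin n) (Fin n) B} (hM : IsLowerUni M)
    {i j : Fin n} (hij : j < i) (t : B) :
    t ^ q ∣ lowerEval K (M * transvection i j t) g - lowerEval K M g := by
  classical
  have key : ∀ (s : Finset (Fin n × Fin n)) (c : Fin n × Fin n → B), (∀ a ∈ s, i ≤ a.1 ∧ a.2 ≤ j) →
      (∀ a, t ∣ c a) → IsLowerUni ((1 + ∑ a ∈ s, single a.1 a.2 (c a)) * M) ∧
      t ^ q ∣ lowerEval K ((1 + ∑ a ∈ s, single a.1 a.2 (c a)) * M) g - lowerEval K M g := by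
    intro s c hs hc
    induction s using Finset.induction_on with
    | empty => simpa using hM
    | insert a s ha ih =>
      obtain ⟨h1, h2⟩ := ih fun b hb => hs b (Finset.mem_insert_of_mem hb)
      obtain ⟨h3, h4⟩ := hs a (Finset.mem_insert_self a s)
      have h5 : (1 + ∑ b ∈ insert a s, single b.1 b.2 (c b)) * M =
          transvection a.1 a.2 (c a) * ((1 + ∑ b ∈ s, single b.1 b.2 (c b)) * M) := by
        rw [← mul_assoc]
        congr 1
        have h6 : single a.1 a.2 (c a) * ∑ b ∈ s, single b.1 b.2 (c b) = 0 := by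
          rw [Finset.mul_sum]
          refine Finset.sum_eq_zero fun b hb => single_mul_single_of_ne _ _ _ _ ?_ _
          exact ((h4.trans_lt hij).trans_le (hs b (Finset.mem_insert_of_mem hb)).1).ne
        rw [Finset.sum_insert ha, transvection, add_mul, one_mul, mul_add, mul_one, h6]
        abel
      rw [h5]
      have h6 : a.2 < a.1 := (h4.trans_lt hij).trans_le h3
      refine ⟨(IsLowerUni.transvection h6 _).mul h1, ?_⟩
      have h7 := (pow_dvd_pow_of_dvd (hc a) q).trans (hg B _ a.1 a.2 (c a) h1 h6)
      simpa using dvd_add h7 h2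
  have h1 : M * transvection i j t = (1 + ∑ a ∈ (Finset.Ici i ×ˢ Finset.Iic j),
      single a.1 a.2 (t * (M a.1 i * M⁻¹ j a.2))) * M := by
    have h2 : ∑ a ∈ (Finset.Ici i ×ˢ Finset.Iic j), single a.1 a.2 (t * (M a.1 i * M⁻¹ j a.2)) =
        M * single i j t * M⁻¹ := by
      ext k l
      rw [Matrix.sum_apply, mul_apply, Finset.sum_eq_single j]
      · rw [mul_single_apply_same]
        by_cases hkl : (k, l) ∈ Finset.Ici i ×ˢ Finset.Iic j
        · rw [Finset.sum_eq_single_of_mem (k, l) hkl, single_apply_same]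
          · ring
          · rintro ⟨k', l'⟩ - hne
            refine single_apply_of_ne _ _ _ _ _ ?_
            rintro ⟨rfl, rfl⟩
            exact hne rfl
        · rw [Finset.sum_eq_zero]
          · rw [Finset.mem_product, Finset.mem_Ici, Finset.mem_Iic, not_and_or, not_le,
          not_le] at hkl
            rcases hkl with h | h
            · rw [hM.2 k i h]; ring
            · rw [hM.inv.2 j l h]; ring
          · rintro ⟨k', l'⟩ hmem
            refine single_apply_of_ne _ _ _ _ _ ?_
            rintro ⟨rfl, rfl⟩
            exact hkl hmem
      · intro b _ hb
        rw [mul_single_apply_of_ne _ _ _ _ _ hb, zero_mul]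
      · simp
    rw [h2, add_mul, one_mul, mul_assoc (M * _), hM.inv_mul, mul_one, transvection, mul_add,
      mul_one]
  rw [h1]
  exact (key _ (fun a => t * (M a.1 i * M⁻¹ j a.2))
    (fun a ha => by simpa using ha) fun a => dvd_mul_right _ _).2

lemma lowerEval_eq_lowerEval_one {B : Type u} [CommRing B] [Algebra K B]
    (hg : ∀ (M : Matrix (Fin n) (Fin n) B) (i j : Fin n) (t : B), IsLowerUni M → (i : ℕ) = j + 1 →
      lowerEval K (M * transvection i j t) g = lowerEval K M g)
    {M : Matrix (Fin n) (Fin n) B} (hM : IsLowerUni M) : lowerEval K M g = lowerEval K 1 g := by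
  have hall : ∀ m : ℕ, ∀ (i j : Fin n), (i : ℕ) = j + 1 + m → ∀ (M : Matrix (Fin n) (Fin n) B)
      (t : B), IsLowerUni M → lowerEval K (M * transvection i j t) g = lowerEval K M g := by
    intro m
    induction m with
    | zero => exact fun i j h M t hM => hg M i j t hM h
    | succ m ih =>
      intro i j h M t hM
      let k : Fin n := ⟨j + 1 + m, by omega⟩
      have hk : (k : ℕ) = j + 1 + m := rfl
      have hik : k < i := by rw [Fin.lt_def]; omega
      have hkj : j < k := by rw [Fin.lt_def]; omega
      have h1 : ∀ M (t : B), IsLowerUni M →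
          lowerEval K (M * transvection i k t) g = lowerEval K M g :=
        fun M t hM => hg M i k t hM (by omega)
      rw [transvection_eq_commutator (hkj.trans hik).ne' hik.ne' hkj.ne' t, ← mul_assoc,
        ← mul_assoc,
        ← mul_assoc]
      have h2 := hM.mul (IsLowerUni.transvection hik t)
      have h3 := h2.mul (IsLowerUni.transvection hkj (1 : B))
      have h4 := h3.mul (IsLowerUni.transvection hik (-t))
      rw [ih k j hk _ _ h4, h1 _ _ h3, ih k j hk _ _ h2, h1 _ _ hM]
  have hclear : ∀ m : ℕ, ∀ M : Matrix (Fin n) (Fin n) B, IsLowerUni M →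
      (∀ i j : Fin n, j < i → (j : ℕ) * n + i + m < n * n → M i j = 0) →
      lowerEval K M g = lowerEval K 1 g := by
    intro m
    induction m with
    | zero =>
      intro M hM h
      congr 1
      congr 1
      ext i j
      rcases lt_trichotomy i j with h1 | rfl | h1
      · rw [hM.2 i j h1, one_apply_ne h1.ne]
      · rw [hM.1, one_apply_eq]
      · rw [h i j h1, one_apply_ne h1.ne']
        have := Nat.mul_le_mul_right n (Nat.succ_le_of_lt j.2)
        rw [Nat.succ_mul] at this
        omega
    | succ m ih =>
      intro M hM h
      by_cases hex : ∃ i j : Fin n, j < i ∧ (j : ℕ) * n + i + m + 1 = n * n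
      · obtain ⟨i, j, hij, hm⟩ := hex
        have h1 := hall (i - j - 1) i j (by rw [Fin.lt_def] at hij; omega) M (-M i j) hM
        rw [← h1]
        refine ih _ (hM.mul (IsLowerUni.transvection hij _)) fun k l hlk hkl => ?_
        by_cases hlj : l = j
        · subst hlj
          rw [mul_transvection_apply_same]
          rcases lt_trichotomy k i with h2 | rfl | h2
          · rw [hM.2 k i h2, h k l hlk (by rw [Fin.lt_def] at h2; omega)]
            ring
          · rw [hM.1]; ring
          · rw [Fin.lt_def] at h2
            omega
        · rw [mul_transvection_apply_of_ne _ _ _ _ hlj]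
          refine h k l hlk ?_
          by_contra hlt
          have h2 : (l : ℕ) * n + k = j * n + i := by omega
          have h3 : ((l : ℕ) * n + k) / n = (j * n + i) / n := by rw [h2]
          have hn : 0 < n := i.pos
          rw [mul_comm, Nat.mul_add_div hn, Nat.div_eq_of_lt k.2, mul_comm, Nat.mul_add_div hn,
            Nat.div_eq_of_lt i.2] at h3
          exact hlj (Fin.ext (by omega))
      · refine ih M hM fun k l hlk hkl => h k l hlk ?_
        by_contra hlt
        exact hex ⟨k, l, hlk, by omega⟩
  exact hclear (n * n) M hM fun i j _ h => by omega

end Invariance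

section Restricted

variable {n : ℕ} {K : Type u} [Field K]

/-- Along the simple root subgroups acting from the right, `f` has degree less than `q`. -/
def IsRestricted (q : ℕ) (f : MvPolynomial (LowerIdx n) K) : Prop :=
  ∀ i j : Fin n, (i : ℕ) = j + 1 → ∃ e : ℕ → MvPolynomial (LowerIdx n) K,
    ∀ (B : Type u) [CommRing B] [Algebra K B] (M : Matrix (Fin n) (Fin n) B) (t : B),
      IsLowerUni M → lowerEval K (M * transvection i j t) f =
        ∑ k ∈ Finset.range q, t ^ k * lowerEval K M (e k)

lemma IsRestricted.add {q : ℕ} {f g : MvPolynomial (LowerIdx n) K} (hf : IsRestricted q f)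
    (hg : IsRestricted q g) : IsRestricted q (f + g) := by
  intro i j hij
  obtain ⟨e, he⟩ := hf i j hij
  obtain ⟨e', he'⟩ := hg i j hij
  refine ⟨fun k => e k + e' k, fun B _ _ M t hM => ?_⟩
  rw [map_add, he B M t hM, he' B M t hM, ← Finset.sum_add_distrib]
  simp [mul_add]

lemma IsRestricted.neg {q : ℕ} {f : MvPolynomial (LowerIdx n) K} (hf : IsRestricted q f) :
    IsRestricted q (-f) := by
  intro i j hij
  obtain ⟨e, he⟩ := hf i j hij
  refine ⟨fun k => -e k, fun B _ _ M t hM => ?_⟩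
  rw [map_neg, he B M t hM, ← Finset.sum_neg_distrib]
  simp

lemma IsRestricted.zero {q : ℕ} : IsRestricted q (0 : MvPolynomial (LowerIdx n) K) :=
  fun _ _ _ => ⟨fun _ => 0, fun B _ _ M t _ => by simp⟩

/-- Left translation of a function on lower unitriangular matrices. -/
noncomputable def leftTranslate (u : Matrix (Fin n) (Fin n) K) :
    MvPolynomial (LowerIdx n) K →ₐ[K] MvPolynomial (LowerIdx n) K :=
  lowerEval K (u.map (algebraMap K _) * genericLower n K)

lemma lowerEval_leftTranslate (u : Matrix (Fin n) (Fin n) K) {B : Type*} [CommRing B] [Algebra K B]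
    {M : Matrix (Fin n) (Fin n) B} (hM : IsLowerUni M) (f : MvPolynomial (LowerIdx n) K) :
    lowerEval K M (leftTranslate u f) = lowerEval K (u.map (algebraMap K B) * M) f := by
  rw [leftTranslate, ← lowerEval_map]
  congr 2
  have h1 : (u.map (algebraMap K (MvPolynomial (LowerIdx n) K)) * genericLower n K).map
      (lowerEval K M) = (u.map (algebraMap K (MvPolynomial (LowerIdx n) K))).map (lowerEval K M) *
        (genericLower n K).map (lowerEval K M) :=
    Matrix.map_mul (f := (lowerEval K M : MvPolynomial (LowerIdx n) K →+* B))
  rw [h1, genericLower_map hM]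
  congr 1
  ext1 i j
  exact (lowerEval K M).commutes _

lemma IsRestricted.leftTranslate {q : ℕ} {f : MvPolynomial (LowerIdx n) K} (hf : IsRestricted q f)
    {u : Matrix (Fin n) (Fin n) K} (hu : IsLowerUni u) : IsRestricted q (leftTranslate u f) := by
  intro i j hij
  obtain ⟨e, he⟩ := hf i j hij
  refine ⟨fun k => _root_.leftTranslate u (e k), fun B _ _ M t hM => ?_⟩
  have hu' : IsLowerUni (u.map (algebraMap K B)) := hu.map _
  have hji : j < i := by rw [Fin.lt_def]; omega
  rw [lowerEval_leftTranslate u (hM.mul (IsLowerUni.transvection hji t)), ← mul_assoc,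
    he B _ t (hu'.mul hM)]
  simp_rw [lowerEval_leftTranslate u hM]

/-- Specialization of the generic lower unitriangular matrix and of an additional variable. -/
noncomputable def lowerEvalX {B : Type*} [CommRing B] [Algebra K B] (M : Matrix (Fin n) (Fin n) B)
    (y : B) : (MvPolynomial (LowerIdx n) K)[X] →ₐ[K] B :=
  { Polynomial.eval₂RingHom (lowerEval K M : MvPolynomial (LowerIdx n) K →+* B) y with
    commutes' := fun c => (Polynomial.eval₂_C _ _).trans ((lowerEval K M).commutes c) }

lemma lowerEvalX_X {B : Type*} [CommRing B] [Algebra K B] (M : Matrix (Fin n) (Fin n) B) (y : B) :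
    lowerEvalX (K := K) M y X = y :=
  Polynomial.eval₂_X _ _

lemma lowerEvalX_C {B : Type*} [CommRing B] [Algebra K B] (M : Matrix (Fin n) (Fin n) B) (y : B)
    (f : MvPolynomial (LowerIdx n) K) : lowerEvalX (K := K) M y (C f) = lowerEval K M f :=
  Polynomial.eval₂_C _ _

lemma genericLower_map_lowerEvalX {B : Type*} [CommRing B] [Algebra K B]
    {M : Matrix (Fin n) (Fin n) B} (hM : IsLowerUni M) (y : B) :
    ((genericLower n K).map C).map (lowerEvalX (K := K) M y) = M := by
  conv_rhs => rw [← genericLower_map (K := K) hM]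
  ext1 i j
  simp [lowerEvalX_C]

lemma transvection_map_algHom {A B : Type*} [CommRing A] [CommRing B] [Algebra K A] [Algebra K B]
    (φ : A →ₐ[K] B) (i j : Fin n) (c : A) : (transvection i j c).map φ = transvection i j (φ c) :=
    by
  ext1 k l
  simp only [transvection, map_apply, Matrix.add_apply, one_apply, single_apply, map_add]
  congr 1 <;> split_ifs <;> simp

lemma lowerEvalX_transvection_mul {B : Type*} [CommRing B] [Algebra K B]
    {M : Matrix (Fin n) (Fin n) B} (hM : IsLowerUni M) (y : B) (i j : Fin n)
    (f : MvPolynomial (LowerIdx n) K) :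
    lowerEvalX M y (lowerEval K (transvection i j X * (genericLower n K).map C) f) =
      lowerEval K (transvection i j y * M) f := by
  rw [← lowerEval_map]
  congr 2
  refine (Matrix.map_mul (f := (lowerEvalX (K := K) M y :
    (MvPolynomial (LowerIdx n) K)[X] →+* B))).trans ?_
  exact congrArg₂ _ ((transvection_map_algHom _ i j _).trans (by rw [lowerEvalX_X]))
    (genericLower_map_lowerEvalX hM y)

lemma lowerEvalX_mul_transvection {B : Type*} [CommRing B] [Algebra K B]
    {M : Matrix (Fin n) (Fin n) B} (hM : IsLowerUni M) (y : B) (i j : Fin n)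
    (f : MvPolynomial (LowerIdx n) K) :
    lowerEvalX M y (lowerEval K ((genericLower n K).map C * transvection i j X) f) =
      lowerEval K (M * transvection i j y) f := by
  rw [← lowerEval_map]
  congr 2
  refine (Matrix.map_mul (f := (lowerEvalX (K := K) M y :
    (MvPolynomial (LowerIdx n) K)[X] →+* B))).trans ?_
  exact congrArg₂ _ (genericLower_map_lowerEvalX hM y)
    ((transvection_map_algHom _ i j _).trans (by rw [lowerEvalX_X]))

lemma isLowerUni_genericLower_map_C : IsLowerUni ((genericLower n K).map C) :=
  isLowerUni_genericLower.map C

lemma lowerEval_genericLower_map_C (f : MvPolynomial (LowerIdx n) K) :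
    lowerEval K ((genericLower n K).map C) f = C f := by
  have := lowerEval_map (Polynomial.CAlgHom (R := K)) (genericLower n K) f
  rw [lowerEval_genericLower] at this
  exact this

lemma exists_lowerEval_transvection_mul_eq {q : ℕ} {ι : Type*} [Fintype ι] {η : ι → K}
    (hη : Function.Injective η) (hq : Fintype.card ι = q) (hη' : ∀ a, η a ^ q = η a) (hq1 : 1 < q)
    {f : MvPolynomial (LowerIdx n) K} {i j : Fin n}
    (hf : ∀ a, leftTranslate (transvection i j (η a)) f = f) :
    ∃ R : (MvPolynomial (LowerIdx n) K)[X],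
      ∀ (B : Type u) [CommRing B] [Algebra K B] (M : Matrix (Fin n) (Fin n) B) (y : B),
      IsLowerUni M → lowerEval K (transvection i j y * M) f =
        lowerEval K M f + (y ^ q - y) * lowerEvalX M y R := by
  set Q := lowerEval K (transvection i j X * (genericLower n K).map C) f - C f with hQ
  have hmonic : (X ^ q - X : (MvPolynomial (LowerIdx n) K)[X]).Monic :=
    monic_X_pow_sub (by rw [degree_X]; exact_mod_cast hq1)
  have hdeg : (X ^ q - X : (MvPolynomial (LowerIdx n) K)[X]).natDegree = q := by
    rw [natDegree_sub_eq_left_of_natDegree_lt] <;> simp [hq1]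
  have hroot : ∀ a, Q.eval (MvPolynomial.C (η a)) = 0 := by
    intro a
    have h1 := lowerEvalX_transvection_mul (isLowerUni_genericLower (n := n) (K := K))
      (MvPolynomial.C (η a)) i j f
    have h2 : ∀ P : (MvPolynomial (LowerIdx n) K)[X], lowerEvalX (genericLower n K)
        (MvPolynomial.C (η a)) P = P.eval (MvPolynomial.C (η a)) := by
      intro P
      have h3 : (lowerEval K (genericLower n K) :
        MvPolynomial (LowerIdx n) K →+* MvPolynomial (LowerIdx n) K) =
        RingHom.id _ := RingHom.ext lowerEval_genericLower
      change P.eval₂ (lowerEval K (genericLower n K) : _ →+* MvPolynomial (LowerIdx n) K) _ = _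
      rw [h3]
      rfl
    rw [h2] at h1
    rw [hQ, eval_sub, eval_C, h1, sub_eq_zero]
    conv_rhs => rw [← hf a, leftTranslate]
    congr 3
    exact (transvection_map_algHom (Algebra.ofId K _) i j (η a)).symm
  have hmod : Q %ₘ (X ^ q - X) = 0 := by
    refine eq_zero_of_natDegree_lt_card_of_eval_eq_zero _
      ((MvPolynomial.C_injective _ K).comp hη) (fun a => ?_) ?_
    · rw [modByMonic_eq_sub_mul_div, eval_sub, eval_mul, Function.comp_apply, hroot]
      simp [← MvPolynomial.C_pow, hη']
    · rw [hq]
      conv_rhs => rw [← hdeg]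
      exact natDegree_modByMonic_lt _ hmonic fun h => by
        rw [h, natDegree_one] at hdeg; omega
  refine ⟨Q /ₘ (X ^ q - X), fun B _ _ M y hM => ?_⟩
  have h1 := modByMonic_add_div Q (X ^ q - X)
  rw [hmod, zero_add] at h1
  have h2 := congrArg (lowerEvalX M y) h1
  rw [map_mul, map_sub, map_pow, lowerEvalX_X] at h2
  rw [h2, hQ, map_sub, lowerEvalX_transvection_mul hM, lowerEvalX_C]
  ring

end Restricted

section RestrictedVanishing

variable {n : ℕ} {K : Type u} [Field K]

lemma pow_dvd_coeff_mul_of_natDegree_le {A : Type*} [CommRing A] [IsDomain A] {y : A} {q h D : ℕ}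
    (hq : 1 < q) (hh : 0 < h) {P R : A[X]}
    (hP : P = ((C y * X ^ h) ^ q - C y * X ^ h) * R) (hD : P.natDegree ≤ D) :
    y ^ q ∣ P.coeff D := by
  rcases hD.lt_or_eq with hlt | rfl
  · rw [coeff_eq_zero_of_natDegree_lt hlt]
    exact dvd_zero _
  rcases eq_or_ne y 0 with rfl | hy
  · have : P = 0 := by
      rw [hP]
      simp [show q ≠ 0 by omega]
    simp [this]
  have h1 : ((C y * X ^ h) ^ q - C y * X ^ h).leadingCoeff = y ^ q := by
    rw [leadingCoeff_sub_of_degree_lt]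
    · rw [mul_pow, ← C_pow, ← pow_mul, leadingCoeff_C_mul_X_pow]
    · rw [mul_pow, ← C_pow, ← pow_mul, degree_C_mul_X_pow _ hy,
        degree_C_mul_X_pow _ (pow_ne_zero _ hy)]
      exact_mod_cast (by nlinarith : h < h * q)
  rw [← leadingCoeff, hP, leadingCoeff_mul, h1]
  exact dvd_mul_right _ _

lemma pow_dvd_lowerEval_leadingCoeff_gradePoly {q : ℕ} (hq : 1 < q)
    {f : MvPolynomial (LowerIdx n) K} {i j : Fin n} (hij : j < i)
    (hf : ∃ R : (MvPolynomial (LowerIdx n) K)[X],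
      ∀ (B : Type u) [CommRing B] [Algebra K B] (M : Matrix (Fin n) (Fin n) B) (y : B),
      IsLowerUni M → lowerEval K (transvection i j y * M) f =
        lowerEval K M f + (y ^ q - y) * lowerEvalX M y R)
    {B : Type*} [CommRing B] [Algebra K B] {M : Matrix (Fin n) (Fin n) B} (hM : IsLowerUni M)
    (y : B) : y ^ q ∣ lowerEval K (transvection i j y * M) (gradePoly f).leadingCoeff -
      lowerEval K M (gradePoly f).leadingCoeff := by
  obtain ⟨R, hR⟩ := hf
  set M0 := (genericLower n K).map C with hM0
  have hM0' : IsLowerUni M0 := isLowerUni_genericLower_map_C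
  have hT : IsLowerUni (transvection i j (X : (MvPolynomial (LowerIdx n) K)[X])) :=
    IsLowerUni.transvection hij _
  have h1 := hR _ (gradeScale M0) (C X * X ^ ((i : ℕ) - j)) hM0'.gradeScale
  rw [← gradeScale_transvection, ← gradeScale_mul hT hM0', lowerEval_gradeScale (hT.mul hM0'),
    lowerEval_gradeScale hM0', ← sub_eq_iff_eq_add'] at h1
  have h2 := pow_dvd_coeff_mul_of_natDegree_le hq (by rw [Fin.lt_def] at hij; omega) h1
    (D := (gradePoly f).natDegree)
    ((natDegree_sub_le _ _).trans (max_le (natDegree_map_le) (natDegree_map_le)))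
  rw [coeff_sub, coeff_map, coeff_map] at h2
  have h3 := map_dvd (lowerEvalX M y) h2
  rw [map_sub, map_pow, lowerEvalX_X] at h3
  convert h3 using 2
  · exact (lowerEvalX_transvection_mul hM y i j _).symm
  · refine Eq.symm ((congrArg (lowerEvalX M y) (lowerEval_genericLower_map_C _)).trans ?_)
    exact lowerEvalX_C _ _ _

lemma IsRestricted.leadingCoeff_gradePoly {q : ℕ} {f : MvPolynomial (LowerIdx n) K}
    (hf : IsRestricted q f) : IsRestricted q (gradePoly f).leadingCoeff := by
  intro i j hij
  obtain ⟨e, he⟩ := hf i j hij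
  refine ⟨fun k => (X ^ k * gradePoly (e k)).coeff (gradePoly f).natDegree,
    fun B _ _ M t hM => ?_⟩
  have hji : j < i := by rw [Fin.lt_def]; omega
  have hT : IsLowerUni (transvection i j t) := IsLowerUni.transvection hji _
  have h1 := he _ (gradeScale M) (C t * X ^ ((i : ℕ) - j)) hM.gradeScale
  rw [← gradeScale_transvection, ← gradeScale_mul hM hT, lowerEval_gradeScale (hM.mul hT)] at h1
  have h2 := congrArg (fun P => P.coeff (gradePoly f).natDegree) h1
  simp only [coeff_map, finsetSum_coeff] at h2
  refine h2.trans (Finset.sum_congr rfl fun k _ => ?_)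
  rw [lowerEval_gradeScale hM, show (i : ℕ) - j = 1 by omega, pow_one, mul_pow, ← C_pow, mul_assoc,
    coeff_C_mul]
  congr 1
  have h3 : (X ^ k * gradePoly (e k)).map (lowerEval K M : MvPolynomial (LowerIdx n) K →+* B) =
      X ^ k * (gradePoly (e k)).map (lowerEval K M : MvPolynomial (LowerIdx n) K →+* B) := by
    rw [Polynomial.map_mul, Polynomial.map_pow, map_X]
  rw [← h3, coeff_map]
  rfl

lemma IsRestricted.lowerEval_mul_transvection_eq {q : ℕ} {g : MvPolynomial (LowerIdx n) K}
    (hg : IsRestricted q g) {i j : Fin n} (hij : (i : ℕ) = j + 1)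
    (hdvd : (X : (MvPolynomial (LowerIdx n) K)[X]) ^ q ∣
      lowerEval K ((genericLower n K).map C * transvection i j X) g -
        lowerEval K ((genericLower n K).map C) g)
    {B : Type*} [CommRing B] [Algebra K B] {M : Matrix (Fin n) (Fin n) B} (hM : IsLowerUni M)
    (t : B) : lowerEval K (M * transvection i j t) g = lowerEval K M g := by
  obtain ⟨e, he⟩ := hg i j hij
  rw [← sub_eq_zero]
  have key : lowerEval K ((genericLower n K).map C * transvection i j X) g -
      lowerEval K ((genericLower n K).map C) g = 0 := by
    rcases Nat.eq_zero_or_pos q with rfl | hq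
    · rw [he _ ((genericLower n K).map C) X isLowerUni_genericLower_map_C]
      have := he _ (genericLower n K) 0 isLowerUni_genericLower
      rw [transvection_zero, mul_one, lowerEval_genericLower] at this
      rw [lowerEval_genericLower_map_C, this]
      simp
    refine eq_zero_of_dvd_of_degree_lt hdvd ?_
    rw [degree_X_pow, he _ _ X isLowerUni_genericLower_map_C]
    simp_rw [lowerEval_genericLower_map_C]
    refine (degree_sub_le _ _).trans_lt (max_lt ?_ ?_)
    · refine (degree_sum_le _ _).trans_lt ?_
      rw [Finset.sup_lt_iff (by exact WithBot.bot_lt_coe _)]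
      intro k hk
      rw [mul_comm]
      exact (degree_C_mul_X_pow_le _ _).trans_lt (by exact_mod_cast Finset.mem_range.1 hk)
    · exact degree_C_le.trans_lt (by exact_mod_cast hq)
  have h2 := congrArg (lowerEvalX M t) key
  rw [map_sub, lowerEvalX_mul_transvection hM, map_zero, lowerEval_genericLower_map_C] at h2
  exact (congrArg (lowerEval K (M * transvection i j t) g - ·) (lowerEvalX_C M t g)).symm.trans h2

/-- Left translation by the unipotent group as an action. -/
noncomputable def leftTranslateHom (F : Type*) [Field F] [Finite F] [Algebra F K] :
    lowerUniGroup n F →* AddMonoid.End (MvPolynomial (LowerIdx n) K) where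
  toFun u := ((leftTranslate ((u⁻¹ : lowerUniGroup n F).1.1.map (algebraMap F K)) :
    MvPolynomial (LowerIdx n) K →ₐ[K] MvPolynomial (LowerIdx n) K) :
      MvPolynomial (LowerIdx n) K →+ MvPolynomial (LowerIdx n) K)
  map_one' := by
    ext1 f
    change leftTranslate _ f = f
    have : ((1 : lowerUniGroup n F)⁻¹).1.1 = 1 := by simp
    rw [this, Matrix.map_one _ (map_zero _) (map_one _), leftTranslate,
      Matrix.map_one _ (map_zero _) (map_one _), one_mul, lowerEval_genericLower]
  map_mul' u v := by
    ext1 f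
    change leftTranslate _ f = leftTranslate _ (leftTranslate _ f)
    have h1 : ((u * v)⁻¹).1.1 = (v⁻¹).1.1 * (u⁻¹).1.1 := by
      rw [_root_.mul_inv_rev]; rfl
    have hu : IsLowerUni (((u⁻¹).1.1.map (algebraMap F K)).map
        (algebraMap K (MvPolynomial (LowerIdx n) K))) := ((u⁻¹).2.map _).map _
    conv_rhs => rw [leftTranslate, lowerEval_leftTranslate _ (hu.mul isLowerUni_genericLower)]
    rw [h1, leftTranslate, ← mul_assoc, Matrix.map_mul, Matrix.map_mul]

lemma leftTranslateHom_apply {F : Type*} [Field F] [Finite F] [Algebra F K] (u : lowerUniGroup n F)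
    (f : MvPolynomial (LowerIdx n) K) : leftTranslateHom F u f =
      leftTranslate ((u⁻¹ : lowerUniGroup n F).1.1.map (algebraMap F K)) f := rfl

/-- A restricted function vanishing on the rational unipotent group vanishes identically. -/
theorem IsRestricted.eq_zero {F : Type*} [Field F] [Fintype F] [Algebra F K] (p : ℕ)
    [Fact p.Prime] [CharP F p] {f : MvPolynomial (LowerIdx n) K}
    (hf : IsRestricted (Fintype.card F) f)
    (h0 : ∀ u : Matrix (Fin n) (Fin n) F, IsLowerUni u →
      lowerEval K (u.map (algebraMap F K)) f = 0) : f = 0 := by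
  by_contra hne
  have hq : 1 < Fintype.card F := Fintype.one_lt_card
  let Z : AddSubgroup (MvPolynomial (LowerIdx n) K) :=
    { carrier := {f | IsRestricted (Fintype.card F) f ∧ ∀ u : Matrix (Fin n) (Fin n) F,
        IsLowerUni u → lowerEval K (u.map (algebraMap F K)) f = 0}
      add_mem' := fun ha hb => ⟨ha.1.add hb.1, fun u hu => by
        rw [map_add, ha.2 u hu, hb.2 u hu, add_zero]⟩
      zero_mem' := ⟨IsRestricted.zero, fun u _ => map_zero _⟩
      neg_mem' := fun ha => ⟨ha.1.neg, fun u hu => by rw [map_neg, ha.2 u hu, neg_zero]⟩ }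
  have hZ : ∀ h : lowerUniGroup n F, ∀ m ∈ Z, leftTranslateHom F h m ∈ Z := by
    intro h m hm
    have hh : IsLowerUni (h⁻¹).1.1 := (h⁻¹).2
    rw [leftTranslateHom_apply]
    refine ⟨hm.1.leftTranslate (hh.map _), fun u hu => ?_⟩
    rw [lowerEval_leftTranslate _ (hu.map _)]
    have := hm.2 _ (hh.mul hu)
    rwa [Matrix.map_mul] at this
  have hpM : ∀ m : MvPolynomial (LowerIdx n) K, p • m = 0 := by
    intro m
    have hK : CharP K p := charP_of_injective_algebraMap (algebraMap F K).injective p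
    have : ((p : K) • m) = 0 := by rw [CharP.cast_eq_zero, zero_smul]
    rwa [Nat.cast_smul_eq_nsmul] at this
  obtain ⟨f, hfZ, hf0, hfix⟩ := exists_ne_zero_fixed_of_isPGroup (isPGroup_lowerUniGroup p) hpM
    (leftTranslateHom F) hZ (z := f) ⟨hf, h0⟩ hne
  set g := (gradePoly f).leadingCoeff with hg
  have hg0 : g ≠ 0 := leadingCoeff_ne_zero.2 (gradePoly_ne_zero hf0)
  have hgres : IsRestricted (Fintype.card F) g := hfZ.1.leadingCoeff_gradePoly
  have hdvd : ∀ (B : Type u) [CommRing B] [Algebra K B] (M : Matrix (Fin n) (Fin n) B)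
      (i j : Fin n) (y : B), IsLowerUni M → j < i →
      y ^ Fintype.card F ∣ lowerEval K (transvection i j y * M) g - lowerEval K M g := by
    intro B _ _ M i j y hM hij
    refine pow_dvd_lowerEval_leadingCoeff_gradePoly hq hij ?_ hM y
    refine exists_lowerEval_transvection_mul_eq (algebraMap F K).injective rfl
      (fun a => by rw [← map_pow, FiniteField.pow_card]) hq fun a => ?_
    have hx : IsLowerUni (transvection i j a) := IsLowerUni.transvection hij a
    let x : lowerUniGroup n F := ⟨⟨transvection i j a, hx.det_eq_one⟩, hx⟩
    have := hfix x⁻¹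
    rw [leftTranslateHom_apply, inv_inv] at this
    have hmap : (transvection i j a).map (algebraMap F K) = transvection i j (algebraMap F K a) :=
      transvection_map_algHom (Algebra.ofId F K) i j a
    rw [← hmap]
    exact this
  have hinv : ∀ (B : Type u) [CommRing B] [Algebra K B] (M : Matrix (Fin n) (Fin n) B)
      (i j : Fin n) (t : B), IsLowerUni M → (i : ℕ) = j + 1 →
      lowerEval K (M * transvection i j t) g = lowerEval K M g := by
    intro B _ _ M i j t hM hij
    refine hgres.lowerEval_mul_transvection_eq hij ?_ hM t
    exact dvd_lowerEval_mul_transvection hdvd isLowerUni_genericLower_map_C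
      (by rw [Fin.lt_def]; omega) X
  have h1 := lowerEval_eq_lowerEval_one (fun M i j t => hinv _ M i j t) (isLowerUni_genericLower (n
    := n) (K := K))
  rw [lowerEval_genericLower] at h1
  have hone : IsLowerUni (1 : Matrix (Fin n) (Fin n) (MvPolynomial (LowerIdx n) K)) :=
    IsLowerUni.one
  have h2 := lowerEval_gradeScale (K := K) hone f
  have h3 : lowerEval K (gradeScale (1 : Matrix (Fin n) (Fin n) (MvPolynomial (LowerIdx n) K))) f
      = 0 := by
    have h4 := hfZ.2 1 IsLowerUni.one
    have h5 := lowerEval_map (Algebra.ofId K (MvPolynomial (LowerIdx n) K)[X])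
      ((1 : Matrix (Fin n) (Fin n) F).map (algebraMap F K)) f
    rw [h4, map_zero] at h5
    convert h5 using 2
    congr 1
    ext1 i j
    simp only [gradeScale, of_apply, map_apply, one_apply]
    split_ifs with h
    · subst h; simp
    · simp
  rw [h3] at h2
  have h6 := congrArg (fun P => P.coeff (gradePoly f).natDegree) h2
  simp only [coeff_map, coeff_zero] at h6
  exact hg0 (h1.trans h6.symm)

end RestrictedVanishing

section MinorSums

variable {n N : ℕ}

lemma natDegree_cornerMinor_map_C_mul_transvection_le {A : Type*} [CommRing A] (r i j : Fin n)
    (hij : (i : ℕ) = j + 1) (G : Matrix (Fin n) (Fin n) A) :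
    (cornerMinor r (G.map C * transvection i j X)).natDegree ≤ if r = j then 1 else 0 := by
  have hji : j < i := by rw [Fin.lt_def]; omega
  split_ifs with h
  · subst h
    have h1 : corner r (G.map C * transvection i r X) = (corner r (G.map C)).updateCol r
        ((fun k => corner r (G.map C) k r) + (X : A[X]) • fun k => if k ≤ r then C (G k i) else 0)
        := by
      ext1 k l
      rw [updateCol_apply]
      by_cases hl : l = r
      · subst hl
        by_cases hk : k ≤ l
        · simp [corner, hk]
        · have : k ≠ l := fun h => hk h.le
          simp [corner, hk]
      · rw [if_neg hl]
        simp [corner, hl]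
    rw [cornerMinor, h1, det_updateCol_add, det_updateCol_smul]
    have h2 : ∀ c : Fin n → A[X], (∀ k, (c k).natDegree = 0) →
        (((corner r (G.map C)).updateCol r c).det).natDegree = 0 := by
      intro c hc
      have h3 : (corner r (G.map C)).updateCol r c =
          ((corner r G).updateCol r (fun k => (c k).coeff 0)).map C := by
        ext1 k l
        rw [map_apply, updateCol_apply, updateCol_apply]
        split_ifs with h4
        · exact eq_C_of_natDegree_eq_zero (hc k)
        · simp only [corner, of_apply, map_apply]
          split_ifs <;> simp
      have h5 := (RingHom.map_det (C : A →+* A[X])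
        ((corner r G).updateCol r (fun k => (c k).coeff 0))).symm
      rw [h3]
      exact (congrArg natDegree h5).trans (natDegree_C _)
    refine (natDegree_add_le _ _).trans (max_le ?_ ?_)
    · rw [h2]
      · omega
      · intro k
        simp only [corner, of_apply, map_apply]
        split_ifs <;> simp
    · refine natDegree_mul_le.trans ?_
      rw [h2, add_zero]
      · exact natDegree_X_le
      · intro k
        split_ifs <;> simp
  · rw [cornerMinor_mul_transvection hji.ne' (fun h1 => by
      rw [Fin.le_def] at h1 ⊢
      have : (r : ℕ) ≠ j := fun h2 => h (Fin.ext h2)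
      omega), cornerMinor_map]
    exact (natDegree_C _).le

lemma natDegree_minorProd_map_C_mul_transvection_lt {A : Type*} [CommRing A] {q : ℕ}
    {a : Fin N → ℕ} (ha : ∀ r, a r < q) {i j : Fin (N + 1)} (hij : (i : ℕ) = j + 1)
    (G : Matrix (Fin (N + 1)) (Fin (N + 1)) A) :
    (minorProd a (G.map C * transvection i j X)).natDegree < q := by
  obtain ⟨j', rfl⟩ : ∃ j' : Fin N, j'.castSucc = j :=
    ⟨⟨j, by omega⟩, rfl⟩
  refine lt_of_le_of_lt (natDegree_prod_le _ _) ?_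
  refine lt_of_le_of_lt (Finset.sum_le_sum (g := fun r => if r = j' then a j' else 0)
    fun r _ => ?_) ?_
  · refine natDegree_pow_le.trans ?_
    have := natDegree_cornerMinor_map_C_mul_transvection_le r.castSucc i j'.castSucc hij G
    by_cases h : r = j'
    · subst h
      rw [if_pos rfl] at this ⊢
      nlinarith
    · rw [if_neg (fun h1 => h (Fin.castSucc_injective _ h1))] at this
      rw [if_neg h, Nat.le_zero.1 this, mul_zero]
  · simpa using ha j'

variable {K : Type u} [Field K]

/-- The sum of the products of minors as a function on generic lower unitriangular matrices. -/
noncomputable def minorProdSum {ι : Type*} (s : Finset ι) (a : Fin N → ℕ)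
    (A : ι → Matrix (Fin (N + 1)) (Fin (N + 1)) K) : MvPolynomial (LowerIdx (N + 1)) K :=
  ∑ j ∈ s, minorProd a ((A j).map (algebraMap K _) * genericLower (N + 1) K)

lemma lowerEval_minorProdSum {ι : Type*} (s : Finset ι) (a : Fin N → ℕ)
    (A : ι → Matrix (Fin (N + 1)) (Fin (N + 1)) K) {B : Type*} [CommRing B] [Algebra K B]
    {M : Matrix (Fin (N + 1)) (Fin (N + 1)) B} (hM : IsLowerUni M) :
    lowerEval K M (minorProdSum s a A) =
      ∑ j ∈ s, minorProd a ((A j).map (algebraMap K B) * M) := by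
  rw [minorProdSum, map_sum]
  refine Finset.sum_congr rfl fun j _ => ?_
  have h1 := minorProd_map a (lowerEval K M : MvPolynomial (LowerIdx (N + 1)) K →+* B)
    ((A j).map (algebraMap K _) * genericLower (N + 1) K)
  refine h1.symm.trans ?_
  rw [Matrix.map_mul]
  congr 2
  · ext1 k l
    exact (lowerEval K M).commutes _
  · exact genericLower_map hM

lemma isRestricted_minorProdSum {ι : Type*} (s : Finset ι) {q : ℕ} {a : Fin N → ℕ}
    (ha : ∀ r, a r < q) (hq : 0 < q) (A : ι → Matrix (Fin (N + 1)) (Fin (N + 1)) K) :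
    IsRestricted q (minorProdSum s a A) := by
  intro i j hij
  have hji : j < i := by rw [Fin.lt_def]; omega
  set P := lowerEval K ((genericLower (N + 1) K).map C * transvection i j X) (minorProdSum s a A)
    with hP
  have hT : IsLowerUni (transvection i j (X : (MvPolynomial (LowerIdx (N + 1)) K)[X])) :=
    IsLowerUni.transvection hji _
  have hdeg : P.natDegree < q := by
    rw [hP, lowerEval_minorProdSum _ _ _ (isLowerUni_genericLower_map_C.mul hT)]
    refine lt_of_le_of_lt (natDegree_sum_le_of_forall_le (n := q - 1) _ _ fun l _ => ?_) (by omega)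
    have h1 := natDegree_minorProd_map_C_mul_transvection_lt ha hij
      ((A l).map (algebraMap K _) * genericLower (N + 1) K)
    rw [Matrix.map_mul, Matrix.mul_assoc] at h1
    exact Nat.le_sub_one_of_lt h1
  refine ⟨fun k => P.coeff k, fun B _ _ M t hM => ?_⟩
  rw [← lowerEvalX_mul_transvection hM t, ← hP]
  conv_lhs => rw [P.as_sum_range' q hdeg, map_sum]
  refine Finset.sum_congr rfl fun k _ => ?_
  rw [← C_mul_X_pow_eq_monomial, map_mul, map_pow, lowerEvalX_X, lowerEvalX_C, mul_comm]

/-- Vanishing of a sum of products of minors on rational lower unitriangular matrices propagates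
to an extension field. -/
lemma sum_minorProd_mul_eq_zero {F : Type*} [Field F] [Fintype F] [Algebra F K] (p : ℕ)
    [Fact p.Prime] [CharP F p] {ι : Type*} (s : Finset ι) {a : Fin N → ℕ}
    (ha : ∀ r, a r ≤ Fintype.card F - 1) (A : ι → Matrix (Fin (N + 1)) (Fin (N + 1)) K)
    (h0 : ∀ u : Matrix (Fin (N + 1)) (Fin (N + 1)) F, IsLowerUni u →
      ∑ j ∈ s, minorProd a (A j * u.map (algebraMap F K)) = 0)
    {u : Matrix (Fin (N + 1)) (Fin (N + 1)) K} (hu : IsLowerUni u) :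
    ∑ j ∈ s, minorProd a (A j * u) = 0 := by
  have hq : 0 < Fintype.card F := Fintype.card_pos
  have h1 := (isRestricted_minorProdSum s (fun r => (ha r).trans_lt (by omega)) hq A).eq_zero p
    fun u hu => by
      rw [lowerEval_minorProdSum _ _ _ (hu.map _)]
      exact h0 u hu
  have h2 := lowerEval_minorProdSum s a A hu
  rw [h1, map_zero] at h2
  exact h2.symm

lemma sum_minorProd_mul_mul_eq_zero_of_unipotent {F : Type*} [Field F] [Fintype F] [Algebra F K]
    (p : ℕ) [Fact p.Prime] [CharP F p] {ι : Type*} (s : Finset ι) {a : Fin N → ℕ}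
    (ha : ∀ r, a r ≤ Fintype.card F - 1) (A : ι → Matrix (Fin (N + 1)) (Fin (N + 1)) F)
    (h0 : ∀ g h : Matrix (Fin (N + 1)) (Fin (N + 1)) F, g.det = 1 → h.det = 1 →
      ∑ j ∈ s, minorProd a (g * A j * h) = 0)
    {v u : Matrix (Fin (N + 1)) (Fin (N + 1)) K} (hv : IsLowerUni vᵀ) (hu : IsLowerUni u) :
    ∑ j ∈ s, minorProd a (v * (A j).map (algebraMap F K) * u) = 0 := by
  have key : ∑ j ∈ s, minorProd a (((A j).map (algebraMap F K) * u)ᵀ * vᵀ) = 0 := by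
    refine sum_minorProd_mul_eq_zero (F := F) p s ha _ (fun w hw => ?_) hv
    have h1 : ∑ j ∈ s, minorProd a ((w.map (algebraMap F K))ᵀ * (A j).map (algebraMap F K) * u)
        = 0 := by
      refine sum_minorProd_mul_eq_zero (F := F) p s ha _ (fun z hz => ?_) hu
      have h2 := congrArg (algebraMap F K) (h0 wᵀ z (by rw [det_transpose, hw.det_eq_one])
        hz.det_eq_one)
      rw [map_sum, map_zero] at h2
      refine Eq.trans (Finset.sum_congr rfl fun j _ => ?_) h2
      rw [← minorProd_map, Matrix.map_mul, Matrix.map_mul, transpose_map]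
    refine Eq.trans (Finset.sum_congr rfl fun j _ => ?_) h1
    rw [← minorProd_transpose, transpose_mul, transpose_transpose, Matrix.mul_assoc]
  refine Eq.trans (Finset.sum_congr rfl fun j _ => ?_) key
  rw [← minorProd_transpose, transpose_mul, transpose_mul, transpose_mul,
    Matrix.mul_assoc]

lemma sum_minorProd_mul_eq_zero_of_cornerMinor_ne_zero {ι : Type*} (s : Finset ι) {a : Fin N → ℕ}
    {g : Matrix (Fin (N + 1)) (Fin (N + 1)) K} (hg : g.det ≠ 0)
    (hgr : ∀ r : Fin N, cornerMinor r.castSucc g ≠ 0)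
    (Y : ι → Matrix (Fin (N + 1)) (Fin (N + 1)) K)
    (h0 : ∀ v : Matrix (Fin (N + 1)) (Fin (N + 1)) K, IsLowerUni vᵀ →
      ∑ j ∈ s, minorProd a (v * Y j) = 0) :
    ∑ j ∈ s, minorProd a (g * Y j) = 0 := by
  revert hgr Y h0
  refine bruhat_induction (P := fun g => (∀ r : Fin N, cornerMinor r.castSucc g ≠ 0) →
    ∀ Y : ι → Matrix (Fin (N + 1)) (Fin (N + 1)) K,
    (∀ v : Matrix (Fin (N + 1)) (Fin (N + 1)) K, IsLowerUni vᵀ →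
      ∑ j ∈ s, minorProd a (v * Y j) = 0) → ∑ j ∈ s, minorProd a (g * Y j) = 0) ?_ ?_ ?_ hg
  · intro l g hl h hgr Y h0
    have := h (fun r => by rw [cornerMinor_lower_mul hl]; exact hgr r) Y h0
    simp_rw [Matrix.mul_assoc, minorProd_lower_mul a hl] at this
    exact this
  · intro u g hu h hgr Y h0
    have hu' : IsLowerUni (u⁻¹)ᵀ := by
      rw [transpose_nonsing_inv]
      exact hu.inv
    have hdet : IsUnit u.det := by
      rw [← det_transpose, hu.det_eq_one]
      exact isUnit_one
    have := h (fun r => by rw [cornerMinor_mul_upper hu]; exact hgr r) (fun j => u⁻¹ * Y j)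
      fun v hv => by
        simp_rw [← Matrix.mul_assoc]
        exact h0 _ (by rw [transpose_mul]; exact hu'.mul hv)
    refine Eq.trans (Finset.sum_congr rfl fun j _ => ?_) this
    rw [← Matrix.mul_assoc, Matrix.mul_assoc g, mul_nonsing_inv _ hdet, Matrix.mul_one]
  · intro w d hgr Y h0
    have hw : ∀ r : Fin N, w r.castSucc ≤ w r.succ := fun r =>
      not_lt.1 fun h => hgr r (cornerMinor_monomialMatrix_of_descent h d)
    have hmono : StrictMono w := Fin.strictMono_iff_lt_succ.mpr fun r =>
      lt_of_le_of_ne (hw r) fun h => (Fin.castSucc_lt_succ).ne (w.injective h)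
    have hw1 : w = 1 := by
      ext i
      have := (StrictMono.range_inj hmono strictMono_id).mp (by
        rw [w.surjective.range_eq, Set.range_id])
      rw [this]; rfl
    subst hw1
    rw [monomialMatrix_one_eq_diagonal]
    simp_rw [minorProd_diagonal_mul]
    rw [← Finset.mul_sum]
    have := h0 1 (by rw [transpose_one]; exact IsLowerUni.one)
    simp_rw [Matrix.one_mul] at this
    rw [this, mul_zero]

/-- Vanishing of a sum of translated products of minors propagates to all matrices over an
infinite extension field. -/
theorem sum_minorProd_mul_mul_eq_zero {F : Type*} [Field F] [Fintype F] [Algebra F K] [Infinite K]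
    (p : ℕ) [Fact p.Prime] [CharP F p] {ι : Type*} (s : Finset ι) {a : Fin N → ℕ}
    (ha : ∀ r, a r ≤ Fintype.card F - 1) (A : ι → Matrix (Fin (N + 1)) (Fin (N + 1)) F)
    (h0 : ∀ g h : Matrix (Fin (N + 1)) (Fin (N + 1)) F, g.det = 1 → h.det = 1 →
      ∑ j ∈ s, minorProd a (g * A j * h) = 0)
    (g h : Matrix (Fin (N + 1)) (Fin (N + 1)) K) :
    ∑ j ∈ s, minorProd a (g * (A j).map (algebraMap F K) * h) = 0 := by
  have hgen : ∀ g h : Matrix (Fin (N + 1)) (Fin (N + 1)) K, g.det ≠ 0 → h.det ≠ 0 →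
      (∀ r : Fin N, cornerMinor r.castSucc g ≠ 0) → (∀ r : Fin N, cornerMinor r.castSucc h ≠ 0) →
      ∑ j ∈ s, minorProd a (g * (A j).map (algebraMap F K) * h) = 0 := by
    intro g h hg hh hgr hhr
    have h1 : ∑ j ∈ s, minorProd a (hᵀ * (g * (A j).map (algebraMap F K))ᵀ) = 0 := by
      refine sum_minorProd_mul_eq_zero_of_cornerMinor_ne_zero s (by rwa [det_transpose])
        (fun r => by rw [cornerMinor_transpose]; exact hhr r) _ fun v hv => ?_
      have h2 : ∑ j ∈ s, minorProd a (g * ((A j).map (algebraMap F K) * vᵀ)) = 0 := by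
        refine sum_minorProd_mul_eq_zero_of_cornerMinor_ne_zero s hg hgr _ fun w hw => ?_
        simp_rw [← Matrix.mul_assoc]
        exact sum_minorProd_mul_mul_eq_zero_of_unipotent p s ha A h0 hw hv
      refine Eq.trans (Finset.sum_congr rfl fun j _ => ?_) h2
      rw [← minorProd_transpose, transpose_mul, transpose_transpose, Matrix.mul_assoc]
    refine Eq.trans (Finset.sum_congr rfl fun j _ => ?_) h1
    rw [← minorProd_transpose, transpose_mul]
  let γ : Matrix (Fin (N + 1)) (Fin (N + 1)) K → Matrix (Fin (N + 1)) (Fin (N + 1)) K[X] :=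
    fun g => 1 + (X : K[X]) • (g - 1).map C
  have hγ : ∀ g t, (γ g).map (evalRingHom t) = 1 + t • (g - 1) := by
    intro g t
    ext1 k l
    simp only [γ, map_apply, Matrix.add_apply, Matrix.smul_apply, smul_eq_mul, coe_evalRingHom,
      eval_add, eval_mul, eval_X, eval_C, Matrix.sub_apply, one_apply]
    split_ifs <;> simp
  let Q : K[X] := ∑ j ∈ s, minorProd a (γ g * ((A j).map (algebraMap F K)).map C * γ h)
  have hQ : ∀ t, Q.eval t = ∑ j ∈ s, minorProd a ((1 + t • (g - 1)) *
      (A j).map (algebraMap F K) * (1 + t • (h - 1))) := by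
    intro t
    rw [eval_finsetSum]
    refine Finset.sum_congr rfl fun j _ => ?_
    rw [← coe_evalRingHom, ← minorProd_map, Matrix.map_mul, Matrix.map_mul, hγ, hγ]
    congr 3
    ext1 k l
    simp
  let W : K[X] := ((γ g).det * ∏ r : Fin N, cornerMinor r.castSucc (γ g)) *
    ((γ h).det * ∏ r : Fin N, cornerMinor r.castSucc (γ h))
  have hW : ∀ t, W.eval t = ((1 + t • (g - 1)).det *
      ∏ r : Fin N, cornerMinor r.castSucc (1 + t • (g - 1))) *
      ((1 + t • (h - 1)).det * ∏ r : Fin N, cornerMinor r.castSucc (1 + t • (h - 1))) := by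
    intro t
    simp only [W, ← coe_evalRingHom, map_mul, map_prod, ← cornerMinor_map, hγ, RingHom.map_det,
      RingHom.mapMatrix_apply]
  have hW0 : W ≠ 0 := by
    intro h1
    have h2 := hW 0
    rw [h1, eval_zero] at h2
    have h3 : ∀ r : Fin N, cornerMinor r.castSucc (1 : Matrix (Fin (N + 1)) (Fin (N + 1)) K) = 1 :=
      fun r => (IsLowerUni.one.corner _).det_eq_one
    simp [h3] at h2
  have hQW : Q * W = 0 := by
    refine Polynomial.funext fun t => ?_
    rw [eval_mul, eval_zero]
    by_cases ht : W.eval t = 0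
    · rw [ht, mul_zero]
    · rw [hW] at ht
      simp only [mul_eq_zero, not_or, Finset.prod_eq_zero_iff, not_exists, Finset.mem_univ,
        true_and] at ht
      rw [hQ, hgen _ _ ht.1.1 ht.2.1 ht.1.2 ht.2.2, zero_mul]
  have hQ0 := (mul_eq_zero.1 hQW).resolve_right hW0
  have h1 := hQ 1
  rw [hQ0, eval_zero] at h1
  simp only [one_smul, add_sub_cancel] at h1
  exact h1.symm

end MinorSums

end

section

open Matrix Polynomial

section Lead

variable {R : Type*} [CommRing R]

/-- `P` has degree at most `D` with coefficient `c` in degree `D`. -/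
def HasTerm (P : R[X]) (D : ℕ) (c : R) : Prop := P.natDegree ≤ D ∧ P.coeff D = c

lemma HasTerm.mul {P Q : R[X]} {D E : ℕ} {c d : R} (hP : HasTerm P D c) (hQ : HasTerm Q E d) :
    HasTerm (P * Q) (D + E) (c * d) :=
  ⟨natDegree_mul_le.trans (add_le_add hP.1 hQ.1), by
    rw [coeff_mul_add_eq_of_natDegree_le hP.1 hQ.1, hP.2, hQ.2]⟩

lemma HasTerm.add {P Q : R[X]} {D : ℕ} {c d : R} (hP : HasTerm P D c) (hQ : HasTerm Q D d) :
    HasTerm (P + Q) D (c + d) :=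
  ⟨natDegree_add_le_of_degree_le hP.1 hQ.1, by rw [coeff_add, hP.2, hQ.2]⟩

lemma HasTerm.zero (D : ℕ) : HasTerm (0 : R[X]) D 0 := ⟨by simp, by simp⟩

lemma HasTerm.C (c : R) : HasTerm (C c) 0 c := ⟨by simp, by simp⟩

lemma HasTerm.one : HasTerm (1 : R[X]) 0 1 := HasTerm.C 1

lemma HasTerm.pow {P : R[X]} {D : ℕ} {c : R} (hP : HasTerm P D c) (k : ℕ) :
    HasTerm (P ^ k) (k * D) (c ^ k) := by
  induction k with
  | zero => simpa using HasTerm.one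
  | succ k ih =>
    rw [pow_succ, pow_succ, Nat.succ_mul]
    exact ih.mul hP

lemma HasTerm.prod {ι : Type*} (s : Finset ι) {P : ι → R[X]} {D : ι → ℕ} {c : ι → R}
    (h : ∀ i ∈ s, HasTerm (P i) (D i) (c i)) :
    HasTerm (∏ i ∈ s, P i) (∑ i ∈ s, D i) (∏ i ∈ s, c i) := by
  classical
  induction s using Finset.induction_on with
  | empty => simpa using HasTerm.one
  | insert i s hi ih =>
    rw [Finset.prod_insert hi, Finset.prod_insert hi, Finset.sum_insert hi]
    exact (h i (Finset.mem_insert_self _ _)).mul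
      (ih fun j hj => h j (Finset.mem_insert_of_mem hj))

end Lead

section LeadingBlock

variable {R : Type*} [CommRing R] {n : ℕ}

/-- The leading principal `r × r` submatrix. -/
def leadingBlock (M : Matrix (Fin n) (Fin n) R) (r : ℕ) (hr : r ≤ n) : Matrix (Fin r) (Fin r) R :=
  M.submatrix (Fin.castLE hr) (Fin.castLE hr)

lemma cornerMinor_eq_det_leadingBlock (r : Fin n) (M : Matrix (Fin n) (Fin n) R) :
    cornerMinor r M = (leadingBlock M (r + 1) r.2).det := by
  rw [cornerMinor, twoBlockTriangular_det (corner r M) (fun i => i ≤ r)]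
  · have h1 : (corner r M).toSquareBlockProp (fun i => ¬ i ≤ r) = 1 := by
      ext ⟨i, hi⟩ ⟨j, hj⟩
      simp [toSquareBlockProp_def, corner, hi, one_apply]
    rw [h1, det_one, mul_one]
    let e : Fin (r + 1) ≃ {i : Fin n // i ≤ r} :=
      { toFun := fun i => ⟨Fin.castLE r.2 i, by
          rw [Fin.le_def]; simpa using Nat.lt_succ_iff.1 i.2⟩
        invFun := fun i => ⟨i.1, Nat.lt_succ_of_le i.2⟩
        left_inv := fun i => rfl
        right_inv := fun i => rfl }
    rw [← det_submatrix_equiv_self e]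
    congr 1
    ext i j
    have h2 : ∀ i : Fin (r + 1), Fin.castLE r.2 i ≤ r := fun i => (e i).2
    simp [toSquareBlockProp_def, corner, leadingBlock, e, h2]
  · intro i hi j hj
    rw [corner, of_apply, if_neg (fun h => hi h.1), if_neg]
    rintro rfl
    exact hi hj

lemma det_eq_of_hook {k : ℕ} (B : Matrix (Fin (k + 2)) (Fin (k + 2)) R)
    (hrow : ∀ j, j ≠ 0 → B 1 j = 0) (hcol : ∀ i, i ≠ 0 → B i 1 = 0) :
    B.det = -(B 1 0 * B 0 1) * (B.submatrix (fun i : Fin k => i.succ.succ) fun i : Fin k =>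
    i.succ.succ).det := by
  rw [det_succ_row B 1, Finset.sum_eq_single 0 (fun j _ hj => by rw [hrow j hj]; ring) (by simp),
    det_succ_column_zero, Finset.sum_eq_single 0]
  · have h1 : (B.submatrix (Fin.succAbove 1) (Fin.succAbove 0)) 0 0 = B 0 1 := by
      rw [submatrix_apply]; rfl
    rw [h1]
    have h2 : ((B.submatrix (Fin.succAbove 1) (Fin.succAbove 0)).submatrix (Fin.succAbove 0)
        Fin.succ) = B.submatrix (fun i : Fin k => i.succ.succ) fun i : Fin k => i.succ.succ := by
      ext i j
      simp only [submatrix_apply]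
      congr 1
    rw [h2]
    simp only [Fin.val_zero, Fin.val_one, add_zero, pow_one, pow_zero]
    ring
  · intro i _ hi
    rw [submatrix_apply]
    have : B (Fin.succAbove 1 i) (Fin.succAbove 0 0) = 0 := by
      refine hcol _ fun h => hi ?_
      have h3 : Fin.succAbove (1 : Fin (k + 2)) 0 = 0 := rfl
      exact Fin.succAbove_right_injective (h.trans h3.symm)
    rw [this]
    ring
  · simp

end LeadingBlock

section Laplace

/-- The nonzero terms of the Laplace expansion of a matrix of monomials, recorded as sign,
exponent and list of letters. -/
def laplaceTerms (E : ℕ → ℕ → Option (ℕ × ℕ)) : ℕ → ℕ → (ℕ → ℕ) → List (ℤ × ℕ × List ℕ)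
  | 0, _, _ => [(1, 0, [])]
  | n + 1, i, cols => (List.range (n + 1)).flatMap fun k =>
    match E i (cols k) with
    | none => []
    | some (l, e) =>
      (laplaceTerms E n (i + 1) fun j => if j < k then cols j else cols (j + 1)).map
        fun t => ((-1) ^ k * t.1, e + t.2.1, l :: t.2.2)

variable {R : Type*} [CommRing R]

/-- The monomial recorded by a term. -/
noncomputable def termVal (τ : ℕ → R) (t : ℤ × ℕ × List ℕ) : R[X] :=
  C ((t.1 : R) * (t.2.2.map τ).prod) * X ^ t.2.1

/-- The monomial recorded by an entry. -/
noncomputable def entryVal (τ : ℕ → R) : Option (ℕ × ℕ) → R[X]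
  | none => 0
  | some (l, e) => C (τ l) * X ^ e

lemma det_entryVal_eq_sum (τ : ℕ → R) (E : ℕ → ℕ → Option (ℕ × ℕ)) (n i : ℕ) (cols : ℕ → ℕ) :
    (of fun a b : Fin n => entryVal τ (E (i + a) (cols b))).det =
      ((laplaceTerms E n i cols).map (termVal τ)).sum := by
  induction n generalizing i cols with
  | zero => simp [laplaceTerms, termVal]
  | succ n ih =>
    rw [det_succ_row_zero, laplaceTerms, List.flatMap_def, List.map_flatten, List.sum_flatten,
      List.map_map, List.map_map]
    have h1 : ∀ f : ℕ → R[X], ((List.range (n + 1)).map f).sum = ∑ k : Fin (n + 1), f k :=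
      fun f => Finset.sum_range f
    rw [h1]
    refine Finset.sum_congr rfl fun k _ => ?_
    have h2 : (of fun a b : Fin (n + 1) => entryVal τ (E (i + a) (cols b))).submatrix Fin.succ
        (Fin.succAbove k) = of fun a b : Fin n => entryVal τ (E (i + 1 + a)
          ((fun j => if j < (k : ℕ) then cols j else cols (j + 1)) b)) := by
      ext1 a b
      rw [submatrix_apply, of_apply, of_apply]
      congr 2
      · simp only [Fin.val_succ]; omega
      · beta_reduce
        by_cases hb : (b : ℕ) < k
        · rw [if_pos hb, Fin.succAbove_of_castSucc_lt _ _ (by rw [Fin.lt_def]; exact hb)]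
          rfl
        · rw [if_neg hb, Fin.succAbove_of_le_castSucc _ _ (by
            rw [Fin.le_def]; exact not_lt.1 hb)]
          rfl
    have h3 := ih (i + 1) fun j => if j < (k : ℕ) then cols j else cols (j + 1)
    rw [h2, h3]
    simp only [Function.comp_apply, of_apply, Fin.val_zero, add_zero]
    rcases hE : E i (cols k) with _ | ⟨l, e⟩
    · simp [entryVal]
    · simp only [entryVal, List.map_map]
      rw [← List.sum_map_mul_left]
      congr 1
      refine List.map_congr_left fun t _ => ?_
      simp only [Function.comp_apply, termVal, List.map_cons, List.prod_cons]
      push_cast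
      simp only [C_mul, C_pow, C_neg, C_1, pow_add]
      ring

lemma hasTerm_sum_termVal (τ : ℕ → R) (D : ℕ) (L : List (ℤ × ℕ × List ℕ))
    (hL : ∀ t ∈ L, t.2.1 ≤ D) : HasTerm ((L.map (termVal τ)).sum) D
      (((L.filter fun t => t.2.1 = D).map fun t => (t.1 : R) * (t.2.2.map τ).prod).sum) := by
  induction L with
  | nil => exact HasTerm.zero D
  | cons t L ih =>
    have ht := hL t (by simp)
    have h1 := ih fun s hs => hL s (by simp [hs])
    rw [List.map_cons, List.sum_cons]
    have h2 : HasTerm (termVal τ t) D (if t.2.1 = D then (t.1 : R) * (t.2.2.map τ).prod else 0) :=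
      ⟨(natDegree_C_mul_X_pow_le _ _).trans ht, by
        rw [termVal, coeff_C_mul_X_pow]
        exact if_congr eq_comm rfl rfl⟩
    convert h2.add h1 using 1
    by_cases h : t.2.1 = D
    · simp [h]
    · simp [h]

end Laplace

lemma det_leadingBlock_of_hook {R : Type*} [CommRing R] {m : ℕ}
    (P : Matrix (Fin (m + 3)) (Fin (m + 3)) R) (Q : Matrix (Fin (m + 1)) (Fin (m + 1)) R)
    (hrow : ∀ b, b ≠ 0 → P 1 b = 0) (hcol : ∀ a, a ≠ 0 → P a 1 = 0)
    (hcore : ∀ a b : Fin (m + 1), P a.succ.succ b.succ.succ = Q a b) (k : ℕ) (hk : k ≤ m + 1) :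
    (leadingBlock P (k + 2) (by omega)).det = -(P 1 0 * P 0 1) * (leadingBlock Q k hk).det := by
  rw [det_eq_of_hook]
  · congr 2
    ext1 a b
    exact hcore (Fin.castLE hk a) (Fin.castLE hk b)
  · exact fun b hb => hrow _ fun h => hb (Fin.castLE_injective _ h)
  · exact fun b hb => hcol _ fun h => hb (Fin.castLE_injective _ h)

section Balanced

variable {K : Type*} [Field K] {m : ℕ}

/-- There are polynomial matrices such that the leading terms of the principal minors of the
conjugated powers of the diagonal matrix `t` do not depend on the exponent. -/
def IsBalanced (t : Fin (m + 1) → K) : Prop :=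
  ∃ (g h : Matrix (Fin (m + 1)) (Fin (m + 1)) K[X]) (D : ℕ → ℕ) (ε : ℕ → K), (∀ r, ε r ≠ 0) ∧
    ∀ (j r : ℕ) (hr : r < m),
      HasTerm (leadingBlock (g * diagonal (fun i => C (t i ^ j)) * h) (r + 1) (by omega)).det
        (D r) (ε r)

/-- Adjoining a pair of mutually inverse elements in front. -/
def consPair (x : K) (t : Fin (m + 1) → K) : Fin (m + 3) → K :=
  Fin.cons x (Fin.cons x⁻¹ t)

lemma IsBalanced.consPair {t : Fin (m + 1) → K} (ht : IsBalanced t) (h1 : t (Fin.last m) = 1)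
    {x : K} (hx : x ≠ 0) : IsBalanced (consPair x t) := by
  obtain ⟨g, h, D, ε, hε, hD⟩ := ht
  let e : Fin (m + 1) → K[X] := fun i => if i = Fin.last m then 1 else 0
  let g' : Matrix (Fin (m + 3)) (Fin (m + 3)) K[X] :=
    of (Fin.cons (Fin.cons 1 (Fin.cons 0 e)) (Fin.cons (Fin.cons 0 (Fin.cons 1 0))
      fun i => Fin.cons 0 (Fin.cons 0 (g i))))
  let h' : Matrix (Fin (m + 3)) (Fin (m + 3)) K[X] :=
    (of (Fin.cons (Fin.cons 0 (Fin.cons 1 e)) (Fin.cons (Fin.cons 1 (Fin.cons 0 0))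
      fun i => Fin.cons 0 (Fin.cons 0 (hᵀ i)))))ᵀ
  have hent : ∀ (j : ℕ) (a b : Fin (m + 3)),
      (g' * diagonal (fun i => C (_root_.consPair x t i ^ j)) * h') a b =
        g' a 0 * C (x ^ j) * h' 0 b + (g' a 1 * C (x⁻¹ ^ j) * h' 1 b +
          ∑ i : Fin (m + 1), g' a i.succ.succ * C (t i ^ j) * h' i.succ.succ b) := by
    intro j a b
    rw [mul_apply]
    simp_rw [mul_diagonal]
    rw [Fin.sum_univ_succ, Fin.sum_univ_succ]
    rfl
  have he : ∀ f : Fin (m + 1) → K[X], ∑ i, e i * f i = f (Fin.last m) := by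
    intro f
    simp [e]
  refine ⟨g', h', fun r => if r = 0 then 0 else if r = 1 then 0 else D (r - 2),
    fun r => if r = 0 then 1 else if r = 1 then -1 else -ε (r - 2), fun r => ?_,
    fun j r hr => ?_⟩
  · beta_reduce
    split_ifs <;> simp [hε]
  have hxj : x ^ j * x⁻¹ ^ j = 1 := by
    rw [← mul_pow, mul_inv_cancel₀ hx, one_pow]
  set P := g' * diagonal (fun i => C (_root_.consPair x t i ^ j)) * h' with hP
  have h00 : P 0 0 = 1 := by
    rw [hP, hent]
    simp [g', h', e, h1]
  have h01 : P 0 1 = C (x ^ j) := by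
    rw [hP, hent]
    simp [g', h']
  have h10 : P 1 0 = C (x⁻¹ ^ j) := by
    rw [hP, hent]
    simp [g', h']
  have hrow : ∀ b, b ≠ 0 → P 1 b = 0 := by
    intro b hb
    obtain ⟨b, rfl⟩ := Fin.exists_succ_eq_of_ne_zero hb
    rw [hP, hent]
    refine Fin.cases ?_ (fun b => ?_) b <;> simp [g', h']
  have hcol : ∀ a, a ≠ 0 → P a 1 = 0 := by
    intro a ha
    obtain ⟨a, rfl⟩ := Fin.exists_succ_eq_of_ne_zero ha
    rw [hP, hent]
    refine Fin.cases ?_ (fun a => ?_) a <;> simp [g', h']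
  have hcore : ∀ a b : Fin (m + 1), P a.succ.succ b.succ.succ =
      (g * diagonal (fun i => C (t i ^ j)) * h) a b := by
    intro a b
    rw [hP, hent, mul_apply]
    simp_rw [mul_diagonal]
    simp [g', h']
  rcases r with _ | _ | r
  · rw [show (leadingBlock P (0 + 1) (by omega)).det = 1 from (det_fin_one _).trans h00]
    simpa using HasTerm.one
  · have h2 := det_leadingBlock_of_hook P _ hrow hcol hcore 0 (by omega)
    rw [h01, h10, ← C_mul, mul_comm (x⁻¹ ^ j), hxj] at h2
    have h3 : (leadingBlock P (0 + 1 + 1) (by omega)).det = C (-1) := by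
      refine h2.trans ?_
      rw [det_fin_zero]
      simp
    rw [h3]
    exact HasTerm.C (-1 : K)
  · have h2 := det_leadingBlock_of_hook P _ hrow hcol hcore (r + 1) (by omega)
    rw [h01, h10, ← C_mul, mul_comm (x⁻¹ ^ j), hxj] at h2
    have h5 := (HasTerm.C (-1 : K)).mul (hD j r (by omega))
    have h6 : (leadingBlock P (r + 1 + 1 + 1) (by omega)).det = C (-1) *
        (leadingBlock (g * diagonal (fun i => C (t i ^ j)) * h) (r + 1) (by omega)).det := by
      refine h2.trans ?_
      simp
    rw [h6]
    simpa using h5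

end Balanced

section Table

/-- The letters, with exponents, at which both of two tables have an entry. -/
def commonLetters (n : ℕ) (A B : List (ℕ × ℕ)) : List (ℕ × ℕ) :=
  (List.range n).filterMap fun i =>
    match A.lookup i, B.lookup i with
    | some e, some e' => some (i, e + e')
    | _, _ => none

/-- The pattern of the product of a matrix with rows `A` and a matrix with columns `B`. -/
def tableEntry (n : ℕ) (A B : List (List (ℕ × ℕ))) (a b : ℕ) : Option (ℕ × ℕ) :=
  (commonLetters n (A.getD a []) (B.getD b [])).head?

/-- The monomial of a table at a letter. -/
noncomputable def tableVal (R : Type*) [CommRing R] (A : List (ℕ × ℕ)) (i : ℕ) : R[X] :=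
  match A.lookup i with
  | none => 0
  | some e => X ^ e

variable {K : Type*} [Field K] {m : ℕ}

lemma sum_map_filterMap {α β M : Type*} [AddCommMonoid M] (f : α → Option β) (v : Option β → M)
    (h0 : v none = 0) (l : List α) :
    ((l.filterMap f).map fun b => v (some b)).sum = (l.map fun a => v (f a)).sum := by
  induction l with
  | nil => rfl
  | cons a l ih =>
    rw [List.filterMap_cons, List.map_cons, List.sum_cons, ← ih]
    cases h : f a with
    | none => simp [h0]
    | some b => simp

lemma prod_map_pow_eq {t : ℕ → K} (j : ℕ) (L : List ℕ) :
    (L.map fun i => t i ^ j).prod = (L.map t).prod ^ j := by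
  induction L with
  | nil => simp
  | cons a l ih => simp [ih, mul_pow]

lemma sum_tableVal_eq (t : ℕ → K) (n : ℕ) (A B : List (ℕ × ℕ))
    (h : (commonLetters n A B).length ≤ 1) :
    ∑ i : Fin n, tableVal K A i * C (t i) * tableVal K B i =
      entryVal t (commonLetters n A B).head? := by
  have h1 : ∀ f : ℕ → K[X], ∑ i : Fin n, f i = ((List.range n).map f).sum :=
    fun f => (Finset.sum_range f).symm
  rw [h1 fun i => tableVal K A i * C (t i) * tableVal K B i]
  have h2 := sum_map_filterMap (fun i =>
    match A.lookup i, B.lookup i with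
    | some e, some e' => some (i, e + e')
    | _, _ => none) (entryVal t) rfl (List.range n)
  have h3 : ((commonLetters n A B).map fun b => entryVal t (some b)).sum =
      entryVal t (commonLetters n A B).head? := by
    match commonLetters n A B, h with
    | [], _ => rfl
    | [a], _ => simp
  rw [← h3]
  refine Eq.trans ?_ h2.symm
  congr 2
  ext1 i
  rw [tableVal, tableVal]
  cases A.lookup i <;> cases B.lookup i <;> simp [entryVal, pow_add]; ring

theorem isBalanced_of_table (t : ℕ → K) (A B : List (List (ℕ × ℕ)))
    (T : List (ℤ × ℕ × List ℕ))
    (hAB : ∀ a < m, ∀ b < m, (commonLetters (m + 1) (A.getD a []) (B.getD b [])).length ≤ 1)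
    (hle : ∀ r < m, ∀ s ∈ laplaceTerms (tableEntry (m + 1) A B) (r + 1) 0 id,
      s.2.1 ≤ (T.getD r (1, 0, [])).2.1)
    (hT : ∀ r < m, (laplaceTerms (tableEntry (m + 1) A B) (r + 1) 0 id).filter
      (fun s => s.2.1 = (T.getD r (1, 0, [])).2.1) = [T.getD r (1, 0, [])])
    (hsign : ∀ r < m, (T.getD r (1, 0, [])).1 = 1 ∨ (T.getD r (1, 0, [])).1 = -1)
    (hprod : ∀ r < m, ((T.getD r (1, 0, [])).2.2.map t).prod = 1) :
    IsBalanced fun i : Fin (m + 1) => t i := by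
  refine ⟨of fun a i => tableVal K (A.getD a []) i, of fun i b => tableVal K (B.getD b []) i,
    fun r => (T.getD r (1, 0, [])).2.1,
    fun r => if r < m then ((T.getD r (1, 0, [])).1 : K) else 1, fun r => ?_, fun j r hr => ?_⟩
  · beta_reduce
    split_ifs with hr
    · rcases hsign r hr with h | h <;> rw [h] <;> simp
    · exact one_ne_zero
  beta_reduce
  rw [if_pos hr]
  have h1 : leadingBlock ((of fun a i : Fin (m + 1) => tableVal K (A.getD a []) i) *
      diagonal (fun i : Fin (m + 1) => C (t i ^ j)) *
      (of fun i b : Fin (m + 1) => tableVal K (B.getD b []) i)) (r + 1) (by omega) =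
      of fun a b : Fin (r + 1) => entryVal (fun i => t i ^ j)
        (tableEntry (m + 1) A B (0 + a) (id b)) := by
    ext1 a b
    rw [leadingBlock, submatrix_apply, mul_apply]
    simp_rw [mul_diagonal]
    rw [of_apply, zero_add, tableEntry, ← sum_tableVal_eq (fun i => t i ^ j)]
    · rfl
    · exact hAB _ (by omega) _ (by simp only [id]; omega)
  rw [h1, det_entryVal_eq_sum]
  have h2 := hasTerm_sum_termVal (fun i => t i ^ j) _ _ (hle r hr)
  rw [hT r hr] at h2
  have h3 : ((T.getD r (1, 0, [])).2.2.map fun i => t i ^ j).prod = 1 := by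
    rw [prod_map_pow_eq, hprod r hr, one_pow]
  simpa only [List.map_cons, List.map_nil, List.sum_cons, List.sum_nil, h3, mul_one, add_zero]
    using h2

lemma isBalanced_six (t : ℕ → K) (h0 : t 5 = 1) (h1 : t 0 * t 1 = 1)
    (h2 : t 2 * t 3 * t 4 = 1) : IsBalanced fun i : Fin 6 => t i := by
  refine isBalanced_of_table (m := 5) t
    [[(5, 0), (0, 0), (2, 0)], [(1, 0), (3, 0)], [(4, 0)], [(5, 2), (2, 0)], [(1, 0)]]
    [[(5, 0), (1, 0), (4, 0)], [(0, 1), (3, 0)], [(2, 0)], [(4, 0)], [(0, 0)]]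
    [(1, 0, [5]), (-1, 1, [0, 1]), (-1, 0, [2, 3, 4]), (1, 2, [2, 3, 4, 5]),
      (1, 0, [0, 3, 4, 2, 1])]
    (by decide +kernel) (by decide +kernel) (by decide +kernel) (by decide +kernel) ?_
  intro r hr
  interval_cases r 
  · simpa using h0
  · simpa using h1
  · simpa [mul_assoc] using h2
  · simpa [h0, mul_assoc] using h2
  · simp
    linear_combination t 2 * t 3 * t 4 * h1 + h2

lemma isBalanced_ten (t : ℕ → K) (h0 : t 9 = 1) (h1 : t 0 * t 1 = 1) (h2 : t 2 * t 3 = 1)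
    (h3 : t 4 * t 5 * t 6 * t 7 * t 8 = 1) : IsBalanced fun i : Fin 10 => t i := by
  refine isBalanced_of_table (m := 9) t
    [[(9, 0), (1, 0), (8, 1)], [(0, 0), (7, 0)], [(9, 0), (3, 0), (6, 0)], [(2, 0), (5, 0)],
      [(4, 0)], [(1, 0), (6, 0)], [(7, 0)], [(1, 0)], [(5, 0)]]
    [[(9, 0), (0, 2), (5, 0)], [(1, 0), (7, 0)], [(0, 0), (2, 0), (4, 0)], [(3, 0), (8, 0)],
      [(6, 0)], [(9, 1), (0, 0)], [(1, 0)], [(0, 3), (2, 0)], [(3, 0)]]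
    [(1, 0, [9]), (-1, 2, [1, 0]), (1, 0, [1, 0, 9]), (1, 2, [1, 0, 3, 2]),
      (1, 1, [8, 7, 6, 5, 4]), (-1, 2, [8, 7, 9, 5, 4, 6]), (1, 1, [8, 0, 6, 5, 4, 1, 7]),
      (-1, 5, [8, 0, 9, 5, 4, 6, 7, 1]), (1, 1, [8, 0, 3, 2, 4, 6, 7, 1, 5])]
    (by decide +kernel) (by decide +kernel) (by decide +kernel) (by decide +kernel) ?_
  intro r hr
  interval_cases r 
  · simpa using h0
  · simp
    linear_combination h1
  · simp [h0]
    linear_combination h1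
  · simp
    linear_combination t 2 * t 3 * h1 + h2
  · simp
    linear_combination h3
  · simp [h0]
    linear_combination h3
  · simp
    linear_combination t 4 * t 5 * t 6 * t 7 * t 8 * h1 + h3
  · simp [h0]
    linear_combination t 4 * t 5 * t 6 * t 7 * t 8 * h1 + h3
  · simp
    linear_combination t 4 * t 5 * t 6 * t 7 * t 8 * t 2 * t 3 * h1 +
      t 4 * t 5 * t 6 * t 7 * t 8 * h2 + h3

end Table

section Pairs

variable {K : Type*} [Field K] {m : ℕ}

lemma prod_consPair {x : K} (hx : x ≠ 0) (t : Fin (m + 1) → K) :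
    ∏ i, consPair x t i = ∏ i, t i := by
  rw [consPair, Fin.prod_cons, Fin.prod_cons, ← mul_assoc, mul_inv_cancel₀ hx, one_mul]

lemma mem_range_consPair {x : K} {t : Fin (m + 1) → K} {y : K} :
    y ∈ Set.range (consPair x t) ↔ y = x ∨ y = x⁻¹ ∨ y ∈ Set.range t := by
  rw [consPair, Fin.range_cons, Set.mem_insert_iff, Fin.range_cons, Set.mem_insert_iff]

lemma injective_consPair {x : K} {t : Fin (m + 1) → K} (ht : Function.Injective t)
    (h1 : x ≠ x⁻¹) (h2 : x ∉ Set.range t) (h3 : x⁻¹ ∉ Set.range t) :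
    Function.Injective (consPair x t) := by
  rw [consPair, Fin.cons_injective_iff, Fin.cons_injective_iff, Fin.range_cons,
    Set.mem_insert_iff, not_or]
  exact ⟨⟨h1, h2⟩, h3, ht⟩

/-- A set of pairs of distinct mutually inverse elements. -/
structure IsPaired (S : Finset K) : Prop where
  zero_notMem : 0 ∉ S
  inv_mem : ∀ s ∈ S, s⁻¹ ∈ S
  ne_inv : ∀ s ∈ S, s ≠ s⁻¹

lemma IsPaired.erase [DecidableEq K] {S : Finset K} (hS : IsPaired S) (s : K) :
    IsPaired ((S.erase s).erase s⁻¹) where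
  zero_notMem := by simp [hS.zero_notMem]
  inv_mem y hy := by
    simp only [Finset.mem_erase] at hy ⊢
    exact ⟨fun h => hy.2.1 (inv_injective h), fun h => hy.1 (by rw [← h, inv_inv]),
      hS.inv_mem y hy.2.2⟩
  ne_inv y hy := hS.ne_inv y (Finset.mem_of_mem_erase (Finset.mem_of_mem_erase hy))

lemma IsPaired.card_erase [DecidableEq K] {S : Finset K} (hS : IsPaired S) {s : K} (hs : s ∈ S) :
    ((S.erase s).erase s⁻¹).card = S.card - 2 := by
  rw [Finset.card_erase_of_mem, Finset.card_erase_of_mem hs]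
  · rfl
  · exact Finset.mem_erase.2 ⟨(hS.ne_inv s hs).symm, hS.inv_mem s hs⟩

lemma IsPaired.eq_or_mem_iff [DecidableEq K] {S : Finset K} (hS : IsPaired S) {s : K} (hs : s ∈ S)
    {y : K} : y ∈ S ↔ y = s ∨ y = s⁻¹ ∨ y ∈ (S.erase s).erase s⁻¹ := by
  simp only [Finset.mem_erase]
  constructor
  · intro h
    by_cases h1 : y = s
    · exact Or.inl h1
    by_cases h2 : y = s⁻¹
    · exact Or.inr (Or.inl h2)
    exact Or.inr (Or.inr ⟨h2, h1, h⟩)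
  · rintro (rfl | rfl | h)
    · exact hs
    · exact hS.inv_mem _ hs
    · exact h.2.2

lemma exists_isBalanced_of_finset {t₀ : Fin (m + 1) → K} (h_inj : Function.Injective t₀)
    (h_last : t₀ (Fin.last m) = 1) (h_prod : ∏ i, t₀ i = 1) (h_bal : IsBalanced t₀) (H : ℕ)
    {S : Finset K} (hS : IsPaired S) (h_card : S.card = 2 * H)
    (h_disj : ∀ s ∈ S, s ∉ Set.range t₀) :
    ∃ t : Fin (m + 2 * H + 1) → K, Function.Injective t ∧ t (Fin.last _) = 1 ∧ ∏ i, t i = 1 ∧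
      (∀ y, y ∈ Set.range t ↔ y ∈ Set.range t₀ ∨ y ∈ S) ∧ IsBalanced t := by
  classical
  induction H generalizing S with
  | zero =>
    obtain rfl : S = ∅ := Finset.card_eq_zero.1 h_card
    exact ⟨t₀, h_inj, h_last, h_prod, by simp, h_bal⟩
  | succ H ih =>
    obtain ⟨s, hs⟩ : S.Nonempty := Finset.card_pos.1 (by omega)
    have hs0 : s ≠ 0 := fun h => hS.zero_notMem (h ▸ hs)
    obtain ⟨t, ht1, ht2, ht3, ht4, ht5⟩ := ih (hS.erase s) (by rw [hS.card_erase hs]; omega)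
      fun y hy => h_disj y ((hS.eq_or_mem_iff hs).2 (Or.inr (Or.inr hy)))
    refine ⟨consPair s t, injective_consPair ht1 (hS.ne_inv s hs) ?_ ?_, ht2,
      (prod_consPair hs0 t).trans ht3, fun y => ?_, ht5.consPair ht2 hs0⟩
    · rw [ht4]
      exact fun h => h.elim (h_disj s hs) fun h => by simp at h
    · rw [ht4]
      exact fun h => h.elim (h_disj _ (hS.inv_mem s hs)) fun h => by simp at h
    · refine mem_range_consPair.trans ?_
      rw [ht4, hS.eq_or_mem_iff hs]
      tauto

end Pairs

section LeadingCoefficient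

variable {K : Type*} [Field K] {N : ℕ}

/-- The sum over the powers of a balanced diagonal matrix only vanishes for a multiple of the
characteristic. -/
theorem IsBalanced.cast_eq_zero [Infinite K] {t : Fin (N + 1) → K} (ht : IsBalanced t)
    (a : Fin N → ℕ) (k : ℕ)
    (h0 : ∀ g h : Matrix (Fin (N + 1)) (Fin (N + 1)) K,
      ∑ j ∈ Finset.range k, minorProd a (g * diagonal (fun i => t i ^ j) * h) = 0) :
    (k : K) = 0 := by
  obtain ⟨g, h, D, ε, hε, hD⟩ := ht
  let P : ℕ → K[X] := fun j => minorProd a (g * diagonal (fun i => C (t i ^ j)) * h)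
  have h1 : ∀ j, HasTerm (P j) (∑ r : Fin N, a r * D r) (∏ r : Fin N, ε r ^ a r) := by
    intro j
    refine HasTerm.prod _ fun r _ => HasTerm.pow ?_ _
    rw [cornerMinor_eq_det_leadingBlock]
    exact hD j r r.2
  have h2 : ∑ j ∈ Finset.range k, P j = 0 := by
    refine Polynomial.funext fun x => ?_
    rw [eval_finsetSum, eval_zero, ← h0 (g.map (evalRingHom x)) (h.map (evalRingHom x))]
    refine Finset.sum_congr rfl fun j _ => ?_
    have h3 := minorProd_map a (evalRingHom x) (g * diagonal (fun i => C (t i ^ j)) * h)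
    rw [Matrix.map_mul, Matrix.map_mul, diagonal_map (map_zero _)] at h3
    simpa [P, Function.comp_def] using h3.symm
  have h3 := congrArg (fun Q => coeff Q (∑ r : Fin N, a r * D r)) h2
  simp only [finsetSum_coeff, coeff_zero] at h3
  rw [Finset.sum_congr rfl fun j _ => (h1 j).2, Finset.sum_const, Finset.card_range,
    nsmul_eq_mul] at h3
  exact (mul_eq_zero.1 h3).resolve_right (Finset.prod_ne_zero_iff.2 fun r _ => pow_ne_zero _ (hε r))

end LeadingCoefficient

section Pieces

variable {K : Type*} [Field K] {q N P : ℕ}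

/-- The orbit of `y` under the `q`-th power map has `N` elements. -/
def HasOrbit (q : ℕ) (y : K) (N : ℕ) : Prop := y ^ q ^ N = y ∧ ∀ d, y ^ q ^ d = y → N ∣ d

lemma HasOrbit.eq {y : K} {N' : ℕ} (h : HasOrbit q y N) (h' : HasOrbit q y N') : N = N' :=
  Nat.dvd_antisymm (h.2 _ h'.1) (h'.2 _ h.1)

lemma HasOrbit.one (q : ℕ) : HasOrbit q (1 : K) 1 :=
  ⟨one_pow _, fun _ _ => one_dvd _⟩

lemma IsPrimitiveRoot.hasOrbit {y : K} (hy : IsPrimitiveRoot y P) (hq : 0 < q)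
    (hw : IsWitness q N P) (hP : P ∣ q ^ N - 1) : HasOrbit q y N := by
  have h0 : y ≠ 0 := hy.ne_zero (by have := hw.one_lt; omega)
  have h1 : ∀ d, y ^ q ^ d = y ↔ P ∣ q ^ d - 1 := by
    intro d
    rw [← hy.pow_eq_one_iff_dvd]
    have h2 : y ^ q ^ d = y ^ (q ^ d - 1) * y := by
      rw [← pow_succ, Nat.sub_add_cancel (pow_pos hq _)]
    rw [h2]
    constructor
    · exact fun h => mul_right_cancel₀ h0 (by rw [h, one_mul])
    · exact fun h => by rw [h, one_mul]
  exact ⟨(h1 N).2 hP, fun d hd => hw.2 d ((h1 d).1 hd)⟩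

lemma IsPrimitiveRoot.pow_pow_injOn {ζ : K} (hζ : IsPrimitiveRoot ζ P) (hq : 0 < q)
    (hw : IsWitness q N P) (hP : P ∣ q ^ N - 1) {i j : ℕ} (hi : i < N) (hj : j < N)
    (h : ζ ^ q ^ i = ζ ^ q ^ j) : i = j := by
  wlog hij : i ≤ j
  · exact (this hζ hq hw hP hj hi h.symm (le_of_not_ge hij)).symm
  have h1 := (hζ.pow_of_coprime (q ^ i) (hw.coprime.symm.pow_left i)).hasOrbit hq hw hP
  have h2 := h1.2 (j - i) (by rw [← pow_mul, ← pow_add, Nat.add_sub_cancel' hij, ← h])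
  have := Nat.eq_zero_of_dvd_of_lt h2 (by omega)
  omega

end Pieces

section PairSets

variable {F : Type*} [Field F] [Fintype F]

local notation "qq" => Fintype.card F
local notation "KK" => AlgebraicClosure F

/-- A set of pairs of mutually inverse elements that is stable under the Frobenius map. -/
structure IsPairSet (S : Finset (AlgebraicClosure F)) : Prop extends IsPaired S where
  pow_card_mem : ∀ s ∈ S, s ^ qq ∈ S

lemma IsPairSet.union [DecidableEq KK] {S T : Finset KK} (hS : IsPairSet S) (hT : IsPairSet T) :
    IsPairSet (S ∪ T) where
  zero_notMem h := (Finset.mem_union.1 h).elim hS.zero_notMem hT.zero_notMem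
  inv_mem s h := Finset.mem_union.2 ((Finset.mem_union.1 h).imp (hS.inv_mem s) (hT.inv_mem s))
  ne_inv s h := (Finset.mem_union.1 h).elim (hS.ne_inv s) (hT.ne_inv s)
  pow_card_mem s h :=
    Finset.mem_union.2 ((Finset.mem_union.1 h).imp (hS.pow_card_mem s) (hT.pow_card_mem s))

lemma pow_card_eq_self_of_eq_inv {y : KK} (h0 : y ≠ 0) (h : y = y⁻¹) : y ^ qq = y := by
  have h1 : y * y = 1 := by
    nth_rewrite 2 [h]
    exact mul_inv_cancel₀ h0
  obtain ⟨c, rfl⟩ : ∃ c : F, algebraMap F KK c = y := by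
    rcases mul_self_eq_one_iff.1 h1 with h | h
    · exact ⟨1, by simp [h]⟩
    · exact ⟨-1, by simp [h]⟩
  rw [← map_pow, FiniteField.pow_card]

lemma exists_isPairSet {h : ℕ} (hh : 0 < h) :
    ∃ (S : Finset KK) (P : ℕ), IsPairSet S ∧ S.card = 2 * h ∧ (∀ s ∈ S, HasOrbit qq s (2 * h)) ∧
      IsWitness qq (2 * h) P ∧ (∀ s ∈ S, s ^ P = 1) ∧ ∀ s ∈ S, ∀ k, s ^ k = 1 → P ∣ k := by
  classical
  have hq : 1 < qq := Fintype.one_lt_card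
  obtain ⟨P, hw, hP⟩ := exists_isWitness_even (q := qq) hq hh
  have hP' : P ∣ qq ^ (2 * h) - 1 := by
    refine hP.trans ⟨qq ^ h - 1, ?_⟩
    rw [← Nat.sq_sub_sq, ← pow_mul, mul_comm h 2, one_pow]
  obtain ⟨ζ, hζ⟩ := exists_primitiveRoot_algebraicClosure (F := F) (by omega) hP'
  have hroot : ∀ i, IsPrimitiveRoot (ζ ^ qq ^ i) P := fun i =>
    hζ.pow_of_coprime _ (hw.coprime.symm.pow_left i)
  have horb : ∀ i, HasOrbit qq (ζ ^ qq ^ i) (2 * h) := fun i =>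
    (hroot i).hasOrbit (by omega) hw hP'
  have h0 : ∀ i, ζ ^ qq ^ i ≠ 0 := fun i => (hroot i).ne_zero (by have := hw.one_lt; omega)
  have hfr : ∀ i, ζ ^ qq ^ i ∈ (Finset.range (2 * h)).image fun i => ζ ^ qq ^ i := by
    intro i
    refine Finset.mem_image.2 ⟨i % (2 * h), Finset.mem_range.2 (Nat.mod_lt _ (by omega)), ?_⟩
    have h3 : ∀ d, (ζ ^ qq ^ (i % (2 * h))) ^ qq ^ (2 * h * d) = ζ ^ qq ^ (i % (2 * h)) := by
      intro d
      induction d with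
      | zero => simp
      | succ d ih => rw [mul_add, mul_one, pow_add, pow_mul _ (qq ^ _), ih, (horb _).1]
    have h4 := h3 (i / (2 * h))
    rw [← pow_mul, ← pow_add, Nat.mod_add_div] at h4
    exact h4.symm
  refine ⟨(Finset.range (2 * h)).image fun i => ζ ^ qq ^ i, P, ⟨⟨?_, ?_, ?_⟩, ?_⟩, ?_, ?_, hw, ?_,
    ?_⟩
  · intro h
    obtain ⟨i, -, hi⟩ := Finset.mem_image.1 h
    exact h0 i hi
  · rw [Finset.forall_mem_image]
    intro i _
    have h5 : (ζ ^ qq ^ i)⁻¹ = ζ ^ qq ^ (i + h) := by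
      refine inv_eq_of_mul_eq_one_right ?_
      rw [← pow_add, pow_add qq, ← mul_one_add, mul_comm, add_comm 1, pow_mul,
        (hζ.pow_eq_one_iff_dvd _).2 hP, one_pow]
    rw [h5]
    exact hfr _
  · rw [Finset.forall_mem_image]
    intro i _ hi
    have h6 := (horb i).2 1 (by rw [pow_one]; exact pow_card_eq_self_of_eq_inv (h0 i) hi)
    have := Nat.le_of_dvd one_pos h6
    omega
  · rw [Finset.forall_mem_image]
    intro i _
    rw [← pow_mul, ← pow_succ]
    exact hfr _
  · rw [Finset.card_image_of_injOn, Finset.card_range]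
    intro i hi j hj hij
    exact hζ.pow_pow_injOn (by omega) hw hP' (Finset.mem_range.1 hi) (Finset.mem_range.1 hj) hij
  · rw [Finset.forall_mem_image]
    exact fun i _ => horb i
  · rw [Finset.forall_mem_image]
    exact fun i _ => (hroot i).pow_eq_one
  · rw [Finset.forall_mem_image]
    exact fun i _ k hk => ((hroot i).pow_eq_one_iff_dvd k).1 hk

/-- An orbit with product one, in order. -/
lemma exists_orbit {n : ℕ} (hn : 3 ≤ n) :
    ∃ (ζ : KK) (P : ℕ), IsWitness qq n P ∧ ζ ^ qq ^ n = ζ ∧ (∀ i, HasOrbit qq (ζ ^ qq ^ i) n) ∧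
      (∀ i < n, ∀ j < n, ζ ^ qq ^ i = ζ ^ qq ^ j → i = j) ∧
      ∏ i ∈ Finset.range n, ζ ^ qq ^ i = 1 ∧ (∀ k, ζ ^ k = 1 ↔ P ∣ k) := by
  have hq : 1 < qq := Fintype.one_lt_card
  obtain ⟨P, hw, hP, hco⟩ := exists_isWitness_coprime (q := qq) hq hn
  obtain ⟨ζ, hζ⟩ := exists_primitiveRoot_algebraicClosure (F := F) (by omega) hP
  have horb : ∀ i, HasOrbit qq (ζ ^ qq ^ i) n := fun i =>
    (hζ.pow_of_coprime _ (hw.coprime.symm.pow_left i)).hasOrbit (by omega) hw hP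
  refine ⟨ζ, P, hw, by simpa using (horb 0).1, horb,
    fun i hi j hj h => hζ.pow_pow_injOn (by omega) hw hP hi hj h, ?_, hζ.pow_eq_one_iff_dvd⟩
  rw [Finset.prod_pow_eq_pow_sum, hζ.pow_eq_one_iff_dvd]
  refine hco.dvd_of_dvd_mul_left ?_
  rw [mul_geomSum]
  exact hP

end PairSets

section Cores

variable {K : Type*} [Field K] {q n : ℕ} {ζ : K}

/-- The orbit of `ζ` followed by `1`. -/
def orbitOne (q n : ℕ) (ζ : K) : Fin (n + 1) → K :=
  Fin.snoc (fun i : Fin n => ζ ^ q ^ (i : ℕ)) 1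

lemma orbitOne_last : orbitOne q n ζ (Fin.last n) = 1 := by
  rw [orbitOne, Fin.snoc_last]

lemma orbitOne_castSucc (i : Fin n) : orbitOne q n ζ i.castSucc = ζ ^ q ^ (i : ℕ) := by
  rw [orbitOne, Fin.snoc_castSucc]

lemma prod_orbitOne (h : ∏ i ∈ Finset.range n, ζ ^ q ^ i = 1) : ∏ i, orbitOne q n ζ i = 1 := by
  rw [Fin.prod_univ_castSucc, orbitOne_last, mul_one, ← h, ← Fin.prod_univ_eq_prod_range]
  exact Finset.prod_congr rfl fun i _ => orbitOne_castSucc i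

lemma mem_range_orbitOne {y : K} :
    y ∈ Set.range (orbitOne q n ζ) ↔ y = 1 ∨ ∃ i < n, y = ζ ^ q ^ i := by
  constructor
  · rintro ⟨i, rfl⟩
    refine Fin.lastCases ?_ (fun i => ?_) i
    · exact Or.inl orbitOne_last
    · exact Or.inr ⟨i, i.2, orbitOne_castSucc i⟩
  · rintro (rfl | ⟨i, hi, rfl⟩)
    · exact ⟨_, orbitOne_last⟩
    · exact ⟨_, orbitOne_castSucc ⟨i, hi⟩⟩

lemma injective_orbitOne (h : ∀ i < n, ∀ j < n, ζ ^ q ^ i = ζ ^ q ^ j → i = j)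
    (h1 : ∀ i < n, ζ ^ q ^ i ≠ 1) : Function.Injective (orbitOne q n ζ) := by
  intro i j
  refine Fin.lastCases ?_ (fun i => ?_) i <;> refine Fin.lastCases ?_ (fun j => ?_) j
  · exact fun _ => rfl
  · rw [orbitOne_last, orbitOne_castSucc]
    exact fun h => absurd h.symm (h1 j j.2)
  · rw [orbitOne_last, orbitOne_castSucc]
    exact fun h => absurd h (h1 i i.2)
  · rw [orbitOne_castSucc, orbitOne_castSucc]
    exact fun hij => congrArg _ (Fin.ext (h i i.2 j j.2 hij))

lemma isBalanced_orbitOne_zero : IsBalanced (orbitOne q 0 ζ) :=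
  ⟨1, 1, 0, 1, fun _ => one_ne_zero, fun _ _ hr => absurd hr (Nat.not_lt_zero _)⟩

lemma isBalanced_consPair_orbitOne {x : K} (hx : x ≠ 0)
    (h : ∏ i ∈ Finset.range 3, ζ ^ q ^ i = 1) : IsBalanced (consPair x (orbitOne q 3 ζ)) := by
  have h1 := isBalanced_six (fun i => consPair x (orbitOne q 3 ζ) (Fin.ofNat 6 i))
    (orbitOne_last (q := q) (n := 3) (ζ := ζ))
    (mul_inv_cancel₀ hx) (by
      rw [← h]
      simp only [Finset.prod_range_succ, Finset.prod_range_zero, one_mul]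
      rfl)
  simpa using h1

lemma isBalanced_consPair_consPair_orbitOne {x y : K} (hx : x ≠ 0) (hy : y ≠ 0)
    (h : ∏ i ∈ Finset.range 5, ζ ^ q ^ i = 1) :
    IsBalanced (consPair x (consPair y (orbitOne q 5 ζ))) := by
  have h1 := isBalanced_ten (fun i => consPair x (consPair y (orbitOne q 5 ζ)) (Fin.ofNat 10 i))
    (orbitOne_last (q := q) (n := 5) (ζ := ζ)) (mul_inv_cancel₀ hx)
    (mul_inv_cancel₀ hy) (by
      rw [← h]
      simp only [Finset.prod_range_succ, Finset.prod_range_zero, one_mul]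
      rfl)
  simpa using h1

lemma IsPaired.one_notMem {S : Finset K} (hS : IsPaired S) : 1 ∉ S :=
  fun h => hS.ne_inv 1 h inv_one.symm

lemma exists_isBalanced_zero {S : Finset K} {H : ℕ} (hS : IsPaired S) (h_card : S.card = 2 * H) :
    ∃ t : Fin (2 * H + 1) → K, Function.Injective t ∧ t (Fin.last _) = 1 ∧ ∏ i, t i = 1 ∧
      (∀ y, y ∈ Set.range t ↔ y = 1 ∨ y ∈ S) ∧ IsBalanced t := by
  have h_range : ∀ y : K, y ∈ Set.range (orbitOne 0 0 (0 : K)) ↔ y = 1 := fun y =>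
    mem_range_orbitOne.trans (by simp)
  obtain ⟨t, h1, h2, h3, h4, h5⟩ := exists_isBalanced_of_finset (t₀ := orbitOne 0 0 (0 : K))
    (fun i j _ => Subsingleton.elim (α := Fin 1) i j) orbitOne_last (prod_orbitOne rfl)
    isBalanced_orbitOne_zero H hS h_card
    fun s hs h => hS.one_notMem ((h_range s).1 h ▸ hs)
  have key : ∀ M, M = 2 * H → ∀ t : Fin (M + 1) → K, Function.Injective t → t (Fin.last _) = 1 →
      ∏ i, t i = 1 → (∀ y, y ∈ Set.range t ↔ y ∈ Set.range (orbitOne 0 0 (0 : K)) ∨ y ∈ S) →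
      IsBalanced t → ∃ t : Fin (2 * H + 1) → K, Function.Injective t ∧ t (Fin.last _) = 1 ∧
        ∏ i, t i = 1 ∧ (∀ y, y ∈ Set.range t ↔ y = 1 ∨ y ∈ S) ∧ IsBalanced t := by
    rintro _ rfl t h1 h2 h3 h4 h5
    exact ⟨t, h1, h2, h3, fun y => by rw [h4, h_range], h5⟩
  exact key _ (by omega) t h1 h2 h3 h4 h5

lemma exists_isBalanced_three {S : Finset K} {H : ℕ} (hS : IsPaired S)
    (h_card : S.card = 2 * (H + 1))
    (h_inj : ∀ i < 3, ∀ j < 3, ζ ^ q ^ i = ζ ^ q ^ j → i = j) (h_one : ∀ i < 3, ζ ^ q ^ i ≠ 1)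
    (h_prod : ∏ i ∈ Finset.range 3, ζ ^ q ^ i = 1) (h_disj : ∀ i < 3, ζ ^ q ^ i ∉ S) :
    ∃ t : Fin (5 + 2 * H + 1) → K, Function.Injective t ∧ t (Fin.last _) = 1 ∧ ∏ i, t i = 1 ∧
      (∀ y, y ∈ Set.range t ↔ y = 1 ∨ (∃ i < 3, y = ζ ^ q ^ i) ∨ y ∈ S) ∧ IsBalanced t := by
  classical
  obtain ⟨x, hx⟩ : S.Nonempty := Finset.card_pos.1 (by omega)
  have hx0 : x ≠ 0 := fun h => hS.zero_notMem (h ▸ hx)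
  have hdis : ∀ s ∈ S, s ∉ Set.range (orbitOne q 3 ζ) := by
    intro s hs h
    rcases mem_range_orbitOne.1 h with rfl | ⟨i, hi, rfl⟩
    · exact hS.one_notMem hs
    · exact h_disj i hi hs
  obtain ⟨t, h1, h2, h3, h4, h5⟩ := exists_isBalanced_of_finset
    (t₀ := consPair x (orbitOne q 3 ζ))
    (injective_consPair (injective_orbitOne h_inj h_one) (hS.ne_inv x hx) (hdis x hx)
      (hdis _ (hS.inv_mem x hx))) (orbitOne_last (q := q) (n := 3) (ζ := ζ))
    ((prod_consPair hx0 _).trans (prod_orbitOne h_prod))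
    (isBalanced_consPair_orbitOne hx0 h_prod) H (hS.erase x) (by rw [hS.card_erase hx]; omega) (by
      intro s hs h
      simp only [Finset.mem_erase] at hs
      rcases mem_range_consPair.1 h with h | h | h
      · exact hs.2.1 h
      · exact hs.1 h
      · exact hdis s hs.2.2 h)
  refine ⟨t, h1, h2, h3, fun y => ?_, h5⟩
  rw [h4, mem_range_consPair, mem_range_orbitOne, hS.eq_or_mem_iff hx]
  simp only [or_left_comm, or_assoc]

lemma exists_isBalanced_five {S : Finset K} {H : ℕ} (hS : IsPaired S)
    (h_card : S.card = 2 * (H + 2))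
    (h_inj : ∀ i < 5, ∀ j < 5, ζ ^ q ^ i = ζ ^ q ^ j → i = j) (h_one : ∀ i < 5, ζ ^ q ^ i ≠ 1)
    (h_prod : ∏ i ∈ Finset.range 5, ζ ^ q ^ i = 1) (h_disj : ∀ i < 5, ζ ^ q ^ i ∉ S) :
    ∃ t : Fin (9 + 2 * H + 1) → K, Function.Injective t ∧ t (Fin.last _) = 1 ∧ ∏ i, t i = 1 ∧
      (∀ y, y ∈ Set.range t ↔ y = 1 ∨ (∃ i < 5, y = ζ ^ q ^ i) ∨ y ∈ S) ∧ IsBalanced t := by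
  classical
  obtain ⟨x, hx⟩ : S.Nonempty := Finset.card_pos.1 (by omega)
  have hc := hS.card_erase hx
  have hS' := hS.erase x
  have hmem := fun y => hS.eq_or_mem_iff hx (y := y)
  have hne : ∀ y ∈ (S.erase x).erase x⁻¹, y ≠ x ∧ y ≠ x⁻¹ ∧ y ∈ S := by
    intro y hy
    simp only [Finset.mem_erase] at hy
    exact ⟨hy.2.1, hy.1, hy.2.2⟩
  generalize (S.erase x).erase x⁻¹ = T at hc hS' hmem hne
  obtain ⟨y, hy⟩ : T.Nonempty := Finset.card_pos.1 (by omega)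
  have hx0 : x ≠ 0 := fun h => hS.zero_notMem (h ▸ hx)
  have hy0 : y ≠ 0 := fun h => hS'.zero_notMem (h ▸ hy)
  have hdis : ∀ s ∈ S, s ∉ Set.range (orbitOne q 5 ζ) := by
    intro s hs h
    rcases mem_range_orbitOne.1 h with rfl | ⟨i, hi, rfl⟩
    · exact hS.one_notMem hs
    · exact h_disj i hi hs
  have hdis' : ∀ s ∈ S, s ∉ T → s ∉ Set.range (consPair y (orbitOne q 5 ζ)) := by
    intro s hs hsT h
    rcases mem_range_consPair.1 h with rfl | rfl | h
    · exact hsT hy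
    · exact hsT (hS'.inv_mem _ hy)
    · exact hdis s hs h
  obtain ⟨t, h1, h2, h3, h4, h5⟩ := exists_isBalanced_of_finset
    (t₀ := consPair x (consPair y (orbitOne q 5 ζ)))
    (injective_consPair (injective_consPair (injective_orbitOne h_inj h_one) (hS'.ne_inv y hy)
      (hdis y (hne y hy).2.2) (hdis _ (hne _ (hS'.inv_mem y hy)).2.2)) (hS.ne_inv x hx)
      (hdis' x hx fun h => (hne x h).1 rfl)
      (hdis' _ (hS.inv_mem x hx) fun h => (hne _ h).2.1 rfl)) (orbitOne_last (q := q) (n :=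
        5) (ζ := ζ))
    ((prod_consPair hx0 _).trans ((prod_consPair hy0 _).trans (prod_orbitOne h_prod)))
    (isBalanced_consPair_consPair_orbitOne hx0 hy0 h_prod) H (hS'.erase y)
    (by rw [hS'.card_erase hy]; omega) (by
      intro s hs h
      simp only [Finset.mem_erase] at hs
      have hs' := hne s hs.2.2
      rcases mem_range_consPair.1 h with h | h | h
      · exact hs'.1 h
      · exact hs'.2.1 h
      rcases mem_range_consPair.1 h with h | h | h
      · exact hs.2.1 h
      · exact hs.1 h
      · exact hdis s hs'.2.2 h)
  refine ⟨t, h1, h2, h3, fun z => ?_, h5⟩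
  rw [h4, mem_range_consPair, mem_range_consPair, mem_range_orbitOne, hmem,
    hS'.eq_or_mem_iff hy]
  simp only [or_left_comm, or_assoc]

end Cores

section DiagonalSums

variable {F : Type*} [Field F] [Fintype F] {N : ℕ}

local notation "qq" => Fintype.card F
local notation "KK" => AlgebraicClosure F

/-- The product of powers of leading minors with exponents `a` is annihilated by the sums over
powers of elements whose order is not a proper divisor of an order divisible by `p`. -/
def IsAnnihilated (F : Type*) [Field F] [Fintype F] (p : ℕ) (a : Fin N → ℕ) : Prop :=
  (∀ r, a r ≤ Fintype.card F - 1) ∧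
  ∀ x, p * orderOf (toPSL (N + 1) F x) ∉
      groupSpectrum (ProjectiveSpecialLinearGroup (Fin (N + 1)) F) →
    ∀ g h : Matrix (Fin (N + 1)) (Fin (N + 1)) F, g.det = 1 → h.det = 1 →
      ∑ j ∈ Finset.range (orderOf (toPSL (N + 1) F x)), minorProd a (g * x.1 ^ j * h) = 0

variable (p : ℕ) [Fact p.Prime] [CharP F p] {a : Fin N → ℕ}

lemma IsAnnihilated.exists_sum_diagonal (ha : IsAnnihilated F p a) {t : Fin (N + 1) → KK}
    (ht : Function.Injective t) (hfr : ∀ i, ∃ j, t j = t i ^ qq) (hdet : ∏ i, t i = 1)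
    (hω : ∀ k, (∀ i j, t i ^ k = t j ^ k) →
      p * k ∉ groupSpectrum (ProjectiveSpecialLinearGroup (Fin (N + 1)) F)) :
    ∃ k, (∀ m, (∀ i j, t i ^ m = t j ^ m) ↔ k ∣ m) ∧
      ∀ g h : Matrix (Fin (N + 1)) (Fin (N + 1)) KK,
        ∑ j ∈ Finset.range k, minorProd a (g * diagonal (fun i => t i ^ j) * h) = 0 := by
  obtain ⟨x, P, P', h1, h2, hx⟩ := exists_SL_diagonal (F := F) t ht hfr hdet
  have hk := fun m => (toPSL_pow_eq_one_iff_of_diagonal h1 h2 hx m).symm.trans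
    orderOf_dvd_iff_pow_eq_one.symm
  refine ⟨orderOf (toPSL (N + 1) F x), hk, fun g h => ?_⟩
  have h3 := sum_minorProd_mul_mul_eq_zero (K := KK) p (Finset.range (orderOf (toPSL (N + 1) F x)))
    ha.1 (fun j => x.1 ^ j) (ha.2 x (hω _ ((hk _).2 dvd_rfl))) (g * P') (P * h)
  rw [← h3]
  refine Finset.sum_congr rfl fun j _ => ?_
  have h4 : (x.1 ^ j).map (algebraMap F KK) = P * diagonal (fun i => t i ^ j) * P' :=
    map_pow_of_diagonal h1 h2 hx j
  rw [h4]
  congr 1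
  calc g * diagonal (fun i => t i ^ j) * h
      = g * (P' * P) * diagonal (fun i => t i ^ j) * (P' * P) * h := by rw [h2]; simp
    _ = _ := by simp only [Matrix.mul_assoc]

lemma IsAnnihilated.false_of_isBalanced (ha : IsAnnihilated F p a) {t : Fin (N + 1) → KK}
    (ht : Function.Injective t) (hfr : ∀ i, t i ^ qq ∈ Set.range t) (hdet : ∏ i, t i = 1)
    (hlast : t (Fin.last N) = 1) (hbal : IsBalanced t)
    {E : ℕ} (hE : ¬ p ∣ E) (htE : ∀ i, t i ^ E = 1)
    (hω : ∀ k, (∀ i, t i ^ k = 1) →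
      p * k ∉ groupSpectrum (ProjectiveSpecialLinearGroup (Fin (N + 1)) F)) : False := by
  have hone : ∀ k, (∀ i j, t i ^ k = t j ^ k) → ∀ i, t i ^ k = 1 := fun k h i => by
    rw [h i (Fin.last N), hlast, one_pow]
  obtain ⟨k, hk, hsum⟩ := ha.exists_sum_diagonal p ht hfr hdet fun k h => hω k (hone k h)
  have h1 := hbal.cast_eq_zero a k hsum
  have : CharP KK p := charP_of_injective_algebraMap (algebraMap F KK).injective p
  rw [CharP.cast_eq_zero_iff KK p] at h1
  exact hE (h1.trans ((hk E).1 fun i j => by rw [htE, htE]))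

lemma IsWitness.not_dvd {M P : ℕ} (hw : IsWitness qq M P) : ¬ p ∣ P := by
  intro h
  have hpq : p ∣ qq := by
    rw [← CharP.cast_eq_zero_iff F p]
    exact FiniteField.cast_card_eq_zero F
  have := Nat.dvd_gcd h hpq
  rw [hw.coprime] at this
  exact (Fact.out : p.Prime).one_lt.ne' (Nat.dvd_one.1 this)

lemma IsAnnihilated.false_of_odd {H : ℕ} (hH : 0 < H) {a : Fin (2 * H) → ℕ}
    (ha : IsAnnihilated F p a) : False := by
  obtain ⟨S, P, hS, h_card, -, hw, hSP, hPS⟩ := exists_isPairSet (F := F) hH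
  obtain ⟨t, h1, h2, h3, h4, h5⟩ := exists_isBalanced_zero hS.toIsPaired h_card
  have h6 : ∀ i, t i = 1 ∨ t i ∈ S := fun i => (h4 _).1 ⟨i, rfl⟩
  refine ha.false_of_isBalanced p h1 (fun i => (h4 _).2 ?_) h3 h2 h5 (hw.not_dvd p) (fun i => ?_)
    fun k hk => ?_
  · rcases h6 i with h | h
    · exact Or.inl (by rw [h, one_pow])
    · exact Or.inr (hS.pow_card_mem _ h)
  · rcases h6 i with h | h
    · rw [h, one_pow]
    · exact hSP _ h
  · obtain ⟨s, hs⟩ : S.Nonempty := Finset.card_pos.1 (by omega)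
    obtain ⟨i, rfl⟩ := (h4 s).2 (Or.inr hs)
    exact mul_notMem_groupSpectrum_one p hw (hPS _ hs k (hk i)) (by omega) le_rfl

end DiagonalSums

section EvenDegree

variable {F : Type*} [Field F] [Fintype F] {N : ℕ}

local notation "qq" => Fintype.card F
local notation "KK" => AlgebraicClosure F

variable (p : ℕ) [Fact p.Prime] [CharP F p]

lemma IsAnnihilated.false_of_orbit {a : Fin N → ℕ} (ha : IsAnnihilated F p a) {S : Finset KK}
    (hS : IsPairSet S) {n P : ℕ} (hn : 0 < n) {ζ : KK} (hfix : ζ ^ qq ^ n = ζ)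
    (hζ : ∀ k, ζ ^ k = 1 ↔ P ∣ k) {t : Fin (N + 1) → KK} (h1 : Function.Injective t)
    (h2 : t (Fin.last N) = 1) (h3 : ∏ i, t i = 1)
    (h4 : ∀ y, y ∈ Set.range t ↔ y = 1 ∨ (∃ i < n, y = ζ ^ qq ^ i) ∨ y ∈ S) (h5 : IsBalanced t)
    {E : ℕ} (hE : ¬ p ∣ E) (hSE : ∀ s ∈ S, s ^ E = 1) (hP : ¬ p ∣ P)
    (hω : ∀ k, P ∣ k → (∀ s ∈ S, s ^ k = 1) →
      p * k ∉ groupSpectrum (ProjectiveSpecialLinearGroup (Fin (N + 1)) F)) : False := by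
  have h6 : ∀ i, t i = 1 ∨ (∃ j < n, t i = ζ ^ qq ^ j) ∨ t i ∈ S := fun i => (h4 _).1 ⟨i, rfl⟩
  refine ha.false_of_isBalanced p h1 (fun i => (h4 _).2 ?_) h3 h2 h5 (E := P * E)
    (fun h => ((Fact.out : p.Prime).dvd_mul.1 h).elim hP hE) (fun i => ?_) fun k hk => ?_
  · rcases h6 i with h | ⟨j, hj, h⟩ | h
    · exact Or.inl (by rw [h, one_pow])
    · refine Or.inr (Or.inl ?_)
      rw [h, ← pow_mul, ← pow_succ]
      rcases Nat.lt_or_ge (j + 1) n with hj' | hj'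
      · exact ⟨j + 1, hj', rfl⟩
      · exact ⟨0, hn, by rw [show j + 1 = n by omega, hfix, pow_zero, pow_one]⟩
    · exact Or.inr (Or.inr (hS.pow_card_mem _ h))
  · rcases h6 i with h | ⟨j, hj, h⟩ | h
    · rw [h, one_pow]
    · rw [h, ← pow_mul, mul_comm, mul_assoc, pow_mul, (hζ P).2 dvd_rfl, one_pow]
    · rw [mul_comm, pow_mul, hSE _ h, one_pow]
  · refine hω k ((hζ k).1 ?_) fun s hs => ?_
    · obtain ⟨i, hi⟩ := (h4 (ζ ^ qq ^ 0)).2 (Or.inr (Or.inl ⟨0, hn, rfl⟩))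
      rw [pow_zero, pow_one] at hi
      rw [← hi, hk]
    · obtain ⟨i, rfl⟩ := (h4 s).2 (Or.inr (Or.inr hs))
      exact hk i

lemma IsAnnihilated.false_of_three {H : ℕ} (hH : ¬ 3 ∣ H + 1) {a : Fin (5 + 2 * H) → ℕ}
    (ha : IsAnnihilated F p a) : False := by
  obtain ⟨S, P, hS, h_card, horb, hw, hSP, hPS⟩ :=
    exists_isPairSet (F := F) (h := H + 1) (by omega)
  obtain ⟨ζ, P', hw', hfix, horb', hinj, hprod, hζ⟩ := exists_orbit (F := F) le_rfl
  obtain ⟨t, h1, h2, h3, h4, h5⟩ := exists_isBalanced_three hS.toIsPaired h_card hinj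
    (fun i _ h => absurd ((horb' i).eq (h ▸ HasOrbit.one _)) (by norm_num)) hprod
    (fun i _ h => absurd ((horb' i).eq (horb _ h)) (by omega))
  refine ha.false_of_orbit p hS (by norm_num) hfix hζ h1 h2 h3 h4 h5 (hw.not_dvd p) hSP
    (hw'.not_dvd p) fun k hk hSk => ?_
  obtain ⟨s, hs⟩ : S.Nonempty := Finset.card_pos.1 (by omega)
  refine mul_notMem_groupSpectrum_two p hw' hw hk (hPS s hs k (hSk s hs)) (by norm_num) (by omega)
    (by omega) ?_
  rw [Nat.Coprime.lcm_eq_mul]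
  · omega
  · exact (Nat.Prime.coprime_iff_not_dvd Nat.prime_three).2 (by omega)

lemma IsAnnihilated.false_of_five {H : ℕ} (hH : ¬ 5 ∣ H + 2) {a : Fin (9 + 2 * H) → ℕ}
    (ha : IsAnnihilated F p a) : False := by
  obtain ⟨S, P, hS, h_card, horb, hw, hSP, hPS⟩ :=
    exists_isPairSet (F := F) (h := H + 2) (by omega)
  obtain ⟨ζ, P', hw', hfix, horb', hinj, hprod, hζ⟩ :=
    exists_orbit (F := F) (n := 5) (by norm_num)
  obtain ⟨t, h1, h2, h3, h4, h5⟩ := exists_isBalanced_five hS.toIsPaired h_card hinj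
    (fun i _ h => absurd ((horb' i).eq (h ▸ HasOrbit.one _)) (by norm_num)) hprod
    (fun i _ h => absurd ((horb' i).eq (horb _ h)) (by omega))
  refine ha.false_of_orbit p hS (by norm_num) hfix hζ h1 h2 h3 h4 h5 (hw.not_dvd p) hSP
    (hw'.not_dvd p) fun k hk hSk => ?_
  obtain ⟨s, hs⟩ : S.Nonempty := Finset.card_pos.1 (by omega)
  refine mul_notMem_groupSpectrum_two p hw' hw hk (hPS s hs k (hSk s hs)) (by norm_num) (by omega)
    (by omega) ?_
  rw [Nat.Coprime.lcm_eq_mul]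
  · omega
  · exact (Nat.Prime.coprime_iff_not_dvd Nat.prime_five).2 (by omega)

lemma lcm_eq_of_gcd_eq_two {a b : ℕ} (h : Nat.gcd a b = 2) : 2 * Nat.lcm a b = a * b := by
  rw [← h, Nat.gcd_mul_lcm]

lemma IsAnnihilated.false_of_five_six {k : ℕ} {a : Fin (9 + 2 * (15 * k + 3)) → ℕ}
    (ha : IsAnnihilated F p a) : False := by
  classical
  obtain ⟨S, P, hS, h_card, horb, hw, hSP, hPS⟩ :=
    exists_isPairSet (F := F) (h := 15 * k + 2) (by omega)
  obtain ⟨S', Q, hS', h_card', horb₂, hw₂, hSQ, hQS⟩ :=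
    exists_isPairSet (F := F) (h := 3) (by omega)
  obtain ⟨ζ, P', hw', hfix, horb', hinj, hprod, hζ⟩ :=
    exists_orbit (F := F) (n := 5) (by norm_num)
  have hc : (S ∪ S').card = 2 * (15 * k + 3 + 2) := by
    rw [Finset.card_union_of_disjoint, h_card, h_card']
    · ring
    · rw [Finset.disjoint_left]
      exact fun s h h' => absurd ((horb s h).eq (horb₂ s h')) (by omega)
  obtain ⟨t, h1, h2, h3, h4, h5⟩ := exists_isBalanced_five (hS.union hS').toIsPaired hc hinj
    (fun i _ h => absurd ((horb' i).eq (h ▸ HasOrbit.one _)) (by norm_num)) hprod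
    (fun i _ h => (Finset.mem_union.1 h).elim
      (fun h => absurd ((horb' i).eq (horb _ h)) (by omega))
      fun h => absurd ((horb' i).eq (horb₂ _ h)) (by omega))
  refine ha.false_of_orbit p (hS.union hS') (by norm_num) hfix hζ h1 h2 h3 h4 h5 (E := P * Q)
    (fun h => ((Fact.out : p.Prime).dvd_mul.1 h).elim (hw.not_dvd p) (hw₂.not_dvd p))
    (fun s hs => ?_) (hw'.not_dvd p) fun m hm hSm => ?_
  · rcases Finset.mem_union.1 hs with h | h
    · rw [pow_mul, hSP s h, one_pow]
    · rw [mul_comm, pow_mul, hSQ s h, one_pow]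
  obtain ⟨s, hs⟩ : S.Nonempty := Finset.card_pos.1 (by omega)
  obtain ⟨s', hs'⟩ : S'.Nonempty := Finset.card_pos.1 (by omega)
  have e1 : 2 * (15 * k + 2) = 4 + 30 * k := by ring
  have g1 : Nat.lcm 5 (2 * 3) = 30 := by decide
  have g2 : Nat.gcd (2 * 3) (4 + 30 * k) = 2 := by
    rw [show 4 + 30 * k = 4 + 2 * 3 * (5 * k) by ring, Nat.gcd_add_mul_left_right]
    decide
  have g3 : Nat.Coprime 5 (4 + 30 * k) :=
    (Nat.Prime.coprime_iff_not_dvd Nat.prime_five).2 (by omega)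
  have g4 : Nat.gcd 30 (4 + 30 * k) = 2 := by
    rw [Nat.gcd_add_mul_left_right]
    decide
  have l2 := lcm_eq_of_gcd_eq_two g2
  have l4 := lcm_eq_of_gcd_eq_two g4
  rw [e1] at hw
  refine mul_notMem_groupSpectrum_three p hw' hw₂ hw hm
    (hQS s' hs' m (hSm s' (Finset.mem_union_right _ hs')))
    (hPS s hs m (hSm s (Finset.mem_union_left _ hs))) (by norm_num) (by norm_num) (by omega)
    (by omega) ?_ ?_ ?_ ?_
  · omega
  · rw [g3.lcm_eq_mul]
    omega
  · rw [g1]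
    omega
  · rw [g1]
    omega

/-- There is no annihilated product of minors in dimension different from two and four. -/
theorem IsAnnihilated.false_of_ne {a : Fin N → ℕ} (ha : IsAnnihilated F p a) (h0 : N ≠ 0)
    (h1 : N ≠ 1) (h3 : N ≠ 3) : False := by
  rcases Nat.even_or_odd N with h | h
  · obtain ⟨H, rfl⟩ := h.exists_two_nsmul
    exact IsAnnihilated.false_of_odd p (H := H) (by simp at h0; omega) ha
  obtain ⟨H, rfl⟩ : ∃ H, N = 5 + 2 * H := by
    obtain ⟨H, rfl⟩ := h
    exact ⟨H - 2, by omega⟩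
  by_cases hH : 3 ∣ H + 1
  · obtain ⟨H', rfl⟩ : ∃ H', H = H' + 2 := ⟨H - 2, by omega⟩
    have e : 5 + 2 * (H' + 2) = 9 + 2 * H' := by ring
    by_cases hH' : 5 ∣ H' + 2
    · obtain ⟨k, rfl⟩ : ∃ k, H' = 15 * k + 3 := ⟨(H' - 3) / 15, by omega⟩
      revert ha
      revert a
      rw [e]
      exact fun ha => ha.false_of_five_six p
    · revert ha
      revert a
      rw [e]
      exact fun ha => ha.false_of_five p hH'
  · exact ha.false_of_three p hH

end EvenDegree

section LowDimension

variable {F : Type*} [Field F] [Fintype F] {N : ℕ}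

local notation "qq" => Fintype.card F
local notation "KK" => AlgebraicClosure F

lemma IsAnnihilated.ne_zero_of_charP_two [CharP F 2] {h : ℕ} (hN : N + 1 = 2 * h)
    {a : Fin N → ℕ} (ha : IsAnnihilated F 2 a) : a ≠ 0 := by
  rintro rfl
  obtain ⟨S, P, hS, h_card, -, hw, hSP, hPS⟩ := exists_isPairSet (F := F) (h := h) (by omega)
  have h2 : ¬ 2 ∣ P := hw.not_dvd 2
  let e : Fin (N + 1) ≃ S := (S.equivFinOfCardEq (by omega)).symm
  have hinv : ∀ i, ∃ j, (e j : KK) = (e i : KK)⁻¹ := fun i =>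
    ⟨e.symm ⟨_, hS.inv_mem _ (e i).2⟩, by simp⟩
  have hpow : ∀ k, (∀ i j, (e i : KK) ^ k = (e j : KK) ^ k) → P ∣ k := by
    intro k hk
    obtain ⟨j, hj⟩ := hinv 0
    have h3 := hk 0 j
    have h0 : (e 0 : KK) ≠ 0 := fun h => hS.zero_notMem (h ▸ (e 0).2)
    rw [hj, inv_pow] at h3
    have h4 : (e 0 : KK) ^ (2 * k) = 1 := by
      rw [two_mul, pow_add]
      nth_rewrite 2 [h3]
      exact mul_inv_cancel₀ (pow_ne_zero _ h0)
    exact ((Nat.coprime_comm.1 ((Nat.Prime.coprime_iff_not_dvd Nat.prime_two).2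
      h2))).dvd_of_dvd_mul_left
      (hPS _ (e 0).2 _ h4)
  obtain ⟨k, hk, hsum⟩ := ha.exists_sum_diagonal 2 (t := fun i => (e i : KK))
    (Subtype.val_injective.comp e.injective)
    (fun i => ⟨e.symm ⟨_, hS.pow_card_mem _ (e i).2⟩, by simp⟩)
    (by
      rw [e.prod_comp (fun s : S => (s : KK)), Finset.prod_coe_sort S (fun s => s)]
      refine Finset.prod_involution (fun s _ => s⁻¹) (fun s hs => ?_) (fun s hs _ h => ?_)
        (fun s hs => hS.inv_mem s hs) (fun s hs => inv_inv s)
      · exact mul_inv_cancel₀ fun h => hS.zero_notMem (h ▸ hs)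
      · exact hS.ne_inv _ hs h.symm)
    (fun k hk => mul_notMem_groupSpectrum_one 2 hw (hpow k hk) (by omega) (by omega))
  have h1 := hsum 1 1
  have : CharP KK 2 := charP_of_injective_algebraMap (algebraMap F KK).injective 2
  simp only [minorProd, Pi.zero_apply, pow_zero, Finset.prod_const_one, Finset.sum_const,
    Finset.card_range, nsmul_eq_mul, mul_one, CharP.cast_eq_zero_iff KK 2] at h1
  exact h2 (h1.trans ((hk P).1 fun i j => by rw [hSP _ (e i).2, hSP _ (e j).2]))

end LowDimension

section LowDimension

variable {F : Type*} [Field F] [Fintype F]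

lemma two_mul_notMem_groupSpectrum_fin_two (p : ℕ) [Fact p.Prime] [CharP F p] :
    p * 2 ∉ groupSpectrum (ProjectiveSpecialLinearGroup (Fin 2) F) := by
  rintro ⟨z, hz⟩
  obtain ⟨y, rfl⟩ := toPSL_surjective 2 F z
  obtain ⟨f, hf, hfm, hdvd⟩ := exists_sq_factor p (x := y) (by rw [hz]; exact dvd_mul_right _ _)
  have hdeg : y.1.charpoly.natDegree = 2 := by simp [charpoly_natDegree_eq_dim]
  have hd := natDegree_le_of_dvd hdvd y.1.charpoly_monic.ne_zero
  rw [hfm.natDegree_mul hfm, hdeg] at hd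
  have h1 := hf.natDegree_pos
  have hf1 : f.natDegree = 1 := by omega
  have hf2 := hfm.eq_X_add_C hf1
  have hy : y.1.charpoly = f * f :=
    (eq_of_monic_of_dvd_of_natDegree_le (hfm.mul hfm) y.1.charpoly_monic hdvd
      (by rw [hfm.natDegree_mul hfm]; omega))
  have h3 : toPSL 2 F y ^ p = 1 := toPSL_pow_char_eq_one p (a := - f.coeff 0) (by
    rw [hy, C_neg, sub_neg_eq_add, ← hf2])
  have h4 := Nat.le_of_dvd (Fact.out : p.Prime).pos (hz ▸ orderOf_dvd_of_pow_eq_one h3)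
  have := (Fact.out : p.Prime).pos
  omega

lemma IsAnnihilated.false_of_one (p : ℕ) [Fact p.Prime] [CharP F p] {a : Fin 1 → ℕ}
    (ha : IsAnnihilated F p a) : False := by
  obtain ⟨x, hx⟩ : ∃ x : SpecialLinearGroup (Fin 2) F, x.1 = !![0, 1; -1, 0] :=
    ⟨⟨!![0, 1; -1, 0], by simp [det_fin_two]⟩, rfl⟩
  have hord : orderOf (toPSL 2 F x) = 2 := by
    have h2 : Fact (Nat.Prime 2) := ⟨Nat.prime_two⟩
    refine orderOf_eq_prime ((toPSL_pow_eq_one_iff x 2).2 ⟨-1, ?_⟩) fun h => ?_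
    · rw [hx]
      ext i j
      fin_cases i <;> fin_cases j <;> simp [pow_two, Matrix.mul_apply]
    · obtain ⟨c, hc⟩ := (toPSL_pow_eq_one_iff x 1).1 (by rw [pow_one, h])
      rw [pow_one, hx] at hc
      simpa using congrFun (congrFun hc 0) 1
  have h1 := ha.2 x (by rw [hord]; exact two_mul_notMem_groupSpectrum_fin_two p) 1 1 (by simp)
    (by simp)
  have h2 : ∀ g : Matrix (Fin 2) (Fin 2) F, minorProd a g = g 0 0 ^ a 0 := by
    intro g
    simp [minorProd, cornerMinor_eq_det_leadingBlock, leadingBlock]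
  rw [hord] at h1
  simp only [Finset.sum_range_succ, Finset.sum_range_zero, h2, hx, one_mul, mul_one, pow_zero,
    pow_one, zero_add] at h1
  rcases Nat.eq_zero_or_pos (a 0) with h | h
  · rw [h] at h1
    simp only [pow_zero, one_add_one_eq_two] at h1
    have h3 : p = 2 := by
      have h4 : ((2 : ℕ) : F) = 0 := by exact_mod_cast h1
      rw [CharP.cast_eq_zero_iff F p] at h4
      exact (Nat.prime_dvd_prime_iff_eq Fact.out Nat.prime_two).1 h4
    subst h3
    exact IsAnnihilated.ne_zero_of_charP_two (h := 1) rfl ha (by ext i; fin_cases i; exact h)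
  · simp [h.ne'] at h1

end LowDimension

section LowDimension

variable {F : Type*} [Field F]

lemma eight_notMem_groupSpectrum_fin_four [CharP F 2] :
    2 * 4 ∉ groupSpectrum (ProjectiveSpecialLinearGroup (Fin 4) F) := by
  rintro ⟨z, hz⟩
  obtain ⟨y, rfl⟩ := toPSL_surjective 4 F z
  have h2 : Fact (Nat.Prime 2) := ⟨Nat.prime_two⟩
  have hs : ∀ (k : ℕ) (w : Matrix (Fin 4) (Fin 4) F), (w - 1) ^ 2 ^ k = w ^ 2 ^ k - 1 := by
    intro k w
    rw [sub_pow_expChar_pow_of_commute 2 k (Commute.one_right w), one_pow]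
  obtain ⟨c, hc⟩ := (toPSL_pow_eq_one_iff y 8).1 (by rw [← pow_orderOf_eq_one (toPSL 4 F y), hz])
  have hc1 : c = 1 := by
    have h3 := congrArg det hc
    rw [det_pow, y.2, one_pow, scalar_apply, det_diagonal, Finset.prod_const, Finset.card_univ,
      Fintype.card_fin] at h3
    have h4 : (c - 1) ^ 2 ^ 2 = 0 := by
      rw [sub_pow_expChar_pow (p := 2), one_pow]
      norm_num [← h3]
    exact sub_eq_zero.1 (pow_eq_zero_iff (by norm_num) |>.1 h4)
  have h5 : (y.1 - 1) ^ 2 ^ 3 = 0 := by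
    rw [hs]
    norm_num
    rw [sub_eq_zero]
    exact hc.trans (by rw [hc1, map_one])
  have h6 := (isNilpotent_charpoly_sub_pow_of_isNilpotent ⟨_, h5⟩).eq_zero
  have h7 : (y.1 - 1) ^ 2 ^ 2 = 0 := by
    have h8 := aeval_self_charpoly (y.1 - 1)
    rw [sub_eq_zero.1 h6] at h8
    simpa using h8
  rw [hs, sub_eq_zero] at h7
  have h8 : toPSL 4 F y ^ 4 = 1 := (toPSL_pow_eq_one_iff y 4).2 ⟨1, by rw [map_one]; exact h7⟩
  have h9 := Nat.le_of_dvd (by norm_num) (hz ▸ orderOf_dvd_of_pow_eq_one h8)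
  omega

variable [Fintype F]

lemma IsAnnihilated.false_of_three_of_charP_two [CharP F 2] {a : Fin 3 → ℕ}
    (ha : IsAnnihilated F 2 a) : False := by
  have h2 : Fact (Nat.Prime 2) := ⟨Nat.prime_two⟩
  obtain ⟨x, hx⟩ : ∃ x : SpecialLinearGroup (Fin 4) F,
      x.1 = !![0, 1, 0, 0; 0, 0, 1, 0; 0, 0, 0, 1; 1, 0, 0, 0] :=
    ⟨⟨!![0, 1, 0, 0; 0, 0, 1, 0; 0, 0, 0, 1; 1, 0, 0, 0], by
      simp [det_succ_row_zero, Fin.sum_univ_succ, Fin.succAbove, CharTwo.neg_eq]⟩, rfl⟩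
  have hx2 : x.1 ^ 2 = !![0, 0, 1, 0; 0, 0, 0, 1; 1, 0, 0, 0; 0, 1, 0, 0] := by
    rw [hx, pow_two]
    ext i j
    fin_cases i <;> fin_cases j <;> simp [Matrix.mul_apply, Fin.sum_univ_succ]
  have hx3 : x.1 ^ 3 = !![0, 0, 0, 1; 1, 0, 0, 0; 0, 1, 0, 0; 0, 0, 1, 0] := by
    rw [pow_succ, hx2, hx]
    ext i j
    fin_cases i <;> fin_cases j <;> simp [Matrix.mul_apply, Fin.sum_univ_succ]
  have hx4 : x.1 ^ 4 = 1 := by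
    rw [pow_succ, hx3, hx]
    ext i j
    fin_cases i <;> fin_cases j <;> simp [Matrix.mul_apply, Fin.sum_univ_succ]
  have hord : orderOf (toPSL 4 F x) = 4 := by
    refine orderOf_eq_prime_pow (p := 2) (n := 1) (fun h => ?_)
      ((toPSL_pow_eq_one_iff x 4).2 ⟨1, by rw [map_one]; exact hx4⟩)
    obtain ⟨c, hc⟩ := (toPSL_pow_eq_one_iff x 2).1 h
    have h3 := congrFun (congrFun (hx2.symm.trans hc) 0) 2
    simp at h3
  have h1 := ha.2 x (by rw [hord]; exact eight_notMem_groupSpectrum_fin_four) 1 1 (by simp)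
    (by simp)
  have hM : ∀ M : Matrix (Fin 4) (Fin 4) F, minorProd a M =
      M 0 0 ^ a 0 * (leadingBlock M 2 (by norm_num)).det ^ a 1 *
        (leadingBlock M 3 (by norm_num)).det ^ a 2 := by
    intro M
    simp [minorProd, cornerMinor_eq_det_leadingBlock, Fin.prod_univ_succ, mul_assoc, leadingBlock]
  rw [hord] at h1
  simp only [Finset.sum_range_succ, Finset.sum_range_zero, one_mul, mul_one, pow_zero,
    pow_one, zero_add] at h1
  obtain ⟨r, hr⟩ := Function.ne_iff.1 (ha.ne_zero_of_charP_two (h := 2) rfl)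
  have hz : ∀ M : Matrix (Fin 4) (Fin 4) F, M 0 0 = 0 → M 0 0 * M 1 1 - M 0 1 * M 1 0 = 0 →
      (leadingBlock M 3 (by norm_num)).det = 0 → minorProd a M = 0 := by
    intro M e1 e2 e3
    have e2' : (leadingBlock M 2 (by norm_num)).det = 0 := by
      rw [det_fin_two]
      exact e2
    rw [hM, e1, e2', e3]
    fin_cases r <;> simp at hr <;> simp [hr]
  rw [hz (x.1 ^ 2), hz (x.1 ^ 3), hx, hz !![0, 1, 0, 0; 0, 0, 1, 0; 0, 0, 0, 1; 1, 0, 0, 0]] at h1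
  · simp [minorProd, cornerMinor_eq_det_leadingBlock, leadingBlock,
      submatrix_one _ (Fin.castLE_injective _)] at h1
  all_goals simp [hx2, hx3, det_fin_three, leadingBlock, Fin.castLE]

end LowDimension

section PrimeField

lemma sum_add_inv_pow_mul {K : Type*} [Field K] {ζ : K} {k A B s : ℕ}
    (hζ : IsPrimitiveRoot (ζ ^ 2) k) (hk : A < k) (hs : A + B = 2 * s) (hsA : s ≤ A) :
    ∑ j ∈ Finset.range k, (ζ ^ j + ζ⁻¹ ^ j) ^ A * (ζ⁻¹ ^ j) ^ B = k * (A.choose s : K) := by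
  have h0 : ζ ≠ 0 := fun h => hζ.ne_zero (by omega) (by rw [h, zero_pow two_ne_zero])
  have h1 : ∀ j, (ζ ^ j + ζ⁻¹ ^ j) ^ A * (ζ⁻¹ ^ j) ^ B =
      ∑ i ∈ Finset.range (A + 1), ((ζ ^ 2) ^ i * (ζ⁻¹ ^ 2) ^ s) ^ j * (A.choose i : K) := by
    intro j
    have h2 : ζ ^ j + ζ⁻¹ ^ j = ζ⁻¹ ^ j * ((ζ ^ 2) ^ j + 1) := by
      rw [inv_pow]
      field_simp
      ring
    rw [h2, mul_pow, mul_right_comm, ← pow_add, hs, add_pow, Finset.mul_sum]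
    refine Finset.sum_congr rfl fun i _ => ?_
    rw [one_pow, mul_one, mul_pow]
    ring
  simp only [h1]
  rw [Finset.sum_comm, Finset.sum_eq_single s]
  · rw [← mul_pow, ← mul_pow, mul_inv_cancel₀ h0]
    simp
  · intro i hi his
    rw [← Finset.sum_mul]
    convert zero_mul _
    have h2 : ((ζ ^ 2) ^ i * (ζ⁻¹ ^ 2) ^ s) ^ k = 1 := by
      rw [inv_pow, inv_pow, ← div_eq_mul_inv, div_pow, pow_right_comm, hζ.pow_eq_one,
        pow_right_comm, hζ.pow_eq_one, one_pow, one_pow, div_one]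
    have h3 := mul_neg_geom_sum ((ζ ^ 2) ^ i * (ζ⁻¹ ^ 2) ^ s) k
    rw [h2, sub_self, mul_eq_zero, sub_eq_zero] at h3
    refine h3.resolve_left fun h => his (hζ.pow_inj (by simp at hi; omega) (by omega) ?_)
    rw [inv_pow, inv_pow, ← div_eq_mul_inv, eq_comm, div_eq_one_iff_eq (by simp [h0])] at h
    exact h
  · intro h
    simp at h
    omega

variable {F : Type*} [Field F] [Fintype F]

local notation "KK" => AlgebraicClosure F

lemma minorProd_fin_four {K : Type*} [Field K] {a : Fin 3 → ℕ} {x y : K} (u v : K) (hu : u * u = u)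
    (hv : v * v = v) (huv : u * v = 0) (hy : y ≠ 0) (j : ℕ) :
    minorProd a (!![u, 1, 1, 0; 0, 0, 0, 1; v, 1, 0, 0; 0, 0, 0, 0] *
      diagonal (fun i => (![x, x⁻¹, y, y⁻¹] i) ^ j) *
      !![u, 0, v, 0; 1, 0, 1, 0; 0, 1, 0, 0; 1, 0, 0, 0]) =
    (-1) ^ (a 1 + a 2) * ((u * x ^ j + x⁻¹ ^ j) ^ a 0 * (v * x ^ j + x⁻¹ ^ j) ^ a 2) := by
  have hyj : y ^ j * y⁻¹ ^ j = 1 := by rw [← mul_pow, mul_inv_cancel₀ hy, one_pow]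
  generalize hM : !![u, 1, 1, 0; 0, 0, 0, 1; v, 1, 0, 0; 0, 0, 0, 0] *
    diagonal (fun i => (![x, x⁻¹, y, y⁻¹] i) ^ j) *
      !![u, 0, v, 0; 1, 0, 1, 0; 0, 1, 0, 0; 1, 0, 0, 0] = M
  have e : M = !![u * x ^ j + x⁻¹ ^ j, y ^ j, x⁻¹ ^ j, 0; y⁻¹ ^ j, 0, 0, 0;
      x⁻¹ ^ j, 0, v * x ^ j + x⁻¹ ^ j, 0; 0, 0, 0, 0] := by
    rw [← hM]
    ext i l
    rw [Matrix.mul_apply, Fin.sum_univ_four]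
    simp only [mul_diagonal]
    fin_cases i <;> fin_cases l <;> simp <;> grind
  have d2 : (leadingBlock M 2 (by norm_num)).det = -1 := by
    rw [e, det_fin_two]
    simpa [leadingBlock, Fin.castLE] using hyj
  have d3 : (leadingBlock M 3 (by norm_num)).det = - (v * x ^ j + x⁻¹ ^ j) := by
    rw [e, det_fin_three]
    simp only [leadingBlock, submatrix_apply]
    simp [Fin.castLE]
    linear_combination - (v * x ^ j + (x ^ j)⁻¹) * hyj
  have d1 : M 0 0 = u * x ^ j + x⁻¹ ^ j := by rw [e]; rfl
  have hm : minorProd a M =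
      M 0 0 ^ a 0 * (leadingBlock M 2 (by norm_num)).det ^ a 1 *
        (leadingBlock M 3 (by norm_num)).det ^ a 2 := by
    simp [minorProd, cornerMinor_eq_det_leadingBlock, Fin.prod_univ_succ, mul_assoc, leadingBlock]
  rw [hm, d1, d2, d3, neg_pow (v * _ + _), pow_add]
  ring

end PrimeField

section PrimeField

variable {F : Type*} [Field F] [Fintype F]

local notation "KK" => AlgebraicClosure F

lemma not_dvd_choose_of_lt {p A s : ℕ} (hp : p.Prime) (hA : A < p) (hs : s ≤ A) :
    ¬ p ∣ A.choose s := by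
  intro h
  have h1 : p ∣ A.factorial := by
    rw [← Nat.choose_mul_factorial_mul_factorial hs, mul_assoc]
    exact h.mul_right _
  exact absurd ((hp.dvd_factorial).1 h1) (by omega)

lemma IsAnnihilated.false_of_three_of_card_eq (p : ℕ) [Fact p.Prime] [CharP F p]
    (hF : Fintype.card F = p) (hp2 : p ≠ 2) {a : Fin 3 → ℕ} (ha : IsAnnihilated F p a)
    (heven : Even (a 0 + a 2)) : False := by
  have hp : p.Prime := Fact.out
  have hodd : p % 2 = 1 := hp.eq_two_or_odd.resolve_left hp2
  obtain ⟨P, hw, hPd⟩ := exists_isWitness_even (q := Fintype.card F) (h := 2)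
    (hF ▸ hp.two_le) two_pos
  obtain ⟨c, rfl⟩ : ∃ c, p = 2 * c + 1 := ⟨p / 2, by omega⟩
  obtain ⟨k₀, hk₀, hk₀'⟩ : ∃ k₀, (2 * c + 1) ^ 2 + 1 = 2 * k₀ ∧ k₀ = 2 * (c * c) + 2 * c + 1 :=
    ⟨_, by ring, rfl⟩
  have hc : 1 ≤ c := by
    rcases Nat.eq_zero_or_pos c with rfl | h
    · exact absurd hp (by norm_num)
    · exact h
  have hcc : c ≤ c * c := Nat.le_mul_self c
  rw [hF, hk₀] at hPd
  have hP2 : P.Coprime 2 := by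
    obtain ⟨⟨ℓ, e, hℓ, he, -, rfl⟩, hd⟩ := hw
    refine Nat.Coprime.pow_left _ ((Nat.coprime_primes hℓ Nat.prime_two).2 ?_)
    rintro rfl
    rcases Nat.lt_or_ge e 2 with h | h
    · obtain rfl : e = 1 := by omega
      have := hd 1 (by rw [hF]; simp)
      omega
    · have : 2 ^ 2 ∣ 2 * k₀ := (pow_dvd_pow 2 h).trans hPd
      omega
  obtain ⟨ζ, hζ⟩ := exists_primitiveRoot_algebraicClosure (F := F) (N := 4) (m := 2 * k₀)
    (by norm_num) (by
      rw [hF, ← hk₀]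
      exact ⟨(2 * c + 1) ^ 2 - 1, by
        rw [show (2 * c + 1) ^ 4 = ((2 * c + 1) ^ 2) ^ 2 by ring, ← Nat.sq_sub_sq, one_pow]⟩)
  have h0 : ζ ≠ 0 := hζ.ne_zero (by omega)
  obtain ⟨y, hy⟩ : ∃ y, y = ζ ^ (2 * c + 1) := ⟨_, rfl⟩
  have hy0 : y ≠ 0 := hy ▸ pow_ne_zero _ h0
  have hyp : y ^ (2 * c + 1) = ζ⁻¹ := by
    rw [← mul_eq_one_iff_eq_inv₀ h0, hy, ← pow_mul, ← pow_succ, ← sq, hk₀, hζ.pow_eq_one]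
  have n1 : ζ * ζ ≠ 1 := by
    rw [← sq]
    exact hζ.pow_ne_one_of_pos_of_lt (by omega) (by omega)
  have n2 : ζ ≠ y := by
    intro h
    rw [hy, pow_succ, eq_comm, mul_eq_right₀ h0] at h
    exact hζ.pow_ne_one_of_pos_of_lt (by omega) (by omega) h
  have n3 : ζ * y ≠ 1 := by
    rw [hy, ← pow_succ']
    exact hζ.pow_ne_one_of_pos_of_lt (by omega) (by omega)
  have n4 : y * y ≠ 1 := by
    rw [hy, ← pow_add]
    exact hζ.pow_ne_one_of_pos_of_lt (by omega) (by omega)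
  have hdiv : ∀ m, (∀ i j, (![ζ, ζ⁻¹, y, y⁻¹] : Fin 4 → KK) i ^ m = ![ζ, ζ⁻¹, y, y⁻¹] j ^ m) →
      k₀ ∣ m := by
    intro m hm
    have h1 : ζ ^ m = ζ⁻¹ ^ m := hm 0 1
    rw [inv_pow, ← mul_eq_one_iff_eq_inv₀ (pow_ne_zero _ h0), ← pow_add, ← two_mul,
      hζ.pow_eq_one_iff_dvd] at h1
    exact Nat.dvd_of_mul_dvd_mul_left two_pos h1
  obtain ⟨k, hk, hsum⟩ := ha.exists_sum_diagonal (2 * c + 1) (t := ![ζ, ζ⁻¹, y, y⁻¹])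
    (by
      intro i j
      fin_cases i <;> fin_cases j <;> simp <;> grind)
    (by
      rw [hF]
      intro i
      fin_cases i
      · exact ⟨2, hy⟩
      · exact ⟨3, by simp [hy]⟩
      · exact ⟨1, hyp.symm⟩
      · exact ⟨0, by simp [hyp]⟩)
    (by
      simp [Fin.prod_univ_four, h0, hy0])
    (fun m hm => mul_notMem_groupSpectrum_one _ hw
      (hP2.dvd_of_dvd_mul_left (hPd.trans (mul_dvd_mul_left 2 (hdiv m hm)))) (by norm_num)
      (by norm_num))
  obtain rfl : k = k₀ := by
    refine Nat.dvd_antisymm ((hk _).1 fun i j => ?_) (hdiv k ((hk _).2 dvd_rfl))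
    have h1 : ζ⁻¹ ^ k₀ = ζ ^ k₀ := by
      rw [inv_pow, ← mul_eq_one_iff_inv_eq₀ (pow_ne_zero _ h0), ← pow_add, ← two_mul,
        hζ.pow_eq_one]
    have h2 : y ^ k₀ = ζ ^ k₀ := by
      rw [hy, ← pow_mul, mul_comm, mul_add, mul_one, pow_add, ← mul_assoc, pow_mul,
        mul_comm k₀, hζ.pow_eq_one, one_pow, one_mul]
    have h3 : y⁻¹ ^ k₀ = ζ ^ k₀ := by rw [inv_pow, h2, ← inv_pow, h1]
    have h4 : ∀ i, (![ζ, ζ⁻¹, y, y⁻¹] : Fin 4 → KK) i ^ k₀ = ζ ^ k₀ := by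
      intro i
      fin_cases i
      · rfl
      · exact h1
      · exact h2
      · exact h3
    rw [h4, h4]
  have : CharP KK (2 * c + 1) :=
    charP_of_injective_algebraMap (algebraMap F KK).injective (2 * c + 1)
  have hζ2 : IsPrimitiveRoot (ζ ^ 2) k := hζ.pow (by omega) rfl
  obtain ⟨s, hs⟩ := heven.exists_two_nsmul
  rw [smul_eq_mul] at hs
  have ha0 := ha.1 0
  have ha2 := ha.1 2
  rw [hF] at ha0 ha2
  have hk0 : (k : KK) ≠ 0 := by
    rw [Ne, CharP.cast_eq_zero_iff KK (2 * c + 1)]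
    intro h
    have h1 := (Nat.dvd_add_right (dvd_pow_self (2 * c + 1) two_ne_zero)).1
      (hk₀ ▸ h.mul_left 2)
    have := Nat.dvd_one.1 h1
    omega
  have hch : ∀ A, A < 2 * c + 1 → s ≤ A → ((A.choose s : ℕ) : KK) ≠ 0 := by
    intro A hA hsA
    rw [Ne, CharP.cast_eq_zero_iff KK (2 * c + 1)]
    exact not_dvd_choose_of_lt hp hA hsA
  have hM : ∀ u v : KK, u * u = u → v * v = v → u * v = 0 →
      ∑ j ∈ Finset.range k, (u * ζ ^ j + ζ⁻¹ ^ j) ^ a 0 * (v * ζ ^ j + ζ⁻¹ ^ j) ^ a 2 = 0 := by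
    intro u v hu hv huv
    refine (mul_eq_zero.1 (?_ : (-1 : KK) ^ (a 1 + a 2) * _ = 0)).resolve_left
      (pow_ne_zero _ (by simp))
    rw [Finset.mul_sum]
    exact (Finset.sum_congr rfl fun j _ => (minorProd_fin_four u v hu hv huv hy0 j).symm).trans
      (hsum _ _)
  rcases le_total (a 2) (a 0) with h | h
  · have h1 := hM 1 0 (by simp) (by simp) (by simp)
    simp only [one_mul, zero_mul, zero_add] at h1
    rw [sum_add_inv_pow_mul hζ2 (by omega) hs (by omega)] at h1
    exact mul_ne_zero hk0 (hch _ (by omega) (by omega)) h1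
  · have h1 := hM 0 1 (by simp) (by simp) (by simp)
    simp only [one_mul, zero_mul, zero_add, mul_comm _ ((_ + _) ^ a 2)] at h1
    rw [sum_add_inv_pow_mul hζ2 (by omega) ((add_comm _ _).trans hs) (by omega)] at h1
    exact mul_ne_zero hk0 (hch _ (by omega) (by omega)) h1

end PrimeField

end

section

open Matrix Polynomial

section Combination

variable {F : Type*} [Field F] [Fintype F] (p : ℕ) [Fact p.Prime] [CharP F p]

theorem false_of_action_of_char {N : ℕ} (h0 : N ≠ 0)
    (h3 : N ≠ 3 ∨ Fintype.card F = p ∨ p = 2) {V : Type*} [AddCommGroup V] [Nontrivial V]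
    (ρ : SpecialLinearGroup (Fin (N + 1)) F →* AddMonoid.End V) (hpV : ∀ v : V, p • v = 0)
    (hker : ∀ z ∈ (toPSL (N + 1) F).ker, ρ z = 1)
    (hnorm : ∀ x, p * orderOf (toPSL (N + 1) F x) ∉
        groupSpectrum (ProjectiveSpecialLinearGroup (Fin (N + 1)) F) →
      ∀ v, ∑ j ∈ Finset.range (orderOf (toPSL (N + 1) F x)), ρ (x ^ j) v = 0) : False := by
  obtain ⟨a, ha1, ha2, ha3⟩ := exists_minorProd_of_action p ρ hpV hker hnorm
  have ha : IsAnnihilated F p a := ⟨ha1, ha2⟩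
  rcases eq_or_ne N 1 with rfl | h1
  · exact ha.false_of_one p
  rcases eq_or_ne N 3 with rfl | h
  · by_cases hp : p = 2
    · subst hp
      exact ha.false_of_three_of_charP_two
    have hF : Fintype.card F = p := (h3.resolve_left (not_not.2 rfl)).resolve_right hp
    refine ha.false_of_three_of_card_eq p hF hp ?_
    have h4 := ha3 (-1) (by norm_num)
    have h5 : (-1 : F) ^ (a 0 + a 2) = 1 := by
      refine Eq.trans ?_ h4
      simp only [minorProd, cornerMinor_eq_det_leadingBlock, Fin.prod_univ_three, leadingBlock,
        submatrix_smul, Pi.smul_apply, submatrix_one _ (Fin.castLE_injective _), det_smul, det_one,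
        Fintype.card_fin, mul_one]
      simp [pow_add, pow_succ]
    rcases Nat.even_or_odd (a 0 + a 2) with h6 | h6
    · exact h6
    · rw [h6.neg_one_pow, neg_eq_iff_add_eq_zero, one_add_one_eq_two] at h5
      have h7 : ((2 : ℕ) : F) = 0 := by exact_mod_cast h5
      rw [CharP.cast_eq_zero_iff F p] at h7
      exact absurd ((Nat.prime_dvd_prime_iff_eq Fact.out Nat.prime_two).1 h7) hp
  · exact ha.false_of_ne p h0 h1 h

theorem injective_of_groupSpectrum_subset {n : ℕ} (hn : 2 ≤ n) (hn2 : n = 2 → 3 < Fintype.card F)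
    (hn4 : n ≠ 4 ∨ Fintype.card F = p ∨ p = 2) {G : Type*} [Group G] [Finite G]
    (f : G →* ProjectiveSpecialLinearGroup (Fin n) F) (hf : Function.Surjective f)
    (hsp : groupSpectrum G ⊆ groupSpectrum (ProjectiveSpecialLinearGroup (Fin n) F)) :
    Function.Injective f := by
  rw [← MonoidHom.ker_eq_bot_iff]
  refine ker_eq_bot_of_elementary_abelian (fun r G _ _ f hr hf hsp hexp hcomm => ?_) G f hf hsp
  by_contra hne
  obtain ⟨V, _, _, _, ρ, hrV, hker, hnorm⟩ :=
    exists_action_of_cover (toPSL n F) r f hr hf hsp hexp hcomm hne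
  by_cases hrp : r = p
  · subst hrp
    obtain ⟨N, rfl⟩ : ∃ N, n = N + 1 := ⟨n - 1, by omega⟩
    exact false_of_action_of_char r (by omega) (hn4.imp_left fun h => by omega) ρ hrV hker hnorm
  · exact false_of_action_of_ne_char p hn hn2 ρ hr hrp hrV hnorm

end Combination

end

/-- A simple group `L = PSL_n(q)` with `n ≠ 4`, or `q` prime, or `q` even, is recognizable
by spectrum from its covers: any finite group surjecting onto `L` with the same spectrum
as `L` is isomorphic to `L`. -/
theorem PSL_recognizable_from_covers (p m q n : ℕ) (hp : p.Prime) (hm : 0 < m)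
    (hq : q = p ^ m) (hn : 2 ≤ n)
    (h22 : ¬ (n = 2 ∧ q = 2)) (h23 : ¬ (n = 2 ∧ q = 3))
    (hcase : n ≠ 4 ∨ q.Prime ∨ Even q)
    (F : Type*) [Field F] [Fintype F] (hF : Fintype.card F = q)
    (G : Type*) [Group G] [Finite G]
    (f : G →* Matrix.ProjectiveSpecialLinearGroup (Fin n) F)
    (hf : Function.Surjective f)
    (hspec : groupSpectrum G = groupSpectrum (Matrix.ProjectiveSpecialLinearGroup (Fin n) F)) :
    Nonempty (G ≃* Matrix.ProjectiveSpecialLinearGroup (Fin n) F) := by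
  have hp' : Fact p.Prime := ⟨hp⟩
  have hchar : CharP F p := charP_of_card_eq_prime_pow (hF.trans hq)
  have h2 : 2 ≤ q := hF ▸ Fintype.one_lt_card
  refine ⟨MulEquiv.ofBijective f ⟨injective_of_groupSpectrum_subset p hn (fun h => ?_)
    (hcase.imp_right fun h => ?_) f hf hspec.subset, hf⟩⟩
  · have h3 : q ≠ 2 := fun h' => h22 ⟨h, h'⟩
    have h4 : q ≠ 3 := fun h' => h23 ⟨h, h'⟩
    omega
  · rw [hF, hq]
    rw [hq] at h
    refine h.imp (fun h => ?_) fun h => ?_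
    · rw [h.eq_one_of_pow, pow_one]
    · exact (hp.even_iff).1 ((Nat.even_pow.1 h).1)
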